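/- For every C > 0 there exists C' > 0 such that the following holds. Let H₀, H, N, 𝐏, 𝓛 satisfy: 1 ≤ H₀ ≤ H, log H₀ ≥ (log H)^{2/3} (log log H)², 𝐏 a set of primes in [H₀, H], 𝓛 = ∑_{p∈𝐏} 1/p ≥ e, and log H ≤ √((log N)/𝓛). Let f : 𝐍 → ℂ (extended by zero outside 𝐍) satisfy |f|₂ ≤ 1 and |f|₄ ≤ e^{C𝓛}. Then (1/N) ∑_{n∈𝐍} | ∑_{σ∈{−1,1}} ∑_{p∈𝐏, p∣n} f(n+σp) − ∑_{σ∈{−1,1}} ∑_{p∈𝐏} f(n+σp)/p |² ≤ C' 𝓛. -/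

import Mathlib

set_option linter.all false
set_option linter.unusedVariables false
set_option linter.unusedSectionVars false
namespace KK
open Finset

section Energy
variable (B : Finset ℤ) (P : Finset ℕ) (io : ℤ → ℕ → ℤ) (t : ℤ → ℕ → ℝ) (f : ℤ → ℝ)

/-- pair of (y_i, j_i) -/
noncomputable def yj : ℕ → (ℤ → ℝ) × (ℤ → ℕ → ℝ)
  | 0 => (f, fun _ _ => 0)
  | i + 1 =>
    (fun n => ∑ p ∈ P, t n p * ((yj i).1 (io n p) - (yj i).2 (io n p) p),
     fun n p => t n p * ((yj i).1 (io n p) - (yj i).2 (io n p) p))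

noncomputable def Yn (i : ℕ) : ℝ := ∑ n ∈ B, (yj P io t f i).1 n ^ 2
noncomputable def Jn (i : ℕ) : ℝ := ∑ n ∈ B, ∑ p ∈ P, (yj P io t f i).2 n p ^ 2
noncomputable def Dn (i : ℕ) : ℝ :=
  ∑ n ∈ B, ((yj P io t f (i+2)).1 n - (yj P io t f i).1 n) ^ 2
noncomputable def En (i : ℕ) : ℝ :=
  ∑ n ∈ B, ∑ p ∈ P, ((yj P io t f (i+2)).2 n p - (yj P io t f i).2 n p) ^ 2

variable {B P io t f}

lemma yj_succ_fst (i : ℕ) (n : ℤ) : (yj P io t f (i+1)).1 n =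
    ∑ p ∈ P, (yj P io t f (i+1)).2 n p := rfl

lemma yj_succ_snd (i : ℕ) (n : ℤ) (p : ℕ) : (yj P io t f (i+1)).2 n p =
    t n p * ((yj P io t f i).1 (io n p) - (yj P io t f i).2 (io n p) p) := rfl

lemma Yn_nonneg (i : ℕ) : 0 ≤ Yn B P io t f i := sum_nonneg fun _ _ => sq_nonneg _
lemma Jn_nonneg (i : ℕ) : 0 ≤ Jn B P io t f i :=
  sum_nonneg fun _ _ => sum_nonneg fun _ _ => sq_nonneg _
lemma Dn_nonneg (i : ℕ) : 0 ≤ Dn B P io t f i := sum_nonneg fun _ _ => sq_nonneg _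
lemma En_nonneg (i : ℕ) : 0 ≤ En B P io t f i :=
  sum_nonneg fun _ _ => sum_nonneg fun _ _ => sq_nonneg _

/-- hypotheses on the kernel -/
structure Ker (B : Finset ℤ) (P : Finset ℕ) (io : ℤ → ℕ → ℤ) (t : ℤ → ℕ → ℝ) : Prop where
  supp : ∀ n, ∀ p ∈ P, t n p ≠ 0 → n ∈ B ∧ io n p ∈ B
  inv : ∀ n, ∀ p ∈ P, io (io n p) p = n
  sym : ∀ n, ∀ p ∈ P, t (io n p) p = t n p

lemma sum_invol (hK : Ker B P io t) (G : ℤ → ℕ → ℝ) :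
    ∑ n ∈ B, ∑ p ∈ P, t n p * G (io n p) p = ∑ n ∈ B, ∑ p ∈ P, t n p * G n p := by
  rw [sum_comm, sum_comm (s := B)]
  refine sum_congr rfl fun p hp => ?_
  refine Finset.sum_bij_ne_zero (fun n _ _ => io n p) ?_ ?_ ?_ ?_
  · intro n hn h
    exact (hK.supp n p hp (left_ne_zero_of_mul h)).2
  · intro a _ _ b _ _ h
    have := congrArg (fun m => io m p) h
    simpa [hK.inv _ p hp] using this
  · intro b hb h
    refine ⟨io b p, (hK.supp b p hp (left_ne_zero_of_mul h)).2, ?_, hK.inv b p hp⟩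
    rw [hK.sym b p hp, hK.inv b p hp]; exact h
  · intro a ha h
    rw [hK.sym a p hp]

lemma sum_invol2 (hK : Ker B P io t) (c : ℝ → ℝ) (hc : c 0 = 0) (G : ℤ → ℕ → ℝ) :
    ∑ n ∈ B, ∑ p ∈ P, c (t n p) * G (io n p) p = ∑ n ∈ B, ∑ p ∈ P, c (t n p) * G n p := by
  have hK' : Ker B P io (fun n p => c (t n p)) :=
    ⟨fun n p hp h => hK.supp n p hp (fun h0 => h (by simp [h0, hc])), hK.inv,
      fun n p hp => by simp only [hK.sym n p hp]⟩
  exact sum_invol hK' G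

lemma key_id (hK : Ker B P io t) (i : ℕ) :
    (Yn B P io t f (i+2) - Jn B P io t f (i+2)) - 2 * (Yn B P io t f (i+1) - Jn B P io t f (i+1))
      + (Yn B P io t f i - Jn B P io t f i) = Dn B P io t f i - En B P io t f i := by
  set y := fun i => (yj P io t f i).1 with hy
  set j := fun i => (yj P io t f i).2 with hj
  have h1 : ∑ n ∈ B, ∑ p ∈ P, j (i+2) n p * (y i n - j i n p) =
      ∑ n ∈ B, ∑ p ∈ P, j (i+1) n p * (y (i+1) n - j (i+1) n p) := by
    have := sum_invol hK (fun n p => (y (i+1) n - j (i+1) n p) * (y i (io n p) - j i (io n p) p))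
    calc _ = ∑ n ∈ B, ∑ p ∈ P, t n p * ((y (i+1) (io n p) - j (i+1) (io n p) p) *
            (y i (io (io n p) p) - j i (io (io n p) p) p)) := by
          refine sum_congr rfl fun n _ => sum_congr rfl fun p hp => ?_
          rw [hK.inv n p hp]
          simp only [hj, hy, yj_succ_snd (i := i+1)]; ring
      _ = _ := this
      _ = _ := by
          refine sum_congr rfl fun n _ => sum_congr rfl fun p hp => ?_
          simp only [hj, hy, yj_succ_snd (i := i)]; ring
  have e1 : ∀ k, ∑ n ∈ B, ∑ p ∈ P, j (k+1) n p * (y (k+1) n - j (k+1) n p) =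
      Yn B P io t f (k+1) - Jn B P io t f (k+1) := by
    intro k
    simp only [Yn, Jn, ← sum_sub_distrib]
    refine sum_congr rfl fun n _ => ?_
    simp only [mul_sub, sum_sub_distrib, ← sum_mul]
    rw [show (yj P io t f (k+1)).1 n = ∑ p ∈ P, j (k+1) n p from rfl]
    rw [show y (k+1) n = ∑ p ∈ P, j (k+1) n p from rfl]
    simp only [sq, hj]
  have e2 : ∑ n ∈ B, ∑ p ∈ P, j (i+2) n p * (y i n - j i n p) =
      ∑ n ∈ B, (y (i+2) n * y i n) - ∑ n ∈ B, ∑ p ∈ P, j (i+2) n p * j i n p := by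
    simp only [← sum_sub_distrib]
    refine sum_congr rfl fun n _ => ?_
    simp only [mul_sub, sum_sub_distrib, ← sum_mul]
    rfl
  have e3 : Dn B P io t f i = Yn B P io t f (i+2) + Yn B P io t f i - 2 * ∑ n ∈ B, (y (i+2) n * y i n) := by
    simp only [Dn, Yn, ← sum_add_distrib, mul_sum, ← sum_sub_distrib]
    refine sum_congr rfl fun n _ => ?_
    simp only [hy]; ring
  have e4 : En B P io t f i = Jn B P io t f (i+2) + Jn B P io t f i
      - 2 * ∑ n ∈ B, ∑ p ∈ P, (j (i+2) n p * j i n p) := by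
    simp only [En, Jn, ← sum_add_distrib, mul_sum, ← sum_sub_distrib]
    refine sum_congr rfl fun n _ => sum_congr rfl fun p _ => ?_
    simp only [hj]; ring
  rw [e1, e2] at h1
  linarith

lemma sq_sub_le (a b : ℝ) : (a - b)^2 ≤ 2 * a^2 + 2 * b^2 := by nlinarith [sq_nonneg (a+b)]

/-- general bound for t²-weighted sums -/
lemma tsq_bound (hK : Ker B P io t) {τ z : ℝ} (hτ : ∀ n, ∑ p ∈ P, t n p ^ 2 ≤ τ)
    (hz : ∀ n, ∀ p ∈ P, |t n p| ≤ z) (u : ℤ → ℝ) (v : ℤ → ℕ → ℝ) :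
    ∑ n ∈ B, ∑ p ∈ P, (t n p * (u (io n p) - v (io n p) p)) ^ 2 ≤
      2 * τ * ∑ n ∈ B, u n ^ 2 + 2 * z^2 * ∑ n ∈ B, ∑ p ∈ P, v n p ^ 2 := by
  have h := sum_invol2 hK (fun x => x^2) (by norm_num) (fun n p => (u n - v n p)^2)
  simp only [mul_pow] at h ⊢
  rw [h, mul_sum, mul_sum, ← sum_add_distrib]
  refine sum_le_sum fun n _ => ?_
  calc ∑ p ∈ P, t n p ^ 2 * (u n - v n p) ^ 2
      ≤ ∑ p ∈ P, (t n p ^ 2 * (2 * u n ^ 2) + 2 * z^2 * v n p ^ 2) := by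
        refine sum_le_sum fun p hp => ?_
        have h1 := sq_sub_le (u n) (v n p)
        have h2 : t n p ^ 2 ≤ z ^ 2 := by
          have := hz n p hp
          exact sq_le_sq' (by linarith [neg_abs_le (t n p)]) (by linarith [le_abs_self (t n p)])
        nlinarith [sq_nonneg (t n p), sq_nonneg (v n p)]
    _ = (∑ p ∈ P, t n p ^ 2) * (2 * u n ^ 2) + 2 * z^2 * ∑ p ∈ P, v n p ^ 2 := by
        rw [sum_add_distrib, sum_mul, mul_sum]
    _ ≤ _ := by
        have := hτ n
        nlinarith [sq_nonneg (u n)]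

lemma Jn_step (hK : Ker B P io t) {τ z : ℝ} (hτ : ∀ n, ∑ p ∈ P, t n p ^ 2 ≤ τ)
    (hz : ∀ n, ∀ p ∈ P, |t n p| ≤ z) (i : ℕ) :
    Jn B P io t f (i+1) ≤ 2 * τ * Yn B P io t f i + 2 * z^2 * Jn B P io t f i :=
  tsq_bound hK hτ hz _ _

lemma En_step (hK : Ker B P io t) {τ z : ℝ} (hτ : ∀ n, ∑ p ∈ P, t n p ^ 2 ≤ τ)
    (hz : ∀ n, ∀ p ∈ P, |t n p| ≤ z) (i : ℕ) :
    En B P io t f (i+1) ≤ 2 * τ * Dn B P io t f i + 2 * z^2 * En B P io t f i := by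
  have := tsq_bound hK hτ hz (fun n => (yj P io t f (i+2)).1 n - (yj P io t f i).1 n)
    (fun n p => (yj P io t f (i+2)).2 n p - (yj P io t f i).2 n p)
  refine le_trans (le_of_eq ?_) this
  simp only [En]
  refine sum_congr rfl fun n _ => sum_congr rfl fun p _ => ?_
  rw [yj_succ_snd, yj_succ_snd (i := i)]
  congr 1; ring

lemma Yn_step (hK : Ker B P io t) {s z : ℝ} (hs : ∀ n, ∑ p ∈ P, |t n p| ≤ s)
    (hz : ∀ n, ∀ p ∈ P, |t n p| ≤ z) (hs0 : 0 ≤ s) (i : ℕ) :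
    Yn B P io t f (i+1) ≤ 2 * s^2 * Yn B P io t f i + 2 * s * z * Jn B P io t f i := by
  set u := (yj P io t f i).1 with hu
  set v := (yj P io t f i).2 with hv
  have h := sum_invol2 hK (fun x => |x|) (by norm_num) (fun n p => (u n - v n p)^2)
  have h1 : Yn B P io t f (i+1) ≤ s * ∑ n ∈ B, ∑ p ∈ P, |t n p| * (u (io n p) - v (io n p) p)^2 := by
    rw [Yn, mul_sum]
    refine sum_le_sum fun n _ => ?_
    rw [yj_succ_fst]
    have := Finset.sum_mul_sq_le_sq_mul_sq P (fun p => Real.sqrt |t n p|)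
      (fun p => Real.sqrt |t n p| * (SignType.sign (t n p) : ℝ) * (u (io n p) - v (io n p) p))
    have e1 : ∑ p ∈ P, Real.sqrt |t n p| * (Real.sqrt |t n p| * (SignType.sign (t n p) : ℝ) * (u (io n p) - v (io n p) p)) = ∑ p ∈ P, (yj P io t f (i+1)).2 n p := by
      refine sum_congr rfl fun p _ => ?_
      rw [yj_succ_snd, ← mul_assoc, ← mul_assoc, Real.mul_self_sqrt (abs_nonneg _), abs_mul_sign]
    have e2 : ∑ p ∈ P, Real.sqrt |t n p| ^ 2 ≤ s := by
      refine le_trans (le_of_eq (sum_congr rfl fun p _ => ?_)) (hs n)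
      rw [Real.sq_sqrt (abs_nonneg _)]
    have e3 : ∑ p ∈ P, (Real.sqrt |t n p| * (SignType.sign (t n p) : ℝ) * (u (io n p) - v (io n p) p))^2 ≤
       ∑ p ∈ P, |t n p| * (u (io n p) - v (io n p) p)^2 := by
      refine sum_le_sum fun p _ => ?_
      rw [mul_pow, mul_pow, Real.sq_sqrt (abs_nonneg _)]
      have : ((SignType.sign (t n p) : SignType) : ℝ)^2 ≤ 1 := by
        rcases SignType.sign (t n p) with _ | _ | _ <;> simp
      have h3 := abs_nonneg (t n p)
      have h4 := sq_nonneg (u (io n p) - v (io n p) p)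
      nlinarith [mul_nonneg h3 h4]
    rw [e1] at this
    refine this.trans ?_
    gcongr
  rw [h] at h1
  refine h1.trans ?_
  have h2 : ∑ n ∈ B, ∑ p ∈ P, |t n p| * (u n - v n p)^2 ≤ 2 * s * Yn B P io t f i + 2 * z * Jn B P io t f i := by
    rw [Yn, Jn, mul_sum, mul_sum, ← sum_add_distrib]
    refine sum_le_sum fun n _ => ?_
    calc ∑ p ∈ P, |t n p| * (u n - v n p) ^ 2
        ≤ ∑ p ∈ P, (|t n p| * (2 * u n ^ 2) + 2 * z * v n p ^ 2) := by
            refine sum_le_sum fun p hp => ?_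
            have h1 := sq_sub_le (u n) (v n p)
            have h2 := hz n p hp
            nlinarith [abs_nonneg (t n p), sq_nonneg (v n p)]
      _ = (∑ p ∈ P, |t n p|) * (2 * u n ^ 2) + 2 * z * ∑ p ∈ P, v n p ^ 2 := by
            rw [sum_add_distrib, sum_mul, mul_sum]
      _ ≤ _ := by
            have := hs n
            nlinarith [sq_nonneg (u n)]
  have := mul_le_mul_of_nonneg_left h2 hs0
  linarith

lemma energy_main (hK : Ker B P io t) {z : ℝ} (hτ : ∀ n, ∑ p ∈ P, t n p ^ 2 ≤ 1/8)
    (hz : ∀ n, ∀ p ∈ P, |t n p| ≤ z) (hz2 : 2 * z^2 ≤ 1/4) (m : ℕ) :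
    Yn B P io t f 1 ≤ 7/4 * Yn B P io t f 0 + 3/2 * (Yn B P io t f (m+1) + Jn B P io t f m) := by
  set Y := Yn B P io t f
  set J := Jn B P io t f
  set D := Dn B P io t f
  set E := En B P io t f
  have hE : ∀ k, E (k+1) ≤ 1/4 * D k + 1/4 * E k := fun k => by
    have := En_step (f := f) hK hτ hz k
    have h2 : 2 * z^2 * E k ≤ 1/4 * E k := mul_le_mul_of_nonneg_right hz2 (En_nonneg k)
    linarith
  have hJ : ∀ k, J (k+1) ≤ 1/4 * Y k + 1/4 * J k := fun k => by
    have := Jn_step (f := f) hK hτ hz k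
    have h2 : 2 * z^2 * J k ≤ 1/4 * J k := mul_le_mul_of_nonneg_right hz2 (Jn_nonneg k)
    linarith
  have hJ0 : J 0 = 0 := by simp [J, Jn, yj]
  have hJ1 : J 1 ≤ 1/8 * Y 0 := by
    have h := sum_invol2 hK (fun x => x^2) (by norm_num) (fun n p => f n ^2)
    have : J 1 = ∑ n ∈ B, ∑ p ∈ P, t n p ^ 2 * f (io n p) ^ 2 := by
      simp [J, Jn, yj, mul_pow]
    rw [this, h]
    simp only [Y, Yn, mul_sum]
    refine sum_le_sum fun n _ => ?_
    rw [← sum_mul]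
    exact mul_le_mul_of_nonneg_right (hτ n) (sq_nonneg _)
  have hE0 : E 0 = J 2 := by simp [E, En, J, Jn, yj]
  have hkey : ∀ k, (Y (k+2) - J (k+2)) - 2 * (Y (k+1) - J (k+1)) + (Y k - J k) = D k - E k :=
    fun k => key_id hK k
  have hEsum : ∀ k, ∑ i ∈ range k, E i + 4/3 * E k ≤ 4/3 * E 0 + 1/3 * ∑ i ∈ range k, D i := by
    intro k
    induction k with
    | zero => simp
    | succ k ih =>
      rw [sum_range_succ, sum_range_succ]
      have := hE k
      nlinarith [Dn_nonneg (B := B) (P := P) (io := io) (t := t) (f := f) k, En_nonneg (B := B) (P := P) (io := io) (t := t) (f := f) k]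
  have htel : ∀ k, (Y (k+1) - J (k+1)) - (Y k - J k) = (Y 1 - J 1) - (Y 0 - J 0) + ∑ i ∈ range k, (D i - E i) := by
    intro k
    induction k with
    | zero => simp
    | succ k ih =>
      rw [sum_range_succ]
      have := hkey k
      linarith
  have h1 := htel m
  rw [sum_sub_distrib] at h1
  have h2 := hEsum m
  have h3 : 0 ≤ ∑ i ∈ range m, D i := sum_nonneg fun i _ => Dn_nonneg i
  have h4 : 0 ≤ E m := En_nonneg m
  have h5 := hJ 1
  have h6 : 0 ≤ J (m+1) := Jn_nonneg _
  have h7 : 0 ≤ Y m := Yn_nonneg _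
  norm_num at h5
  linarith

lemma energy_final (hK : Ker B P io t) {z s ε : ℝ} (hτ : ∀ n, ∑ p ∈ P, t n p ^ 2 ≤ 1/8)
    (hz : ∀ n, ∀ p ∈ P, |t n p| ≤ z) (hz2 : 2 * z^2 ≤ 1/4) (hs : ∀ n, ∑ p ∈ P, |t n p| ≤ s)
    (hs0 : z ≤ s) (hz0 : 0 ≤ z) (l : ℕ)
    (hY : ∀ i, l ≤ i → i ≤ 4 * l + 1 → Yn B P io t f i ≤ ε) :
    Yn B P io t f 1 ≤ 7/4 * Yn B P io t f 0 + 3/2 *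
      (2 * ε + (2 * z^2)^(3*l) * (4 * s^2 + 1)^l * Yn B P io t f 0) := by
  set Y := Yn B P io t f
  set J := Jn B P io t f
  have hJ : ∀ k, J (k+1) ≤ 1/4 * Y k + 2 * z^2 * J k := fun k => by
    have := Jn_step (f := f) hK hτ hz k
    linarith
  have hYs : ∀ k, Y (k+1) ≤ 2 * s^2 * Y k + 2 * s * z * J k := fun k =>
    Yn_step hK hs hz (hz0.trans hs0) k
  have hYn : ∀ k, 0 ≤ Y k := fun k => Yn_nonneg k
  have hJn : ∀ k, 0 ≤ J k := fun k => Jn_nonneg k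
  have hM : ∀ k, Y k + J k ≤ (4 * s^2+1)^k * Y 0 := by
    intro k
    induction k with
    | zero => simp [J, Jn, yj]
    | succ k ih =>
      have h1 := hJ k
      have h2 := hYs k
      have h3 : 2 * s * z * J k ≤ 2 * s^2 * J k := by nlinarith [hJn k, mul_nonneg (hz0.trans hs0) (hJn k)]
      have h4 : 2 * z^2 * J k ≤ 1/4 * J k := mul_le_mul_of_nonneg_right hz2 (hJn k)
      calc Y (k+1) + J (k+1) ≤ (4 * s^2+1) * (Y k + J k) := by
            nlinarith [hYn k, hJn k, mul_nonneg (sq_nonneg s) (hYn k), mul_nonneg (sq_nonneg s) (hJn k)]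
        _ ≤ (4 * s^2+1) * ((4 * s^2+1)^k * Y 0) := by gcongr
        _ = _ := by ring
  have hε : 0 ≤ ε := (hYn l).trans (hY l le_rfl (by omega))
  have hJm : ∀ k, k ≤ 3 * l → J (l + k) ≤ 1/2 * ε + (2*z^2)^k * J l := by
    intro k
    induction k with
    | zero => intro _; simp; linarith
    | succ k ih =>
      intro hk
      have h1 := ih (by omega)
      have h2 := hJ (l+k)
      have h3 := hY (l+k) (by omega) (by omega)
      have h4 : 2 * z^2 * J (l+k) ≤ 2 * z^2 * (1/2 * ε + (2*z^2)^k * J l) := by gcongr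
      have h5 : 2 * z^2 * (1/2 * ε) ≤ 1/4 * (1/2 * ε) := mul_le_mul_of_nonneg_right hz2 (by linarith)
      rw [← add_assoc, pow_succ]
      linarith
  have h1 := hJm (3*l) le_rfl
  have h2 := energy_main (f := f) hK hτ hz hz2 (4*l)
  have h3 := hY (4*l+1) (by omega) (by omega)
  have h4 := hM l
  have h5 : (2*z^2)^(3*l) * J l ≤ (2*z^2)^(3*l) * ((4 * s^2 + 1)^l * Y 0) := by
    gcongr; linarith [hYn l]
  rw [show l + 3 * l = 4 * l by ring] at h1
  change Y 1 ≤ _ at h2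
  change Y 1 ≤ 7/4 * Y 0 + 3/2 * (Y (4*l+1) + J (4*l)) at h2
  rw [← mul_assoc] at h5
  linarith

end Energy
end KK

set_option linter.all false
set_option linter.unusedVariables false
set_option linter.unusedSectionVars false
namespace KK
open Finset

section CRT

/-- average over a period -/
noncomputable def Ev (q : ℕ) (g : ℤ → ℝ) : ℝ := (∑ r ∈ range q, g r) / q

def Per (q : ℕ) (g : ℤ → ℝ) : Prop := ∀ n, g (n + q) = g n

lemma Per.add_mul {q : ℕ} {g : ℤ → ℝ} (h : Per q g) (n : ℤ) (k : ℕ) : g (n + k * q) = g n := by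
  induction k with
  | zero => simp
  | succ k ih =>
    rw [← ih, ← h (n + k * q)]; congr 1; push_cast; ring

lemma Per.mod {q : ℕ} {g : ℤ → ℝ} (h : Per q g) (n : ℕ) : g ((n % q : ℕ) : ℤ) = g n := by
  rw [← h.add_mul ((n % q : ℕ) : ℤ) (n / q)]
  congr 1
  have := Nat.mod_add_div' n q
  exact_mod_cast this

lemma Per.mul' {q r : ℕ} {g : ℤ → ℝ} (h : Per q g) : Per (q * r) g := by
  intro n
  have := h.add_mul n r
  rw [← this]; congr 1; push_cast; ring

lemma Per.mul {q : ℕ} {g h : ℤ → ℝ} (hg : Per q g) (hh : Per q h) : Per q (fun n => g n * h n) := by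
  intro n; simp only [hg n, hh n]

lemma sum_period_mul {Q q : ℕ} (hc : Nat.Coprime Q q) {h g : ℤ → ℝ} (hh : Per Q h) (hg : Per q g) (hQ : 0 < Q) (hq : 0 < q) :
    ∑ r ∈ range (Q * q), h r * g r = (∑ r ∈ range Q, h r) * ∑ r ∈ range q, g r := by
  rw [sum_mul_sum, ← sum_product']
  have hm : ∀ n ∈ range (Q*q), (n % Q, n % q) ∈ range Q ×ˢ range q := by
    intro n _
    simp [Nat.mod_lt _ hQ, Nat.mod_lt _ hq]
  have hinj : Set.InjOn (fun n => (n % Q, n % q)) (range (Q*q) : Set ℕ) := by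
    intro a ha b hb hab
    simp only [Prod.mk.injEq] at hab
    have := (Nat.modEq_and_modEq_iff_modEq_mul hc).1 ⟨hab.1, hab.2⟩
    simp only [coe_range, Set.mem_Iio] at ha hb
    exact Nat.ModEq.eq_of_lt_of_lt this ha hb
  refine sum_nbij (fun n => (n % Q, n % q)) hm hinj ?_ ?_
  · exact surjOn_of_injOn_of_card_le _ hm hinj (by simp)
  · intro n _
    simp only
    rw [hh.mod, hg.mod]

lemma per_prod {T : Finset ℕ} {g : ℕ → ℤ → ℝ} (hg : ∀ q ∈ T, Per q (g q)) :
    Per (∏ q ∈ T, q) (fun n => ∏ q ∈ T, g q n) := by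
  intro n
  refine prod_congr rfl fun q hq => ?_
  obtain ⟨c, hc⟩ := dvd_prod_of_mem (fun q => q) hq
  have := (hg q hq).mul' (r := c) n
  rw [hc]; exact this

lemma sum_period_prod {T : Finset ℕ} (hT : ∀ q ∈ T, q.Prime) {g : ℕ → ℤ → ℝ}
    (hg : ∀ q ∈ T, Per q (g q)) :
    ∑ r ∈ range (∏ q ∈ T, q), ∏ q ∈ T, g q r = ∏ q ∈ T, ∑ r ∈ range q, g q r := by
  induction T using Finset.induction_on with
  | empty => simp
  | insert p T hp ih =>
    simp only [prod_insert hp]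
    have hT' : ∀ q ∈ T, q.Prime := fun q hq => hT q (mem_insert_of_mem hq)
    have hg' : ∀ q ∈ T, Per q (g q) := fun q hq => hg q (mem_insert_of_mem hq)
    rw [← ih hT' hg']
    refine sum_period_mul ?_ (hg p (mem_insert_self _ _)) (per_prod hg') (hT p (mem_insert_self _ _)).pos
      (prod_pos fun q hq => (hT' q hq).pos)
    refine Nat.Coprime.prod_right fun q hq => ?_
    refine (Nat.coprime_primes (hT p (mem_insert_self _ _)) (hT' q hq)).2 ?_
    rintro rfl; exact hp hq

lemma sum_shift {Q : ℕ} {G : ℤ → ℝ} (hG : Per Q G) (a : ℤ) :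
    ∑ i ∈ range Q, G (a + i) = ∑ i ∈ range Q, G i := by
  have h1 : ∀ a : ℤ, ∑ i ∈ range Q, G (a + 1 + i) = ∑ i ∈ range Q, G (a + i) := by
    intro a
    have e1 := sum_range_succ (fun i : ℕ => G (a + i)) Q
    have e2 := sum_range_succ' (fun i : ℕ => G (a + i)) Q
    rw [e1, hG a] at e2
    simp only [Nat.cast_zero, add_zero] at e2
    have := add_right_cancel e2
    rw [this]
    refine sum_congr rfl fun i _ => ?_
    congr 1; push_cast; ring
  induction a using Int.induction_on with
  | zero => simp
  | succ i ih => rw [h1, ih]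
  | pred i ih => rw [← ih, ← h1]; simp

lemma sum_interval {Q : ℕ} (hQ : 0 < Q) {G : ℤ → ℝ} (hG : Per Q G) (hb : ∀ n, |G n| ≤ 1) (a : ℤ) (M : ℕ) :
    |∑ i ∈ range M, G (a + i) - M * Ev Q G| ≤ 2 * Q := by
  have hk : ∀ k r : ℕ, ∑ i ∈ range (Q * k + r), G (a + i) = k * ∑ i ∈ range Q, G i + ∑ i ∈ range r, G (a + i) := by
    intro k r
    induction k with
    | zero => simp
    | succ k ih =>
      rw [show Q * (k+1) + r = (Q * k + r) + Q by ring, sum_range_add, ih]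
      have := sum_shift hG (a + (Q * k + r : ℕ))
      have e : ∑ x ∈ range Q, G (a + ((Q * k + r + x : ℕ) : ℤ)) = ∑ i ∈ range Q, G i := by
        rw [← this]; refine sum_congr rfl fun i _ => ?_
        congr 1; push_cast; ring
      rw [e]; push_cast; ring
  have h1 := hk (M / Q) (M % Q)
  rw [Nat.div_add_mod] at h1
  rw [h1]
  have hQ' : (0:ℝ) < Q := by exact_mod_cast hQ
  have hS : |∑ i ∈ range Q, G i| ≤ Q := by
    refine (abs_sum_le_sum_abs _ _).trans ?_
    refine (sum_le_sum fun (i:ℕ) _ => hb (i:ℤ)).trans ?_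
    simp
  have hr : |∑ i ∈ range (M % Q), G (a + i)| ≤ Q := by
    refine (abs_sum_le_sum_abs _ _).trans ?_
    refine (sum_le_sum fun (i:ℕ) _ => hb (a+i)).trans ?_
    simp; exact_mod_cast (Nat.mod_lt M hQ).le
  have hM : (M : ℝ) = Q * (M / Q : ℕ) + (M % Q : ℕ) := by exact_mod_cast (Nat.div_add_mod M Q).symm
  have e : ((M / Q : ℕ) : ℝ) * ∑ i ∈ range Q, G i + ∑ i ∈ range (M % Q), G (a + i) - M * Ev Q G
      = ∑ i ∈ range (M % Q), G (a + i) - ((M % Q : ℕ) / Q : ℝ) * ∑ i ∈ range Q, G i := by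
    rw [Ev]
    have : (M : ℝ) * ((∑ r ∈ range Q, G r) / Q) = (M / Q : ℝ) * ∑ r ∈ range Q, G r := by ring
    rw [this, show (M / Q : ℝ) = (M / Q : ℕ) + (M % Q : ℕ) / Q by
      rw [hM, add_div]; field_simp]
    ring
  rw [e]
  refine (abs_sub _ _).trans ?_
  have h2 : |((M % Q : ℕ) / Q : ℝ) * ∑ i ∈ range Q, G i| ≤ 1 * Q := by
    rw [abs_mul]
    refine mul_le_mul ?_ hS (abs_nonneg _) (by norm_num)
    rw [abs_of_nonneg (by positivity), div_le_one hQ']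
    exact_mod_cast (Nat.mod_lt M hQ).le
  linarith

lemma crt_avg {T : Finset ℕ} (hT : ∀ q ∈ T, q.Prime) {g : ℕ → ℤ → ℝ}
    (hg : ∀ q ∈ T, Per q (g q)) (hb : ∀ q ∈ T, ∀ n, |g q n| ≤ 1) (a : ℤ) (M : ℕ) :
    |∑ i ∈ range M, ∏ q ∈ T, g q (a + i) - M * ∏ q ∈ T, Ev q (g q)| ≤ 2 * ∏ q ∈ T, (q : ℝ) := by
  have h := sum_interval (Q := ∏ q ∈ T, q) (prod_pos fun q hq => (hT q hq).pos) (per_prod hg) (fun n => by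
    rw [abs_prod]; exact prod_le_one (fun _ _ => abs_nonneg _) fun q hq => hb q hq n) a M
  have e : Ev (∏ q ∈ T, q) (fun n => ∏ q ∈ T, g q n) = ∏ q ∈ T, Ev q (g q) := by
    rw [Ev, sum_period_prod hT hg]
    simp only [Ev, prod_div_distrib]
    push_cast; rfl
  rw [e] at h
  push_cast at h
  exact h

/-- with a parity condition -/
noncomputable def parI (π : ℤ) (n : ℤ) : ℝ := if (2:ℤ) ∣ n - π then 1 else 0

lemma parI_per (π : ℤ) : Per 2 (parI π) := by
  intro n
  simp only [parI]
  congr 1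
  apply propext
  constructor <;> intro h <;> omega

lemma parI_Ev (π : ℤ) : Ev 2 (parI π) = 1/2 := by
  simp only [Ev, parI, sum_range_succ, range_zero, sum_empty]
  rcases Int.emod_two_eq_zero_or_one π with h | h
  · rw [if_pos (by push_cast; omega), if_neg (by push_cast; omega)]; norm_num
  · rw [if_neg (by push_cast; omega), if_pos (by push_cast; omega)]; norm_num

lemma crt_avg_par {T : Finset ℕ} (hT : ∀ q ∈ T, q.Prime) (h2 : 2 ∉ T) {g : ℕ → ℤ → ℝ}
    (hg : ∀ q ∈ T, Per q (g q)) (hb : ∀ q ∈ T, ∀ n, |g q n| ≤ 1) (π a : ℤ) (M : ℕ) :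
    |∑ i ∈ range M, parI π (a + i) * ∏ q ∈ T, g q (a + i) - M / 2 * ∏ q ∈ T, Ev q (g q)|
      ≤ 4 * ∏ q ∈ T, (q : ℝ) := by
  have h := crt_avg (T := insert 2 T) (g := Function.update g 2 (parI π)) ?_ ?_ ?_ a M
  · rw [prod_insert h2, prod_insert h2] at h
    simp only [Function.update_self, parI_Ev] at h
    have e1 : ∏ q ∈ T, Ev q (Function.update g 2 (parI π) q) = ∏ q ∈ T, Ev q (g q) := by
      refine prod_congr rfl fun q hq => ?_
      rw [Function.update_of_ne]; rintro rfl; exact h2 hq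
    have e2 : ∀ n, ∏ q ∈ insert 2 T, Function.update g 2 (parI π) q n = parI π n * ∏ q ∈ T, g q n := by
      intro n
      rw [prod_insert h2, Function.update_self]
      congr 1
      refine prod_congr rfl fun q hq => ?_
      rw [Function.update_of_ne]; rintro rfl; exact h2 hq
    simp only [e1, e2] at h
    push_cast at h
    calc _ = _ := by rw [show (M:ℝ) / 2 * ∏ q ∈ T, Ev q (g q) = M * (1/2 * ∏ q ∈ T, Ev q (g q)) by ring]
      _ ≤ _ := h
      _ = _ := by ring
  · intro q hq
    rcases mem_insert.1 hq with rfl | hq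
    · exact Nat.prime_two
    · exact hT q hq
  · intro q hq
    rcases mem_insert.1 hq with rfl | hq'
    · simpa using parI_per π
    · rw [Function.update_of_ne]
      · exact hg q hq'
      · rintro rfl; exact h2 hq'
  · intro q hq n
    rcases mem_insert.1 hq with rfl | hq'
    · simp only [Function.update_self, parI]; split_ifs <;> simp
    · rw [Function.update_of_ne]
      · exact hb q hq' n
      · rintro rfl; exact h2 hq'

end CRT

section Bonf
variable {ι : Type*} [DecidableEq ι]

noncomputable def esy (S : Finset ι) (Y : ι → ℝ) (k : ℕ) : ℝ := ∑ T ∈ powersetCard k S, ∏ i ∈ T, Y i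

lemma esy_zero (S : Finset ι) (Y : ι → ℝ) : esy S Y 0 = 1 := by simp [esy]

lemma esy_insert {S : Finset ι} {x : ι} (hx : x ∉ S) (Y : ι → ℝ) (k : ℕ) :
    esy (insert x S) Y (k+1) = esy S Y (k+1) + Y x * esy S Y k := by
  simp only [esy]
  rw [powersetCard_succ_insert hx, sum_union, sum_image, mul_sum]
  · congr 1
    refine sum_congr rfl fun T hT => ?_
    rw [prod_insert]
    exact fun h => hx ((mem_powersetCard.1 hT).1 h)
  · intro a ha b hb hab
    have ha' : x ∉ a := fun h => hx ((mem_powersetCard.1 ha).1 h)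
    have hb' : x ∉ b := fun h => hx ((mem_powersetCard.1 hb).1 h)
    rw [← erase_insert ha', ← erase_insert hb', hab]
  · rw [disjoint_left]
    intro T hT hT'
    obtain ⟨U, _, rfl⟩ := mem_image.1 hT'
    exact hx ((mem_powersetCard.1 hT).1 (mem_insert_self _ _))

lemma esy_nonneg {S : Finset ι} {Y : ι → ℝ} (hY : ∀ i ∈ S, 0 ≤ Y i) (k : ℕ) : 0 ≤ esy S Y k :=
  sum_nonneg fun T hT => prod_nonneg fun i hi => hY i ((mem_powersetCard.1 hT).1 hi)

noncomputable def bon (S : Finset ι) (Y : ι → ℝ) (J : ℕ) : ℝ := ∑ k ∈ range J, (-1)^k * esy S Y k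

lemma bon_insert {S : Finset ι} {x : ι} (hx : x ∉ S) (Y : ι → ℝ) (J : ℕ) :
    bon (insert x S) Y (J+1) = bon S Y (J+1) - Y x * bon S Y J := by
  simp only [bon]
  rw [sum_range_succ', sum_range_succ' (fun k => (-1)^k * esy S Y k)]
  simp only [esy_insert hx, esy_zero, mul_sum]
  have : ∀ k, (-1:ℝ)^(k+1) * (esy S Y (k+1) + Y x * esy S Y k) =
    (-1)^(k+1) * esy S Y (k+1) - Y x * ((-1)^k * esy S Y k) := fun k => by ring
  simp only [this, sum_sub_distrib]
  ring

lemma bonferroni_aux {S : Finset ι} {Y : ι → ℝ} (h0 : ∀ i ∈ S, 0 ≤ Y i) (h1 : ∀ i ∈ S, Y i ≤ 1) (J : ℕ) :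
    0 ≤ (-1)^J * (∏ i ∈ S, (1 - Y i) - bon S Y J) ∧
      (-1)^J * (∏ i ∈ S, (1 - Y i) - bon S Y J) ≤ esy S Y J := by
  induction S using Finset.induction_on generalizing J with
  | empty =>
    cases J with
    | zero => simp [bon, esy]
    | succ J =>
      have : bon (∅ : Finset ι) Y (J+1) = 1 := by
        rw [bon, sum_range_succ', esy_zero]
        have : ∀ k, esy (∅ : Finset ι) Y (k+1) = 0 := fun k => by
          rw [esy, powersetCard_eq_empty.2 (by simp)]; simp
        simp [this]
      simp [this, esy_nonneg]
  | insert x S hx ih =>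
    have h0' : ∀ i ∈ S, 0 ≤ Y i := fun i hi => h0 i (mem_insert_of_mem hi)
    have h1' : ∀ i ∈ S, Y i ≤ 1 := fun i hi => h1 i (mem_insert_of_mem hi)
    cases J with
    | zero =>
      simp only [bon, range_zero, sum_empty, pow_zero, one_mul, sub_zero, esy_zero]
      exact ⟨prod_nonneg fun i hi => by linarith [h1 i hi],
        prod_le_one (fun i hi => by linarith [h1 i hi]) fun i hi => by linarith [h0 i hi]⟩
    | succ J =>
      have a1 := ih h0' h1' (J+1)
      have a2 := ih h0' h1' J
      rw [bon_insert hx, esy_insert hx, prod_insert hx]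
      have hx0 := h0 x (mem_insert_self _ _)
      have e : (-1:ℝ)^(J+1) * ((1 - Y x) * ∏ i ∈ S, (1 - Y i) - (bon S Y (J+1) - Y x * bon S Y J))
        = (-1)^(J+1) * (∏ i ∈ S, (1 - Y i) - bon S Y (J+1)) + Y x * ((-1)^J * (∏ i ∈ S, (1 - Y i) - bon S Y J)) := by
        ring
      rw [e]
      constructor
      · have := mul_nonneg hx0 a2.1; linarith [a1.1]
      · have := mul_le_mul_of_nonneg_left a2.2 hx0; linarith [a1.2]

lemma bonferroni {S : Finset ι} {Y : ι → ℝ} (h0 : ∀ i ∈ S, 0 ≤ Y i) (h1 : ∀ i ∈ S, Y i ≤ 1) (J : ℕ) :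
    |∏ i ∈ S, (1 - Y i) - bon S Y J| ≤ esy S Y J := by
  have := bonferroni_aux h0 h1 J
  have e : |∏ i ∈ S, (1 - Y i) - bon S Y J| = |(-1)^J * (∏ i ∈ S, (1 - Y i) - bon S Y J)| := by
    rw [abs_mul]; simp
  rw [e, abs_of_nonneg this.1]
  exact this.2

lemma esy_le {S : Finset ι} {Y : ι → ℝ} (h0 : ∀ i ∈ S, 0 ≤ Y i) (J : ℕ) {x : ℝ} (hx : 0 < x) :
    esy S Y J ≤ Real.exp (x * ∑ i ∈ S, Y i) / x^J := by
  rw [le_div_iff₀ (by positivity)]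
  have h1 : ∏ i ∈ S, (1 + x * Y i) ≤ Real.exp (x * ∑ i ∈ S, Y i) := by
    rw [mul_sum, Real.exp_sum]
    refine prod_le_prod (fun i hi => ?_) fun i _ => ?_
    · have := mul_nonneg hx.le (h0 i hi); linarith
    · rw [add_comm]; exact Real.add_one_le_exp _
  refine le_trans ?_ h1
  rw [prod_one_add, esy, sum_mul]
  calc _ = ∑ T ∈ powersetCard J S, ∏ i ∈ T, (x * Y i) := by
        refine sum_congr rfl fun T hT => ?_
        rw [prod_mul_distrib, prod_const, (mem_powersetCard.1 hT).2, mul_comm]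
    _ ≤ _ := by
        refine sum_le_sum_of_subset_of_nonneg (fun T hT => ?_) fun T hT _ => ?_
        · exact mem_powerset.2 (mem_powersetCard.1 hT).1
        · exact prod_nonneg fun i hi => mul_nonneg hx.le (h0 i (mem_powerset.1 hT hi))

end Bonf
end KK

set_option linter.all false
set_option linter.unusedVariables false
set_option linter.unusedSectionVars false
namespace KK
open Finset

section ExpMain

lemma crt_two {P D T : Finset ℕ} (hP : ∀ q ∈ P, q.Prime) (h2 : 2 ∉ P) (hD : D ⊆ P) (hT : T ⊆ P \ D)
    {φ Y : ℕ → ℤ → ℝ} (hφ : ∀ q ∈ D, Per q (φ q)) (hφ1 : ∀ q ∈ D, ∀ n, |φ q n| ≤ 1)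
    (hY : ∀ q ∈ P \ D, Per q (Y q)) (hY0 : ∀ q ∈ P \ D, ∀ n, 0 ≤ Y q n) (hY1 : ∀ q ∈ P \ D, ∀ n, Y q n ≤ 1)
    {H : ℝ} (hH : ∀ q ∈ P, (q:ℝ) ≤ H) (π a : ℤ) (M : ℕ) :
    |∑ i ∈ range M, parI π (a + i) * ((∏ q ∈ D, φ q (a + i)) * ∏ q ∈ T, Y q (a+i))
      - M / 2 * ((∏ q ∈ D, Ev q (φ q)) * ∏ q ∈ T, Ev q (Y q))| ≤ 4 * H ^ (D.card + T.card) := by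
  have hdis : Disjoint D T := by
    rw [disjoint_left]; intro q hq hq'; exact (mem_sdiff.1 (hT hq')).2 hq
  have hTP : ∀ q ∈ T, q ∈ P := fun q hq => (mem_sdiff.1 (hT hq)).1
  have hTD : ∀ q ∈ T, q ∉ D := fun q hq => (mem_sdiff.1 (hT hq)).2
  have hDT : ∀ q ∈ D ∪ T, q ∈ P := fun q hq => by
    rcases mem_union.1 hq with h | h
    · exact hD h
    · exact hTP q h
  set g : ℕ → ℤ → ℝ := fun q => if q ∈ D then φ q else Y q with hg
  have h := crt_avg_par (T := D ∪ T) (g := g) (fun q hq => hP q (hDT q hq)) (fun h => h2 (hDT 2 h)) ?_ ?_ π a M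
  · have e1 : ∀ n, ∏ q ∈ D ∪ T, g q n = (∏ q ∈ D, φ q n) * ∏ q ∈ T, Y q n := by
      intro n
      rw [prod_union hdis]
      congr 1
      · exact prod_congr rfl fun q hq => by simp [hg, hq]
      · exact prod_congr rfl fun q hq => by simp [hg, hTD q hq]
    have e2 : ∏ q ∈ D ∪ T, Ev q (g q) = (∏ q ∈ D, Ev q (φ q)) * ∏ q ∈ T, Ev q (Y q) := by
      rw [prod_union hdis]
      congr 1
      · exact prod_congr rfl fun q hq => by simp [hg, hq]
      · exact prod_congr rfl fun q hq => by simp [hg, hTD q hq]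
    simp only [e1, e2] at h
    refine h.trans ?_
    have : ∏ q ∈ D ∪ T, (q:ℝ) ≤ H ^ (D.card + T.card) := by
      rw [← card_union_of_disjoint hdis, ← prod_const]
      exact prod_le_prod (fun _ _ => by positivity) fun q hq => hH q (hDT q hq)
    linarith
  · intro q hq
    by_cases hqD : q ∈ D
    · simpa [hg, hqD] using hφ q hqD
    · have : q ∈ T := by simpa [hqD] using hq
      simpa [hg, hqD] using hY q (hT this)
  · intro q hq n
    by_cases hqD : q ∈ D
    · simpa [hg, hqD] using hφ1 q hqD n
    · have : q ∈ T := by simpa [hqD] using hq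
      simp only [hg, hqD, if_false]
      rw [abs_of_nonneg (hY0 q (hT this) n)]; exact hY1 q (hT this) n

lemma Ev_nonneg {q : ℕ} {g : ℤ → ℝ} (h : ∀ n, 0 ≤ g n) : 0 ≤ Ev q g :=
  div_nonneg (sum_nonneg fun _ _ => h _) (by positivity)

lemma Ev_mono {q : ℕ} {g h : ℤ → ℝ} (hh : ∀ n, g n ≤ h n) : Ev q g ≤ Ev q h := by
  unfold Ev; gcongr with i _; exact hh _

lemma Ev_const {q : ℕ} (hq : 0 < q) (c : ℝ) : Ev q (fun _ => c) = c := by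
  simp [Ev]; field_simp

lemma Ev_le_one {q : ℕ} (hq : 0 < q) {g : ℤ → ℝ} (h : ∀ n, g n ≤ 1) : Ev q g ≤ 1 := by
  have := Ev_mono (q := q) h
  rwa [Ev_const hq] at this

lemma Ev_add {q : ℕ} (g h : ℤ → ℝ) : Ev q (fun n => g n + h n) = Ev q g + Ev q h := by
  simp [Ev, sum_add_distrib, add_div]

lemma Ev_mul_left {q : ℕ} (c : ℝ) (h : ℤ → ℝ) : Ev q (fun n => c * h n) = c * Ev q h := by
  simp [Ev, ← mul_sum, mul_div_assoc]

lemma Ev_sum {q : ℕ} {κ : Type*} (s : Finset κ) (g : κ → ℤ → ℝ) :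
    Ev q (fun n => ∑ k ∈ s, g k n) = ∑ k ∈ s, Ev q (g k) := by
  simp only [Ev]; rw [sum_comm, sum_div]

lemma Per.int {q : ℕ} {g : ℤ → ℝ} (h : Per q g) (n : ℤ) (k : ℤ) : g (n + k * q) = g n := by
  rcases Int.eq_nat_or_neg k with ⟨m, rfl | rfl⟩
  · exact h.add_mul n m
  · have := h.add_mul (n + -m * q) m
    rw [← this]; congr 1; ring

lemma Ev_ind_mul {q : ℕ} (hq : 0 < q) (c : ℤ) {g : ℤ → ℝ} (hg : Per q g) :
    Ev q (fun n => (if (q:ℤ) ∣ n + c then 1 else 0) * g n) = g (-c) / q := by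
  unfold Ev
  congr 1
  have hq' : (0:ℤ) < q := by exact_mod_cast hq
  have hr := Int.emod_nonneg (-c) hq'.ne'
  have hr2 := Int.emod_lt_of_pos (-c) hq'
  have hd := Int.emod_add_mul_ediv (-c) q
  rw [sum_eq_single ((-c) % q).toNat]
  · have e : ((((-c) % q).toNat : ℕ) : ℤ) = (-c) % q := Int.toNat_of_nonneg hr
    simp only [e]
    rw [if_pos, one_mul]
    · rw [← hg.int ((-c) % q) ((-c) / q)]; congr 1; linarith
    · exact ⟨-((-c)/q), by linarith⟩
  · intro b hb hne
    simp only []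
    rw [if_neg, zero_mul]
    rintro ⟨k, hk⟩
    apply hne
    have hb' : (b:ℤ) < q := by exact_mod_cast mem_range.1 hb
    have : (-c) % q = b := by
      have : -c = b + q * (-k) := by linarith
      rw [this, Int.add_mul_emod_self_left, Int.emod_eq_of_lt (by positivity) hb']
    rw [this]; simp
  · intro h
    exfalso; apply h
    rw [mem_range]; omega

lemma Ev_ind {q : ℕ} (hq : 0 < q) (c : ℤ) :
    Ev q (fun n => (if (q:ℤ) ∣ n + c then (1:ℝ) else 0)) = 1 / q := by
  have := Ev_ind_mul hq c (g := fun _ => 1) (fun n => rfl)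
  simpa using this

lemma ind_per (q : ℕ) (c : ℤ) : Per q (fun n => if (q:ℤ) ∣ n + c then (1:ℝ) else 0) := by
  intro n
  have : ((q:ℤ) ∣ n + q + c) ↔ ((q:ℤ) ∣ n + c) := by
    rw [show n + q + c = (n + c) + q by ring]; exact dvd_add_self_right
  simp only [this]

theorem exp_main {P D : Finset ℕ} (hP : ∀ q ∈ P, q.Prime) (h2 : 2 ∉ P) (hD : D ⊆ P)
    {φ Y : ℕ → ℤ → ℝ} (hφ : ∀ q ∈ D, Per q (φ q)) (hφ1 : ∀ q ∈ D, ∀ n, |φ q n| ≤ 1)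
    (hY : ∀ q ∈ P \ D, Per q (Y q)) (hY0 : ∀ q ∈ P \ D, ∀ n, 0 ≤ Y q n) (hY1 : ∀ q ∈ P \ D, ∀ n, Y q n ≤ 1)
    {H : ℝ} (hH1 : 1 ≤ H) (hH : ∀ q ∈ P, (q:ℝ) ≤ H) (hcard : (P.card : ℝ) ≤ H) (J : ℕ) (π a : ℤ) (M : ℕ) :
    |∑ i ∈ range M, parI π (a + i) * ((∏ q ∈ D, φ q (a + i)) * ∏ q ∈ P \ D, (1 - Y q (a+i)))| ≤
      M / 2 * ((∏ q ∈ D, |Ev q (φ q)|) * (1 + esy (P \ D) (fun q => Ev q (Y q)) J) +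
        (∏ q ∈ D, Ev q (fun n => |φ q n|)) * esy (P \ D) (fun q => Ev q (Y q)) J)
      + 4 * (J + 1) * H ^ J * H ^ (D.card + J) := by
  set e := esy (P \ D) (fun q => Ev q (Y q)) J with he
  have hEY0 : ∀ q ∈ P \ D, 0 ≤ Ev q (Y q) := fun q hq => Ev_nonneg (hY0 q hq)
  have hEY1 : ∀ q ∈ P \ D, Ev q (Y q) ≤ 1 := fun q hq =>
    Ev_le_one (hP q (mem_sdiff.1 hq).1).pos (hY1 q hq)
  have hpar : ∀ n, 0 ≤ parI π n := fun n => by unfold parI; split_ifs <;> norm_num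
  -- count
  have hcnt : ∀ k, k ≤ J → ((powersetCard k (P \ D)).card : ℝ) ≤ H ^ J := by
    intro k hk
    rw [card_powersetCard]
    calc (((P \ D).card.choose k : ℕ) : ℝ) ≤ ((P \ D).card : ℝ) ^ k := by
          exact_mod_cast Nat.choose_le_pow _ _
      _ ≤ H ^ k := by
          gcongr
          refine le_trans ?_ hcard
          exact_mod_cast card_le_card sdiff_subset
      _ ≤ H ^ J := pow_le_pow_right₀ hH1 hk
  -- per k estimate
  have hk : ∀ (φ' : ℕ → ℤ → ℝ), (∀ q ∈ D, Per q (φ' q)) → (∀ q ∈ D, ∀ n, |φ' q n| ≤ 1) → ∀ k, k ≤ J →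
      |∑ i ∈ range M, parI π (a + i) * ((∏ q ∈ D, φ' q (a + i)) * esy (P \ D) (fun q => Y q (a+i)) k)
        - M / 2 * ((∏ q ∈ D, Ev q (φ' q)) * esy (P \ D) (fun q => Ev q (Y q)) k)| ≤
      4 * H ^ J * H ^ (D.card + J) := by
    intro φ' h1 h2' k hk
    have e1 : ∑ i ∈ range M, parI π (a + i) * ((∏ q ∈ D, φ' q (a + i)) * esy (P \ D) (fun q => Y q (a+i)) k)
        - M / 2 * ((∏ q ∈ D, Ev q (φ' q)) * esy (P \ D) (fun q => Ev q (Y q)) k)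
        = ∑ T ∈ powersetCard k (P \ D), (∑ i ∈ range M, parI π (a + i) * ((∏ q ∈ D, φ' q (a + i)) * ∏ q ∈ T, Y q (a+i))
      - M / 2 * ((∏ q ∈ D, Ev q (φ' q)) * ∏ q ∈ T, Ev q (Y q))) := by
      rw [sum_sub_distrib, sum_comm]
      simp only [esy, mul_sum]
    rw [e1]
    refine (abs_sum_le_sum_abs _ _).trans ?_
    have : ∀ T ∈ powersetCard k (P \ D), |∑ i ∈ range M, parI π (a + i) * ((∏ q ∈ D, φ' q (a + i)) * ∏ q ∈ T, Y q (a+i))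
      - M / 2 * ((∏ q ∈ D, Ev q (φ' q)) * ∏ q ∈ T, Ev q (Y q))| ≤ 4 * H ^ (D.card + J) := by
      intro T hT
      have hT' := mem_powersetCard.1 hT
      refine (crt_two hP h2 hD hT'.1 h1 h2' hY hY0 hY1 hH π a M).trans ?_
      have : H ^ (D.card + T.card) ≤ H ^ (D.card + J) := pow_le_pow_right₀ hH1 (by omega)
      linarith
    refine (sum_le_sum this).trans ?_
    rw [sum_const, nsmul_eq_mul]
    have h3 := hcnt k hk
    have h4 : 0 ≤ 4 * H ^ (D.card + J) := by positivity
    calc _ ≤ H ^ J * (4 * H ^ (D.card + J)) := mul_le_mul_of_nonneg_right h3 h4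
      _ = _ := by ring
  -- splitting
  have hsplit : ∑ i ∈ range M, parI π (a + i) * ((∏ q ∈ D, φ q (a + i)) * ∏ q ∈ P \ D, (1 - Y q (a+i)))
      = ∑ i ∈ range M, parI π (a + i) * ((∏ q ∈ D, φ q (a + i)) * bon (P \ D) (fun q => Y q (a+i)) J)
      + ∑ i ∈ range M, parI π (a + i) * ((∏ q ∈ D, φ q (a + i)) * (∏ q ∈ P \ D, (1 - Y q (a+i)) - bon (P \ D) (fun q => Y q (a+i)) J)) := by
    rw [← sum_add_distrib]
    refine sum_congr rfl fun i _ => ?_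
    ring
  have hA : |∑ i ∈ range M, parI π (a + i) * ((∏ q ∈ D, φ q (a + i)) * bon (P \ D) (fun q => Y q (a+i)) J)|
      ≤ M / 2 * ((∏ q ∈ D, |Ev q (φ q)|) * (1 + e)) + J * (4 * H ^ J * H ^ (D.card + J)) := by
    have e1 : ∑ i ∈ range M, parI π (a + i) * ((∏ q ∈ D, φ q (a + i)) * bon (P \ D) (fun q => Y q (a+i)) J)
        = M / 2 * ((∏ q ∈ D, Ev q (φ q)) * bon (P \ D) (fun q => Ev q (Y q)) J) +
          ∑ k ∈ range J, (-1)^k * (∑ i ∈ range M, parI π (a + i) * ((∏ q ∈ D, φ q (a + i)) * esy (P \ D) (fun q => Y q (a+i)) k)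
        - M / 2 * ((∏ q ∈ D, Ev q (φ q)) * esy (P \ D) (fun q => Ev q (Y q)) k)) := by
      simp only [bon, mul_sub, sum_sub_distrib, mul_sum]
      rw [sum_comm, add_comm]
      have : ∀ k, (-1:ℝ) ^ k * (M / 2 * ((∏ q ∈ D, Ev q (φ q)) * esy (P \ D) (fun q => Ev q (Y q)) k)) =
        M / 2 * ((∏ q ∈ D, Ev q (φ q)) * ((-1)^k * esy (P \ D) (fun q => Ev q (Y q)) k)) := fun k => by ring
      simp only [this, sub_add_cancel]
      refine sum_congr rfl fun k _ => sum_congr rfl fun i _ => ?_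
      ring
    rw [e1]
    refine (abs_add_le _ _).trans (add_le_add ?_ ?_)
    · rw [abs_mul, abs_mul, abs_of_nonneg (by positivity : (0:ℝ) ≤ M / 2), abs_prod]
      gcongr
      have hb := bonferroni hEY0 hEY1 J
      have h3 : |∏ q ∈ P \ D, (1 - Ev q (Y q))| ≤ 1 := by
        rw [abs_prod]
        refine prod_le_one (fun _ _ => abs_nonneg _) fun q hq => ?_
        rw [abs_of_nonneg (by linarith [hEY1 q hq])]; linarith [hEY0 q hq]
      have h4 := abs_sub_abs_le_abs_sub (bon (P \ D) (fun q => Ev q (Y q)) J) (∏ q ∈ P \ D, (1 - Ev q (Y q)))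
      rw [abs_sub_comm] at hb
      linarith
    · refine (abs_sum_le_sum_abs _ _).trans ?_
      rw [← nsmul_eq_mul, ← card_range J, ← sum_const, card_range]
      refine sum_le_sum fun k hk' => ?_
      rw [abs_mul, abs_pow, abs_neg, abs_one, one_pow, one_mul]
      exact hk φ hφ hφ1 k (mem_range.1 hk').le
  have hB : |∑ i ∈ range M, parI π (a + i) * ((∏ q ∈ D, φ q (a + i)) * (∏ q ∈ P \ D, (1 - Y q (a+i)) - bon (P \ D) (fun q => Y q (a+i)) J))|
      ≤ M / 2 * ((∏ q ∈ D, Ev q (fun n => |φ q n|)) * e) + 4 * H ^ J * H ^ (D.card + J) := by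
    have h1 := hk (fun q n => |φ q n|) (fun q hq n => by simp only [hφ q hq n]) (fun q hq n => by rw [abs_abs]; exact hφ1 q hq n) J le_rfl
    have h3 := (abs_le.1 h1).2
    refine (abs_sum_le_sum_abs _ _).trans ?_
    refine le_trans (sum_le_sum fun i _ => ?_) (by linarith : ∑ i ∈ range M, parI π (a + i) * ((∏ q ∈ D, |φ q (a + i)|) * esy (P \ D) (fun q => Y q (a+i)) J) ≤ _)
    rw [abs_mul, abs_mul, abs_of_nonneg (hpar _), abs_prod]
    refine mul_le_mul_of_nonneg_left (mul_le_mul_of_nonneg_left ?_ (prod_nonneg fun _ _ => abs_nonneg _)) (hpar _)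
    exact bonferroni (fun q hq => hY0 q hq _) (fun q hq => hY1 q hq _) J
  rw [hsplit]
  refine (abs_add_le _ _).trans ((add_le_add hA hB).trans (le_of_eq ?_))
  ring

end ExpMain
end KK

set_option linter.all false
set_option linter.unusedVariables false
set_option linter.unusedSectionVars false
namespace KK
open Finset

/-- number of primes of P dividing n -/
noncomputable def om (P : Finset ℕ) (n : ℤ) : ℕ := (P.filter fun q : ℕ => (q:ℤ) ∣ n).card
noncomputable def indd (q : ℕ) (n : ℤ) : ℝ := if (q:ℤ) ∣ n then 1 else 0

section Family
variable {K : Type*} [Fintype K] [DecidableEq K]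

noncomputable def Nq (u u' : K → ℤ) (q : ℕ) (n : ℤ) : ℕ :=
  (univ.filter fun k => (q:ℤ) ∣ n + u k).card + (univ.filter fun k => (q:ℤ) ∣ n + u' k).card

noncomputable def fam (P : Finset ℕ) (θ : ℝ) (x : K → ℕ) (u u' : K → ℤ) (n : ℤ) : ℝ :=
  ∏ k, ((indd (x k) (n + u k) - 1 / x k) * θ ^ om P (n + u k) * θ ^ om P (n + u' k))

noncomputable def phi (x : K → ℕ) (u : K → ℤ) (q : ℕ) (n : ℤ) : ℝ :=
  ∏ k ∈ univ.filter (fun k => x k = q), (indd q (n + u k) - 1 / q)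

lemma indd_nonneg (q : ℕ) (n : ℤ) : 0 ≤ indd q n := by unfold indd; split_ifs <;> norm_num
lemma indd_le_one (q : ℕ) (n : ℤ) : indd q n ≤ 1 := by unfold indd; split_ifs <;> norm_num
lemma indd_per (q : ℕ) (c : ℤ) : Per q (fun n => indd q (n + c)) := ind_per q c
lemma Ev_indd {q : ℕ} (hq : 0 < q) (c : ℤ) : Ev q (fun n => indd q (n + c)) = 1 / q := Ev_ind hq c

lemma fac_abs_le_one {q : ℕ} (hq : 0 < q) (n : ℤ) : |indd q n - 1 / q| ≤ 1 := by
  have h : (1:ℝ) / q ≤ 1 := by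
    rw [div_le_one (by exact_mod_cast hq)]; exact_mod_cast hq
  have h0 : (0:ℝ) ≤ 1 / q := by positivity
  rw [abs_le]; constructor <;> linarith [indd_nonneg q n, indd_le_one q n]

lemma fac_abs_le {q : ℕ} (n : ℤ) : |indd q n - 1 / q| ≤ indd q n + 1 / q := by
  have h0 : (0:ℝ) ≤ 1 / q := by positivity
  rw [abs_le]; constructor <;> linarith [indd_nonneg q n]

lemma phi_per (x : K → ℕ) (u : K → ℤ) (q : ℕ) : Per q (phi x u q) := by
  intro n
  unfold phi
  refine prod_congr rfl fun k _ => ?_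
  have := indd_per q (u k) n
  simp only at this
  rw [this]

lemma phi_abs_le_one (x : K → ℕ) (u : K → ℤ) {q : ℕ} (hq : 0 < q) (n : ℤ) : |phi x u q n| ≤ 1 := by
  unfold phi
  rw [abs_prod]
  exact prod_le_one (fun _ _ => abs_nonneg _) fun k _ => fac_abs_le_one hq _

lemma Nq_per (u u' : K → ℤ) (q : ℕ) (n : ℤ) : Nq u u' q (n + q) = Nq u u' q n := by
  have : ∀ c : ℤ, ((q:ℤ) ∣ n + q + c) ↔ ((q:ℤ) ∣ n + c) := fun c => by
    rw [show n + q + c = (n + c) + q by ring]; exact dvd_add_self_right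
  simp only [Nq, this]

lemma prod_pow_om (P : Finset ℕ) (θ : ℝ) (u : K → ℤ) (n : ℤ) :
    ∏ k, θ ^ om P (n + u k) = ∏ q ∈ P, θ ^ (univ.filter fun k => (q:ℤ) ∣ n + u k).card := by
  have h1 : ∀ k, θ ^ om P (n + u k) = ∏ q ∈ P, if (q:ℤ) ∣ n + u k then θ else 1 := by
    intro k; rw [prod_ite]; simp [om]
  simp only [h1]
  rw [prod_comm]
  refine prod_congr rfl fun q _ => ?_
  rw [prod_ite]; simp

lemma fam_fac (P : Finset ℕ) (θ : ℝ) (x : K → ℕ) (u u' : K → ℤ) (hx : ∀ k, x k ∈ P) (n : ℤ) :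
    fam P θ x u u' n = (∏ q ∈ univ.image x, (phi x u q n * θ ^ Nq u u' q n)) *
      ∏ q ∈ P \ univ.image x, (1 - (1 - θ ^ Nq u u' q n)) := by
  have hD : univ.image x ⊆ P := by
    intro q hq; obtain ⟨k, _, rfl⟩ := mem_image.1 hq; exact hx k
  have h1 : fam P θ x u u' n = (∏ k, (indd (x k) (n + u k) - 1 / x k)) * ∏ q ∈ P, θ ^ Nq u u' q n := by
    unfold fam
    rw [prod_mul_distrib, prod_mul_distrib, prod_pow_om, prod_pow_om, mul_assoc, ← prod_mul_distrib]
    congr 1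
    refine prod_congr rfl fun q _ => ?_
    rw [← pow_add, Nq]
  have h2 : ∏ k, (indd (x k) (n + u k) - 1 / x k) = ∏ q ∈ univ.image x, phi x u q n := by
    rw [← prod_fiberwise_of_maps_to (g := x) (t := univ.image x) (fun k _ => mem_image_of_mem _ (mem_univ k))]
    refine prod_congr rfl fun q _ => ?_
    unfold phi
    refine prod_congr rfl fun k hk => ?_
    rw [(mem_filter.1 hk).2]
  rw [h1, h2, prod_mul_distrib, mul_assoc]
  congr 1
  rw [← prod_sdiff hD, mul_comm]
  congr 1
  exact prod_congr rfl fun q _ => by ring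

lemma one_sub_pow_le {θ : ℝ} (h0 : 0 ≤ θ) (h1 : θ ≤ 1) (k : ℕ) : 1 - θ ^ k ≤ k * (1 - θ) := by
  have := one_add_mul_le_pow (a := θ - 1) (by linarith) k
  simp at this; linarith

lemma Ev_Y_le {θ : ℝ} (h0 : 0 ≤ θ) (h1 : θ ≤ 1) (u u' : K → ℤ) {q : ℕ} (hq : 0 < q) :
    Ev q (fun n => 1 - θ ^ Nq u u' q n) ≤ 2 * Fintype.card K * (1 - θ) / q := by
  have hN : ∀ n, ((Nq u u' q n : ℕ) : ℝ) = ∑ k, indd q (n + u k) + ∑ k, indd q (n + u' k) := by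
    intro n
    simp only [Nq, indd, sum_boole]; push_cast; rfl
  calc Ev q (fun n => 1 - θ ^ Nq u u' q n)
      ≤ Ev q (fun n => (1 - θ) * (∑ k, indd q (n + u k) + ∑ k, indd q (n + u' k))) := by
        refine Ev_mono fun n => ?_
        rw [← hN, mul_comm]; exact one_sub_pow_le h0 h1 _
    _ = _ := by
        rw [Ev_mul_left, Ev_add, Ev_sum, Ev_sum]
        simp only [Ev_indd hq, sum_const, card_univ, nsmul_eq_mul]
        ring

lemma phi_abs_ev (x : K → ℕ) (u : K → ℤ) {q : ℕ} (hq : 0 < q) (hk : q ∈ univ.image x) :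
    Ev q (fun n => |phi x u q n|) ≤ 3 * (1 / q) := by
  obtain ⟨k, _, hk⟩ := mem_image.1 hk
  calc Ev q (fun n => |phi x u q n|) ≤ Ev q (fun n => indd q (n + u k) + 1 / q) := by
        refine Ev_mono fun n => ?_
        unfold phi
        rw [abs_prod]
        refine (prod_le_of_mem_of_le_one hk n).trans (fac_abs_le _)
    _ = 1 / q + 1 / q := by rw [Ev_add, Ev_indd hq, Ev_const hq]
    _ ≤ _ := by have : (0:ℝ) ≤ 1 / q := by positivity
                linarith
where
  prod_le_of_mem_of_le_one {k : K} (hk : x k = q) (n : ℤ) :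
    ∏ k ∈ univ.filter (fun k => x k = q), |indd q (n + u k) - 1 / q| ≤ |indd q (n + u k) - 1 / q| := by
    have hm : k ∈ univ.filter (fun k => x k = q) := by simp [hk]
    rw [← mul_prod_erase _ _ hm]
    refine mul_le_of_le_one_right (abs_nonneg _) ?_
    exact prod_le_one (fun _ _ => abs_nonneg _) fun k _ => fac_abs_le_one hq _

lemma phi_abs_ev_nc (x : K → ℕ) (u : K → ℤ) {q : ℕ} (hq : 0 < q) {k k' : K} (hk : x k = q) (hk' : x k' = q)
    (hne : ¬ (q:ℤ) ∣ u k - u k') :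
    Ev q (fun n => |phi x u q n|) ≤ 3 * (1 / q) * (1 / q) := by
  have hkk : k ≠ k' := by rintro rfl; simp at hne
  calc Ev q (fun n => |phi x u q n|) ≤ Ev q (fun n => 1 / q * (indd q (n + u k) + indd q (n + u k') + 1 / q)) := by
        refine Ev_mono fun n => ?_
        unfold phi
        rw [abs_prod]
        have hm : k ∈ univ.filter (fun k => x k = q) := by simp [hk]
        have hm' : k' ∈ (univ.filter (fun k => x k = q)).erase k := by simp [hk', hkk.symm]
        rw [← mul_prod_erase _ _ hm, ← mul_prod_erase _ _ hm', ← mul_assoc]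
        have h1 : |indd q (n + u k) - 1 / q| * |indd q (n + u k') - 1 / q| ≤ (indd q (n + u k) + 1 / q) * (indd q (n + u k') + 1 / q) := by
          gcongr
          · have := indd_nonneg q (n + u k); positivity
          · exact fac_abs_le _
          · exact fac_abs_le _
        have h2 : indd q (n + u k) * indd q (n + u k') = 0 := by
          unfold indd
          split_ifs with h1 h2
          · exfalso; apply hne
            have := dvd_sub h1 h2
            simpa using this
          all_goals simp
        refine (mul_le_of_le_one_right (by positivity) ?_).trans ?_
        · exact prod_le_one (fun _ _ => abs_nonneg _) fun k _ => fac_abs_le_one hq _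
        · refine h1.trans (le_of_eq ?_)
          linear_combination h2
    _ = _ := by
        rw [Ev_mul_left, Ev_add, Ev_add, Ev_indd hq, Ev_indd hq, Ev_const hq]; ring

lemma phi_single_ev {θ : ℝ} (h0 : 0 ≤ θ) (h1 : θ ≤ 1) (x : K → ℕ) (u u' : K → ℤ) {q : ℕ} (hq : 0 < q) {k : K} (hk : x k = q)
    (huniq : ∀ k', x k' = q → k' = k) (hN : Nq u u' q (- u k) ≤ 4) (hV : (Fintype.card K : ℝ) ≤ q) :
    |Ev q (fun n => phi x u q n * θ ^ Nq u u' q n)| ≤ 3 * (1 / q) * (2 * (1 - θ)) := by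
  have hphi : ∀ n, phi x u q n = indd q (n + u k) - 1 / q := by
    intro n
    unfold phi
    have : univ.filter (fun k => x k = q) = {k} := by
      ext k'; simp only [mem_filter, mem_univ, true_and, mem_singleton]
      exact ⟨huniq k', fun h => h ▸ hk⟩
    rw [this, prod_singleton]
  have hg : Per q (fun n => θ ^ Nq u u' q n) := fun n => by simp only [Nq_per]
  have e1 : Ev q (fun n => phi x u q n * θ ^ Nq u u' q n) = 1 / q * (θ ^ Nq u u' q (- u k) - Ev q (fun n => θ ^ Nq u u' q n)) := by
    have a1 := Ev_ind_mul hq (u k) hg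
    have a2 : Ev q (fun n => phi x u q n * θ ^ Nq u u' q n) = Ev q (fun n => (indd q (n + u k)) * θ ^ Nq u u' q n + (-(1/q)) * θ ^ Nq u u' q n) := by
      congr 1; funext n; rw [hphi]; ring
    rw [a2, Ev_add, Ev_mul_left]
    unfold indd
    rw [a1]; ring
  have h2 : 1 - Ev q (fun n => θ ^ Nq u u' q n) ≤ 2 * (1 - θ) := by
    have a := Ev_Y_le h0 h1 u u' hq
    have b : Ev q (fun n => 1 - θ ^ Nq u u' q n) = 1 - Ev q (fun n => θ ^ Nq u u' q n) := by
      have := Ev_add (q := q) (fun n => 1 - θ ^ Nq u u' q n) (fun n => θ ^ Nq u u' q n)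
      simp only [sub_add_cancel] at this
      rw [Ev_const hq] at this
      linarith
    rw [← b]
    refine a.trans ?_
    have hq' : (0:ℝ) < q := by exact_mod_cast hq
    rw [div_le_iff₀ hq']
    have : 0 ≤ 1 - θ := by linarith
    nlinarith
  have h3 : Ev q (fun n => θ ^ Nq u u' q n) ≤ 1 := Ev_le_one hq fun n => pow_le_one₀ h0 h1
  have h4 : θ ^ Nq u u' q (- u k) ≤ 1 := pow_le_one₀ h0 h1
  have h5 : 1 - θ ^ Nq u u' q (- u k) ≤ 4 * (1 - θ) := by
    refine (one_sub_pow_le h0 h1 _).trans ?_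
    have : ((Nq u u' q (- u k) : ℕ) : ℝ) ≤ 4 := by exact_mod_cast hN
    exact mul_le_mul_of_nonneg_right this (by linarith)
  rw [e1, abs_mul, abs_of_nonneg (by positivity : (0:ℝ) ≤ 1 / q)]
  have : |θ ^ Nq u u' q (- u k) - Ev q (fun n => θ ^ Nq u u' q n)| ≤ 6 * (1 - θ) := by
    rw [abs_le]; constructor <;> linarith
  calc _ ≤ 1 / (q:ℝ) * (6 * (1 - θ)) := by gcongr
    _ = _ := by ring

lemma prod_dist_bound {D : Finset ℕ} {S : Finset ℕ} (hS : S ⊆ D) {E : ℕ → ℝ} (c : ℝ)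
    (hE0 : ∀ q ∈ D, 0 ≤ E q) (h1 : ∀ q ∈ D, E q ≤ 3 * (1/q)) (h2 : ∀ q ∈ S, E q ≤ 3 * (1/q) * c) :
    ∏ q ∈ D, E q ≤ 3 ^ D.card * (∏ q ∈ D, (1/(q:ℝ))) * c ^ S.card := by
  calc ∏ q ∈ D, E q ≤ ∏ q ∈ D, (3 * (1/(q:ℝ)) * if q ∈ S then c else 1) := by
        refine prod_le_prod hE0 fun q hq => ?_
        split_ifs with h
        · exact h2 q h
        · rw [mul_one]; exact h1 q hq
    _ = _ := by
        rw [prod_mul_distrib, prod_mul_distrib, prod_const, prod_ite, prod_const, prod_const_one, mul_one]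
        congr 2
        rw [filter_mem_eq_inter, inter_eq_right.2 hS]

theorem fam_abs {P : Finset ℕ} (hP : ∀ q ∈ P, q.Prime) (h2 : 2 ∉ P) {H : ℝ} (hH1 : 1 ≤ H) (hH : ∀ q ∈ P, (q:ℝ) ≤ H)
    (x : K → ℕ) (u : K → ℤ) (hx : ∀ k, x k ∈ P) (NC : Finset ℕ)
    (hNC : ∀ q ∈ NC, ∃ k k', x k = q ∧ x k' = q ∧ ¬ (q:ℤ) ∣ u k - u k') (π a : ℤ) (M : ℕ) :
    ∑ i ∈ range M, parI π (a + i) * |∏ k, (indd (x k) (a + i + u k) - 1 / x k)| ≤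
      M * (3 ^ Fintype.card K * (∏ q ∈ univ.image x, (1/(q:ℝ))) * ∏ q ∈ NC, (1/(q:ℝ))) + 4 * H ^ Fintype.card K := by
  have hD : univ.image x ⊆ P := by
    intro q hq; obtain ⟨k, _, rfl⟩ := mem_image.1 hq; exact hx k
  have hNCD : NC ⊆ univ.image x := by
    intro q hq; obtain ⟨k, _, hk, _⟩ := hNC q hq; exact mem_image.2 ⟨k, mem_univ _, hk⟩
  have hc : (univ.image x).card ≤ Fintype.card K := by
    rw [← card_univ]; exact card_image_le
  have h := crt_two (T := ∅) (Y := fun _ _ => 0) hP h2 hD (empty_subset _)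
    (φ := fun q n => |phi x u q n|) (fun q _ n => by simp only [phi_per x u q n])
    (fun q hq n => by rw [abs_abs]; exact phi_abs_le_one x u (hP q (hD hq)).pos n)
    (fun _ _ _ => rfl) (fun _ _ _ => le_rfl) (fun _ _ _ => by norm_num) hH π a M
  have e : ∀ n, |∏ k, (indd (x k) (n + u k) - 1 / x k)| = ∏ q ∈ univ.image x, |phi x u q n| := by
    intro n
    rw [← abs_prod]
    congr 1
    rw [← prod_fiberwise_of_maps_to (g := x) (t := univ.image x) (fun k _ => mem_image_of_mem _ (mem_univ k))]
    refine prod_congr rfl fun q _ => ?_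
    unfold phi
    refine prod_congr rfl fun k hk => ?_
    rw [(mem_filter.1 hk).2]
  simp only [prod_empty, mul_one, card_empty, add_zero] at h
  simp only [e]
  have h3 := (abs_le.1 h).2
  have h4 : ∏ q ∈ univ.image x, Ev q (fun n => |phi x u q n|) ≤
      3 ^ Fintype.card K * (∏ q ∈ univ.image x, (1/(q:ℝ))) * ∏ q ∈ NC, (1/(q:ℝ)) := by
    calc _ ≤ ∏ q ∈ univ.image x, (3 * (1/(q:ℝ)) * if q ∈ NC then 1/(q:ℝ) else 1) := by
          refine prod_le_prod (fun q _ => Ev_nonneg fun n => abs_nonneg _) fun q hq => ?_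
          split_ifs with h
          · obtain ⟨k, k', hk, hk', hn⟩ := hNC q h
            exact phi_abs_ev_nc x u (hP q (hD hq)).pos hk hk' hn
          · rw [mul_one]; exact phi_abs_ev x u (hP q (hD hq)).pos hq
      _ = 3 ^ (univ.image x).card * (∏ q ∈ univ.image x, (1/(q:ℝ))) * ∏ q ∈ NC, (1/(q:ℝ)) := by
          rw [prod_mul_distrib, prod_mul_distrib, prod_const, prod_ite, prod_const_one, mul_one]
          congr 2
          rw [filter_mem_eq_inter, inter_eq_right.2 hNCD]
      _ ≤ _ := by
          gcongr
          norm_num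
  have h5 : H ^ (univ.image x).card ≤ H ^ Fintype.card K := pow_le_pow_right₀ hH1 hc
  have h6 : 0 ≤ ∏ q ∈ univ.image x, Ev q (fun n => |phi x u q n|) :=
    prod_nonneg fun q _ => Ev_nonneg fun n => abs_nonneg _
  have h7 : (M:ℝ) / 2 * ∏ q ∈ univ.image x, Ev q (fun n => |phi x u q n|) ≤
     M * (3 ^ Fintype.card K * (∏ q ∈ univ.image x, (1/(q:ℝ))) * ∏ q ∈ NC, (1/(q:ℝ))) := by
    have : (0:ℝ) ≤ M := by positivity
    have h8 := mul_le_mul_of_nonneg_left h4 this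
    nlinarith [mul_nonneg this h6]
  linarith

theorem fam_avg {P : Finset ℕ} (hP : ∀ q ∈ P, q.Prime) (h2 : 2 ∉ P) {H : ℝ} (hH1 : 1 ≤ H) (hH : ∀ q ∈ P, (q:ℝ) ≤ H)
    (hcard : (P.card : ℝ) ≤ H) {θ Λ : ℝ} (h0 : 0 ≤ θ) (h1 : θ ≤ 1) (hΛ : ∑ q ∈ P, (1/(q:ℝ)) ≤ Λ) (hθΛ : (1 - θ) * Λ ≤ 1)
    (x : K → ℕ) (u u' : K → ℤ) (hx : ∀ k, x k ∈ P) (hV : ∀ q ∈ P, (Fintype.card K : ℝ) ≤ q) (S : Finset ℕ)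
    (hS : ∀ q ∈ S, ∃ k, x k = q ∧ (∀ k', x k' = q → k' = k) ∧ Nq u u' q (- u k) ≤ 4)
    (J : ℕ) {X : ℝ} (hX : 0 < X) (π a : ℤ) (M : ℕ) :
    |∑ i ∈ range M, parI π (a + i) * fam P θ x u u' (a + i)| ≤
      M * 3 ^ Fintype.card K * (∏ q ∈ univ.image x, (1/(q:ℝ))) *
        ((1 + Real.exp (X * (2 * Fintype.card K)) / X ^ J) * (2 * (1 - θ)) ^ S.card + Real.exp (X * (2 * Fintype.card K)) / X ^ J)
      + 4 * (J + 1) * H ^ J * H ^ (Fintype.card K + J) := by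
  set V := Fintype.card K with hVdef
  set D := univ.image x with hDdef
  have hD : D ⊆ P := by
    intro q hq; obtain ⟨k, _, rfl⟩ := mem_image.1 hq; exact hx k
  have hSD : S ⊆ D := by
    intro q hq; obtain ⟨k, hk, _⟩ := hS q hq; exact mem_image.2 ⟨k, mem_univ _, hk⟩
  have hc : D.card ≤ V := by
    rw [hVdef, ← card_univ]; exact card_image_le
  have hpos : ∀ q ∈ P, 0 < q := fun q hq => (hP q hq).pos
  have hp1 : ∀ q n, θ ^ Nq u u' q n ≤ 1 := fun q n => pow_le_one₀ h0 h1
  have hp0 : ∀ q n, 0 ≤ θ ^ Nq u u' q n := fun q n => pow_nonneg h0 _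
  have hb : ∀ q n, |phi x u q n * θ ^ Nq u u' q n| ≤ |phi x u q n| := fun q n => by
    rw [abs_mul, abs_of_nonneg (hp0 q n)]
    exact mul_le_of_le_one_right (abs_nonneg _) (hp1 q n)
  have hmain := exp_main (D := D) hP h2 hD
    (φ := fun q n => phi x u q n * θ ^ Nq u u' q n) (Y := fun q n => 1 - θ ^ Nq u u' q n)
    (fun q _ n => by simp only [phi_per x u q n, Nq_per])
    (fun q hq n => (hb q n).trans (phi_abs_le_one x u (hpos q (hD hq)) n))
    (fun q _ n => by simp only [Nq_per])
    (fun q _ n => by linarith [hp1 q n]) (fun q _ n => by linarith [hp0 q n]) hH1 hH hcard J π a M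
  have hfac : ∀ n, fam P θ x u u' n = (∏ q ∈ D, (phi x u q n * θ ^ Nq u u' q n)) *
      ∏ q ∈ P \ D, (1 - (1 - θ ^ Nq u u' q n)) := fun n => fam_fac P θ x u u' hx n
  simp only [hfac]
  refine hmain.trans ?_
  set e := esy (P \ D) (fun q => Ev q (fun n => 1 - θ ^ Nq u u' q n)) J with he
  set e' := Real.exp (X * (2 * V)) / X ^ J with he'
  have hEY0 : ∀ q ∈ P \ D, 0 ≤ Ev q (fun n => 1 - θ ^ Nq u u' q n) := fun q _ => Ev_nonneg fun n => by linarith [hp1 q n]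
  have he0 : 0 ≤ e := esy_nonneg hEY0 J
  have hee : e ≤ e' := by
    refine (esy_le hEY0 J hX).trans ?_
    rw [he']
    gcongr
    calc ∑ q ∈ P \ D, Ev q (fun n => 1 - θ ^ Nq u u' q n)
        ≤ ∑ q ∈ P \ D, 2 * V * (1 - θ) * (1 / q) := by
          refine sum_le_sum fun q hq => ?_
          have := Ev_Y_le h0 h1 u u' (hpos q (mem_sdiff.1 hq).1)
          rw [mul_one_div]; exact this
      _ ≤ ∑ q ∈ P, 2 * V * (1 - θ) * (1 / q) := by
          refine sum_le_sum_of_subset_of_nonneg sdiff_subset fun q _ _ => ?_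
          have : 0 ≤ 1 - θ := by linarith
          positivity
      _ = 2 * V * ((1 - θ) * ∑ q ∈ P, (1 / (q:ℝ))) := by rw [← mul_sum]; ring
      _ ≤ 2 * V * 1 := by
          gcongr
          refine le_trans ?_ hθΛ
          exact mul_le_mul_of_nonneg_left hΛ (by linarith)
      _ = 2 * V := by ring
  have hA : ∏ q ∈ D, |Ev q (fun n => phi x u q n * θ ^ Nq u u' q n)| ≤ 3 ^ V * (∏ q ∈ D, (1/(q:ℝ))) * (2 * (1 - θ)) ^ S.card := by
    have h := prod_dist_bound hSD (E := fun q => |Ev q (fun n => phi x u q n * θ ^ Nq u u' q n)|) (2 * (1 - θ))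
      (fun _ _ => abs_nonneg _) (fun q hq => ?_) (fun q hq => ?_)
    · refine h.trans ?_
      have : 0 ≤ 1 - θ := by linarith
      gcongr
      norm_num
    · refine le_trans ?_ (phi_abs_ev x u (hpos q (hD hq)) hq)
      have h3 : |Ev q (fun n => phi x u q n * θ ^ Nq u u' q n)| ≤ Ev q (fun n => |phi x u q n * θ ^ Nq u u' q n|) := by
        unfold Ev
        rw [abs_div, Nat.abs_cast]
        gcongr
        exact abs_sum_le_sum_abs _ _
      exact h3.trans (Ev_mono fun n => hb q n)
    · obtain ⟨k, hk, hu, hN⟩ := hS q hq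
      exact phi_single_ev h0 h1 x u u' (hpos q (hD (hSD hq))) hk hu hN (hV q (hD (hSD hq)))
  have hB : ∏ q ∈ D, Ev q (fun n => |phi x u q n * θ ^ Nq u u' q n|) ≤ 3 ^ V * (∏ q ∈ D, (1/(q:ℝ))) := by
    have h := prod_dist_bound (S := ∅) (D := D) (empty_subset _) (E := fun q => Ev q (fun n => |phi x u q n * θ ^ Nq u u' q n|)) 1
      (fun _ _ => Ev_nonneg fun _ => abs_nonneg _) (fun q hq => ?_) (fun q hq => by simp at hq)
    · refine h.trans ?_
      simp only [card_empty, pow_zero, mul_one]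
      gcongr
      norm_num
    · exact (Ev_mono fun n => hb q n).trans (phi_abs_ev x u (hpos q (hD hq)) hq)
  have hA0 : 0 ≤ ∏ q ∈ D, |Ev q (fun n => phi x u q n * θ ^ Nq u u' q n)| := prod_nonneg fun _ _ => abs_nonneg _
  have hB0 : 0 ≤ ∏ q ∈ D, Ev q (fun n => |phi x u q n * θ ^ Nq u u' q n|) := prod_nonneg fun _ _ => Ev_nonneg fun _ => abs_nonneg _
  have hW0 : 0 ≤ ∏ q ∈ D, (1/(q:ℝ)) := prod_nonneg fun _ _ => by positivity
  have hθ' : 0 ≤ 1 - θ := by linarith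
  have hC : (∏ q ∈ D, |Ev q (fun n => phi x u q n * θ ^ Nq u u' q n)|) * (1 + e) +
      (∏ q ∈ D, Ev q (fun n => |phi x u q n * θ ^ Nq u u' q n|)) * e ≤
      3 ^ V * (∏ q ∈ D, (1/(q:ℝ))) * ((1 + e') * (2 * (1 - θ)) ^ S.card + e') := by
    calc _ ≤ (3 ^ V * (∏ q ∈ D, (1/(q:ℝ))) * (2 * (1 - θ)) ^ S.card) * (1 + e') + (3 ^ V * (∏ q ∈ D, (1/(q:ℝ)))) * e' := by
          gcongr
      _ = _ := by ring
  have hC0 : 0 ≤ (∏ q ∈ D, |Ev q (fun n => phi x u q n * θ ^ Nq u u' q n)|) * (1 + e) +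
      (∏ q ∈ D, Ev q (fun n => |phi x u q n * θ ^ Nq u u' q n|)) * e := by positivity
  have hE : H ^ (D.card + J) ≤ H ^ (V + J) := pow_le_pow_right₀ hH1 (by omega)
  refine add_le_add ?_ ?_
  · have : (0:ℝ) ≤ M := by positivity
    have h8 := mul_le_mul_of_nonneg_left hC this
    have h9 := mul_nonneg this hC0
    nlinarith
  · gcongr

end Family
end KK

set_option linter.all false
set_option linter.unusedVariables false
set_option linter.unusedSectionVars false
namespace KK
open Finset
open scoped Classical

noncomputable def sgn (n : ℤ) : ℤ := if Even n then 1 else -1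
noncomputable def nb (n : ℤ) (p : ℕ) : ℤ := n + sgn n * p
noncomputable def walk : ℤ → List ℕ → ℤ
  | n, [] => n
  | n, p :: w => walk (nb n p) w
def alt : List ℕ → ℤ
  | [] => 0
  | p :: w => p - alt w

lemma sgn_cases (n : ℤ) : sgn n = 1 ∨ sgn n = -1 := by unfold sgn; split_ifs <;> simp
lemma sgn_sq (n : ℤ) : sgn n * sgn n = 1 := by rcases sgn_cases n with h | h <;> rw [h] <;> norm_num

lemma sgn_nb {p : ℕ} (hp : Odd p) (n : ℤ) : sgn (nb n p) = - sgn n := by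
  have hp' : Odd (p:ℤ) := by exact_mod_cast hp
  have h : Even (nb n p) ↔ ¬ Even n := by
    unfold nb
    have hp2 : ¬ Even (p:ℤ) := by simpa using hp'
    rcases sgn_cases n with h | h <;> rw [h] <;> simp only [Int.even_add, Int.even_mul, one_mul, neg_mul, even_neg] <;> tauto
  unfold sgn
  by_cases h1 : Even n
  · rw [if_pos h1, if_neg (by rw [h]; simpa using h1)]
  · rw [if_neg h1, if_pos (by rw [h]; exact h1)]; norm_num

lemma nb_nb {p : ℕ} (hp : Odd p) (n : ℤ) : nb (nb n p) p = n := by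
  have : nb (nb n p) p = nb n p + sgn (nb n p) * p := rfl
  rw [this, sgn_nb hp]; unfold nb; ring

lemma walk_eq {w : List ℕ} (hw : ∀ p ∈ w, Odd p) (n : ℤ) : walk n w = n + sgn n * alt w := by
  induction w generalizing n with
  | nil => simp [walk, alt]
  | cons p w ih =>
    have h1 : Odd p := hw p (by simp)
    rw [walk, ih (fun q hq => hw q (by simp [hq])), sgn_nb h1, alt]; unfold nb; ring

lemma walk_append (w w' : List ℕ) (n : ℤ) : walk n (w ++ w') = walk (walk n w) w' := by
  induction w generalizing n with
  | nil => simp [walk]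
  | cons p w ih => simp [walk, ih]

lemma walk_reverse {w : List ℕ} (hw : ∀ p ∈ w, Odd p) (n : ℤ) : walk (walk n w) w.reverse = n := by
  induction w generalizing n with
  | nil => simp [walk]
  | cons p w ih =>
    have h1 : Odd p := hw p (by simp)
    rw [walk, List.reverse_cons, walk_append, ih (fun q hq => hw q (by simp [hq])), walk, walk, nb_nb h1]

/-! words -/
noncomputable def words (P : Finset ℕ) : ℕ → Finset (List ℕ)
  | 0 => {[]}
  | k + 1 => (P ×ˢ words P k).image fun x => x.1 :: x.2

lemma sum_words_succ (P : Finset ℕ) (k : ℕ) (F : List ℕ → ℝ) :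
    ∑ w ∈ words P (k+1), F w = ∑ p ∈ P, ∑ w ∈ words P k, F (p :: w) := by
  rw [words, sum_image, sum_product]
  rintro ⟨a, b⟩ _ ⟨c, d⟩ _ h
  simpa using h

lemma sum_words_zero (P : Finset ℕ) (F : List ℕ → ℝ) : ∑ w ∈ words P 0, F w = F [] := by simp [words]

lemma mem_words {P : Finset ℕ} {k : ℕ} {w : List ℕ} : w ∈ words P k ↔ w.length = k ∧ ∀ p ∈ w, p ∈ P := by
  induction k generalizing w with
  | zero => simp only [words, mem_singleton]; constructor
            · rintro rfl; simp
            · rintro ⟨h, _⟩; exact List.length_eq_zero_iff.1 h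
  | succ k ih =>
    simp only [words, mem_image, mem_product, Prod.exists]
    constructor
    · rintro ⟨p, w', ⟨hp, hw⟩, rfl⟩
      rw [ih] at hw
      refine ⟨by simp [hw.1], fun q hq => ?_⟩
      rcases List.mem_cons.1 hq with rfl | h
      · exact hp
      · exact hw.2 q h
    · rintro ⟨h1, h2⟩
      cases w with
      | nil => simp at h1
      | cons p w => exact ⟨p, w, ⟨h2 p (by simp), ih.2 ⟨by simpa using h1, fun q hq => h2 q (by simp [hq])⟩⟩, rfl⟩

lemma sum_words_add (P : Finset ℕ) (k m : ℕ) (F : List ℕ → ℝ) :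
    ∑ w ∈ words P (k + m), F w = ∑ a ∈ words P k, ∑ b ∈ words P m, F (a ++ b) := by
  induction k generalizing F with
  | zero => simp [words]
  | succ k ih =>
    rw [show k + 1 + m = (k + m) + 1 by ring, sum_words_succ, sum_words_succ]
    refine sum_congr rfl fun p _ => ?_
    rw [ih]; rfl

/-- history sums -/
noncomputable def hp (g : List ℕ → ℕ → ℝ) : List ℕ → List ℕ → ℝ
  | _, [] => 1
  | h, p :: w => g h p * hp g (h ++ [p]) w

lemma hp_nonneg {g : List ℕ → ℕ → ℝ} (hg : ∀ h p, 0 ≤ g h p) (h w : List ℕ) : 0 ≤ hp g h w := by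
  induction w generalizing h with
  | nil => simp [hp]
  | cons p w ih => exact mul_nonneg (hg _ _) (ih _)

lemma seqsum (P : Finset ℕ) {g : List ℕ → ℕ → ℝ} {c : ℝ} (L : ℕ) (hg : ∀ h p, 0 ≤ g h p) (hc : 0 ≤ c)
    (k : ℕ) (h : List ℕ) (hP : ∀ q ∈ h, q ∈ P) (hL : h.length + k ≤ L)
    (hs : ∀ h : List ℕ, (∀ q ∈ h, q ∈ P) → h.length < L → ∑ p ∈ P, g h p ≤ c) :
    ∑ w ∈ words P k, hp g h w ≤ c ^ k := by
  induction k generalizing h with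
  | zero => simp [words, hp]
  | succ k ih =>
    rw [sum_words_succ]
    simp only [hp]
    calc ∑ p ∈ P, ∑ w ∈ words P k, g h p * hp g (h ++ [p]) w
        ≤ ∑ p ∈ P, g h p * c ^ k := by
          refine sum_le_sum fun p hp' => ?_
          rw [← mul_sum]
          refine mul_le_mul_of_nonneg_left (ih _ ?_ (by simp; omega)) (hg _ _)
          intro q hq
          rcases List.mem_append.1 hq with h1 | h1
          · exact hP q h1
          · simp at h1; rw [h1]; exact hp'
      _ ≤ c * c ^ k := by
          rw [← sum_mul]
          exact mul_le_mul_of_nonneg_right (hs h hP (by omega)) (by positivity)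
      _ = _ := by ring

lemma hp_eq (g : List ℕ → ℕ → ℝ) (h w : List ℕ) :
    hp g h w = ∏ k ∈ range w.length, g (h ++ w.take k) (w.getD k 0) := by
  induction w generalizing h with
  | nil => simp [hp]
  | cons p w ih =>
    rw [hp, ih, List.length_cons, prod_range_succ']
    simp [mul_comm]

lemma hp_append (g : List ℕ → ℕ → ℝ) (h w w' : List ℕ) :
    hp g h (w ++ w') = hp g h w * hp g (h ++ w) w' := by
  induction w generalizing h with
  | nil => simp [hp]
  | cons p w ih => simp [hp, ih, mul_assoc]

/-! kernel products -/
noncomputable def tw (t : ℤ → ℕ → ℝ) : ℤ → List ℕ → ℝ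
  | _, [] => 1
  | n, p :: w => t n p * tw t (nb n p) w

lemma tw_append (t : ℤ → ℕ → ℝ) (w w' : List ℕ) (n : ℤ) : tw t n (w ++ w') = tw t n w * tw t (walk n w) w' := by
  induction w generalizing n with
  | nil => simp [tw, walk]
  | cons p w ih => simp [tw, walk, ih, mul_assoc]

lemma tw_abs_sum {P : Finset ℕ} {t : ℤ → ℕ → ℝ} {s : ℝ} (hs : ∀ n, ∑ p ∈ P, |t n p| ≤ s) (hs0 : 0 ≤ s) (k : ℕ) (n : ℤ) :
    ∑ w ∈ words P k, |tw t n w| ≤ s ^ k := by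
  induction k generalizing n with
  | zero => simp [words, tw]
  | succ k ih =>
    rw [sum_words_succ]
    simp only [tw, abs_mul, ← mul_sum]
    calc _ ≤ ∑ p ∈ P, |t n p| * s ^ k := sum_le_sum fun p _ => mul_le_mul_of_nonneg_left (ih _) (abs_nonneg _)
      _ ≤ s * s ^ k := by rw [← sum_mul]; exact mul_le_mul_of_nonneg_right (hs n) (by positivity)
      _ = _ := by ring

def NB : List ℕ → Prop
  | [] => True
  | p :: w => w.head? ≠ some p ∧ NB w

lemma NB_of_nodup {w : List ℕ} (h : w.Nodup) : NB w := by
  induction w with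
  | nil => trivial
  | cons p w ih =>
    rw [List.nodup_cons] at h
    refine ⟨fun h' => h.1 ?_, ih h.2⟩
    exact List.mem_of_mem_head? h'

lemma NB_index {w : List ℕ} (h : NB w) (k : ℕ) (hk : k + 1 < w.length) : w.getD k 0 ≠ w.getD (k+1) 0 := by
  induction w generalizing k with
  | nil => simp at hk
  | cons p w ih =>
    cases k with
    | zero =>
      cases w with
      | nil => simp at hk
      | cons q w => intro h'; apply h.1; simp at h' ⊢; exact h'.symm
    | succ k => simpa using ih h.2 k (by simpa using hk)

lemma yj_words (P : Finset ℕ) (t : ℤ → ℕ → ℝ) (f : ℤ → ℝ) (i : ℕ) :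
    (∀ n, (yj P nb t f i).1 n = ∑ w ∈ words P i, if NB w then tw t n w * f (walk n w) else 0) ∧
    (∀ n, ∀ p ∈ P, (yj P nb t f i).2 n p = ∑ w ∈ words P i, if NB w ∧ w.head? = some p then tw t n w * f (walk n w) else 0) := by
  induction i with
  | zero => simp [words, yj, NB, tw, walk]
  | succ i ih =>
    have h2 : ∀ n, ∀ p ∈ P, (yj P nb t f (i+1)).2 n p = ∑ w ∈ words P i, if NB (p :: w) then tw t n (p :: w) * f (walk n (p :: w)) else 0 := by
      intro n p hp
      rw [yj_succ_snd, ih.1, ih.2 _ p hp, ← sum_sub_distrib, mul_sum]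
      refine sum_congr rfl fun w _ => ?_
      by_cases h1 : NB w <;> by_cases h3 : w.head? = some p <;> simp [h1, h3, NB, tw, walk]
      ring
    refine ⟨fun n => ?_, fun n p hp => ?_⟩
    · rw [yj_succ_fst, sum_words_succ]
      exact sum_congr rfl fun p hp => h2 n p hp
    · rw [sum_words_succ, h2 n p hp]
      rw [sum_eq_single_of_mem p hp]
      · simp
      · intro q _ hq; simp [hq]

/-! good words -/
def Good (w : List ℕ) : Prop :=
  w.Nodup ∧ ∀ a < w.length, ∀ c ≤ w.length, ((w.getD a 0 : ℕ) : ℤ) ∣ alt (w.take c) - alt (w.take a) → c = a ∨ c = a + 1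

noncomputable def GW (P : Finset ℕ) (l : ℕ) : Finset (List ℕ) := (words P l).filter Good

noncomputable def Top (t : ℤ → ℕ → ℝ) (S : Finset (List ℕ)) (f : ℤ → ℝ) (n : ℤ) : ℝ := ∑ w ∈ S, tw t n w * f (walk n w)

lemma vert_sub {w : List ℕ} (hw : ∀ p ∈ w, Odd p) (n : ℤ) (a c : ℕ) :
    walk n (w.take c) - walk n (w.take a) = sgn n * (alt (w.take c) - alt (w.take a)) := by
  rw [walk_eq (fun p hp => hw p (List.mem_of_mem_take hp)), walk_eq (fun p hp => hw p (List.mem_of_mem_take hp))]; ring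

lemma dvd_sgn (n m q : ℤ) : q ∣ sgn n * m ↔ q ∣ m := by
  rcases sgn_cases n with h | h <;> rw [h] <;> simp

lemma good_iff {w : List ℕ} (hw : ∀ p ∈ w, Odd p) (n : ℤ) : Good w ↔ w.Nodup ∧ ∀ a < w.length, ∀ c ≤ w.length,
    ((w.getD a 0 : ℕ) : ℤ) ∣ walk n (w.take c) - walk n (w.take a) → c = a ∨ c = a + 1 := by
  unfold Good
  simp only [vert_sub hw, dvd_sgn]

lemma take_succ_getD {w : List ℕ} {a : ℕ} (h : a < w.length) : w.take (a+1) = w.take a ++ [w.getD a 0] := by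
  rw [List.take_succ_eq_append_getElem h, List.getD_eq_getElem _ _ h]

lemma walk_step {w : List ℕ} {a : ℕ} (h : a < w.length) (n : ℤ) :
    walk n (w.take (a+1)) = nb (walk n (w.take a)) (w.getD a 0) := by
  rw [take_succ_getD h, walk_append]; rfl

lemma nb_sub_dvd (n : ℤ) (p : ℕ) : (p:ℤ) ∣ nb n p - n := by unfold nb; simp

lemma walk_rev_take {w : List ℕ} (hw : ∀ p ∈ w, Odd p) (n : ℤ) {c : ℕ} (hc : c ≤ w.length) :
    walk (walk n w) (w.reverse.take c) = walk n (w.take (w.length - c)) := by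
  have h1 : w.reverse.take c = (w.drop (w.length - c)).reverse := by
    rw [List.take_reverse]
  rw [h1]
  conv_lhs => rw [← List.take_append_drop (w.length - c) w]
  rw [walk_append]
  have : (List.take (w.length - c) w ++ List.drop (w.length - c) w) = w := List.take_append_drop _ _
  rw [this]
  exact walk_reverse (fun p hp => hw p (List.mem_of_mem_drop hp)) _

lemma getD_reverse {w : List ℕ} {a : ℕ} (ha : a < w.length) : w.reverse.getD a 0 = w.getD (w.length - 1 - a) 0 := by
  rw [List.getD_eq_getElem _ _ (by simpa using ha), List.getD_eq_getElem _ _ (by omega), List.getElem_reverse]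

lemma good_reverse {w : List ℕ} (hw : ∀ p ∈ w, Odd p) (hg : Good w) : Good w.reverse := by
  have hw' : ∀ p ∈ w.reverse, Odd p := fun p hp => hw p (List.mem_reverse.1 hp)
  rw [good_iff hw' (walk 0 w)]
  rw [good_iff hw 0] at hg
  refine ⟨List.nodup_reverse.2 hg.1, fun a ha c hc hd => ?_⟩
  rw [List.length_reverse] at ha hc
  rw [walk_rev_take hw 0 hc, walk_rev_take hw 0 ha.le, getD_reverse ha] at hd
  set b := w.length - 1 - a with hb
  have hb1 : w.length - a = b + 1 := by omega
  rw [hb1] at hd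
  have h3 : ((w.getD b 0 : ℕ) : ℤ) ∣ walk 0 (w.take (b+1)) - walk 0 (w.take b) := by
    rw [walk_step (by omega)]; exact nb_sub_dvd _ _
  have h4 := hg.2 b (by omega) (w.length - c) (by omega) (by have := dvd_add hd h3; simpa using this)
  omega

section Op
variable {B : Finset ℤ} {P : Finset ℕ} {t : ℤ → ℕ → ℝ}

lemma sum_invol1 (hK : Ker B P nb t) {p : ℕ} (hp : p ∈ P) (G : ℤ → ℝ) :
    ∑ n ∈ B, t n p * G (nb n p) = ∑ n ∈ B, t n p * G n := by
  have hK' : Ker B {p} nb t := ⟨fun n q hq => hK.supp n q (by simp at hq; rwa [hq]),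
    fun n q hq => hK.inv n q (by simp at hq; rwa [hq]), fun n q hq => hK.sym n q (by simp at hq; rwa [hq])⟩
  have := sum_invol hK' (fun n _ => G n)
  simpa using this

lemma tw_rev (hK : Ker B P nb t) {w : List ℕ} (hw : ∀ p ∈ w, p ∈ P) (G : ℤ → ℤ → ℝ) :
    ∑ n ∈ B, tw t n w * G n (walk n w) = ∑ n ∈ B, tw t n w.reverse * G (walk n w.reverse) n := by
  induction w generalizing G with
  | nil => simp [tw, walk]
  | cons p w ih =>
    have hp : p ∈ P := hw p (by simp)
    have h1 : ∑ n ∈ B, tw t n (p :: w) * G n (walk n (p :: w)) = ∑ n ∈ B, t n p * (tw t n w * G (nb n p) (walk n w)) := by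
      rw [← sum_invol1 hK hp]
      refine sum_congr rfl fun n _ => ?_
      rw [hK.inv n p hp, tw, walk]; ring
    have h2 := ih (fun q hq => hw q (by simp [hq])) (fun n m => t n p * G (nb n p) m)
    rw [h1]
    calc _ = ∑ n ∈ B, tw t n w * (t n p * G (nb n p) (walk n w)) := sum_congr rfl fun n _ => by ring
      _ = _ := h2
      _ = _ := by
        refine sum_congr rfl fun n _ => ?_
        rw [List.reverse_cons, tw_append, walk_append]; simp [tw, walk]; ring

lemma Top_sym (hK : Ker B P nb t) {S : Finset (List ℕ)} (hS : ∀ w ∈ S, ∀ p ∈ w, p ∈ P) (hr : ∀ w ∈ S, w.reverse ∈ S)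
    (f h : ℤ → ℝ) : ∑ n ∈ B, h n * Top t S f n = ∑ n ∈ B, Top t S h n * f n := by
  unfold Top
  simp only [mul_sum, sum_mul]
  rw [sum_comm, sum_comm (s := B)]
  refine sum_nbij' List.reverse List.reverse hr hr (fun w _ => by simp) (fun w _ => by simp) fun w hw => ?_
  have := tw_rev hK (hS w hw) (fun n m => h n * f m)
  calc _ = ∑ n ∈ B, tw t n w * (h n * f (walk n w)) := sum_congr rfl fun n _ => by ring
    _ = _ := this
    _ = _ := sum_congr rfl fun n _ => by ring

noncomputable def nsq (B : Finset ℤ) (f : ℤ → ℝ) : ℝ := ∑ n ∈ B, f n ^ 2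
lemma nsq_nonneg (f : ℤ → ℝ) : 0 ≤ nsq B f := sum_nonneg fun _ _ => sq_nonneg _

lemma Top_logconv (hK : Ker B P nb t) {S : Finset (List ℕ)} (hS : ∀ w ∈ S, ∀ p ∈ w, p ∈ P) (hr : ∀ w ∈ S, w.reverse ∈ S)
    (f : ℤ → ℝ) : nsq B (Top t S f) ^ 2 ≤ nsq B f * nsq B (Top t S (Top t S f)) := by
  have h1 : nsq B (Top t S f) = ∑ n ∈ B, f n * Top t S (Top t S f) n := by
    rw [Top_sym hK hS hr]; exact sum_congr rfl fun n _ => by ring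
  rw [h1]
  exact sum_mul_sq_le_sq_mul_sq _ _ _

lemma Top_pow (hK : Ker B P nb t) {S : Finset (List ℕ)} (hS : ∀ w ∈ S, ∀ p ∈ w, p ∈ P) (hr : ∀ w ∈ S, w.reverse ∈ S)
    (f : ℤ → ℝ) (k : ℕ) : nsq B (Top t S f) ^ (k+1) ≤ nsq B f ^ k * nsq B ((Top t S)^[k+1] f) := by
  set a : ℕ → ℝ := fun k => nsq B ((Top t S)^[k] f) with ha
  have h0 : ∀ k, 0 ≤ a k := fun k => nsq_nonneg _
  have hl : ∀ k, a (k+1)^2 ≤ a k * a (k+2) := by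
    intro k
    have := Top_logconv hK hS hr ((Top t S)^[k] f)
    simp only [ha, Function.iterate_succ_apply']; exact this
  have h1 : ∀ k, a k * a 1 ≤ a 0 * a (k+1) := by
    intro k
    induction k with
    | zero => exact le_rfl
    | succ k ih =>
      rcases (h0 (k+1)).eq_or_lt with h | h
      · rw [← h]; simp; exact mul_nonneg (h0 0) (h0 _)
      · have h2 := hl k
        have h3 : a (k+1) * (a (k+1) * a 1) ≤ a (k+1) * (a 0 * a (k+2)) := by
          nlinarith [mul_le_mul_of_nonneg_right h2 (h0 1), mul_le_mul_of_nonneg_right ih (h0 (k+2))]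
        exact le_of_mul_le_mul_left h3 h
  have h2 : ∀ k, a 1 ^ (k+1) ≤ a 0 ^ k * a (k+1) := by
    intro k
    induction k with
    | zero => simp
    | succ k ih =>
      calc a 1 ^ (k+1+1) = a 1 ^ (k+1) * a 1 := pow_succ _ _
        _ ≤ a 0 ^ k * a (k+1) * a 1 := mul_le_mul_of_nonneg_right ih (h0 1)
        _ = a 0 ^ k * (a (k+1) * a 1) := by ring
        _ ≤ a 0 ^ k * (a 0 * a (k+2)) := mul_le_mul_of_nonneg_left (h1 _) (pow_nonneg (h0 0) _)
        _ = _ := by ring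
  exact h2 k

lemma Top_iter_sym (hK : Ker B P nb t) {S : Finset (List ℕ)} (hS : ∀ w ∈ S, ∀ p ∈ w, p ∈ P) (hr : ∀ w ∈ S, w.reverse ∈ S)
    (k : ℕ) (f h : ℤ → ℝ) : ∑ n ∈ B, h n * (Top t S)^[k] f n = ∑ n ∈ B, (Top t S)^[k] h n * f n := by
  induction k generalizing f h with
  | zero => simp
  | succ k ih =>
    rw [Function.iterate_succ_apply, ih, Function.iterate_succ_apply', ← Top_sym hK hS hr]

/-- blocks -/
noncomputable def blk (P : Finset ℕ) (l k : ℕ) : Finset (List ℕ) :=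
  (words P (k * l)).filter fun W => ∀ i < k, Good ((W.drop (i * l)).take l)

lemma iter_eq (l k : ℕ) (f : ℤ → ℝ) (n : ℤ) :
    (Top t (GW P l))^[k] f n = ∑ W ∈ blk P l k, tw t n W * f (walk n W) := by
  induction k generalizing n with
  | zero => simp [blk, words, tw, walk]
  | succ k ih =>
    rw [Function.iterate_succ_apply', Top, GW, blk, sum_filter, sum_filter, show (k+1) * l = l + k * l by ring, sum_words_add]
    refine sum_congr rfl fun w hw => ?_
    have hl := (mem_words.1 hw).1
    have key : ∀ W, (∀ i < k + 1, Good (((w ++ W).drop (i * l)).take l)) ↔ Good w ∧ ∀ i < k, Good ((W.drop (i * l)).take l) := by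
      intro W
      constructor
      · intro h
        refine ⟨?_, fun i hi => ?_⟩
        · have := h 0 (by omega); simpa [← hl] using this
        · have := h (i+1) (by omega)
          rw [show (i+1) * l = w.length + i * l by rw [hl]; ring, ← List.drop_drop, List.drop_left] at this
          exact this
      · rintro ⟨h1, h2⟩ i hi
        cases i with
        | zero => simpa [← hl] using h1
        | succ i =>
          rw [show (i+1) * l = w.length + i * l by rw [hl]; ring, ← List.drop_drop, List.drop_left]
          exact h2 i (by omega)
    by_cases hg : Good w
    · rw [if_pos hg]
      change tw t n w * (Top t (GW P l))^[k] f (walk n w) = _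
      rw [ih, blk, sum_filter, mul_sum]
      refine sum_congr rfl fun W _ => ?_
      rw [tw_append, walk_append]
      by_cases hc : ∀ i < k, Good ((W.drop (i * l)).take l)
      · rw [if_pos hc, if_pos ((key W).2 ⟨hg, hc⟩)]; ring
      · rw [if_neg hc, if_neg (fun h => hc ((key W).1 h).2), mul_zero]
    · rw [if_neg hg]
      exact (sum_eq_zero fun W _ => if_neg fun h => hg ((key W).1 h).1).symm

lemma GW_sub {l : ℕ} : ∀ w ∈ GW P l, ∀ p ∈ w, p ∈ P := fun w hw => (mem_words.1 (mem_filter.1 hw).1).2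
lemma GW_rev (hodd : ∀ p ∈ P, Odd p) {l : ℕ} : ∀ w ∈ GW P l, w.reverse ∈ GW P l := by
  intro w hw
  obtain ⟨h1, h2⟩ := mem_filter.1 hw
  rw [mem_words] at h1
  refine mem_filter.2 ⟨mem_words.2 ⟨by simp [h1.1], fun p hp => h1.2 p (List.mem_reverse.1 hp)⟩, good_reverse (fun p hp => hodd p (h1.2 p hp)) h2⟩

lemma abs_nb_sub (n : ℤ) (p : ℕ) : |nb n p - n| = p := by
  unfold nb
  rw [add_sub_cancel_left, abs_mul]
  rcases sgn_cases n with h | h <;> rw [h] <;> simp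

lemma walk_dist {Hn : ℕ} {w : List ℕ} (hw : ∀ p ∈ w, p ≤ Hn) (n : ℤ) : |walk n w - n| ≤ w.length * Hn := by
  induction w generalizing n with
  | nil => simp [walk]
  | cons p w ih =>
    have h1 := ih (fun q hq => hw q (by simp [hq])) (nb n p)
    have h2 := abs_nb_sub n p
    have h3 : (p:ℤ) ≤ Hn := by exact_mod_cast hw p (by simp)
    have h4 : |walk n (p :: w) - n| ≤ |walk (nb n p) w - nb n p| + |nb n p - n| := by
      rw [walk]; exact abs_sub_le _ _ _
    push_cast [List.length_cons]
    linarith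

/-- trace inequality -/
lemma trace_ineq (hK : Ker B P nb t) (hodd : ∀ p ∈ P, Odd p) {Hn : ℕ} (hH : ∀ p ∈ P, p ≤ Hn) {Sf : Finset ℤ} (hSf : Sf ⊆ B)
    {f : ℤ → ℝ} (hf : ∀ n, n ∉ Sf → f n = 0) {F : ℝ} (hF : ∀ n, |f n| ≤ F) (l k : ℕ) :
    nsq B ((Top t (GW P l))^[k] f) ≤ (2 * (k * l * Hn) + 1) * F ^ 2 *
      ∑ m ∈ Sf, ∑ W ∈ blk P l (2 * k), if walk m W = m then tw t m W else 0 := by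
  set T := Top t (GW P l) with hT
  set δ : ℤ → ℤ → ℝ := fun m n => if n = m then 1 else 0 with hδ
  have hlin : ∀ n, T^[k] f n = ∑ m ∈ Sf, f m * T^[k] (δ m) n := by
    intro n
    simp only [hT, iter_eq, mul_sum]
    rw [sum_comm]
    refine sum_congr rfl fun W _ => ?_
    have : f (walk n W) = ∑ m ∈ Sf, f m * δ m (walk n W) := by
      simp only [hδ, mul_ite, mul_one, mul_zero, sum_ite_eq]
      split_ifs with h
      · rfl
      · exact hf _ h
    rw [this, mul_sum]
    exact sum_congr rfl fun m _ => by ring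
  have hloc : ∀ n m, T^[k] (δ m) n ≠ 0 → m ∈ Icc (n - k * l * Hn) (n + k * l * Hn) := by
    intro n m h
    rw [hT, iter_eq] at h
    obtain ⟨W, hW, h1⟩ := exists_ne_zero_of_sum_ne_zero h
    have h2 : walk n W = m := by
      by_contra h3; apply h1; simp [hδ, h3]
    obtain ⟨h3, h4⟩ := mem_words.1 (mem_filter.1 hW).1
    have h5 := walk_dist (fun p hp => hH p (h4 p hp)) n
    rw [h2, h3, abs_le] at h5
    push_cast at h5
    rw [mem_Icc]; constructor <;> linarith
  have hcs : ∀ n, (T^[k] f n)^2 ≤ (2 * (k * l * Hn) + 1) * ∑ m ∈ Sf, F^2 * (T^[k] (δ m) n)^2 := by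
    intro n
    set I := Icc (n - k * l * Hn : ℤ) (n + k * l * Hn) with hI
    have e1 : T^[k] f n = ∑ m ∈ Sf ∩ I, f m * T^[k] (δ m) n := by
      rw [hlin]
      symm
      refine sum_subset inter_subset_left fun m hm hm' => ?_
      by_contra h
      exact hm' (mem_inter.2 ⟨hm, hloc n m (right_ne_zero_of_mul h)⟩)
    have hcard : ((Sf ∩ I).card : ℝ) ≤ 2 * (k * l * Hn) + 1 := by
      have h1 : (Sf ∩ I).card ≤ I.card := card_le_card inter_subset_right
      have h2 : I.card = 2 * (k * l * Hn) + 1 := by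
        rw [hI, Int.card_Icc, show (n + k * l * Hn + 1 - (n - k * l * Hn) : ℤ) = ((2 * (k * l * Hn) + 1 : ℕ) : ℤ) by push_cast; ring, Int.toNat_natCast]
      rw [h2] at h1; exact_mod_cast h1
    rw [e1]
    calc (∑ m ∈ Sf ∩ I, f m * T^[k] (δ m) n)^2 ≤ (Sf ∩ I).card * ∑ m ∈ Sf ∩ I, (f m * T^[k] (δ m) n)^2 := sq_sum_le_card_mul_sum_sq
      _ ≤ (2 * (k * l * Hn) + 1) * ∑ m ∈ Sf, F^2 * (T^[k] (δ m) n)^2 := by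
        refine mul_le_mul hcard ?_ (sum_nonneg fun _ _ => sq_nonneg _) (by positivity)
        calc _ ≤ ∑ m ∈ Sf ∩ I, F^2 * (T^[k] (δ m) n)^2 := by
              refine sum_le_sum fun m _ => ?_
              rw [mul_pow]
              refine mul_le_mul_of_nonneg_right ?_ (sq_nonneg _)
              rw [← sq_abs]; exact pow_le_pow_left₀ (abs_nonneg _) (hF m) 2
          _ ≤ _ := sum_le_sum_of_subset_of_nonneg inter_subset_left fun _ _ _ => by positivity
  have htr : ∀ m ∈ Sf, ∑ n ∈ B, (T^[k] (δ m) n)^2 = ∑ W ∈ blk P l (2 * k), if walk m W = m then tw t m W else 0 := by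
    intro m hm
    have h1 : ∑ n ∈ B, (T^[k] (δ m) n)^2 = ∑ n ∈ B, δ m n * T^[k] (T^[k] (δ m)) n := by
      rw [Top_iter_sym hK GW_sub (GW_rev hodd)]; exact sum_congr rfl fun n _ => by ring
    rw [h1, ← Function.iterate_add_apply]
    simp only [hδ, ite_mul, one_mul, zero_mul, sum_ite_eq', hSf hm, if_true]
    rw [← two_mul, hT, iter_eq]
    exact sum_congr rfl fun W _ => by simp
  calc nsq B (T^[k] f) = ∑ n ∈ B, (T^[k] f n)^2 := rfl
    _ ≤ ∑ n ∈ B, (2 * (k * l * Hn) + 1) * ∑ m ∈ Sf, F^2 * (T^[k] (δ m) n)^2 := sum_le_sum fun n _ => hcs n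
    _ = (2 * (k * l * Hn) + 1) * F ^ 2 * ∑ m ∈ Sf, ∑ n ∈ B, (T^[k] (δ m) n)^2 := by
      rw [← mul_sum, sum_comm]; simp only [← mul_sum]; ring
    _ = _ := by rw [sum_congr rfl htr]
end Op
end KK

set_option linter.all false
set_option linter.unusedVariables false
set_option linter.unusedSectionVars false
namespace KK
open Finset
open scoped Classical

/-- an abstract good path -/
structure GP (l : ℕ) (p : ℕ → ℕ) (y : ℕ → ℤ) : Prop where
  step : ∀ a < l, ((p a : ℕ) : ℤ) ∣ y (a+1) - y a
  ne : ∀ a < l, y (a+1) ≠ y a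
  inj : ∀ a < l, ∀ a' < l, p a = p a' → a = a'
  good : ∀ a < l, ∀ c ≤ l, ((p a : ℕ) : ℤ) ∣ y c - y a → c = a ∨ c = a + 1

section Pair
variable (l : ℕ) (p q : ℕ → ℕ) (y v : ℕ → ℤ)

def inq (a : ℕ) : Prop := ∃ b < l, p a = q b
noncomputable def NCs : Finset ℕ := (range l).filter fun a => ∃ b < l, p a = q b ∧ ¬ ((p a : ℕ) : ℤ) ∣ y a - v b
noncomputable def ALs : Finset ℕ := (range l).filter fun a => a + 1 < l ∧ ¬ inq l p q a ∧ ∃ b < l, p (a+1) = q b ∧ ((p (a+1) : ℕ) : ℤ) ∣ y (a+1) - v b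
noncomputable def E1s : Finset ℕ := (range l).filter fun a => ¬ inq l p q a ∧ ∃ c ≤ l, v c ≠ y a ∧ ((p a : ℕ) : ℤ) ∣ y a - v c
noncomputable def BTs : Finset ℕ := (range l).filter fun a => a + 1 < l ∧ ∃ b < l, ∃ b' < l, p (a+1) = q b ∧ p a = q b' ∧ (b + 2 ≤ b' ∨ b' + 2 ≤ b) ∧
  ((p (a+1) : ℕ) : ℤ) ∣ y (a+1) - v b ∧ ((p a : ℕ) : ℤ) ∣ y a - v b'
noncomputable def T1s : Finset ℕ := (range l).filter fun a => a + 1 < l ∧ ¬ inq l p q a ∧ inq l p q (a+1)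
noncomputable def T2s : Finset ℕ := (range l).filter fun a => a + 1 < l ∧ inq l p q a ∧ ¬ inq l p q (a+1)
noncomputable def T3s : Finset ℕ := (range l).filter fun a => a + 1 < l ∧ ∃ b < l, ∃ b' < l, p (a+1) = q b ∧ p a = q b' ∧ (b + 2 ≤ b' ∨ b' + 2 ≤ b)
noncomputable def Echo : Finset ℕ := (range l).filter fun a => ¬ inq l p q a ∧ ∃ c ≤ l, ((p a : ℕ) : ℤ) ∣ y a - v c

def FewP (t : ℕ) : Prop := (NCs l p q y v).card < t ∧ (ALs l p q y v).card < t ∧ (E1s l p q y v).card < t ∧ (BTs l p q y v).card < t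

variable {l p q y v}

lemma T1_le : (T1s l p q).card ≤ (ALs l p q y v).card + (NCs l p q y v).card := by
  have h : T1s l p q ⊆ ALs l p q y v ∪ (NCs l p q y v).image (fun a => a - 1) := by
    intro a ha
    obtain ⟨h0, h1, h2, b, hb, h3⟩ := by simpa [T1s] using ha
    rw [mem_union]
    by_cases hd : ((p (a+1) : ℕ) : ℤ) ∣ y (a+1) - v b
    · left; simp only [ALs, mem_filter, mem_range]; exact ⟨h0, h1, h2, b, hb, h3, hd⟩
    · right; exact mem_image.2 ⟨a+1, by simp only [NCs, mem_filter, mem_range]; exact ⟨h1, b, hb, h3, hd⟩, by simp⟩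
  exact (card_le_card h).trans ((card_union_le _ _).trans (Nat.add_le_add_left card_image_le _))

lemma updown (s : ℕ → Prop) (m : ℕ) :
    ((range m).filter fun a => s a ∧ ¬ s (a+1)).card + (if s m then 1 else 0) = ((range m).filter fun a => ¬ s a ∧ s (a+1)).card + (if s 0 then 1 else 0) := by
  induction m with
  | zero => simp
  | succ m ih =>
    rw [range_add_one, filter_insert, filter_insert]
    by_cases h1 : s m <;> by_cases h2 : s (m+1) <;> simp [h1, h2] at ih ⊢ <;> omega

lemma T2_le : (T2s l p q).card ≤ 1 + (T1s l p q).card := by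
  have h1 : T2s l p q = (range (l-1)).filter fun a => inq l p q a ∧ ¬ inq l p q (a+1) := by
    ext a; simp only [T2s, mem_filter, mem_range]; constructor
    · rintro ⟨_, h, h'⟩; exact ⟨by omega, h'⟩
    · rintro ⟨h, h'⟩; exact ⟨by omega, by omega, h'⟩
  have h2 : T1s l p q = (range (l-1)).filter fun a => ¬ inq l p q a ∧ inq l p q (a+1) := by
    ext a; simp only [T1s, mem_filter, mem_range]; constructor
    · rintro ⟨_, h, h'⟩; exact ⟨by omega, h'⟩
    · rintro ⟨h, h'⟩; exact ⟨by omega, by omega, h'⟩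
  have := updown (inq l p q) (l-1)
  rw [h1, h2]
  split_ifs at this <;> omega

lemma T3_le : (T3s l p q).card ≤ (BTs l p q y v).card + 2 * (NCs l p q y v).card := by
  have h : T3s l p q ⊆ BTs l p q y v ∪ ((NCs l p q y v).image (fun a => a - 1) ∪ NCs l p q y v) := by
    intro a ha
    obtain ⟨h0, h1, b, hb, b', hb', h2, h3, h4⟩ := by simpa [T3s] using ha
    rw [mem_union, mem_union]
    by_cases hd : ((p (a+1) : ℕ) : ℤ) ∣ y (a+1) - v b
    · by_cases hd' : ((p a : ℕ) : ℤ) ∣ y a - v b'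
      · left; simp only [BTs, mem_filter, mem_range]; exact ⟨h0, h1, b, hb, b', hb', h2, h3, h4, hd, hd'⟩
      · right; right; simp only [NCs, mem_filter, mem_range]; exact ⟨h0, b', hb', h3, hd'⟩
    · right; left; exact mem_image.2 ⟨a+1, by simp only [NCs, mem_filter, mem_range]; exact ⟨h1, b, hb, h2, hd⟩, by simp⟩
  have := (card_le_card h).trans (card_union_le _ _)
  have h3 := card_union_le ((NCs l p q y v).image (fun a => a - 1)) (NCs l p q y v)
  have h4 : ((NCs l p q y v).image (fun a => a - 1)).card ≤ _ := card_image_le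
  omega

lemma Echo_le (hy : GP l p y) : (Echo l p q y v).card ≤ 2 + 2 * (E1s l p q y v).card + (ALs l p q y v).card + (NCs l p q y v).card := by
  have h : Echo l p q y v ⊆ E1s l p q y v ∪ ({0} ∪ ((E1s l p q y v).image (fun a => a + 1) ∪ (T2s l p q).image (fun a => a+1))) := by
    intro a ha
    obtain ⟨h0, h1, c, hc, hd⟩ := by simpa [Echo] using ha
    simp only [mem_union]
    by_cases he : v c = y a
    · right
      cases a with
      | zero => left; simp
      | succ a =>
        right
        by_cases hq : inq l p q a
        · right; refine mem_image.2 ⟨a, ?_, rfl⟩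
          simp only [T2s, mem_filter, mem_range]; exact ⟨by omega, h0, hq, h1⟩
        · left; refine mem_image.2 ⟨a, ?_, rfl⟩
          simp only [E1s, mem_filter, mem_range]
          refine ⟨by omega, hq, c, hc, ?_, ?_⟩
          · rw [he]; exact hy.ne a (by omega)
          · rw [he, ← dvd_neg, neg_sub]; exact hy.step a (by omega)
    · left; simp only [E1s, mem_filter, mem_range]; exact ⟨h0, h1, c, hc, he, hd⟩
  have h1 := (card_le_card h).trans (card_union_le _ _)
  have h2 := card_union_le ({0} : Finset ℕ) ((E1s l p q y v).image (fun a => a + 1) ∪ (T2s l p q).image (fun a => a+1))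
  have h3 := card_union_le ((E1s l p q y v).image (fun a => a + 1)) ((T2s l p q).image (fun a => a+1))
  have h4 : ((E1s l p q y v).image (fun a => a + 1)).card ≤ _ := card_image_le
  have h5 : ((T2s l p q).image (fun a => a + 1)).card ≤ _ := card_image_le
  have h6 := T2_le (l := l) (p := p) (q := q)
  have h7 := T1_le (l := l) (p := p) (q := q) (y := y) (v := v)
  have h8 : ({0} : Finset ℕ).card = 1 := rfl
  omega

/-- beta positions never hit a vertex of the other path -/
lemma beta_ne (hy : GP l p y) (hv : GP l q v) {a b b' : ℕ} (ha : a + 1 < l) (hb : b < l) (hb' : b' < l)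
    (h1 : p (a+1) = q b) (h2 : p a = q b') (h3 : b + 2 ≤ b' ∨ b' + 2 ≤ b)
    (h4 : ((p (a+1) : ℕ) : ℤ) ∣ y (a+1) - v b) (h5 : ((p a : ℕ) : ℤ) ∣ y a - v b') (c : ℕ) (hc : c ≤ l) : v c ≠ y (a+1) := by
  intro he
  rw [h1, ← he] at h4
  have e1 := hv.good b hb c hc h4
  have h6 := dvd_add (hy.step a (by omega)) h5
  rw [h2, ← he] at h6
  have e2 := hv.good b' hb' c hc (by simpa using h6)
  omega
end Pair

lemma gp_of_good {w : List ℕ} (hw : ∀ p ∈ w, Odd p) (hg : Good w) (n : ℤ) :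
    GP w.length (fun a => w.getD a 0) (fun c => walk n (w.take c)) where
  step a ha := by simp only [walk_step ha]; exact nb_sub_dvd _ _
  ne a ha := by
    simp only [walk_step ha]
    intro h
    have h1 := abs_nb_sub (walk n (w.take a)) (w.getD a 0)
    rw [h, sub_self, abs_zero] at h1
    have h2 : w.getD a 0 ∈ w := by rw [List.getD_eq_getElem _ _ ha]; exact List.getElem_mem ha
    have := (hw _ h2).pos
    omega
  inj a ha a' ha' h := by
    simp only [List.getD_eq_getElem _ _ ha, List.getD_eq_getElem _ _ ha'] at h
    exact (List.Nodup.getElem_inj_iff hg.1).1 h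
  good := ((good_iff hw n).1 hg).2

/-- Erdos-Szekeres, labels -/
lemma erdos_szekeres (S : Finset ℕ) (g : ℕ → ℕ) (hinj : Set.InjOn g S) (u : ℕ) (hS : u * u ≤ S.card) (hu : 0 < u) :
    (∃ C ⊆ S, C.card = u ∧ ∀ a ∈ C, ∀ b ∈ C, a < b → g a < g b) ∨
    (∃ C ⊆ S, C.card = u ∧ ∀ a ∈ C, ∀ b ∈ C, a < b → g b < g a) := by
  by_contra hcon
  push Not at hcon
  obtain ⟨hc1, hc2⟩ := hcon
  let Q : ℕ → ℕ → Prop := fun a k => ∃ C ⊆ S, C.card = k + 1 ∧ (∀ x ∈ C, ∀ z ∈ C, x < z → g x < g z) ∧ a ∈ C ∧ ∀ x ∈ C, x ≤ a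
  have hQ0 : ∀ a ∈ S, Q a 0 := fun a ha => ⟨{a}, by simpa using ha, by simp, by simp, by simp, by simp⟩
  have hQlt : ∀ a k, Q a k → k + 1 < u := by
    rintro a k ⟨C, hC, hk, hm, _⟩
    by_contra hlt
    push Not at hlt
    obtain ⟨C', hC', hcard⟩ := exists_subset_card_eq (s := C) (n := u) (by omega)
    obtain ⟨x, hx, z, hz, hxz, h⟩ := hc1 C' (hC'.trans hC) hcard
    exact absurd (hm x (hC' hx) z (hC' hz) hxz) (by omega)
  -- label
  let lab : ℕ → ℕ := fun a => Nat.findGreatest (Q a) u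
  have hlab : ∀ a ∈ S, Q a (lab a) := fun a ha => Nat.findGreatest_spec (P := Q a) (Nat.zero_le _) (hQ0 a ha)
  have hmaps : ∀ a ∈ S, lab a ∈ range (u - 1) := fun a ha => by
    have := hQlt a _ (hlab a ha); simp; omega
  by_cases hu1 : u = 1
  · subst hu1
    obtain ⟨a, ha⟩ : S.Nonempty := card_pos.1 (by omega)
    have := hQlt a 0 (hQ0 a ha); omega
  obtain ⟨k, hk, hfib⟩ := exists_le_card_fiber_of_mul_le_card_of_maps_to (n := u) hmaps ⟨0, by simp; omega⟩
    (by rw [card_range]; exact (Nat.mul_le_mul_right _ (by omega)).trans hS)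
  obtain ⟨C, hC, hcard⟩ := exists_subset_card_eq hfib
  obtain ⟨x, hx, z, hz, hxz, h⟩ := hc2 C (hC.trans (filter_subset _ _)) hcard
  obtain ⟨hxS, hxk⟩ := mem_filter.1 (hC hx)
  obtain ⟨hzS, hzk⟩ := mem_filter.1 (hC hz)
  have hlt : g x < g z := lt_of_le_of_ne h fun he => hxz.ne (hinj hxS hzS he)
  obtain ⟨D, hD, hDk, hDm, hxD, hDx⟩ := hlab x hxS
  have : Q z (lab x + 1) := by
    refine ⟨insert z D, insert_subset hzS hD, ?_, ?_, by simp, ?_⟩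
    · rw [card_insert_of_notMem, hDk]
      intro hzD; have := hDx z hzD; omega
    · intro a ha b hb hab
      rcases mem_insert.1 ha with ha' | ha' <;> rcases mem_insert.1 hb with hb' | hb'
      · omega
      · have := hDx b hb'; omega
      · rw [hb']
        rcases (hDx a ha').eq_or_lt with h' | h'
        · rw [h']; exact hlt
        · exact (hDm a ha' x hxD h').trans hlt
      · exact hDm a ha' b hb' hab
    · intro a ha
      rcases mem_insert.1 ha with rfl | ha
      · exact le_rfl
      · have := hDx a ha; omega
  have h5 := hQlt z _ this
  have h6 : lab x + 1 ≤ lab z := Nat.le_findGreatest (by omega) this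
  omega
end KK

set_option linter.all false
set_option linter.unusedVariables false
set_option linter.unusedSectionVars false
namespace KK
open Finset
open scoped Classical

structure Env (P : Finset ℕ) (Λ δ H0 ρ : ℝ) (Hn l : ℕ) (Bm : ℤ) : Prop where
  prime : ∀ p ∈ P, p.Prime
  odd : ∀ p ∈ P, Odd p
  ge : ∀ p ∈ P, H0 ≤ p
  le : ∀ p ∈ P, p ≤ Hn
  sum : ∑ p ∈ P, 1 / (p:ℝ) ≤ Λ
  hδ : 0 ≤ δ
  hres : ∀ q ∈ P, ∀ c s : ℤ, (s = 1 ∨ s = -1) → ∑ p ∈ P, (if (q:ℤ) ∣ c + s * p then 1 / (p:ℝ) else 0) ≤ δ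
  hdiv : ∀ m : ℤ, m ≠ 0 → |m| ≤ Bm → ∑ p ∈ P, (if (p:ℤ) ∣ m then 1 / (p:ℝ) else 0) ≤ δ
  hρ1 : 1 ≤ ρ
  hρH : ρ ≤ H0
  hρδ : ρ * (2 * l + 1) * δ ≤ 1

noncomputable def iw (D : Finset ℕ) : ℝ := ∏ q ∈ D, 1 / (q:ℝ)
lemma iw_nonneg (D : Finset ℕ) : 0 ≤ iw D := prod_nonneg fun _ _ => by positivity
lemma iw_pos {D : Finset ℕ} (h : ∀ q ∈ D, 0 < q) : 0 < iw D := prod_pos fun q hq => by have := h q hq; positivity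
noncomputable def bs (s : Finset ℕ) (p : ℕ) : ℝ := if p ∈ s then 1 else 1 / (p:ℝ)
lemma bs_nonneg (s : Finset ℕ) (p : ℕ) : 0 ≤ bs s p := by unfold bs; split_ifs <;> positivity

lemma iw_step (s D : Finset ℕ) (p : ℕ) : iw ((insert p D) \ s) = bs s p * iw (D \ insert p s) := by
  unfold bs
  split_ifs with h
  · rw [one_mul, insert_sdiff_of_mem _ h, insert_eq_of_mem h]
  · rw [insert_sdiff_of_notMem _ h]
    have : insert p (D \ s) = insert p (D \ insert p s) := by
      ext x; simp only [mem_insert, mem_sdiff]; tauto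
    rw [this, iw, prod_insert (by simp)]; rfl

lemma sum_bs {P : Finset ℕ} {Λ : ℝ} (hΛ : ∑ p ∈ P, 1 / (p:ℝ) ≤ Λ) (s : Finset ℕ) : ∑ p ∈ P, bs s p ≤ s.card + Λ := by
  calc ∑ p ∈ P, bs s p ≤ ∑ p ∈ P, ((if p ∈ s then 1 else 0) + 1 / (p:ℝ)) := by
        refine sum_le_sum fun p _ => ?_
        unfold bs; split_ifs
        · have : (0:ℝ) ≤ 1 / p := by positivity
          linarith
        · linarith
    _ ≤ s.card + Λ := by
        rw [sum_add_distrib]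
        refine add_le_add ?_ hΛ
        rw [sum_boole]
        exact_mod_cast card_le_card (fun x hx => (mem_filter.1 hx).2)

/-- crude sums -/
lemma crude {P : Finset ℕ} {Λ c : ℝ} (hΛ : ∑ p ∈ P, 1 / (p:ℝ) ≤ Λ) (hΛ0 : 0 ≤ Λ) (k : ℕ) (s : Finset ℕ) (hc : s.card + k + Λ ≤ c) :
    ∑ w ∈ words P k, iw (w.toFinset \ s) ≤ c ^ k := by
  induction k generalizing s with
  | zero => simp [words, iw]
  | succ k ih =>
    rw [sum_words_succ]
    have hc0 : 0 ≤ c := by push_cast at hc; nlinarith [Nat.cast_nonneg (α := ℝ) s.card, Nat.cast_nonneg (α := ℝ) k]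
    calc ∑ p ∈ P, ∑ w ∈ words P k, iw ((p :: w).toFinset \ s) = ∑ p ∈ P, bs s p * ∑ w ∈ words P k, iw (w.toFinset \ insert p s) := by
          refine sum_congr rfl fun p _ => ?_
          rw [mul_sum]
          refine sum_congr rfl fun w _ => ?_
          rw [List.toFinset_cons, iw_step]
      _ ≤ ∑ p ∈ P, bs s p * c ^ k := by
          refine sum_le_sum fun p _ => mul_le_mul_of_nonneg_left (ih _ ?_) (bs_nonneg _ _)
          have : ((insert p s).card : ℝ) ≤ s.card + 1 := by exact_mod_cast card_insert_le _ _
          push_cast at hc; linarith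
      _ ≤ c * c ^ k := by
          rw [← sum_mul]
          refine mul_le_mul_of_nonneg_right ((sum_bs hΛ s).trans ?_) (by positivity)
          push_cast at hc; linarith [Nat.cast_nonneg (α := ℝ) k]
      _ = _ := by ring

lemma prod_getD {w : List ℕ} (hw : w.Nodup) (f : ℕ → ℝ) : ∏ a ∈ range w.length, f (w.getD a 0) = ∏ q ∈ w.toFinset, f q := by
  induction w with
  | nil => simp
  | cons p w ih =>
    rw [List.nodup_cons] at hw
    rw [List.length_cons, prod_range_succ', List.toFinset_cons, prod_insert (by simpa using hw.1), ← ih hw.2]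
    simp [mul_comm]

/-! AE -/
section AE
variable {P : Finset ℕ} {Λ δ H0 ρ : ℝ} {Hn l : ℕ} {Bm : ℤ}

noncomputable def gAE (ρ : ℝ) (l : ℕ) (w' : List ℕ) (y0 v0 : ℤ) (h : List ℕ) (p : ℕ) : ℝ :=
  bs w'.toFinset p * (1 + if p ∈ w'.toFinset then 0 else
    ρ * (∑ b ∈ range l, (if ((w'.getD b 0 : ℕ) : ℤ) ∣ nb (walk y0 h) p - walk v0 (w'.take b) then (1:ℝ) else 0) +
      ∑ c ∈ range (l+1), (if walk v0 (w'.take c) ≠ walk y0 h ∧ (p:ℤ) ∣ walk y0 h - walk v0 (w'.take c) then (1:ℝ) else 0)))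

lemma gAE_nonneg (hρ : 0 ≤ ρ) (w' : List ℕ) (y0 v0 : ℤ) (h : List ℕ) (p : ℕ) : 0 ≤ gAE ρ l w' y0 v0 h p := by
  unfold gAE
  refine mul_nonneg (bs_nonneg _ _) ?_
  split_ifs
  · norm_num
  · have h1 : ∀ b ∈ range l, (0:ℝ) ≤ (if ((w'.getD b 0 : ℕ) : ℤ) ∣ nb (walk y0 h) p - walk v0 (w'.take b) then (1:ℝ) else 0) := fun b _ => by split_ifs <;> norm_num
    have h2 : ∀ c ∈ range (l+1), (0:ℝ) ≤ (if walk v0 (w'.take c) ≠ walk y0 h ∧ (p:ℤ) ∣ walk y0 h - walk v0 (w'.take c) then (1:ℝ) else 0) := fun b _ => by split_ifs <;> norm_num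
    have := sum_nonneg h1
    have := sum_nonneg h2
    positivity

lemma vert_dist {Hn l : ℕ} {w w' : List ℕ} (hw : ∀ p ∈ w, p ≤ Hn) (hw' : ∀ p ∈ w', p ≤ Hn) (hl : w.length ≤ l) (hl' : w'.length ≤ l) (y0 v0 : ℤ) :
    |walk y0 w - walk v0 w'| ≤ |y0 - v0| + 2 * l * Hn := by
  have h1 := walk_dist hw y0
  have h2 := walk_dist hw' v0
  have h3 : (w.length : ℤ) * Hn ≤ l * Hn := by exact_mod_cast Nat.mul_le_mul_right _ hl
  have h4 : (w'.length : ℤ) * Hn ≤ l * Hn := by exact_mod_cast Nat.mul_le_mul_right _ hl'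
  rw [abs_le] at *
  have h5 := abs_le.1 (le_refl |y0 - v0|)
  constructor <;> linarith [h1.1, h1.2, h2.1, h2.2, h5.1, h5.2]

lemma gAE_sum (hE : Env P Λ δ H0 ρ Hn l Bm) {w' : List ℕ} (hw' : w' ∈ words P l) {y0 v0 : ℤ} (hB : |y0 - v0| + 2 * l * Hn ≤ Bm)
    (h : List ℕ) (hh : ∀ q ∈ h, q ∈ P) (hl : h.length < l) :
    ∑ p ∈ P, gAE ρ l w' y0 v0 h p ≤ Λ + 2 * l + 1 := by
  obtain ⟨hwl, hwP⟩ := mem_words.1 hw'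
  have hρ0 : 0 ≤ ρ := zero_le_one.trans hE.hρ1
  set y := walk y0 h with hy
  have e : ∀ p ∈ P, gAE ρ l w' y0 v0 h p ≤ bs w'.toFinset p + ρ * (∑ b ∈ range l, (if ((w'.getD b 0 : ℕ) : ℤ) ∣ (y - walk v0 (w'.take b)) + sgn y * p then 1 / (p:ℝ) else 0) +
      ∑ c ∈ range (l+1), (if walk v0 (w'.take c) ≠ y ∧ (p:ℤ) ∣ y - walk v0 (w'.take c) then 1 / (p:ℝ) else 0)) := by
    intro p _
    unfold gAE
    rw [← hy]
    by_cases hp : p ∈ w'.toFinset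
    · rw [if_pos hp, add_zero, mul_one]
      have h1 : ∀ b ∈ range l, (0:ℝ) ≤ (if ((w'.getD b 0 : ℕ) : ℤ) ∣ (y - walk v0 (w'.take b)) + sgn y * p then 1 / (p:ℝ) else 0) := fun b _ => by split_ifs <;> positivity
      have h2 : ∀ c ∈ range (l+1), (0:ℝ) ≤ (if walk v0 (w'.take c) ≠ y ∧ (p:ℤ) ∣ y - walk v0 (w'.take c) then 1 / (p:ℝ) else 0) := fun b _ => by split_ifs <;> positivity
      have := sum_nonneg h1
      have := sum_nonneg h2
      have : 0 ≤ ρ * (∑ b ∈ range l, (if ((w'.getD b 0 : ℕ) : ℤ) ∣ (y - walk v0 (w'.take b)) + sgn y * p then 1 / (p:ℝ) else 0) +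
      ∑ c ∈ range (l+1), (if walk v0 (w'.take c) ≠ y ∧ (p:ℤ) ∣ y - walk v0 (w'.take c) then 1 / (p:ℝ) else 0)) := by positivity
      linarith
    · rw [if_neg hp]
      have hb : bs w'.toFinset p = 1 / (p:ℝ) := by unfold bs; rw [if_neg hp]
      rw [hb, mul_add, mul_one]
      refine add_le_add le_rfl (le_of_eq ?_)
      have e1 : ∀ b, nb y p - walk v0 (w'.take b) = (y - walk v0 (w'.take b)) + sgn y * p := fun b => by unfold nb; ring
      simp only [e1]
      rw [mul_left_comm]
      congr 1
      rw [mul_add, mul_sum, mul_sum]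
      congr 1 <;> exact sum_congr rfl fun b _ => by rw [mul_ite, mul_one, mul_zero]
  calc _ ≤ _ := sum_le_sum e
    _ = ∑ p ∈ P, bs w'.toFinset p + ρ * (∑ b ∈ range l, ∑ p ∈ P, (if ((w'.getD b 0 : ℕ) : ℤ) ∣ (y - walk v0 (w'.take b)) + sgn y * p then 1 / (p:ℝ) else 0) +
      ∑ c ∈ range (l+1), ∑ p ∈ P, (if walk v0 (w'.take c) ≠ y ∧ (p:ℤ) ∣ y - walk v0 (w'.take c) then 1 / (p:ℝ) else 0)) := by
        rw [sum_add_distrib, ← mul_sum, sum_add_distrib]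
        congr 3 <;> rw [sum_comm]
    _ ≤ (l + Λ) + ρ * (∑ b ∈ range l, δ + ∑ c ∈ range (l+1), δ) := by
        refine add_le_add ((sum_bs hE.sum _).trans ?_) (mul_le_mul_of_nonneg_left (add_le_add (sum_le_sum fun b hb => ?_) (sum_le_sum fun c hc => ?_)) hρ0)
        · have : w'.toFinset.card ≤ l := hwl ▸ List.toFinset_card_le w'
          have : (w'.toFinset.card : ℝ) ≤ l := by exact_mod_cast this
          linarith
        · refine hE.hres _ (hwP _ ?_) _ _ (sgn_cases y)
          rw [List.getD_eq_getElem _ _ (by rw [hwl]; simpa using hb)]; exact List.getElem_mem _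
        · by_cases hne : walk v0 (w'.take c) ≠ y
          · simp only [hne, ne_eq, not_false_eq_true, true_and]
            refine hE.hdiv _ (sub_ne_zero.2 hne.symm) ?_
            exact (vert_dist (fun p hp => hE.le p (hh p hp)) (fun p hp => hE.le p (hwP p (List.mem_of_mem_take hp))) hl.le
              (by rw [List.length_take]; omega) y0 v0).trans hB
          · simp [hne]; exact hE.hδ
    _ ≤ _ := by
        rw [sum_const, sum_const, card_range, card_range, nsmul_eq_mul, nsmul_eq_mul]
        have := hE.hρδ
        push_cast
        have h0 : (0:ℝ) ≤ l := by positivity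
        nlinarith

/-- the pair notations for lists -/
noncomputable def gd (w : List ℕ) (a : ℕ) : ℕ := w.getD a 0
noncomputable def vt (y0 : ℤ) (w : List ℕ) (c : ℕ) : ℤ := walk y0 (w.take c)

lemma inq_iff {w w' : List ℕ} (hw : w.length = l) (hw' : w'.length = l) {a : ℕ} (ha : a < l) :
    inq l (gd w) (gd w') a ↔ gd w a ∈ w'.toFinset := by
  unfold inq gd
  constructor
  · rintro ⟨b, hb, h⟩
    rw [h, List.mem_toFinset, List.getD_eq_getElem _ _ (by omega)]; exact List.getElem_mem _
  · intro h
    rw [List.mem_toFinset, List.mem_iff_getElem] at h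
    obtain ⟨b, hb, h⟩ := h
    exact ⟨b, by omega, by rw [← h, List.getD_eq_getElem _ _ hb]⟩

lemma one_le_sum_ite {m : ℕ} {Q : ℕ → Prop} {b : ℕ} (hb : b < m) (h : Q b) : (1:ℝ) ≤ ∑ b ∈ range m, (if Q b then (1:ℝ) else 0) := by
  have := single_le_sum (f := fun b => if Q b then (1:ℝ) else 0) (s := range m) (fun i _ => by split_ifs <;> norm_num) (mem_range.2 hb)
  simpa [h] using this

lemma auxAE {A B : ℝ} (hρ : 0 ≤ ρ) (hA : 1 ≤ A) (hB : 0 ≤ B) : ρ ≤ 1 + ρ * (A + B) := by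
  have h1 : ρ * 1 ≤ ρ * (A + B) := mul_le_mul_of_nonneg_left (by linarith) hρ
  linarith

lemma gAE_lower (hρ : 1 ≤ ρ) {w w' : List ℕ} (hwl : w.length = l) (hw'l : w'.length = l) (hnd : w.Nodup) (y0 v0 : ℤ)
    (S : Finset ℕ) (hS : S ⊆ range l)
    (hS2 : ∀ a ∈ S, a ∈ ALs l (gd w) (gd w') (vt y0 w) (vt v0 w') ∨ a ∈ E1s l (gd w) (gd w') (vt y0 w) (vt v0 w')) :
    iw (w.toFinset \ w'.toFinset) * ρ ^ S.card ≤ hp (gAE ρ l w' y0 v0) [] w := by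
  have hρ0 : 0 ≤ ρ := zero_le_one.trans hρ
  have e1 : iw (w.toFinset \ w'.toFinset) = ∏ a ∈ range l, bs w'.toFinset (gd w a) := by
    have := prod_getD hnd (bs w'.toFinset)
    rw [hwl] at this
    unfold gd
    rw [this]
    unfold bs iw
    rw [prod_ite, prod_const_one, one_mul, sdiff_eq_filter]
  have e2 : ρ ^ S.card = ∏ a ∈ range l, if a ∈ S then ρ else 1 := by
    rw [prod_ite, prod_const_one, mul_one, prod_const, filter_mem_eq_inter, inter_eq_right.2 hS]
  rw [e1, e2, hp_eq, hwl, ← prod_mul_distrib]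
  refine prod_le_prod (fun a _ => mul_nonneg (bs_nonneg _ _) (by split_ifs <;> linarith)) fun a ha => ?_
  have hal := mem_range.1 ha
  rw [List.nil_append]
  unfold gAE
  refine mul_le_mul_of_nonneg_left ?_ (bs_nonneg _ _)
  have hA : (0:ℝ) ≤ ∑ b ∈ range l, (if ((w'.getD b 0 : ℕ) : ℤ) ∣ nb (walk y0 (w.take a)) (w.getD a 0) - walk v0 (w'.take b) then (1:ℝ) else 0) :=
    sum_nonneg fun b _ => by split_ifs <;> norm_num
  have hB : (0:ℝ) ≤ ∑ c ∈ range (l+1), (if walk v0 (w'.take c) ≠ walk y0 (w.take a) ∧ ((w.getD a 0 : ℕ):ℤ) ∣ walk y0 (w.take a) - walk v0 (w'.take c) then (1:ℝ) else 0) :=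
    sum_nonneg fun b _ => by split_ifs <;> norm_num
  by_cases haS : a ∈ S
  · rw [if_pos haS]
    rcases hS2 a haS with h | h
    · simp only [ALs, mem_filter, mem_range] at h
      obtain ⟨_, h1, h2, b, hb, h3, h4⟩ := h
      rw [inq_iff hwl hw'l hal] at h2
      have h2' : w.getD a 0 ∉ w'.toFinset := h2
      rw [if_neg h2']
      have h5 : vt y0 w (a+1) = nb (walk y0 (w.take a)) (w.getD a 0) := walk_step (by omega) y0
      rw [h5, h3] at h4
      have h6 := one_le_sum_ite (Q := fun b => ((w'.getD b 0 : ℕ) : ℤ) ∣ nb (walk y0 (w.take a)) (w.getD a 0) - walk v0 (w'.take b)) hb h4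
      refine auxAE hρ0 ?_ hB
      convert h6
    · simp only [E1s, mem_filter, mem_range] at h
      obtain ⟨_, h2, c, hc, h3, h4⟩ := h
      rw [inq_iff hwl hw'l hal] at h2
      have h2' : w.getD a 0 ∉ w'.toFinset := h2
      rw [if_neg h2']
      have h6 := one_le_sum_ite (Q := fun c => walk v0 (w'.take c) ≠ walk y0 (w.take a) ∧ ((w.getD a 0 : ℕ):ℤ) ∣ walk y0 (w.take a) - walk v0 (w'.take c)) (Nat.lt_succ_of_le hc) ⟨h3, h4⟩
      rw [add_comm (∑ b ∈ range l, _)]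
      refine auxAE hρ0 ?_ hA
      convert h6
  · rw [if_neg haS]
    split_ifs
    · norm_num
    · have := mul_nonneg hρ0 (add_nonneg hA hB)
      linarith

lemma iw_union (D E : Finset ℕ) : iw (D ∪ E) = iw (D \ E) * iw E := by
  unfold iw
  rw [← prod_union sdiff_disjoint, sdiff_union_self_eq_union]

lemma GW_mem {w : List ℕ} (h : w ∈ GW P l) : w ∈ words P l ∧ Good w := mem_filter.1 h

lemma AE_sum (hE : Env P Λ δ H0 ρ Hn l Bm) (hΛ0 : 0 ≤ Λ) {y0 v0 : ℤ} (hB : |y0 - v0| + 2 * l * Hn ≤ Bm) (t : ℕ)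
    (Q : List ℕ → List ℕ → Prop)
    (hQ : ∀ w ∈ GW P l, ∀ w' ∈ GW P l, Q w w' → t ≤ (ALs l (gd w) (gd w') (vt y0 w) (vt v0 w')).card ∨ t ≤ (E1s l (gd w) (gd w') (vt y0 w) (vt v0 w')).card) :
    (∑ w ∈ GW P l, ∑ w' ∈ GW P l, if Q w w' then iw (w.toFinset ∪ w'.toFinset) else 0) * ρ ^ t ≤ (Λ + 2 * l + 1) ^ (2 * l) := by
  have hρ0 : 0 ≤ ρ := zero_le_one.trans hE.hρ1
  set c := Λ + 2 * l + 1 with hc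
  have hc0 : 0 ≤ c := by positivity
  rw [sum_comm, sum_mul]
  have key : ∀ w' ∈ GW P l, (∑ w ∈ GW P l, if Q w w' then iw (w.toFinset ∪ w'.toFinset) else 0) * ρ ^ t ≤ iw w'.toFinset * c ^ l := by
    intro w' hw'
    obtain ⟨hw'W, hw'g⟩ := GW_mem hw'
    have hw'l := (mem_words.1 hw'W).1
    rw [sum_mul]
    calc ∑ w ∈ GW P l, (if Q w w' then iw (w.toFinset ∪ w'.toFinset) else 0) * ρ ^ t
        ≤ ∑ w ∈ GW P l, iw w'.toFinset * hp (gAE ρ l w' y0 v0) [] w := by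
          refine sum_le_sum fun w hw => ?_
          obtain ⟨hwW, hwg⟩ := GW_mem hw
          have hwl := (mem_words.1 hwW).1
          have hn := hp_nonneg (gAE_nonneg (l := l) hρ0 w' y0 v0) [] w
          split_ifs with hq
          · rw [iw_union, mul_comm (iw (_ \ _)), mul_assoc]
            refine mul_le_mul_of_nonneg_left ?_ (iw_nonneg _)
            rcases hQ w hw w' hw' hq with h | h
            · refine le_trans ?_ (gAE_lower hE.hρ1 hwl hw'l hwg.1 y0 v0 _ (filter_subset _ _) (fun a ha => Or.inl ha))
              exact mul_le_mul_of_nonneg_left (pow_le_pow_right₀ hE.hρ1 h) (iw_nonneg _)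
            · refine le_trans ?_ (gAE_lower hE.hρ1 hwl hw'l hwg.1 y0 v0 _ (filter_subset _ _) (fun a ha => Or.inr ha))
              exact mul_le_mul_of_nonneg_left (pow_le_pow_right₀ hE.hρ1 h) (iw_nonneg _)
          · rw [zero_mul]; exact mul_nonneg (iw_nonneg _) hn
      _ ≤ ∑ w ∈ words P l, iw w'.toFinset * hp (gAE ρ l w' y0 v0) [] w :=
          sum_le_sum_of_subset_of_nonneg (filter_subset _ _) fun w _ _ => mul_nonneg (iw_nonneg _) (hp_nonneg (gAE_nonneg (l := l) hρ0 w' y0 v0) [] w)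
      _ ≤ _ := by
          rw [← mul_sum]
          refine mul_le_mul_of_nonneg_left ?_ (iw_nonneg _)
          refine seqsum P l (gAE_nonneg hρ0 w' y0 v0) hc0 l [] (by simp) (by simp) fun h hh hl => ?_
          exact gAE_sum hE hw'W hB h hh hl
  calc _ ≤ ∑ w' ∈ GW P l, iw w'.toFinset * c ^ l := sum_le_sum key
    _ ≤ ∑ w' ∈ words P l, iw w'.toFinset * c ^ l :=
        sum_le_sum_of_subset_of_nonneg (filter_subset _ _) fun w _ _ => mul_nonneg (iw_nonneg _) (by positivity)
    _ ≤ c ^ l * c ^ l := by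
        rw [← sum_mul]
        refine mul_le_mul_of_nonneg_right ?_ (by positivity)
        have := crude (c := c) hE.sum hΛ0 l ∅ (by rw [hc]; simp; linarith [Nat.cast_nonneg (α := ℝ) l])
        simpa using this
    _ = _ := by rw [← pow_add, two_mul]
end AE
end KK

set_option linter.all false
set_option linter.unusedVariables false
set_option linter.unusedSectionVars false
namespace KK
open Finset
open scoped Classical

noncomputable def Ff (ρ : ℝ) : Finset ℕ → ℤ → ℤ → List ℕ → List ℕ → ℝ
  | _, _, _, [], _ => 1
  | _, _, _, _ :: _, [] => 1
  | s, y, v, p :: w, q :: w' =>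
      Ff ρ (insert p s) (nb y p) v w (q :: w') + Ff ρ (insert q s) y (nb v q) (p :: w) w' +
      (if p = q ∧ p ∉ s ∧ (p:ℤ) ∣ y - v ∧ y ≠ v then ρ * Ff ρ (insert p s) (nb y p) (nb v q) w w' else 0)
termination_by _ _ _ w w' => w.length + w'.length

lemma Ff_nil (ρ : ℝ) (s : Finset ℕ) (y v : ℤ) (w' : List ℕ) : Ff ρ s y v [] w' = 1 := by rw [Ff.eq_def]
lemma Ff_nil' (ρ : ℝ) (s : Finset ℕ) (y v : ℤ) (w : List ℕ) : Ff ρ s y v w [] = 1 := by cases w <;> rw [Ff.eq_def]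
lemma Ff_cons (ρ : ℝ) (s : Finset ℕ) (y v : ℤ) (p q : ℕ) (w w' : List ℕ) : Ff ρ s y v (p :: w) (q :: w') =
      Ff ρ (insert p s) (nb y p) v w (q :: w') + Ff ρ (insert q s) y (nb v q) (p :: w) w' +
      (if p = q ∧ p ∉ s ∧ (p:ℤ) ∣ y - v ∧ y ≠ v then ρ * Ff ρ (insert p s) (nb y p) (nb v q) w w' else 0) := by
  rw [Ff.eq_def]

lemma Ff_nonneg {ρ : ℝ} (hρ : 0 ≤ ρ) (m : ℕ) : ∀ (s : Finset ℕ) (y v : ℤ) (w w' : List ℕ), w.length + w'.length = m → 1 ≤ Ff ρ s y v w w' := by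
  induction m using Nat.strong_induction_on with
  | _ m ih =>
    intro s y v w w' hm
    match w, w' with
    | [], w' => rw [Ff_nil]
    | w, [] => rw [Ff_nil']
    | p :: w, q :: w' =>
      rw [Ff_cons]
      have h1 := ih (w.length + (q :: w').length) (by simp at hm ⊢; omega) (insert p s) (nb y p) v w (q :: w') rfl
      have h2 := ih ((p :: w).length + w'.length) (by simp at hm ⊢; omega) (insert q s) y (nb v q) (p :: w) w' rfl
      have h3 := ih (w.length + w'.length) (by simp at hm ⊢; omega) (insert p s) (nb y p) (nb v q) w w' rfl
      split_ifs
      · have := mul_nonneg hρ (zero_le_one.trans h3); linarith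
      · linarith

noncomputable def F3 (ρ : ℝ) (s : Finset ℕ) (y v : ℤ) (p q : ℕ) (w w' : List ℕ) : ℝ :=
  if p = q ∧ p ∉ s ∧ (p:ℤ) ∣ y - v ∧ y ≠ v then ρ * Ff ρ (insert p s) (nb y p) (nb v q) w w' else 0
lemma F3_pos {ρ : ℝ} {s : Finset ℕ} {y v : ℤ} {p : ℕ} {w w' : List ℕ} (h : p ∉ s ∧ (p:ℤ) ∣ y - v ∧ y ≠ v) : F3 ρ s y v p p w w' = ρ * Ff ρ (insert p s) (nb y p) (nb v p) w w' := if_pos ⟨rfl, h⟩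
lemma F3_neg {ρ : ℝ} {s : Finset ℕ} {y v : ℤ} {p q : ℕ} {w w' : List ℕ} (h : ¬ (p = q ∧ p ∉ s ∧ (p:ℤ) ∣ y - v ∧ y ≠ v)) : F3 ρ s y v p q w w' = 0 := if_neg h

section
variable {P : Finset ℕ} {Λ δ H0 ρ : ℝ} {Hn l : ℕ} {Bm : ℤ}

lemma iw_step2 (s D E : Finset ℕ) (p : ℕ) : iw ((insert p D ∪ E) \ s) = bs s p * iw ((D ∪ E) \ insert p s) := by
  rw [insert_union, iw_step]
lemma iw_step2' (s D E : Finset ℕ) (p : ℕ) : iw ((D ∪ insert p E) \ s) = bs s p * iw ((D ∪ E) \ insert p s) := by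
  rw [union_insert, iw_step]

lemma nb_diff (y v : ℤ) (p : ℕ) (hp : p ≤ Hn) : |nb y p - v| ≤ |y - v| + Hn := by
  have h := abs_nb_sub y p
  have h1 : |nb y p - v| ≤ |nb y p - y| + |y - v| := by
    have := abs_add_le (nb y p - y) (y - v); simpa using this
  have h2 : (p:ℤ) ≤ Hn := by exact_mod_cast hp
  omega

lemma Ff_upper (hE : Env P Λ δ H0 ρ Hn l Bm) (hΛ0 : 0 ≤ Λ) {c : ℝ} (hc : c = Λ + 2 * l + 1) (m : ℕ) : ∀ (k k' : ℕ) (s : Finset ℕ) (y v : ℤ), k + k' = m → s.card + k + k' ≤ 2 * l →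
    |y - v| + (k + k') * Hn ≤ Bm →
    ∑ w ∈ words P k, ∑ w' ∈ words P k', iw ((w.toFinset ∪ w'.toFinset) \ s) * Ff ρ s y v w w' ≤ (3 * c) ^ (k + k') := by
  have hρ0 : 0 ≤ ρ := zero_le_one.trans hE.hρ1
  have hl0 : (0:ℝ) ≤ l := by positivity
  have hc1 : 1 ≤ c := by rw [hc]; linarith
  induction m using Nat.strong_induction_on with
  | _ m ih =>
  intro k k' s y v hm hs hB
  have hs' : (s.card : ℝ) + k + k' ≤ 2 * l := by exact_mod_cast hs
  have hcr : ∀ j : ℕ, c ^ j ≤ (3 * c) ^ j := fun j => pow_le_pow_left₀ (by linarith) (by linarith) _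
  match k, k', hm, hs, hB, hs' with
  | 0, k', hm, hs, hB, hs' =>
    rw [sum_words_zero]
    simp only [Ff_nil, mul_one, List.toFinset_nil, empty_union, zero_add]
    refine (crude hE.sum hΛ0 k' s ?_).trans (hcr k')
    push_cast at hs'; rw [hc]; linarith
  | k+1, 0, hm, hs, hB, hs' =>
    simp only [sum_words_zero, Ff_nil', mul_one, List.toFinset_nil, union_empty, add_zero]
    refine (crude hE.sum hΛ0 (k+1) s ?_).trans (hcr (k+1))
    push_cast at hs' ⊢; rw [hc]; linarith
  | k+1, k'+1, hm, hs, hB, hs' =>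
    have hci : ∀ p, (insert p s).card ≤ s.card + 1 := fun p => card_insert_le _ _
    push_cast at hB
    have hHn : (0:ℤ) ≤ Hn := by positivity
    have hyv : |y - v| ≤ Bm := by nlinarith
    have hsb := sum_bs hE.sum s
    have hsb' : ∑ p ∈ P, bs s p ≤ c := hsb.trans (by push_cast at hs'; rw [hc]; linarith)
    set A := (3 * c) ^ (k + k' + 1) with hA
    have hA0 : 0 ≤ A := by positivity
    have T1 : ∑ w ∈ words P (k+1), ∑ w' ∈ words P (k'+1), iw ((w.toFinset ∪ w'.toFinset) \ s) * Ff ρ (insert (w.headD 0) s) (nb y (w.headD 0)) v w.tail w' ≤ c * A := by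
      rw [sum_words_succ]
      calc _ = ∑ p ∈ P, bs s p * ∑ w ∈ words P k, ∑ w' ∈ words P (k'+1), iw ((w.toFinset ∪ w'.toFinset) \ insert p s) * Ff ρ (insert p s) (nb y p) v w w' := by
            refine sum_congr rfl fun p _ => ?_
            simp only [mul_sum]
            refine sum_congr rfl fun w _ => sum_congr rfl fun w' _ => ?_
            rw [List.toFinset_cons, iw_step2, mul_assoc]; rfl
        _ ≤ ∑ p ∈ P, bs s p * A := by
            refine sum_le_sum fun p hp => mul_le_mul_of_nonneg_left ?_ (bs_nonneg _ _)
            have := ih (k + (k'+1)) (by omega) k (k'+1) (insert p s) (nb y p) v rfl (by have := hci p; omega) (by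
              have := nb_diff y v p (hE.le p hp); push_cast; nlinarith)
            exact this.trans (le_of_eq (by rw [hA, add_assoc]))
        _ ≤ _ := by rw [← sum_mul]; exact mul_le_mul_of_nonneg_right hsb' hA0
    have T2 : ∑ w ∈ words P (k+1), ∑ w' ∈ words P (k'+1), iw ((w.toFinset ∪ w'.toFinset) \ s) * Ff ρ (insert (w'.headD 0) s) y (nb v (w'.headD 0)) w w'.tail ≤ c * A := by
      rw [sum_comm, sum_words_succ]
      calc _ = ∑ p ∈ P, bs s p * ∑ w ∈ words P (k+1), ∑ w' ∈ words P k', iw ((w.toFinset ∪ w'.toFinset) \ insert p s) * Ff ρ (insert p s) y (nb v p) w w' := by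
            refine sum_congr rfl fun p _ => ?_
            rw [sum_comm]
            simp only [mul_sum]
            refine sum_congr rfl fun w _ => sum_congr rfl fun w' _ => ?_
            rw [List.toFinset_cons, iw_step2', mul_assoc]; rfl
        _ ≤ ∑ p ∈ P, bs s p * A := by
            refine sum_le_sum fun p hp => mul_le_mul_of_nonneg_left ?_ (bs_nonneg _ _)
            have := ih ((k+1) + k') (by omega) (k+1) k' (insert p s) y (nb v p) rfl (by have := hci p; omega) (by
              have := nb_diff v y p (hE.le p hp); rw [abs_sub_comm y, abs_sub_comm v y] at *; push_cast; nlinarith)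
            exact this.trans (le_of_eq (by rw [hA]; congr 1; omega))
        _ ≤ _ := by rw [← sum_mul]; exact mul_le_mul_of_nonneg_right hsb' hA0
    have T3 : ∑ w ∈ words P (k+1), ∑ w' ∈ words P (k'+1), iw ((w.toFinset ∪ w'.toFinset) \ s) *
        F3 ρ s y v (w.headD 0) (w'.headD 0) w.tail w'.tail ≤ c * A := by
      rw [sum_words_succ]
      calc _ = ∑ p ∈ P, (if p ∉ s ∧ (p:ℤ) ∣ y - v ∧ y ≠ v then (1 / (p:ℝ)) * ρ * ∑ w ∈ words P k, ∑ w' ∈ words P k', iw ((w.toFinset ∪ w'.toFinset) \ insert p s) * Ff ρ (insert p s) (nb y p) (nb v p) w w' else 0) := by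
            refine sum_congr rfl fun p hp => ?_
            simp only [sum_words_succ, List.headD_cons, List.tail_cons]
            by_cases h : p ∉ s ∧ (p:ℤ) ∣ y - v ∧ y ≠ v
            · rw [if_pos h, mul_sum]
              refine sum_congr rfl fun w _ => ?_
              rw [sum_eq_single p]
              · rw [mul_sum]
                refine sum_congr rfl fun w' _ => ?_
                rw [F3_pos h, List.toFinset_cons, List.toFinset_cons, insert_union, union_insert, insert_idem, iw_step]
                unfold bs; rw [if_neg h.1]; ring
              · intro q _ hq
                refine sum_eq_zero fun w' _ => ?_
                rw [F3_neg (fun hh => hq hh.1.symm), mul_zero]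
              · intro hh; exact absurd hp hh
            · rw [if_neg h]
              refine sum_eq_zero fun w _ => sum_eq_zero fun q _ => sum_eq_zero fun w' _ => ?_
              rw [F3_neg (fun hh => h hh.2), mul_zero]
        _ ≤ ∑ p ∈ P, (if (p:ℤ) ∣ y - v ∧ y ≠ v then 1 / (p:ℝ) else 0) * (ρ * (3 * c) ^ (k + k')) := by
            refine sum_le_sum fun p hp => ?_
            have := ih (k + k') (by omega) k k' (insert p s) (nb y p) (nb v p) rfl (by have := hci p; omega) (by
              have h1 := nb_diff y (nb v p) p (hE.le p hp)
              have h2 := nb_diff v y p (hE.le p hp); rw [abs_sub_comm y, abs_sub_comm v y] at *; push_cast; nlinarith)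
            have h0 : 0 ≤ ρ * (3 * c) ^ (k + k') := by positivity
            by_cases h : (p:ℤ) ∣ y - v ∧ y ≠ v
            · rw [if_pos h]
              split_ifs
              · rw [mul_assoc]
                exact mul_le_mul_of_nonneg_left (mul_le_mul_of_nonneg_left this hρ0) (by positivity)
              · positivity
            · rw [if_neg h, if_neg (fun hh => h hh.2), zero_mul]
        _ ≤ δ * (ρ * (3 * c) ^ (k + k')) := by
            rw [← sum_mul]
            refine mul_le_mul_of_nonneg_right ?_ (by positivity)
            by_cases h : y = v
            · simp [h]; exact hE.hδ
            · simp only [ne_eq, h, not_false_eq_true, and_true]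
              exact hE.hdiv _ (sub_ne_zero.2 h) hyv
        _ ≤ 1 * (3 * c) ^ (k + k') := by
            rw [← mul_assoc]
            refine mul_le_mul_of_nonneg_right ?_ (by positivity)
            have h1 := hE.hρδ
            have h2 := mul_nonneg hρ0 hE.hδ
            nlinarith [mul_nonneg h2 hl0]
        _ ≤ c * A := by
            rw [hA, pow_succ, one_mul]
            have : 0 ≤ (3 * c) ^ (k + k') := by positivity
            nlinarith [mul_le_mul_of_nonneg_left (show 1 ≤ c * (3 * c) by nlinarith) this]
    calc _ = _ + _ + _ := by
          rw [← sum_add_distrib, ← sum_add_distrib]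
          refine sum_congr rfl fun w hw => ?_
          rw [← sum_add_distrib, ← sum_add_distrib]
          refine sum_congr rfl fun w' hw' => ?_
          rw [← mul_add, ← mul_add]
          have h1 := (mem_words.1 hw).1
          have h2 := (mem_words.1 hw').1
          match w, w', h1, h2 with
          | p :: w, q :: w', _, _ => rw [Ff_cons]; rfl
      _ ≤ c * A + c * A + c * A := add_le_add (add_le_add T1 T2) T3
      _ = _ := by rw [hA]; ring

lemma Ff_lower (hρ0 : 0 ≤ ρ) {w w' : List ℕ} (hw : w.length = l) (hw' : w'.length = l) (hn : w.Nodup) (hn' : w'.Nodup) (y0 v0 : ℤ) (g : ℕ → ℕ) (m : ℕ) :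
    ∀ (a b : ℕ) (s C : Finset ℕ), (l - a) + (l - b) = m → (∀ a' b', a ≤ a' → b ≤ b' → a' < l → b' < l → gd w a' = gd w' b' → gd w a' ∉ s) →
    (∀ x ∈ C, a ≤ x ∧ b ≤ g x ∧ x < l ∧ g x < l ∧ gd w x = gd w' (g x) ∧ ((gd w x : ℕ):ℤ) ∣ vt y0 w x - vt v0 w' (g x) ∧ vt y0 w x ≠ vt v0 w' (g x)) →
    (∀ x ∈ C, ∀ z ∈ C, x < z → g x < g z) →
    ρ ^ C.card ≤ Ff ρ s (vt y0 w a) (vt v0 w' b) (w.drop a) (w'.drop b) := by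
  have hinj : ∀ {u : List ℕ}, u.length = l → u.Nodup → ∀ i j, i < l → j < l → gd u i = gd u j → i = j := by
    intro u hu hun i j hi hj h
    unfold gd at h
    rw [List.getD_eq_getElem _ _ (by omega), List.getD_eq_getElem _ _ (by omega)] at h
    exact (List.Nodup.getElem_inj_iff hun).1 h
  have hdrop : ∀ {u : List ℕ}, u.length = l → ∀ i, i < l → u.drop i = gd u i :: u.drop (i+1) := by
    intro u hu i hi
    unfold gd
    rw [List.getD_eq_getElem _ _ (by omega)]
    exact List.drop_eq_getElem_cons (by omega)
  have hstep : ∀ {u : List ℕ}, u.length = l → ∀ n i, i < l → nb (vt n u i) (gd u i) = vt n u (i+1) := by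
    intro u hu n i hi
    exact (walk_step (by omega) n).symm
  induction m using Nat.strong_induction_on with
  | _ m ih =>
  intro a b s C hm hs hC hmono
  by_cases hCe : C = ∅
  · rw [hCe, card_empty, pow_zero]; exact Ff_nonneg hρ0 _ _ _ _ _ _ rfl
  obtain ⟨x0, hx0⟩ := nonempty_iff_ne_empty.2 hCe
  obtain ⟨h1, h2, h3, h4, -⟩ := hC x0 hx0
  have ha : a < l := by omega
  have hb : b < l := by omega
  rw [hdrop hw a ha, hdrop hw' b hb, Ff_cons, ← hdrop hw a ha, ← hdrop hw' b hb, hstep hw y0 a ha, hstep hw' v0 b hb]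
  have n1 := zero_le_one.trans (Ff_nonneg hρ0 _ (insert (gd w a) s) (vt y0 w (a+1)) (vt v0 w' b) (w.drop (a+1)) (w'.drop b) rfl)
  have n2 := zero_le_one.trans (Ff_nonneg hρ0 _ (insert (gd w' b) s) (vt y0 w a) (vt v0 w' (b+1)) (w.drop a) (w'.drop (b+1)) rfl)
  have n3 := zero_le_one.trans (Ff_nonneg hρ0 _ (insert (gd w a) s) (vt y0 w (a+1)) (vt v0 w' (b+1)) (w.drop (a+1)) (w'.drop (b+1)) rfl)
  have n4 : 0 ≤ (if gd w a = gd w' b ∧ gd w a ∉ s ∧ ((gd w a : ℕ):ℤ) ∣ vt y0 w a - vt v0 w' b ∧ vt y0 w a ≠ vt v0 w' b then ρ * Ff ρ (insert (gd w a) s) (vt y0 w (a+1)) (vt v0 w' (b+1)) (w.drop (a+1)) (w'.drop (b+1)) else 0) := by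
    split_ifs
    · positivity
    · exact le_rfl
  by_cases haC : a ∈ C
  · by_cases hga : g a = b
    · obtain ⟨_, _, _, _, e1, e2, e3⟩ := hC a haC
      rw [hga] at e1 e2 e3
      rw [if_pos ⟨e1, hs a b le_rfl le_rfl ha hb e1, e2, e3⟩]
      have := ih ((l - (a+1)) + (l - (b+1))) (by omega) (a+1) (b+1) (insert (gd w a) s) (C.erase a) rfl ?_ ?_ ?_
      · rw [← card_erase_add_one haC, pow_succ, mul_comm]
        have := mul_le_mul_of_nonneg_left this hρ0
        linarith
      · intro a' b' h1 h2 h3 h4 h5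
        rw [mem_insert, not_or]
        exact ⟨fun h => by have := hinj hw hn _ _ h3 ha h; omega, hs a' b' (by omega) (by omega) h3 h4 h5⟩
      · intro x hx
        obtain ⟨hx1, hx2⟩ := mem_erase.1 hx
        obtain ⟨f1, f2, f3⟩ := hC x hx2
        have := hmono a haC x hx2 (by omega)
        exact ⟨by omega, by omega, f3⟩
      · exact fun x hx z hz => hmono x (mem_of_mem_erase hx) z (mem_of_mem_erase hz)
    · have := ih ((l - a) + (l - (b+1))) (by omega) a (b+1) (insert (gd w' b) s) C rfl ?_ ?_ hmono
      · linarith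
      · intro a' b' h1 h2 h3 h4 h5
        rw [mem_insert, not_or]
        exact ⟨fun h => by have := hinj hw' hn' _ _ h4 hb (h5.symm.trans h); omega, hs a' b' (by omega) (by omega) h3 h4 h5⟩
      · intro x hx
        obtain ⟨f1, f2, f3⟩ := hC x hx
        obtain ⟨g1, g2, g3⟩ := hC a haC
        refine ⟨f1, ?_, f3⟩
        rcases f1.eq_or_lt with h | h
        · rw [← h]; omega
        · have := hmono a haC x hx h; omega
  · have := ih ((l - (a+1)) + (l - b)) (by omega) (a+1) b (insert (gd w a) s) C rfl ?_ ?_ hmono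
    · linarith
    · intro a' b' h1 h2 h3 h4 h5
      rw [mem_insert, not_or]
      exact ⟨fun h => by have := hinj hw hn _ _ h3 ha h; omega, hs a' b' (by omega) (by omega) h3 h4 h5⟩
    · intro x hx
      obtain ⟨f1, f3⟩ := hC x hx
      refine ⟨?_, f3⟩
      rcases f1.eq_or_lt with h | h
      · rw [h] at haC; exact absurd hx haC
      · omega
end
end KK

set_option linter.all false
set_option linter.unusedVariables false
set_option linter.unusedSectionVars false
namespace KK
open Finset
open scoped Classical

section
variable {P : Finset ℕ} {Λ δ H0 ρ : ℝ} {Hn l : ℕ} {Bm : ℤ}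

lemma GW_odd (hE : Env P Λ δ H0 ρ Hn l Bm) {w : List ℕ} (hw : w ∈ GW P l) : ∀ p ∈ w, Odd p := fun p hp => hE.odd p (GW_sub w hw p hp)

lemma GW_GP (hE : Env P Λ δ H0 ρ Hn l Bm) {w : List ℕ} (hw : w ∈ GW P l) (n : ℤ) : GP l (gd w) (vt n w) := by
  have h := gp_of_good (GW_odd hE hw) (GW_mem hw).2 n
  rw [(mem_words.1 (GW_mem hw).1).1] at h
  exact h

lemma BT_lower (hE : Env P Λ δ H0 ρ Hn l Bm) {w w' : List ℕ} (hw : w ∈ GW P l) (hw' : w' ∈ GW P l) (y0 v0 : ℤ) {u : ℕ} (hu : 0 < u)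
    (huc : u * u ≤ (BTs l (gd w) (gd w') (vt y0 w) (vt v0 w')).card) :
    ρ ^ u ≤ Ff ρ ∅ y0 v0 w w' + Ff ρ ∅ y0 (walk v0 w') w w'.reverse := by
  have hρ0 : 0 ≤ ρ := zero_le_one.trans hE.hρ1
  have gw := GW_GP hE hw y0
  have gw' := GW_GP hE hw' v0
  have hwl := (mem_words.1 (GW_mem hw).1).1
  have hwl' := (mem_words.1 (GW_mem hw').1).1
  have hF1 := zero_le_one.trans (Ff_nonneg hρ0 _ ∅ y0 v0 w w' rfl)
  have hF2 := zero_le_one.trans (Ff_nonneg hρ0 _ ∅ y0 (walk v0 w') w w'.reverse rfl)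
  have hex : ∀ a, ∃ b, a ∈ BTs l (gd w) (gd w') (vt y0 w) (vt v0 w') → a + 1 < l ∧ b < l ∧ gd w (a+1) = gd w' b ∧
      ((gd w (a+1) : ℕ) : ℤ) ∣ vt y0 w (a+1) - vt v0 w' b ∧ ∀ c ≤ l, vt v0 w' c ≠ vt y0 w (a+1) := by
    intro a
    by_cases ha : a ∈ BTs l (gd w) (gd w') (vt y0 w) (vt v0 w')
    · simp only [BTs, mem_filter, mem_range] at ha
      obtain ⟨h0, h1, b, hb, b', hb', h2, h3, h4, h5, h6⟩ := ha
      exact ⟨b, fun _ => ⟨h1, hb, h2, h5, fun c hc => beta_ne gw gw' h1 hb hb' h2 h3 h4 h5 h6 c hc⟩⟩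
    · exact ⟨0, fun h => absurd h ha⟩
  choose g hg using hex
  have hinj : Set.InjOn g (BTs l (gd w) (gd w') (vt y0 w) (vt v0 w')) := by
    intro a ha a' ha' h
    obtain ⟨h1, h2, h3, _⟩ := hg a ha
    obtain ⟨h1', h2', h3', _⟩ := hg a' ha'
    have := gw.inj (a+1) h1 (a'+1) h1' (by rw [h3, h3', h])
    omega
  have hsucc : ∀ C : Finset ℕ, (C.image (fun a => a + 1)).card = C.card := fun C => card_image_of_injective _ (add_left_injective 1)
  rcases erdos_szekeres _ g hinj u huc hu with ⟨C, hC, hcard, hmono⟩ | ⟨C, hC, hcard, hmono⟩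
  · have := Ff_lower hρ0 hwl hwl' (GW_mem hw).2.1 (GW_mem hw').2.1 y0 v0 (fun x => g (x - 1)) _ 0 0 ∅ (C.image fun a => a + 1) rfl (by simp) (by
        intro x hx
        obtain ⟨a, ha, rfl⟩ := mem_image.1 hx
        obtain ⟨h1, h2, h3, h4, h5⟩ := hg a (hC ha)
        simp only [Nat.add_sub_cancel]
        exact ⟨Nat.zero_le _, Nat.zero_le _, h1, h2, h3, h4, (h5 _ h2.le).symm⟩) (by
        intro x hx z hz hxz
        obtain ⟨a, ha, rfl⟩ := mem_image.1 hx
        obtain ⟨b, hb, rfl⟩ := mem_image.1 hz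
        exact hmono a ha b hb (by omega))
    rw [hsucc, hcard] at this
    simp only [vt, List.take_zero, List.drop_zero, walk] at this
    linarith
  · have hwr := GW_rev hE.odd w' hw'
    have hwlr := (mem_words.1 (GW_mem hwr).1).1
    have hvt : ∀ c ≤ l, vt (walk v0 w') w'.reverse c = vt v0 w' (l - c) := fun c hc => by
      unfold vt; rw [walk_rev_take (GW_odd hE hw') v0 (by omega), hwl']
    have hgd : ∀ c < l, gd w'.reverse c = gd w' (l - 1 - c) := fun c hc => by
      unfold gd; rw [getD_reverse (by omega), hwl']
    have := Ff_lower hρ0 hwl hwlr (GW_mem hw).2.1 (GW_mem hwr).2.1 y0 (walk v0 w') (fun x => l - 1 - g (x - 1)) _ 0 0 ∅ (C.image fun a => a + 1) rfl (by simp) (by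
        intro x hx
        obtain ⟨a, ha, rfl⟩ := mem_image.1 hx
        obtain ⟨h1, h2, h3, h4, h5⟩ := hg a (hC ha)
        simp only [Nat.add_sub_cancel]
        have e1 : l - 1 - (l - 1 - g a) = g a := by omega
        have e2 : l - (l - 1 - g a) = g a + 1 := by omega
        rw [hgd _ (by omega), hvt _ (by omega), e1, e2]
        refine ⟨Nat.zero_le _, Nat.zero_le _, h1, by omega, h3, ?_, (h5 _ (by omega)).symm⟩
        have h6 := gw'.step (g a) h2
        rw [← h3] at h6
        have := dvd_sub h4 h6
        rwa [sub_sub_sub_cancel_right] at this) (by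
        intro x hx z hz hxz
        obtain ⟨a, ha, rfl⟩ := mem_image.1 hx
        obtain ⟨b, hb, rfl⟩ := mem_image.1 hz
        have h1 := hmono a ha b hb (by omega)
        obtain ⟨_, h2, _⟩ := hg a (hC ha)
        obtain ⟨_, h3, _⟩ := hg b (hC hb)
        simp only [Nat.add_sub_cancel]
        omega)
    rw [hsucc, hcard] at this
    simp only [vt, List.take_zero, List.drop_zero, walk] at this
    linarith

lemma words_rev {k : ℕ} {w : List ℕ} (hw : w ∈ words P k) : w.reverse ∈ words P k := by
  rw [mem_words] at *; simpa using hw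

lemma sum_words_rev (k : ℕ) (G : List ℕ → ℝ) : ∑ w ∈ words P k, G w.reverse = ∑ w ∈ words P k, G w :=
  sum_bij' (fun w _ => w.reverse) (fun w _ => w.reverse) (fun w hw => words_rev hw) (fun w hw => words_rev hw) (by simp) (by simp) (by simp)

lemma BT_sum (hE : Env P Λ δ H0 ρ Hn l Bm) (hΛ0 : 0 ≤ Λ) {y0 v0 : ℤ} (hB : |y0 - v0| + 3 * l * Hn ≤ Bm) {u : ℕ} (hu : 0 < u) :
    (∑ w ∈ GW P l, ∑ w' ∈ GW P l, if u * u ≤ (BTs l (gd w) (gd w') (vt y0 w) (vt v0 w')).card then iw (w.toFinset ∪ w'.toFinset) else 0) * ρ ^ u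
      ≤ (2 * l * Hn + 2) * (3 * (Λ + 2 * l + 1)) ^ (2 * l) := by
  have hρ0 : 0 ≤ ρ := zero_le_one.trans hE.hρ1
  set c := Λ + 2 * l + 1 with hc
  set B : Finset ℤ := Finset.Icc (v0 - l * Hn) (v0 + l * Hn) with hBd
  have hHn : (0:ℤ) ≤ l * Hn := by positivity
  have hBc : (B.card : ℝ) = 2 * l * Hn + 1 := by
    rw [hBd, Int.card_Icc]
    have : ((v0 + l * Hn + 1 - (v0 - l * Hn)).toNat : ℤ) = 2 * l * Hn + 1 := by
      rw [Int.toNat_of_nonneg (by linarith)]; ring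
    exact_mod_cast this
  have hFn : ∀ (v : ℤ) (w w' : List ℕ), 0 ≤ Ff ρ ∅ y0 v w w' := fun v w w' => zero_le_one.trans (Ff_nonneg hρ0 _ ∅ y0 v w w' rfl)
  have U : ∀ v : ℤ, |y0 - v| + 2 * l * Hn ≤ Bm → ∑ w ∈ words P l, ∑ w' ∈ words P l, iw (w.toFinset ∪ w'.toFinset) * Ff ρ ∅ y0 v w w' ≤ (3 * c) ^ (2 * l) := by
    intro v hv
    have := Ff_upper hE hΛ0 hc _ l l ∅ y0 v rfl (by simp; omega) (by linarith)
    simpa [two_mul] using this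
  have step : ∀ w ∈ GW P l, ∀ w' ∈ GW P l, (if u * u ≤ (BTs l (gd w) (gd w') (vt y0 w) (vt v0 w')).card then iw (w.toFinset ∪ w'.toFinset) else 0) * ρ ^ u
      ≤ iw (w.toFinset ∪ w'.toFinset) * Ff ρ ∅ y0 v0 w w' + ∑ v ∈ B, iw (w.toFinset ∪ w'.toFinset) * Ff ρ ∅ y0 v w w'.reverse := by
    intro w hw w' hw'
    have hv : walk v0 w' ∈ B := by
      have h1 := walk_dist (fun p hp => hE.le p (GW_sub w' hw' p hp)) v0
      rw [(mem_words.1 (GW_mem hw').1).1, abs_le] at h1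
      rw [hBd, mem_Icc]; constructor <;> linarith [h1.1, h1.2]
    have h2 : iw (w.toFinset ∪ w'.toFinset) * Ff ρ ∅ y0 (walk v0 w') w w'.reverse ≤ ∑ v ∈ B, iw (w.toFinset ∪ w'.toFinset) * Ff ρ ∅ y0 v w w'.reverse :=
      single_le_sum (f := fun v => iw (w.toFinset ∪ w'.toFinset) * Ff ρ ∅ y0 v w w'.reverse) (fun v _ => mul_nonneg (iw_nonneg _) (hFn _ _ _)) hv
    have h3 := mul_nonneg (iw_nonneg (w.toFinset ∪ w'.toFinset)) (hFn v0 w w')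
    have h4 := mul_nonneg (iw_nonneg (w.toFinset ∪ w'.toFinset)) (hFn (walk v0 w') w w'.reverse)
    split_ifs with h
    · have := mul_le_mul_of_nonneg_left (BT_lower hE hw hw' y0 v0 hu h) (iw_nonneg (w.toFinset ∪ w'.toFinset))
      rw [mul_add] at this; linarith
    · rw [zero_mul]; linarith
  have pos : ∀ w w' : List ℕ, 0 ≤ iw (w.toFinset ∪ w'.toFinset) * Ff ρ ∅ y0 v0 w w' + ∑ v ∈ B, iw (w.toFinset ∪ w'.toFinset) * Ff ρ ∅ y0 v w w'.reverse :=
    fun w w' => add_nonneg (mul_nonneg (iw_nonneg _) (hFn _ _ _)) (sum_nonneg fun v _ => mul_nonneg (iw_nonneg _) (hFn _ _ _))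
  calc _ = ∑ w ∈ GW P l, ∑ w' ∈ GW P l, (if u * u ≤ (BTs l (gd w) (gd w') (vt y0 w) (vt v0 w')).card then iw (w.toFinset ∪ w'.toFinset) else 0) * ρ ^ u := by
        simp only [sum_mul]
    _ ≤ ∑ w ∈ GW P l, ∑ w' ∈ GW P l, (iw (w.toFinset ∪ w'.toFinset) * Ff ρ ∅ y0 v0 w w' + ∑ v ∈ B, iw (w.toFinset ∪ w'.toFinset) * Ff ρ ∅ y0 v w w'.reverse) :=
        sum_le_sum fun w hw => sum_le_sum fun w' hw' => step w hw w' hw'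
    _ ≤ ∑ w ∈ words P l, ∑ w' ∈ words P l, (iw (w.toFinset ∪ w'.toFinset) * Ff ρ ∅ y0 v0 w w' + ∑ v ∈ B, iw (w.toFinset ∪ w'.toFinset) * Ff ρ ∅ y0 v w w'.reverse) := by
        refine (sum_le_sum fun w _ => sum_le_sum_of_subset_of_nonneg (filter_subset _ _) fun w' _ _ => pos w w').trans ?_
        exact sum_le_sum_of_subset_of_nonneg (filter_subset _ _) fun w _ _ => sum_nonneg fun w' _ => pos w w'
    _ = ∑ w ∈ words P l, ∑ w' ∈ words P l, iw (w.toFinset ∪ w'.toFinset) * Ff ρ ∅ y0 v0 w w' +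
        ∑ v ∈ B, ∑ w ∈ words P l, ∑ w' ∈ words P l, iw (w.toFinset ∪ w'.toFinset) * Ff ρ ∅ y0 v w w' := by
        simp only [sum_add_distrib]
        congr 1
        rw [sum_comm' (s := B) (t' := words P l) (s' := fun _ => B) (t := fun _ => words P l) (by simp [and_comm])]
        refine sum_congr rfl fun w _ => ?_
        rw [sum_comm]
        refine sum_congr rfl fun v _ => ?_
        rw [← sum_words_rev]
        simp
    _ ≤ (3 * c) ^ (2 * l) + ∑ v ∈ B, (3 * c) ^ (2 * l) := by
        refine add_le_add (U v0 (by nlinarith)) (sum_le_sum fun v hv => U v ?_)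
        rw [hBd, mem_Icc] at hv
        have h1 : |y0 - v| ≤ |y0 - v0| + l * Hn := by
          have h2 : |v0 - v| ≤ l * Hn := by rw [abs_le]; constructor <;> linarith [hv.1, hv.2]
          have := abs_add_le (y0 - v0) (v0 - v)
          simp only [sub_add_sub_cancel] at this
          linarith
        linarith
    _ = _ := by rw [sum_const, nsmul_eq_mul, hBc]; ring

noncomputable def NCp (l : ℕ) (y0 v0 : ℤ) (w w' : List ℕ) : Finset ℕ := (NCs l (gd w) (gd w') (vt y0 w) (vt v0 w')).image (gd w)

lemma iw_le_one (D : Finset ℕ) : iw D ≤ 1 := prod_le_one (fun _ _ => by positivity) fun q _ => by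
  rcases Nat.eq_zero_or_pos q with rfl | h
  · simp
  · rw [div_le_one (by exact_mod_cast h)]; exact_mod_cast h

lemma pair_bound (hE : Env P Λ δ H0 ρ Hn l Bm) (hΛ0 : 0 ≤ Λ) {y0 v0 : ℤ} (hB : |y0 - v0| + 3 * l * Hn ≤ Bm) {u : ℕ} (hu : 0 < u) :
    (∑ w ∈ GW P l, ∑ w' ∈ GW P l, if ¬ FewP l (gd w) (gd w') (vt y0 w) (vt v0 w') (u * u) then iw (w.toFinset ∪ w'.toFinset) * iw (NCp l y0 v0 w w') else 0) * ρ ^ u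
      ≤ (2 * l * Hn + 4) * (3 * (Λ + 2 * l + 1)) ^ (2 * l) := by
  have hρ0 : 0 ≤ ρ := zero_le_one.trans hE.hρ1
  set c := Λ + 2 * l + 1 with hc
  have hl0 : (0:ℝ) ≤ l := by positivity
  have hc1 : 1 ≤ c := by rw [hc]; linarith
  have hHn : (0:ℤ) ≤ l * Hn := by positivity
  have hcc : c ^ (2 * l) ≤ (3 * c) ^ (2 * l) := pow_le_pow_left₀ (by linarith) (by linarith) _
  have huu : ρ ^ u ≤ ρ ^ (u * u) := pow_le_pow_right₀ hE.hρ1 (Nat.le_mul_self u)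
  set Q := fun w w' => u * u ≤ (ALs l (gd w) (gd w') (vt y0 w) (vt v0 w')).card ∨ u * u ≤ (E1s l (gd w) (gd w') (vt y0 w) (vt v0 w')).card with hQ
  have A := AE_sum hE hΛ0 (y0 := y0) (v0 := v0) (by linarith) (u * u) Q (fun w _ w' _ h => h)
  have Bt := BT_sum hE hΛ0 hB hu
  rw [← hc] at A Bt
  -- NC
  have N : (∑ w ∈ GW P l, ∑ w' ∈ GW P l, if u * u ≤ (NCs l (gd w) (gd w') (vt y0 w) (vt v0 w')).card then iw (w.toFinset ∪ w'.toFinset) * iw (NCp l y0 v0 w w') else 0) * ρ ^ (u * u) ≤ c ^ (2 * l) := by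
    have cr : ∑ w ∈ words P l, ∑ w' ∈ words P l, iw (w.toFinset ∪ w'.toFinset) ≤ c ^ (2 * l) := by
      have := crude (c := c) hE.sum hΛ0 (l + l) ∅ (by rw [hc]; push_cast; simp; linarith)
      rw [sum_words_add] at this
      simpa [two_mul, List.toFinset_append] using this
    refine le_trans ?_ cr
    simp only [sum_mul]
    calc _ ≤ ∑ w ∈ GW P l, ∑ w' ∈ GW P l, iw (w.toFinset ∪ w'.toFinset) := by
          refine sum_le_sum fun w hw => sum_le_sum fun w' hw' => ?_
          split_ifs with h
          · rw [mul_assoc]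
            refine mul_le_of_le_one_right (iw_nonneg _) ?_
            have hcard : (NCp l y0 v0 w w').card = (NCs l (gd w) (gd w') (vt y0 w) (vt v0 w')).card := by
              unfold NCp
              refine card_image_of_injOn fun a ha a' ha' h => ?_
              have h1 := mem_range.1 (mem_of_mem_filter _ ha)
              have h2 := mem_range.1 (mem_of_mem_filter _ ha')
              exact (GW_GP hE hw y0).inj a h1 a' h2 h
            have hpos : ∀ q ∈ NCp l y0 v0 w w', ρ ≤ q := by
              intro q hq
              obtain ⟨a, ha, rfl⟩ := mem_image.1 hq
              have h1 := mem_range.1 (mem_of_mem_filter _ ha)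
              refine hE.hρH.trans (hE.ge _ (GW_sub w hw _ ?_))
              unfold gd
              rw [List.getD_eq_getElem _ _ (by rw [(mem_words.1 (GW_mem hw).1).1]; exact h1)]; exact List.getElem_mem _
            have hle : iw (NCp l y0 v0 w w') ≤ (1 / ρ) ^ (NCp l y0 v0 w w').card := by
              unfold iw
              rw [← prod_const]
              refine prod_le_prod (fun _ _ => by positivity) fun q hq => ?_
              exact one_div_le_one_div_of_le (lt_of_lt_of_le one_pos hE.hρ1) (hpos q hq)
            have hle2 : (1 / ρ) ^ (NCp l y0 v0 w w').card ≤ (1 / ρ) ^ (u * u) := by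
              refine pow_le_pow_of_le_one (by positivity) ?_ (by rw [hcard]; exact h)
              rw [div_le_one (by linarith [hE.hρ1])]; exact hE.hρ1
            calc _ ≤ (1 / ρ) ^ (u * u) * ρ ^ (u * u) := mul_le_mul_of_nonneg_right (hle.trans hle2) (by positivity)
              _ = 1 := by rw [← mul_pow, one_div, inv_mul_cancel₀ (by linarith [hE.hρ1]), one_pow]
          · rw [zero_mul]; exact iw_nonneg _
      _ ≤ _ := by
          refine (sum_le_sum fun w _ => sum_le_sum_of_subset_of_nonneg (filter_subset _ _) fun w' _ _ => iw_nonneg _).trans ?_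
          exact sum_le_sum_of_subset_of_nonneg (filter_subset _ _) fun w _ _ => sum_nonneg fun w' _ => iw_nonneg _
  have key : ∀ w w', (if ¬ FewP l (gd w) (gd w') (vt y0 w) (vt v0 w') (u * u) then iw (w.toFinset ∪ w'.toFinset) * iw (NCp l y0 v0 w w') else 0)
      ≤ (if Q w w' then iw (w.toFinset ∪ w'.toFinset) else 0) + (if u * u ≤ (BTs l (gd w) (gd w') (vt y0 w) (vt v0 w')).card then iw (w.toFinset ∪ w'.toFinset) else 0)
        + (if u * u ≤ (NCs l (gd w) (gd w') (vt y0 w) (vt v0 w')).card then iw (w.toFinset ∪ w'.toFinset) * iw (NCp l y0 v0 w w') else 0) := by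
    intro w w'
    have h0 := iw_nonneg (w.toFinset ∪ w'.toFinset)
    have h1 := mul_nonneg h0 (iw_nonneg (NCp l y0 v0 w w'))
    have h2 : iw (w.toFinset ∪ w'.toFinset) * iw (NCp l y0 v0 w w') ≤ iw (w.toFinset ∪ w'.toFinset) := mul_le_of_le_one_right h0 (iw_le_one _)
    have e1 : 0 ≤ (if Q w w' then iw (w.toFinset ∪ w'.toFinset) else 0) := by split_ifs <;> first | exact h0 | exact le_rfl
    have e2 : 0 ≤ (if u * u ≤ (BTs l (gd w) (gd w') (vt y0 w) (vt v0 w')).card then iw (w.toFinset ∪ w'.toFinset) else 0) := by split_ifs <;> first | exact h0 | exact le_rfl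
    have e3 : 0 ≤ (if u * u ≤ (NCs l (gd w) (gd w') (vt y0 w) (vt v0 w')).card then iw (w.toFinset ∪ w'.toFinset) * iw (NCp l y0 v0 w w') else 0) := by split_ifs <;> first | exact h1 | exact le_rfl
    by_cases hF : FewP l (gd w) (gd w') (vt y0 w) (vt v0 w') (u * u)
    · rw [if_neg (not_not.2 hF)]; linarith
    · rw [if_pos hF]
      unfold FewP at hF
      by_cases c1 : Q w w'
      · rw [if_pos c1]; linarith
      by_cases c2 : u * u ≤ (BTs l (gd w) (gd w') (vt y0 w) (vt v0 w')).card
      · rw [if_pos c2]; linarith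
      by_cases c3 : u * u ≤ (NCs l (gd w) (gd w') (vt y0 w) (vt v0 w')).card
      · rw [if_pos c3]; linarith
      · exfalso; simp only [hQ, not_or, not_le] at c1; exact hF ⟨by omega, c1.1, c1.2, by omega⟩
  set S1 := ∑ w ∈ GW P l, ∑ w' ∈ GW P l, (if Q w w' then iw (w.toFinset ∪ w'.toFinset) else 0) with hS1
  set S2 := ∑ w ∈ GW P l, ∑ w' ∈ GW P l, (if u * u ≤ (BTs l (gd w) (gd w') (vt y0 w) (vt v0 w')).card then iw (w.toFinset ∪ w'.toFinset) else 0) with hS2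
  set S3 := ∑ w ∈ GW P l, ∑ w' ∈ GW P l, (if u * u ≤ (NCs l (gd w) (gd w') (vt y0 w) (vt v0 w')).card then iw (w.toFinset ∪ w'.toFinset) * iw (NCp l y0 v0 w w') else 0) with hS3
  have p1 : 0 ≤ S1 := sum_nonneg fun w _ => sum_nonneg fun w' _ => by split_ifs <;> first | exact iw_nonneg _ | exact le_rfl
  have p3 : 0 ≤ S3 := sum_nonneg fun w _ => sum_nonneg fun w' _ => by split_ifs <;> first | exact mul_nonneg (iw_nonneg _) (iw_nonneg _) | exact le_rfl
  have tot : (∑ w ∈ GW P l, ∑ w' ∈ GW P l, if ¬ FewP l (gd w) (gd w') (vt y0 w) (vt v0 w') (u * u) then iw (w.toFinset ∪ w'.toFinset) * iw (NCp l y0 v0 w w') else 0) ≤ S1 + S2 + S3 := by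
    rw [hS1, hS2, hS3]
    simp only [← sum_add_distrib]
    exact sum_le_sum fun w _ => sum_le_sum fun w' _ => key w w'
  have hρu : 0 ≤ ρ ^ u := by positivity
  calc _ ≤ (S1 + S2 + S3) * ρ ^ u := mul_le_mul_of_nonneg_right tot hρu
    _ = S1 * ρ ^ u + S2 * ρ ^ u + S3 * ρ ^ u := by ring
    _ ≤ S1 * ρ ^ (u * u) + S2 * ρ ^ u + S3 * ρ ^ (u * u) := by
        have := mul_le_mul_of_nonneg_left huu p1
        have := mul_le_mul_of_nonneg_left huu p3
        linarith
    _ ≤ _ := by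
        have A' : S1 * ρ ^ (u * u) ≤ c ^ (2 * l) := by
          refine le_trans (le_of_eq ?_) A
          rw [hS1]; congr!
        have e : (2 * (l:ℝ) * Hn + 4) * (3 * c) ^ (2 * l) = (2 * l * Hn + 2) * (3 * c) ^ (2 * l) + 2 * (3 * c) ^ (2 * l) := by ring
        rw [e]; linarith
end
end KK

set_option linter.all false
set_option linter.unusedVariables false
set_option linter.unusedSectionVars false
namespace KK
open Finset
open scoped Classical

section
variable {P : Finset ℕ} {Λ δ H0 ρ : ℝ} {Hn l : ℕ} {Bm : ℤ}

def bw (l : ℕ) (W : List ℕ) (i : ℕ) : List ℕ := (W.drop (i * l)).take l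
noncomputable def bst (π : ℤ) (l : ℕ) (W : List ℕ) (i : ℕ) : ℤ := walk π (W.take (i * l))
def FewAll (l M : ℕ) (π : ℤ) (t : ℕ) (W : List ℕ) : Prop := ∀ i < M, ∀ j < M, i ≠ j →
  FewP l (gd (bw l W i)) (gd (bw l W j)) (vt (bst π l W i) (bw l W i)) (vt (bst π l W j) (bw l W j)) t

lemma blk_mem {M : ℕ} {W : List ℕ} (h : W ∈ blk P l M) : W.length = M * l ∧ (∀ p ∈ W, p ∈ P) ∧ ∀ i < M, bw l W i ∈ GW P l := by
  unfold blk at h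
  rw [mem_filter, mem_words] at h
  refine ⟨h.1.1, h.1.2, fun i hi => ?_⟩
  unfold GW
  rw [mem_filter, mem_words]
  have hle : (i + 1) * l ≤ M * l := Nat.mul_le_mul_right _ hi
  refine ⟨⟨?_, ?_⟩, h.2 i hi⟩
  · unfold bw
    rw [List.length_take, List.length_drop, h.1.1]
    have : (i+1) * l = i * l + l := by ring
    omega
  · intro p hp
    exact h.1.2 p (List.mem_of_mem_drop (List.mem_of_mem_take hp))

lemma gd_bw (W : List ℕ) (i : ℕ) {a : ℕ} (ha : a < l) : gd (bw l W i) a = W.getD (i * l + a) 0 := by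
  unfold gd bw
  simp [List.getD_eq_getElem?_getD, List.getElem?_take, List.getElem?_drop, ha]

lemma vt_bw (π : ℤ) (W : List ℕ) (i : ℕ) {c : ℕ} (hc : c ≤ l) : vt (bst π l W i) (bw l W i) c = walk π (W.take (i * l + c)) := by
  unfold vt bst bw
  rw [List.take_take, min_eq_left hc, ← walk_append, List.take_add]

lemma idx_split {M k : ℕ} (hk : k < M * l) : k / l < M ∧ k % l < l ∧ (k / l) * l + k % l = k := by
  have hl : 0 < l := Nat.pos_of_ne_zero fun h => by subst h; simp at hk
  exact ⟨(Nat.div_lt_iff_lt_mul hl).2 hk, Nat.mod_lt _ hl, Nat.div_add_mod' k l⟩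

/-- non-break predicate -/
def nbk (h : List ℕ) (p : ℕ) : Prop :=
  (h.idxOf (h.getD (h.length - 1) 0) = h.length - 1 ∧ p ∉ h) ∨
  (h.idxOf (h.getD (h.length - 1) 0) ≠ h.length - 1 ∧
    (p = h.getD (h.idxOf (h.getD (h.length - 1) 0) + 1) 0 ∨ p = h.getD (h.idxOf (h.getD (h.length - 1) 0) - 1) 0))
noncomputable def gf1 (Λ : ℝ) (h : List ℕ) (p : ℕ) : ℝ := if p ∈ h then 1 else 1 / ((p:ℝ) * Λ)
noncomputable def gf2 (κ : ℝ) (h : List ℕ) (p : ℕ) : ℝ := if nbk h p then 1 else κ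

lemma hp_mul (g g' : List ℕ → ℕ → ℝ) (h w : List ℕ) : hp (fun h p => g h p * g' h p) h w = hp g h w * hp g' h w := by
  rw [hp_eq, hp_eq, hp_eq, prod_mul_distrib]

lemma hp_gf1 (hΛ : 0 < Λ) (h w : List ℕ) :
    hp (gf1 Λ) h w = iw (w.toFinset \ h.toFinset) * (1 / Λ) ^ (w.toFinset \ h.toFinset).card := by
  induction w generalizing h with
  | nil => simp [hp, iw]
  | cons p w ih =>
    have e : (h ++ [p]).toFinset = insert p h.toFinset := by ext; simp [or_comm]
    rw [hp, ih, e, List.toFinset_cons]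
    unfold gf1
    split_ifs with hm
    · have hm' : p ∈ h.toFinset := by simpa using hm
      rw [one_mul, insert_sdiff_of_mem _ hm', insert_eq_of_mem hm']
    · have hm' : p ∉ h.toFinset := by simpa using hm
      rw [insert_sdiff_of_notMem _ hm']
      have e2 : insert p (w.toFinset \ h.toFinset) = insert p (w.toFinset \ insert p h.toFinset) := by
        ext x; by_cases hx : x = p <;> simp [hx]
      rw [e2]
      have hn : p ∉ w.toFinset \ insert p h.toFinset := by simp
      rw [card_insert_of_notMem hn]
      unfold iw
      rw [prod_insert hn, pow_succ]
      field_simp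

lemma sum_gf (hΛ : ∑ p ∈ P, 1 / (p:ℝ) ≤ Λ) (hΛ0 : 0 < Λ) (V : ℕ) (h : List ℕ) (hV : h.length < V) :
    ∑ p ∈ P, gf1 Λ h p * gf2 (1 / (1 + V)) h p ≤ 4 := by
  have hκ : (0:ℝ) < 1 / (1 + V) := by positivity
  have hκ1 : (1:ℝ) / (1 + V) ≤ 1 := by rw [div_le_one (by positivity)]; linarith [(Nat.cast_nonneg V : (0:ℝ) ≤ V)]
  set A := h.getD (h.idxOf (h.getD (h.length - 1) 0) + 1) 0
  set B := h.getD (h.idxOf (h.getD (h.length - 1) 0) - 1) 0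
  have key : ∀ p ∈ P, gf1 Λ h p * gf2 (1 / (1 + V)) h p ≤ 1 / (p:ℝ) * (1 / Λ) + (if p ∈ h.toFinset then 1 / (1 + (V:ℝ)) else 0) + (if p = A then 1 else 0) + (if p = B then 1 else 0) := by
    intro p _
    have h0 : (0:ℝ) ≤ 1 / (p:ℝ) * (1 / Λ) := by positivity
    have hA : (0:ℝ) ≤ (if p = A then 1 else 0) := by split_ifs <;> norm_num
    have hB : (0:ℝ) ≤ (if p = B then 1 else 0) := by split_ifs <;> norm_num
    have h2 : gf2 (1 / (1 + V)) h p ≤ 1 := by unfold gf2; split_ifs <;> [exact le_rfl; exact hκ1]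
    by_cases hm : p ∈ h
    · have e1 : gf1 Λ h p = 1 := by unfold gf1; rw [if_pos hm]
      rw [e1, one_mul, if_pos (by simpa using hm)]
      unfold gf2
      split_ifs with hn hA' hB'
      all_goals try linarith
      unfold nbk at hn
      rcases hn with hn | hn
      · exact absurd hm hn.2
      · rcases hn.2 with h' | h'
        · exact absurd h' hA'
        · exact absurd h' (by assumption)
    · have e1 : gf1 Λ h p = 1 / (p:ℝ) * (1 / Λ) := by unfold gf1; rw [if_neg hm]; rw [div_mul_div_comm, one_mul]
      rw [e1, if_neg (by simpa using hm)]
      have := mul_le_mul_of_nonneg_left h2 h0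
      linarith
  refine (sum_le_sum key).trans ?_
  rw [sum_add_distrib, sum_add_distrib, sum_add_distrib, ← sum_mul]
  have s1 : (∑ p ∈ P, 1 / (p:ℝ)) * (1 / Λ) ≤ 1 := by
    rw [mul_one_div, div_le_one hΛ0]; exact hΛ
  have s2 : ∑ p ∈ P, (if p ∈ h.toFinset then 1 / (1 + (V:ℝ)) else 0) ≤ 1 := by
    rw [← sum_filter, sum_const, nsmul_eq_mul, mul_one_div, div_le_one (by positivity)]
    have : ((P.filter fun p => p ∈ h.toFinset).card : ℝ) ≤ V := by
      exact_mod_cast ((card_le_card fun x hx => (mem_filter.1 hx).2).trans (List.toFinset_card_le h)).trans hV.le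
    linarith
  have s3 : ∀ A : ℕ, ∑ p ∈ P, (if p = A then (1:ℝ) else 0) ≤ 1 := fun A => by
    rw [sum_ite_eq']; split_ifs <;> norm_num
  linarith [s3 A, s3 B]

/-- breaks of W -/
noncomputable def brk (W : List ℕ) : Finset ℕ := (range W.length).filter fun k => ¬ nbk (W.take k) (W.getD k 0)

lemma hp_gf2 (V : ℕ) (W : List ℕ) : hp (gf2 (1 / (1 + V))) [] W = (1 / (1 + (V:ℝ))) ^ (brk W).card := by
  rw [hp_eq]
  simp only [List.nil_append, gf2]
  rw [prod_ite]
  simp [brk]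

lemma few_count (hΛ : ∑ p ∈ P, 1 / (p:ℝ) ≤ Λ) (hΛ0 : 0 < Λ) (V E : ℕ) (Q : Finset (List ℕ)) (hQ : Q ⊆ words P V)
    (hE : ∀ W ∈ Q, (brk W).card ≤ E) :
    ∑ W ∈ Q, iw W.toFinset * (1 / Λ) ^ W.toFinset.card ≤ 4 ^ V * (1 + (V:ℝ)) ^ E := by
  have hs := seqsum P (g := fun h p => gf1 Λ h p * gf2 (1 / (1 + V)) h p) (c := 4) V (fun h p => by
    unfold gf1 gf2; split_ifs <;> positivity) (by norm_num) V [] (by simp) (by simp) (fun h _ hV => sum_gf hΛ hΛ0 V h hV)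
  have h1 : (1:ℝ) ≤ 1 + V := by linarith [(Nat.cast_nonneg V : (0:ℝ) ≤ V)]
  calc ∑ W ∈ Q, iw W.toFinset * (1 / Λ) ^ W.toFinset.card
      ≤ ∑ W ∈ Q, hp (fun h p => gf1 Λ h p * gf2 (1 / (1 + V)) h p) [] W * (1 + (V:ℝ)) ^ E := by
        refine sum_le_sum fun W hW => ?_
        rw [hp_mul, hp_gf1 hΛ0, hp_gf2, List.toFinset_nil, sdiff_empty, mul_assoc]
        refine le_mul_of_one_le_right (mul_nonneg (iw_nonneg _) (by positivity)) ?_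
        rw [one_div, inv_pow, inv_mul_eq_div, one_le_div (by positivity)]
        exact pow_le_pow_right₀ h1 (hE W hW)
    _ = (∑ W ∈ Q, hp (fun h p => gf1 Λ h p * gf2 (1 / (1 + V)) h p) [] W) * (1 + (V:ℝ)) ^ E := by rw [sum_mul]
    _ ≤ _ := by
        refine mul_le_mul_of_nonneg_right (le_trans ?_ hs) (by positivity)
        refine sum_le_sum_of_subset_of_nonneg hQ fun W _ _ => hp_nonneg (fun h p => by
          unfold gf1 gf2; split_ifs <;> positivity) _ _
end
end KK

set_option linter.all false
set_option linter.unusedVariables false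
set_option linter.unusedSectionVars false
namespace KK
open Finset
open scoped Classical

section
variable {P : Finset ℕ} {Λ δ H0 ρ : ℝ} {Hn l : ℕ} {Bm : ℤ}

lemma getD_take_lt {W : List ℕ} {k j : ℕ} (h : j < k) : (W.take k).getD j 0 = W.getD j 0 := by
  simp [List.getD_eq_getElem?_getD, List.getElem?_take, h]

lemma getD_inj_block (hE : Env P Λ δ H0 ρ Hn l Bm) {M : ℕ} {W : List ℕ} (hW : W ∈ blk P l M) {i a a' : ℕ} (hi : i < M)
    (ha : a < l) (ha' : a' < l) (h : W.getD (i * l + a) 0 = W.getD (i * l + a') 0) : a = a' := by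
  have := GW_GP hE ((blk_mem hW).2.2 i hi) 0
  exact this.inj a ha a' ha' (by rw [gd_bw W i ha, gd_bw W i ha', h])

lemma inq_bw (W : List ℕ) (i j : ℕ) {a : ℕ} (ha : a < l) :
    inq l (gd (bw l W i)) (gd (bw l W j)) a ↔ ∃ b < l, W.getD (i * l + a) 0 = W.getD (j * l + b) 0 := by
  unfold inq
  constructor
  · rintro ⟨b, hb, h⟩; exact ⟨b, hb, by rwa [gd_bw W i ha, gd_bw W j hb] at h⟩
  · rintro ⟨b, hb, h⟩; exact ⟨b, hb, by rwa [gd_bw W i ha, gd_bw W j hb]⟩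

lemma brk_sub (hE : Env P Λ δ H0 ρ Hn l Bm) {M : ℕ} {W : List ℕ} (hW : W ∈ blk P l M) :
    brk W ⊆ (range M).image (fun i => i * l) ∪ ((range M ×ˢ range M).filter fun ij => ij.1 ≠ ij.2).biUnion fun ij =>
      (T1s l (gd (bw l W ij.1)) (gd (bw l W ij.2)) ∪ T2s l (gd (bw l W ij.1)) (gd (bw l W ij.2)) ∪ T3s l (gd (bw l W ij.1)) (gd (bw l W ij.2))).image fun a => ij.1 * l + a + 1 := by
  intro k hk
  obtain ⟨hWl, hWP, hG⟩ := blk_mem hW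
  unfold brk at hk
  rw [mem_filter, mem_range, hWl] at hk
  obtain ⟨hkl, hn⟩ := hk
  obtain ⟨hi, ha0, hka⟩ := idx_split hkl
  set i := k / l
  rcases Nat.eq_zero_or_pos (k % l) with h0 | h0
  · refine mem_union_left _ (mem_image.2 ⟨i, mem_range.2 hi, by omega⟩)
  obtain ⟨a, ha⟩ : ∃ a, k % l = a + 1 := ⟨k % l - 1, by omega⟩
  have hal : a + 1 < l := by omega
  have hk1 : k = i * l + (a + 1) := by omega
  refine mem_union_right _ ?_
  have hlen : (W.take k).length = k := by rw [List.length_take]; omega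
  have hkpos : 0 < k := by omega
  set h := W.take k with hh
  have hz : h.getD (h.length - 1) 0 = W.getD (k - 1) 0 := by rw [hlen, hh, getD_take_lt (by omega)]
  unfold nbk at hn
  rw [hz, hlen] at hn
  have hk2 : k - 1 = i * l + a := by omega
  set zz := W.getD (k - 1) 0 with hzz
  have hmem : zz ∈ h := by
    rw [← hz, List.getD_eq_getElem _ _ (by omega)]; exact List.getElem_mem _
  set b := h.idxOf zz with hb
  have hbk : b < k := by rw [← hlen]; exact List.idxOf_lt_length_of_mem hmem
  have hWb : W.getD b 0 = zz := by
    rw [← getD_take_lt hbk, List.getD_eq_getElem _ _ (by rw [hlen]; exact hbk)]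
    exact List.getElem_idxOf _
  have hmin : ∀ k' < b, W.getD k' 0 ≠ zz := by
    intro k' hk' he
    have h1 : h.getD k' 0 = zz := by rw [hh, getD_take_lt (by omega)]; exact he
    have : h.idxOf zz ≤ k' := by
      by_contra hlt
      push Not at hlt
      have := List.not_of_lt_findIdx (p := (· == zz)) (xs := h) (i := k') (by simpa [List.idxOf] using hlt)
      rw [List.getD_eq_getElem _ _ (by omega)] at h1
      simp [h1] at this
    omega
  rw [mem_biUnion]
  by_cases hbe : b = k - 1
  · have hp : W.getD k 0 ∈ h := by
      by_contra hp; exact hn (Or.inl ⟨hbe, hp⟩)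
    obtain ⟨k', hk', hpk⟩ := List.mem_iff_getElem.1 hp
    rw [← List.getD_eq_getElem _ 0 hk'] at hpk
    rw [hlen] at hk'
    rw [hh, getD_take_lt hk'] at hpk
    obtain ⟨hj, hb1, hkb⟩ := idx_split (show k' < M * l by omega)
    set j := k' / l
    have hji : i ≠ j := by
      intro hij
      rw [← hkb, ← hij, hk1] at hpk
      have := getD_inj_block hE hW hi hb1 hal hpk
      rw [← hij] at hkb
      omega
    refine ⟨(i, j), mem_filter.2 ⟨mem_product.2 ⟨mem_range.2 hi, mem_range.2 hj⟩, hji⟩, mem_image.2 ⟨a, ?_, by simp only; omega⟩⟩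
    refine mem_union_left _ (mem_union_left _ ?_)
    unfold T1s
    rw [mem_filter, mem_range]
    refine ⟨by omega, hal, ?_, ?_⟩
    · rw [inq_bw _ _ _ (by omega)]
      rintro ⟨b2, hb2, he⟩
      have hjlt : j < i := lt_of_le_of_ne (Nat.div_le_div_right hk'.le) (Ne.symm hji)
      have : (j + 1) * l ≤ i * l := Nat.mul_le_mul_right _ hjlt
      have : (j + 1) * l = j * l + l := by ring
      exact hmin (j * l + b2) (by omega) (by rw [← he, hzz, hk2])
    · rw [inq_bw _ _ _ hal]
      exact ⟨k' % l, hb1, by rw [← hk1, hkb, hpk]⟩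
  · obtain ⟨hj, hb1, hkb⟩ := idx_split (show b < M * l by omega)
    set j := b / l
    have hji : i ≠ j := by
      intro hij
      rw [← hkb, ← hij, hzz, hk2] at hWb
      have := getD_inj_block hE hW hi hb1 (by omega) hWb
      rw [← hij] at hkb
      omega
    have hn1 : W.getD k 0 ≠ W.getD (b + 1) 0 := fun he => hn (Or.inr ⟨hbe, Or.inl (by rw [hh, getD_take_lt (by omega)]; exact he)⟩)
    have hn2 : W.getD k 0 ≠ W.getD (b - 1) 0 := fun he => hn (Or.inr ⟨hbe, Or.inr (by rw [hh, getD_take_lt (by omega)]; exact he)⟩)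
    refine ⟨(i, j), mem_filter.2 ⟨mem_product.2 ⟨mem_range.2 hi, mem_range.2 hj⟩, hji⟩, mem_image.2 ⟨a, ?_, by simp only; omega⟩⟩
    have hza : W.getD (i * l + a) 0 = W.getD (j * l + b % l) 0 := by rw [hkb, hWb, ← hk2]
    by_cases hq : inq l (gd (bw l W i)) (gd (bw l W j)) (a + 1)
    · refine mem_union_right _ ?_
      have hq' := (inq_bw _ _ _ hal).1 hq
      obtain ⟨b2, hb2, he⟩ := hq'
      unfold T3s
      rw [mem_filter, mem_range]
      rw [← hk1] at he
      refine ⟨by omega, hal, b2, hb2, b % l, hb1, ?_, ?_, ?_⟩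
      · rw [gd_bw _ _ hal, gd_bw _ _ hb2, ← hk1, he]
      · rw [gd_bw _ _ (by omega), gd_bw _ _ hb1, hza]
      · have c1 : b2 ≠ b % l := by
          rintro rfl
          rw [hkb, hWb, hzz, hk2, hk1] at he
          have := getD_inj_block hE hW hi hal (by omega) he
          omega
        have c2 : b2 ≠ b % l + 1 := by
          intro hc; rw [hc, ← add_assoc, hkb] at he; exact hn1 he
        have c3 : b2 + 1 ≠ b % l := by
          intro hc
          have : j * l + b2 = b - 1 := by omega
          rw [this] at he; exact hn2 he
        omega
    · refine mem_union_left _ (mem_union_right _ ?_)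
      unfold T2s
      rw [mem_filter, mem_range]
      exact ⟨by omega, hal, (inq_bw _ _ _ (by omega)).2 ⟨b % l, hb1, hza⟩, hq⟩

lemma brk_le (hE : Env P Λ δ H0 ρ Hn l Bm) {M : ℕ} {W : List ℕ} (hW : W ∈ blk P l M) {π : ℤ} {t : ℕ} (hF : FewAll l M π t W) :
    (brk W).card ≤ M + M * M * (1 + 7 * t) := by
  refine (card_le_card (brk_sub hE hW)).trans ((card_union_le _ _).trans (add_le_add (card_image_le.trans (card_range M).le) ?_))
  refine (card_biUnion_le_card_mul _ _ (1 + 7 * t) ?_).trans (Nat.mul_le_mul_right _ ?_)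
  · rintro ⟨i, j⟩ hij
    rw [mem_filter, mem_product, mem_range, mem_range] at hij
    obtain ⟨h1, h2, h3, h4⟩ := hF i hij.1.1 j hij.1.2 hij.2
    refine card_image_le.trans ((card_union_le _ _).trans ?_)
    have := card_union_le (T1s l (gd (bw l W i)) (gd (bw l W j))) (T2s l (gd (bw l W i)) (gd (bw l W j)))
    have t1 := T1_le (l := l) (p := gd (bw l W i)) (q := gd (bw l W j)) (y := vt (bst π l W i) (bw l W i)) (v := vt (bst π l W j) (bw l W j))
    have t2 := T2_le (l := l) (p := gd (bw l W i)) (q := gd (bw l W j))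
    have t3 := T3_le (l := l) (p := gd (bw l W i)) (q := gd (bw l W j)) (y := vt (bst π l W i) (bw l W i)) (v := vt (bst π l W j) (bw l W j))
    simp only at *
    omega
  · refine (card_filter_le _ _).trans ?_
    rw [card_product, card_range]
end
end KK

set_option linter.all false
set_option linter.unusedVariables false
set_option linter.unusedSectionVars false
namespace KK
open Finset
open scoped Classical

section
variable {P : Finset ℕ} {Λ δ H0 ρ : ℝ} {Hn l : ℕ} {Bm : ℤ}

noncomputable def xW (W : List ℕ) (V : ℕ) (k : Fin V) : ℕ := W.getD k 0
noncomputable def uW (π : ℤ) (W : List ℕ) (V : ℕ) (k : Fin V) : ℤ := sgn π * alt (W.take k)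
noncomputable def vW (π : ℤ) (W : List ℕ) (V : ℕ) (k : Fin V) : ℤ := sgn π * alt (W.take (k + 1))

lemma odd_take {W : List ℕ} (h : ∀ p ∈ W, Odd p) (k : ℕ) : ∀ p ∈ W.take k, Odd p := fun p hp => h p (List.mem_of_mem_take hp)

lemma uW_eq {W : List ℕ} (h : ∀ p ∈ W, Odd p) (π : ℤ) {V : ℕ} (k : Fin V) : walk π (W.take k) = π + uW π W V k := walk_eq (odd_take h k) π
lemma vW_eq {W : List ℕ} (h : ∀ p ∈ W, Odd p) (π : ℤ) {V : ℕ} (k : Fin V) : walk π (W.take (k+1)) = π + vW π W V k := walk_eq (odd_take h (k+1)) π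

lemma image_xW {W : List ℕ} {V : ℕ} (h : W.length = V) : univ.image (xW W V) = W.toFinset := by
  ext q
  simp only [mem_image, mem_univ, true_and, xW, List.mem_toFinset, List.mem_iff_getElem]
  constructor
  · rintro ⟨k, rfl⟩
    exact ⟨k, by omega, by rw [List.getD_eq_getElem _ _ (by omega)]⟩
  · rintro ⟨k, hk, rfl⟩
    exact ⟨⟨k, by omega⟩, by rw [List.getD_eq_getElem _ _ (by simpa using hk)]⟩

/-- position congruence facts for a single prime outside all echoes -/
lemma single_pos (hE : Env P Λ δ H0 ρ Hn l Bm) {M : ℕ} {W : List ℕ} (hW : W ∈ blk P l M) (π : ℤ) {i a : ℕ} (hi : i < M) (ha : a < l)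
    (huq : ∀ k' < M * l, W.getD k' 0 = W.getD (i * l + a) 0 → k' = i * l + a)
    (hec : ∀ j < M, i ≠ j → a ∉ Echo l (gd (bw l W i)) (gd (bw l W j)) (vt (bst π l W i) (bw l W i)) (vt (bst π l W j) (bw l W j)))
    {j c : ℕ} (hj : j < M) (hc : c ≤ l) (hd : ((W.getD (i * l + a) 0 : ℕ) : ℤ) ∣ walk π (W.take (j * l + c)) - walk π (W.take (i * l + a))) :
    j * l + c = i * l + a ∨ j * l + c = i * l + a + 1 := by
  by_cases hij : i = j
  · subst hij
    have g := GW_GP hE ((blk_mem hW).2.2 i hi) (bst π l W i)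
    have := g.good a ha c hc (by rwa [gd_bw _ _ ha, vt_bw _ _ _ hc, vt_bw _ _ _ ha.le])
    omega
  · exfalso
    refine hec j hj hij ?_
    unfold Echo
    rw [mem_filter, mem_range]
    refine ⟨ha, ?_, c, hc, ?_⟩
    · rw [inq_bw _ _ _ ha]
      rintro ⟨b, hb, he⟩
      have h1 : (j+1) * l ≤ M * l := Nat.mul_le_mul_right _ hj
      have h2 : (j+1) * l = j * l + l := by ring
      have h3 := huq (j * l + b) (by omega) he.symm
      rcases lt_or_gt_of_ne hij with h | h
      · have : (i+1) * l ≤ j * l := Nat.mul_le_mul_right _ h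
        have h4 : (i+1) * l = i * l + l := by ring
        omega
      · have : (j+1) * l ≤ i * l := Nat.mul_le_mul_right _ h
        omega
    · rw [gd_bw _ _ ha, vt_bw _ _ _ hc, vt_bw _ _ _ ha.le, ← dvd_neg, neg_sub]; exact hd

lemma single_Nq (hE : Env P Λ δ H0 ρ Hn l Bm) {M : ℕ} {W : List ℕ} (hW : W ∈ blk P l M) (π : ℤ) {i a : ℕ} (hi : i < M) (ha : a < l)
    (huq : ∀ k' < M * l, W.getD k' 0 = W.getD (i * l + a) 0 → k' = i * l + a)
    (hec : ∀ j < M, i ≠ j → a ∉ Echo l (gd (bw l W i)) (gd (bw l W j)) (vt (bst π l W i) (bw l W i)) (vt (bst π l W j) (bw l W j)))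
    (k : Fin (M * l)) (hk : (k:ℕ) = i * l + a) :
    Nq (uW π W (M * l)) (vW π W (M * l)) (W.getD (i * l + a) 0) (- uW π W (M * l) k) ≤ 4 := by
  obtain ⟨hWl, hWP, hG⟩ := blk_mem hW
  have hodd : ∀ p ∈ W, Odd p := fun p hp => hE.odd p (hWP p hp)
  unfold Nq
  have c1 : (univ.filter fun k' => ((W.getD (i * l + a) 0 : ℕ):ℤ) ∣ - uW π W (M * l) k + uW π W (M * l) k').card ≤ 2 := by
    have : ((univ.filter fun k' => ((W.getD (i * l + a) 0 : ℕ):ℤ) ∣ - uW π W (M * l) k + uW π W (M * l) k').image fun k' : Fin (M*l) => (k':ℕ)) ⊆ {i * l + a, i * l + a + 1} := by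
      intro m hm
      obtain ⟨k', hk', rfl⟩ := mem_image.1 hm
      rw [mem_filter] at hk'
      obtain ⟨h1, h2, h3⟩ := idx_split k'.2
      have := single_pos hE hW π hi ha huq hec h1 h2.le (by
        rw [h3, ← hk, uW_eq hodd, uW_eq hodd]
        have e : π + uW π W (M * l) k' - (π + uW π W (M * l) k) = - uW π W (M * l) k + uW π W (M * l) k' := by ring
        rw [e, hk]; exact hk'.2)
      rw [h3] at this
      simp only [mem_insert, mem_singleton]; exact this
    rw [← card_image_of_injective _ Fin.val_injective]
    exact (card_le_card this).trans card_le_two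
  have c2 : (univ.filter fun k' => ((W.getD (i * l + a) 0 : ℕ):ℤ) ∣ - uW π W (M * l) k + vW π W (M * l) k').card ≤ 2 := by
    have : ((univ.filter fun k' => ((W.getD (i * l + a) 0 : ℕ):ℤ) ∣ - uW π W (M * l) k + vW π W (M * l) k').image fun k' : Fin (M*l) => (k':ℕ) + 1) ⊆ {i * l + a, i * l + a + 1} := by
      intro m hm
      obtain ⟨k', hk', rfl⟩ := mem_image.1 hm
      rw [mem_filter] at hk'
      obtain ⟨h1, h2, h3⟩ := idx_split k'.2
      have := single_pos hE hW π hi ha huq hec (c := (k':ℕ) % l + 1) h1 (by omega) (by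
        rw [← add_assoc, h3, ← hk, uW_eq hodd, vW_eq hodd]
        have e : π + vW π W (M * l) k' - (π + uW π W (M * l) k) = - uW π W (M * l) k + vW π W (M * l) k' := by ring
        rw [e, hk]; exact hk'.2)
      rw [← add_assoc, h3] at this
      simp only [mem_insert, mem_singleton]; exact this
    rw [← card_image_of_injective _ (f := fun k' : Fin (M*l) => (k':ℕ) + 1) (fun x y h => Fin.ext (by simpa using h))]
    exact (card_le_card this).trans card_le_two
  omega

lemma two_card (W : List ℕ) : 2 * W.toFinset.card ≤ W.length + (W.toFinset.filter fun q => W.count q = 1).card := by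
  have h := List.sum_toFinset_count_eq_length W
  rw [← h, card_filter, ← sum_add_distrib, mul_comm, ← smul_eq_mul, ← sum_const]
  refine sum_le_sum fun q hq => ?_
  have : 0 < W.count q := List.count_pos_iff.2 (by simpa using hq)
  split_ifs <;> omega

lemma count_one_uniq {W : List ℕ} {q k k' : ℕ} (hc : W.count q = 1) (hk : k < W.length) (hk' : k' < W.length)
    (h : W.getD k 0 = q) (h' : W.getD k' 0 = q) : k' = k := by
  by_contra hne
  wlog hlt : k < k' generalizing k k'
  · exact this hk' hk h' h (fun e => hne e.symm) (by omega)
  have h1 : q ∈ W.take (k+1) := by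
    rw [take_succ_getD hk, h]; simp
  have h2 : q ∈ W.drop (k+1) := by
    rw [List.mem_iff_getElem]
    refine ⟨k' - (k+1), by rw [List.length_drop]; omega, ?_⟩
    rw [List.getElem_drop]
    rw [List.getD_eq_getElem _ _ hk'] at h'
    rw [← h']; congr 1; omega
  have : W.count q = (W.take (k+1)).count q + (W.drop (k+1)).count q := by
    rw [← List.count_append, List.take_append_drop]
  have := List.count_pos_iff.2 h1
  have := List.count_pos_iff.2 h2
  omega

lemma few_S (hE : Env P Λ δ H0 ρ Hn l Bm) {M : ℕ} {W : List ℕ} (hW : W ∈ blk P l M) {π : ℤ} {t : ℕ} (hF : FewAll l M π t W) :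
    ∃ S : Finset ℕ, (∀ q ∈ S, ∃ k, xW W (M * l) k = q ∧ (∀ k', xW W (M * l) k' = q → k' = k) ∧ Nq (uW π W (M * l)) (vW π W (M * l)) q (- uW π W (M * l) k) ≤ 4) ∧
      2 * W.toFinset.card ≤ M * l + 2 * S.card + 2 * (M * M * (2 + 4 * t)) := by
  obtain ⟨hWl, hWP, hG⟩ := blk_mem hW
  set D1 := W.toFinset.filter fun q => W.count q = 1 with hD1
  set Bd := ((range M ×ˢ range M).filter fun ij => ij.1 ≠ ij.2).biUnion fun ij =>
      (Echo l (gd (bw l W ij.1)) (gd (bw l W ij.2)) (vt (bst π l W ij.1) (bw l W ij.1)) (vt (bst π l W ij.2) (bw l W ij.2))).image fun a => W.getD (ij.1 * l + a) 0 with hBd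
  refine ⟨D1 \ Bd, ?_, ?_⟩
  · intro q hq
    rw [mem_sdiff, hD1, mem_filter] at hq
    obtain ⟨⟨hqW, hqc⟩, hqB⟩ := hq
    obtain ⟨k, hk, hkq⟩ := List.mem_iff_getElem.1 (List.mem_toFinset.1 hqW)
    rw [← List.getD_eq_getElem _ 0 hk] at hkq
    have hk' : k < M * l := by omega
    obtain ⟨h1, h2, h3⟩ := idx_split hk'
    refine ⟨⟨k, hk'⟩, hkq, fun k' hk'q => Fin.ext (count_one_uniq hqc hk (by rw [hWl]; exact k'.2) hkq hk'q), ?_⟩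
    have := single_Nq hE hW π (i := k / l) (a := k % l) h1 h2 (fun k' hk2 he => by
        rw [h3] at he ⊢
        exact count_one_uniq hqc hk (by omega) hkq (by rw [he, hkq])) (fun j hj hij hec => by
        refine hqB (mem_biUnion.2 ⟨(k / l, j), mem_filter.2 ⟨mem_product.2 ⟨mem_range.2 h1, mem_range.2 hj⟩, hij⟩, mem_image.2 ⟨k % l, hec, ?_⟩⟩)
        simp only [h3, hkq]) ⟨k, hk'⟩ (by simp only [h3])
    rwa [h3, hkq] at this
  · have hB : Bd.card ≤ M * M * (2 + 4 * t) := by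
      refine (card_biUnion_le_card_mul _ _ (2 + 4 * t) ?_).trans (Nat.mul_le_mul_right _ ?_)
      · rintro ⟨i, j⟩ hij
        rw [mem_filter, mem_product, mem_range, mem_range] at hij
        obtain ⟨h1, h2, h3, h4⟩ := hF i hij.1.1 j hij.1.2 hij.2
        refine card_image_le.trans ?_
        have := Echo_le (l := l) (p := gd (bw l W i)) (q := gd (bw l W j)) (y := vt (bst π l W i) (bw l W i)) (v := vt (bst π l W j) (bw l W j)) (GW_GP hE (hG i hij.1.1) _)
        simp only at *
        omega
      · refine (card_filter_le _ _).trans ?_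
        rw [card_product, card_range]
    have h1 : 2 * W.toFinset.card ≤ W.length + D1.card := by convert two_card W
    have h2 := le_card_sdiff Bd D1
    rw [hWl] at h1
    omega
end
end KK

set_option linter.all false
set_option linter.unusedVariables false
set_option linter.unusedSectionVars false
namespace KK
open Finset
open scoped Classical

section
variable {P : Finset ℕ} {Λ δ H0 ρ : ℝ} {Hn l : ℕ} {Bm : ℤ}

lemma take_drop_mid {α : Type*} (A w R : List α) {a l : ℕ} (hA : A.length = a) (hw : w.length = l) : ((A ++ (w ++ R)).drop a).take l = w := by
  subst hA; subst hw; simp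

lemma two_block (hE : Env P Λ δ H0 ρ Hn l Bm) (hΛ0 : 0 ≤ Λ) (E : List ℕ → List ℕ → ℤ → ℤ → ℝ) (hE0 : ∀ w w' y v, 0 ≤ E w w' y v) (π : ℤ) (a b d : ℕ) (Bd : ℕ)
    (hBd : (a + (l + (b + (l + d)))) * Hn ≤ Bd) {c : ℝ} (hc1 : 1 ≤ c) (hc : (a + (l + (b + (l + d))) : ℕ) + Λ ≤ c) :
    ∑ W ∈ words P (a + (l + (b + (l + d)))), iw W.toFinset * E ((W.drop a).take l) ((W.drop (a + l + b)).take l) (walk π (W.take a)) (walk π (W.take (a + l + b)))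
    ≤ c ^ (a + (l + (b + (l + d)))) * ∑ y ∈ Icc (π - Bd) (π + Bd), ∑ v ∈ Icc (π - Bd) (π + Bd), ∑ w ∈ words P l, ∑ w' ∈ words P l, iw (w.toFinset ∪ w'.toFinset) * E w w' y v := by
  set X : List ℕ → List ℕ → ℝ := fun w w' => ∑ y ∈ Icc (π - Bd) (π + Bd), ∑ v ∈ Icc (π - Bd) (π + Bd), iw (w.toFinset ∪ w'.toFinset) * E w w' y v with hX
  have hX0 : ∀ w w', 0 ≤ X w w' := fun w w' => sum_nonneg fun y _ => sum_nonneg fun v _ => mul_nonneg (iw_nonneg _) (hE0 _ _ _ _)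
  have hbox : ∀ (W : List ℕ), (∀ p ∈ W, p ∈ P) → W.length ≤ a + (l + (b + (l + d))) → walk π W ∈ Icc (π - Bd) (π + Bd) := by
    intro W hW hlen
    have := walk_dist (fun p hp => hE.le p (hW p hp)) π (Hn := Hn)
    have h2 : ((W.length : ℤ)) * Hn ≤ Bd := by exact_mod_cast (Nat.mul_le_mul_right Hn hlen).trans hBd
    rw [mem_Icc]
    have := abs_le.1 (this.trans h2)
    constructor <;> linarith
  calc _ = ∑ A ∈ words P a, ∑ w ∈ words P l, ∑ B ∈ words P b, ∑ w' ∈ words P l, ∑ C ∈ words P d,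
        iw (A ++ (w ++ (B ++ (w' ++ C)))).toFinset * E w w' (walk π A) (walk π (A ++ (w ++ B))) := by
        rw [sum_words_add]
        refine sum_congr rfl fun A hA => ?_
        rw [sum_words_add]
        refine sum_congr rfl fun w hw => ?_
        rw [sum_words_add]
        refine sum_congr rfl fun B hB => ?_
        rw [sum_words_add]
        refine sum_congr rfl fun w' hw' => ?_
        refine sum_congr rfl fun C hC => ?_
        have hA := (mem_words.1 hA).1
        have hw := (mem_words.1 hw).1
        have hw' := (mem_words.1 hw').1
        have hB := (mem_words.1 hB).1
        have e1 : (A ++ (w ++ (B ++ (w' ++ C)))) = (A ++ (w ++ B)) ++ (w' ++ C) := by simp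
        have hl3 : (A ++ (w ++ B)).length = a + l + b := by simp; omega
        congr 1
        congr 1
        · exact take_drop_mid A w _ hA hw
        · rw [e1]; exact take_drop_mid _ w' _ hl3 hw'
        · rw [← hA]; simp
        · rw [e1, ← hl3, List.take_left]
    _ ≤ ∑ A ∈ words P a, ∑ w ∈ words P l, ∑ B ∈ words P b, ∑ w' ∈ words P l, ∑ C ∈ words P d,
        iw ((A ++ (B ++ C)).toFinset \ (w.toFinset ∪ w'.toFinset)) * X w w' := by
        refine sum_le_sum fun A hA => sum_le_sum fun w hw => sum_le_sum fun B hB => sum_le_sum fun w' hw' => sum_le_sum fun C hC => ?_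
        have e : (A ++ (w ++ (B ++ (w' ++ C)))).toFinset = (A ++ (B ++ C)).toFinset ∪ (w.toFinset ∪ w'.toFinset) := by
          ext q; simp; tauto
        rw [e, iw_union, mul_assoc]
        refine mul_le_mul_of_nonneg_left ?_ (iw_nonneg _)
        rw [mem_words] at hA hw hB
        have m1 := hbox A hA.2 (by omega)
        have m2 := hbox (A ++ (w ++ B)) (by
          intro p hp; simp only [List.mem_append] at hp
          rcases hp with h | h | h
          exacts [hA.2 p h, hw.2 p h, hB.2 p h]) (by simp; omega)
        rw [hX]
        refine le_trans ?_ (single_le_sum (f := fun y => ∑ v ∈ Icc (π - Bd) (π + Bd), iw (w.toFinset ∪ w'.toFinset) * E w w' y v) (fun y _ => sum_nonneg fun v _ => mul_nonneg (iw_nonneg _) (hE0 _ _ _ _)) m1)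
        exact single_le_sum (f := fun v => iw (w.toFinset ∪ w'.toFinset) * E w w' (walk π A) v) (fun v _ => mul_nonneg (iw_nonneg _) (hE0 _ _ _ _)) m2
    _ = ∑ w ∈ words P l, ∑ w' ∈ words P l, X w w' * ∑ A ∈ words P a, ∑ B ∈ words P b, ∑ C ∈ words P d,
        iw ((A ++ (B ++ C)).toFinset \ (w.toFinset ∪ w'.toFinset)) := by
        rw [sum_comm]
        refine sum_congr rfl fun w _ => ?_
        have : ∀ A ∈ words P a, (∑ B ∈ words P b, ∑ w' ∈ words P l, ∑ C ∈ words P d, iw ((A ++ (B ++ C)).toFinset \ (w.toFinset ∪ w'.toFinset)) * X w w')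
          = ∑ w' ∈ words P l, ∑ B ∈ words P b, ∑ C ∈ words P d, iw ((A ++ (B ++ C)).toFinset \ (w.toFinset ∪ w'.toFinset)) * X w w' := fun A _ => sum_comm
        rw [sum_congr rfl this, sum_comm]
        refine sum_congr rfl fun w' _ => ?_
        simp only [mul_sum, mul_comm]
    _ ≤ ∑ w ∈ words P l, ∑ w' ∈ words P l, X w w' * c ^ (a + (l + (b + (l + d)))) := by
        refine sum_le_sum fun w hw => sum_le_sum fun w' hw' => mul_le_mul_of_nonneg_left ?_ (hX0 _ _)
        have e : ∑ A ∈ words P a, ∑ B ∈ words P b, ∑ C ∈ words P d, iw ((A ++ (B ++ C)).toFinset \ (w.toFinset ∪ w'.toFinset))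
          = ∑ W ∈ words P (a + (b + d)), iw (W.toFinset \ (w.toFinset ∪ w'.toFinset)) := by
          rw [sum_words_add]
          refine sum_congr rfl fun A _ => ?_
          rw [sum_words_add P b d (fun W => iw ((A ++ W).toFinset \ (w.toFinset ∪ w'.toFinset)))]
        rw [e]
        refine (crude hE.sum hΛ0 _ _ (c := c) ?_).trans (pow_le_pow_right₀ hc1 (by omega))
        refine le_trans ?_ hc
        have h1 : (w.toFinset ∪ w'.toFinset).card ≤ l + l := by
          refine (card_union_le _ _).trans (add_le_add ?_ ?_)
          · exact (List.toFinset_card_le _).trans (mem_words.1 hw).1.le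
          · exact (List.toFinset_card_le _).trans (mem_words.1 hw').1.le
        have h2 : (w.toFinset ∪ w'.toFinset).card + (a + (b + d)) ≤ a + (l + (b + (l + d))) := by omega
        have h3 : (((w.toFinset ∪ w'.toFinset).card + (a + (b + d)) : ℕ) : ℝ) ≤ ((a + (l + (b + (l + d))) : ℕ) : ℝ) := by exact_mod_cast h2
        push_cast at h3 ⊢
        linarith
    _ = _ := by
        simp only [← sum_mul]
        rw [mul_comm]
        congr 1
        rw [hX]
        rw [sum_congr rfl fun w _ => sum_comm]
        rw [sum_comm]
        refine sum_congr rfl fun y _ => ?_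
        rw [sum_congr rfl fun w _ => sum_comm]
        rw [sum_comm]

end
end KK

set_option linter.all false
set_option linter.unusedVariables false
set_option linter.unusedSectionVars false
namespace KK
open Finset
open scoped Classical

section
variable {P : Finset ℕ} {Λ δ H0 ρ : ℝ} {Hn l : ℕ} {Bm : ℤ}

noncomputable def badE (P : Finset ℕ) (l u : ℕ) (w w' : List ℕ) (y v : ℤ) : ℝ :=
  if w ∈ GW P l ∧ w' ∈ GW P l ∧ ¬ FewP l (gd w) (gd w') (vt y w) (vt v w') (u * u) then iw (NCp l y v w w') else 0
lemma badE_nonneg (u : ℕ) (w w' : List ℕ) (y v : ℤ) : 0 ≤ badE P l u w w' y v := by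
  unfold badE; split_ifs <;> [exact iw_nonneg _; exact le_rfl]

lemma badE_sum (hE : Env P Λ δ H0 ρ Hn l Bm) (hΛ0 : 0 ≤ Λ) {y0 v0 : ℤ} (hB : |y0 - v0| + 3 * l * Hn ≤ Bm) {u : ℕ} (hu : 0 < u) :
    ∑ w ∈ words P l, ∑ w' ∈ words P l, iw (w.toFinset ∪ w'.toFinset) * badE P l u w w' y0 v0 ≤ (2 * l * Hn + 4) * (3 * (Λ + 2 * l + 1)) ^ (2 * l) / ρ ^ u := by
  have hρ : 0 < ρ := lt_of_lt_of_le one_pos hE.hρ1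
  rw [le_div_iff₀ (by positivity)]
  refine le_trans (le_of_eq ?_) (pair_bound hE hΛ0 hB hu)
  congr 1
  have hsub : GW P l ⊆ words P l := filter_subset _ _
  rw [← sum_subset hsub]
  · refine sum_congr rfl fun w hw => ?_
    rw [← sum_subset hsub]
    · refine sum_congr rfl fun w' hw' => ?_
      unfold badE
      by_cases h : FewP l (gd w) (gd w') (vt y0 w) (vt v0 w') (u * u)
      · rw [if_neg (by tauto), if_neg (by tauto), mul_zero]
      · rw [if_pos ⟨hw, hw', h⟩, if_pos h]
    · intro w' _ hw'
      unfold badE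
      rw [if_neg (by tauto), mul_zero]
  · intro w _ hw
    refine sum_eq_zero fun w' _ => ?_
    unfold badE
    rw [if_neg (by tauto), mul_zero]

lemma bad_pair (hE : Env P Λ δ H0 ρ Hn l Bm) (hΛ0 : 0 ≤ Λ) (π : ℤ) {M i j : ℕ} (hi : i < M) (hj : j < M) (hij : i ≠ j)
    (hB : (2 * (M * l * Hn) + 3 * l * Hn : ℕ) ≤ Bm) {u : ℕ} (hu : 0 < u) {c : ℝ} (hc1 : 1 ≤ c) (hc : (M * l : ℕ) + Λ ≤ c) :
    ∑ W ∈ words P (M * l), iw W.toFinset * badE P l u (bw l W i) (bw l W j) (bst π l W i) (bst π l W j)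
     ≤ c ^ (M * l) * ((2 * (M * l * Hn : ℕ) + 1) ^ 2 * ((2 * l * Hn + 4) * (3 * (Λ + 2 * l + 1)) ^ (2 * l) / ρ ^ u)) := by
  set PB := (2 * l * Hn + 4) * (3 * (Λ + 2 * l + 1)) ^ (2 * l) / ρ ^ u with hPB
  have gen : ∀ (E : List ℕ → List ℕ → ℤ → ℤ → ℝ), (∀ w w' y v, 0 ≤ E w w' y v) →
      (∀ y v : ℤ, |y - v| + 3 * l * Hn ≤ Bm → ∑ w ∈ words P l, ∑ w' ∈ words P l, iw (w.toFinset ∪ w'.toFinset) * E w w' y v ≤ PB) →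
      ∀ i j, i < j → j < M →
      ∑ W ∈ words P (M * l), iw W.toFinset * E (bw l W i) (bw l W j) (bst π l W i) (bst π l W j) ≤ c ^ (M * l) * ((2 * (M * l * Hn : ℕ) + 1) ^ 2 * PB) := by
    intro E hE0 hES i j hij hj
    obtain ⟨b, rfl⟩ : ∃ b, j = i + 1 + b := ⟨j - i - 1, by omega⟩
    obtain ⟨d, rfl⟩ : ∃ d, M = i + 1 + b + 1 + d := ⟨M - (i + 1 + b + 1), by omega⟩
    have eV : (i + 1 + b + 1 + d) * l = i * l + (l + (b * l + (l + d * l))) := by ring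
    have h := two_block hE hΛ0 E hE0 π (i * l) (b * l) (d * l) ((i + 1 + b + 1 + d) * l * Hn) (by rw [eV]) hc1 (by rw [eV] at hc; exact hc)
    have ej : (i + 1 + b) * l = i * l + l + b * l := by ring
    rw [eV] at h ⊢
    unfold bw bst
    rw [ej]
    refine h.trans (mul_le_mul_of_nonneg_left ?_ (by positivity))
    set Bd := (i * l + (l + (b * l + (l + d * l)))) * Hn with hBd
    have hcard : ((Icc (π - (Bd:ℤ)) (π + Bd)).card : ℝ) = 2 * Bd + 1 := by
      rw [Int.card_Icc]
      have : (π + (Bd:ℤ) + 1 - (π - Bd)).toNat = 2 * Bd + 1 := by omega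
      rw [this]; push_cast; ring
    have hle : ∀ y ∈ Icc (π - (Bd:ℤ)) (π + Bd), ∑ v ∈ Icc (π - (Bd:ℤ)) (π + Bd), ∑ w ∈ words P l, ∑ w' ∈ words P l, iw (w.toFinset ∪ w'.toFinset) * E w w' y v ≤ (2 * Bd + 1) * PB := by
      intro y hy
      rw [← hcard, ← nsmul_eq_mul]
      refine sum_le_card_nsmul _ _ _ fun v hv => hES y v ?_
      rw [mem_Icc] at hy hv
      have : |y - v| ≤ 2 * Bd := abs_le.2 ⟨by linarith, by linarith⟩
      rw [eV, ← hBd] at hB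
      push_cast at hB
      linarith
    refine (sum_le_card_nsmul _ _ _ hle).trans (le_of_eq ?_)
    rw [nsmul_eq_mul, hcard]; push_cast; ring
  rcases lt_or_gt_of_ne hij with h | h
  · exact gen _ (badE_nonneg u) (fun y v hyv => badE_sum hE hΛ0 hyv hu) i j h hj
  · refine gen (fun w w' y v => badE P l u w' w v y) (fun w w' y v => badE_nonneg u _ _ _ _) (fun y v hyv => ?_) j i h hi
    rw [sum_comm]
    simp only [union_comm]
    exact badE_sum hE hΛ0 (by rw [abs_sub_comm]; exact hyv) hu

lemma card_words (P : Finset ℕ) (k : ℕ) : ((words P k).card : ℝ) = (P.card : ℝ) ^ k := by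
  have : ((words P k).card : ℝ) = ∑ w ∈ words P k, (1:ℝ) := by simp
  rw [this]
  induction k with
  | zero => simp [words]
  | succ k ih => 
    rw [sum_words_succ]
    have ih' := ih (by simp)
    rw [ih']; simp [pow_succ]; ring

lemma card_P_le (hE : Env P Λ δ H0 ρ Hn l Bm) : P.card ≤ Hn := by
  have : P ⊆ Icc 1 Hn := fun p hp => mem_Icc.2 ⟨(hE.prime p hp).one_le, hE.le p hp⟩
  simpa using card_le_card this

lemma fam_abs_le (hE : Env P Λ δ H0 ρ Hn l Bm) {θ : ℝ} (h0 : 0 ≤ θ) (h1 : θ ≤ 1) {V : ℕ} (x : Fin V → ℕ) (u u' : Fin V → ℤ) (n : ℤ) :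
    |fam P θ x u u' n| ≤ |∏ k, (indd (x k) (n + u k) - 1 / x k)| := by
  unfold fam
  rw [abs_prod, abs_prod]
  refine prod_le_prod (fun _ _ => abs_nonneg _) fun k _ => ?_
  rw [abs_mul, abs_mul, abs_of_nonneg (pow_nonneg h0 (om P (n + u k))), abs_of_nonneg (pow_nonneg h0 (om P (n + u' k))), mul_assoc]
  exact mul_le_of_le_one_right (abs_nonneg _) (mul_le_one₀ (pow_le_one₀ h0 h1) (pow_nonneg h0 _) (pow_le_one₀ h0 h1))

lemma xW_mem {M : ℕ} {W : List ℕ} (hW : W ∈ blk P l M) (k : Fin (M * l)) : xW W (M * l) k ∈ P := by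
  obtain ⟨hWl, hWP, hG⟩ := blk_mem hW
  unfold xW
  rw [List.getD_eq_getElem _ _ (by omega)]
  exact hWP _ (List.getElem_mem _)

lemma two_notin (hE : Env P Λ δ H0 ρ Hn l Bm) : 2 ∉ P := fun h => by have := hE.odd 2 h; revert this; decide

lemma many_one (hE : Env P Λ δ H0 ρ Hn l Bm) (hHn : 1 ≤ Hn) {θ : ℝ} (h0 : 0 ≤ θ) (h1 : θ ≤ 1) {M : ℕ} {W : List ℕ} (hW : W ∈ blk P l M) (π : ℤ)
    {i j : ℕ} (hi : i < M) (hj : j < M) (a : ℤ) (N : ℕ) :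
    |∑ n ∈ range N, parI π (a + n) * fam P θ (xW W (M * l)) (uW π W (M * l)) (vW π W (M * l)) (a + n)| ≤
      N * (3 ^ (M * l) * iw W.toFinset * iw (NCp l (bst π l W i) (bst π l W j) (bw l W i) (bw l W j))) + 4 * (Hn:ℝ) ^ (M * l) := by
  obtain ⟨hWl, hWP, hG⟩ := blk_mem hW
  have hodd : ∀ p ∈ W, Odd p := fun p hp => hE.odd p (hWP p hp)
  have h := fam_abs hE.prime (two_notin hE) (H := Hn) (by exact_mod_cast hHn) (fun q hq => by exact_mod_cast hE.le q hq)
    (xW W (M * l)) (uW π W (M * l)) (xW_mem hW) (NCp l (bst π l W i) (bst π l W j) (bw l W i) (bw l W j)) (by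
      intro q hq
      unfold NCp NCs at hq
      obtain ⟨a, ha, rfl⟩ := mem_image.1 hq
      rw [mem_filter, mem_range] at ha
      obtain ⟨ha, b, hb, he, hn⟩ := ha
      rw [gd_bw _ _ ha, vt_bw _ _ _ ha.le, vt_bw _ _ _ hb.le] at hn
      rw [gd_bw _ _ ha, gd_bw _ _ hb] at he
      have hk : i * l + a < M * l := by
        have h1 : (i+1) * l ≤ M * l := Nat.mul_le_mul_right _ hi
        have h2 : (i+1) * l = i * l + l := by ring
        omega
      have hk' : j * l + b < M * l := by
        have h1 : (j+1) * l ≤ M * l := Nat.mul_le_mul_right _ hj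
        have h2 : (j+1) * l = j * l + l := by ring
        omega
      refine ⟨⟨_, hk⟩, ⟨_, hk'⟩, ?_, ?_, ?_⟩
      · rw [gd_bw _ _ ha]; rfl
      · rw [gd_bw _ _ ha, he]; rfl
      · rw [gd_bw _ _ ha]
        have e1 := uW_eq hodd π (⟨_, hk⟩ : Fin (M * l))
        have e2 := uW_eq hodd π (⟨_, hk'⟩ : Fin (M * l))
        simp only at e1 e2
        rw [e1, e2, add_sub_add_left_eq_sub] at hn
        exact hn) π a N
  rw [Fintype.card_fin, image_xW hWl] at h
  refine le_trans ?_ h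
  refine (abs_sum_le_sum_abs _ _).trans (sum_le_sum fun n _ => ?_)
  have hp : 0 ≤ parI π (a + n) := by unfold parI; split_ifs <;> norm_num
  rw [abs_mul, abs_of_nonneg hp]
  exact mul_le_mul_of_nonneg_left (fam_abs_le hE h0 h1 _ _ _ _) hp

lemma many_sum (hE : Env P Λ δ H0 ρ Hn l Bm) (hΛ0 : 0 ≤ Λ) (hHn : 1 ≤ Hn) {θ : ℝ} (h0 : 0 ≤ θ) (h1 : θ ≤ 1) (π : ℤ) {M : ℕ}
    (hB : (2 * (M * l * Hn) + 3 * l * Hn : ℕ) ≤ Bm) {u : ℕ} (hu : 0 < u) {c : ℝ} (hc1 : 1 ≤ c) (hc : (M * l : ℕ) + Λ ≤ c) (a : ℤ) (N : ℕ) :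
    ∑ W ∈ (blk P l M).filter (fun W => ¬ FewAll l M π (u * u) W),
      |∑ n ∈ range N, parI π (a + n) * fam P θ (xW W (M * l)) (uW π W (M * l)) (vW π W (M * l)) (a + n)| ≤
     N * 3 ^ (M * l) * (M ^ 2 * (c ^ (M * l) * ((2 * (M * l * Hn : ℕ) + 1) ^ 2 * ((2 * l * Hn + 4) * (3 * (Λ + 2 * l + 1)) ^ (2 * l) / ρ ^ u))))
      + (Hn:ℝ) ^ (M * l) * (4 * (Hn:ℝ) ^ (M * l)) := by
  set PB := c ^ (M * l) * ((2 * (M * l * Hn : ℕ) + 1) ^ 2 * ((2 * l * Hn + 4) * (3 * (Λ + 2 * l + 1)) ^ (2 * l) / ρ ^ u)) with hPB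
  have hρ : 0 < ρ := lt_of_lt_of_le one_pos hE.hρ1
  have hPB0 : 0 ≤ PB := by positivity
  have hsub : (blk P l M) ⊆ words P (M * l) := filter_subset _ _
  set e : List ℕ → ℕ → ℕ → ℝ := fun W i j => iw W.toFinset * badE P l u (bw l W i) (bw l W j) (bst π l W i) (bst π l W j) with he
  have he0 : ∀ W i j, 0 ≤ e W i j := fun W i j => mul_nonneg (iw_nonneg _) (badE_nonneg _ _ _ _ _)
  set IJ := (range M ×ˢ range M).filter fun ij : ℕ × ℕ => ij.1 ≠ ij.2 with hIJ
  have hIJc : (IJ.card : ℝ) ≤ M ^ 2 := by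
    have : IJ.card ≤ M * M := (card_filter_le _ _).trans (by rw [card_product, card_range])
    rw [sq]; exact_mod_cast this
  have one : ∀ W ∈ (blk P l M).filter (fun W => ¬ FewAll l M π (u * u) W),
      |∑ n ∈ range N, parI π (a + n) * fam P θ (xW W (M * l)) (uW π W (M * l)) (vW π W (M * l)) (a + n)| ≤
        N * 3 ^ (M * l) * (∑ ij ∈ IJ, e W ij.1 ij.2) + 4 * (Hn:ℝ) ^ (M * l) := by
    intro W hW
    rw [mem_filter] at hW
    obtain ⟨hW, hF⟩ := hW
    unfold FewAll at hF
    push Not at hF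
    obtain ⟨i, hi, j, hj, hij, hf⟩ := hF
    refine (many_one hE hHn h0 h1 hW π hi hj a N).trans (add_le_add_left ?_ _)
    have : iw W.toFinset * iw (NCp l (bst π l W i) (bst π l W j) (bw l W i) (bw l W j)) = e W i j := by
      rw [he]; simp only; unfold badE
      rw [if_pos ⟨(blk_mem hW).2.2 i hi, (blk_mem hW).2.2 j hj, hf⟩]
    rw [mul_assoc (3 ^ (M * l) : ℝ), this, ← mul_assoc]
    refine mul_le_mul_of_nonneg_left ?_ (by positivity)
    exact single_le_sum (f := fun ij : ℕ × ℕ => e W ij.1 ij.2) (fun ij _ => he0 W _ _) (mem_filter.2 ⟨mem_product.2 ⟨mem_range.2 hi, mem_range.2 hj⟩, hij⟩ : (i, j) ∈ IJ)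
  refine (sum_le_sum one).trans ?_
  rw [sum_add_distrib, sum_const, nsmul_eq_mul, ← mul_sum]
  have hcw : (((blk P l M).filter (fun W => ¬ FewAll l M π (u * u) W)).card : ℝ) ≤ (Hn:ℝ) ^ (M * l) := by
    have h1 : ((blk P l M).filter (fun W => ¬ FewAll l M π (u * u) W)).card ≤ (words P (M * l)).card := card_le_card ((filter_subset _ _).trans hsub)
    have h2 : (((blk P l M).filter (fun W => ¬ FewAll l M π (u * u) W)).card : ℝ) ≤ (words P (M * l)).card := by exact_mod_cast h1
    rw [card_words] at h2
    exact h2.trans (pow_le_pow_left₀ (by positivity) (by exact_mod_cast card_P_le hE) _)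
  refine add_le_add (mul_le_mul_of_nonneg_left ?_ (by positivity)) (mul_le_mul_of_nonneg_right hcw (by positivity))
  rw [sum_comm]
  refine le_trans (sum_le_card_nsmul _ _ PB fun ij hij => ?_) ?_
  · rw [hIJ, mem_filter, mem_product, mem_range, mem_range] at hij
    refine le_trans ?_ (bad_pair hE hΛ0 π hij.1.1 hij.1.2 hij.2 hB hu hc1 hc)
    exact sum_le_sum_of_subset_of_nonneg ((filter_subset _ _).trans hsub) fun W _ _ => he0 W _ _
  · rw [nsmul_eq_mul]
    exact mul_le_mul_of_nonneg_right hIJc hPB0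

end
end KK

set_option linter.all false
set_option linter.unusedVariables false
set_option linter.unusedSectionVars false
namespace KK
open Finset
open scoped Classical

section
variable {P : Finset ℕ} {Λ δ H0 ρ : ℝ} {Hn l : ℕ} {Bm : ℤ}

lemma few_weight {Λ : ℝ} (hΛ : 1 ≤ Λ) {d s V A : ℕ} (hd : d ≤ V) (hs : s ≤ d) (h : d ≤ s + A) {e : ℝ} (he : 0 ≤ e) :
    (1 + e) * (2 * (1 / Λ)) ^ s + e ≤ (1 / Λ) ^ d * ((1 + e) * (2 ^ V * Λ ^ A) + Λ ^ V * e) := by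
  have hΛ0 : 0 < Λ := by linarith
  have h1 : (2 * (1 / Λ)) ^ s ≤ (1 / Λ) ^ d * (2 ^ V * Λ ^ A) := by
    rw [mul_pow, one_div, inv_pow, inv_pow, inv_mul_eq_div, ← div_eq_mul_inv, div_le_div_iff₀ (by positivity) (by positivity)]
    calc (2:ℝ) ^ s * Λ ^ d ≤ 2 ^ V * Λ ^ (s + A) := mul_le_mul (pow_le_pow_right₀ (by norm_num) (hs.trans hd)) (pow_le_pow_right₀ hΛ h) (by positivity) (by positivity)
      _ = _ := by rw [pow_add]; ring
  have h2 : 1 ≤ (1 / Λ) ^ d * Λ ^ V := by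
    rw [one_div, inv_pow, inv_mul_eq_div, one_le_div (by positivity)]
    exact pow_le_pow_right₀ hΛ hd
  have h3 := mul_le_mul_of_nonneg_left h1 (by linarith : 0 ≤ 1 + e)
  have h4 := mul_le_mul_of_nonneg_left h2 he
  calc _ ≤ (1 + e) * ((1 / Λ) ^ d * (2 ^ V * Λ ^ A)) + e * ((1 / Λ) ^ d * Λ ^ V) := by linarith
    _ = _ := by ring

lemma few_sum (hE : Env P Λ δ H0 ρ Hn l Bm) (hΛ1 : 1 ≤ Λ) (hHn : 1 ≤ Hn) (π : ℤ) {R M : ℕ} (hM : M = 2 * R)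
    (hV : (M * l : ℕ) ≤ H0) (t J : ℕ) {X : ℝ} (hX : 0 < X) (a : ℤ) (N : ℕ) {e' : ℝ} (he' : e' = Real.exp (X * (2 * (M * l : ℕ))) / X ^ J) :
    ∑ W ∈ (blk P l M).filter (fun W => FewAll l M π t W),
      |∑ n ∈ range N, parI π (a + n) * fam P (1 - 1 / Λ) (xW W (M * l)) (uW π W (M * l)) (vW π W (M * l)) (a + n)| ≤
     N * 3 ^ (M * l) * (4 ^ (M * l) * (1 + (M * l : ℕ)) ^ (M + M * M * (1 + 7 * t)) * ((1 + e') * (2 ^ (M * l) * Λ ^ (R * l + M * M * (2 + 4 * t))) + Λ ^ (M * l) * e'))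
      + (Hn:ℝ) ^ (M * l) * (4 * (J + 1) * (Hn:ℝ) ^ J * (Hn:ℝ) ^ (M * l + J)) := by
  have hΛ0 : 0 < Λ := by linarith
  have he0 : 0 ≤ e' := by rw [he']; positivity
  have hi1 : 1 / Λ ≤ 1 := by rw [div_le_one hΛ0]; exact hΛ1
  have hi0 : 0 < 1 / Λ := by positivity
  set Z := (1 + e') * (2 ^ (M * l) * Λ ^ (R * l + M * M * (2 + 4 * t))) + Λ ^ (M * l) * e' with hZ
  set Er := 4 * ((J:ℝ) + 1) * (Hn:ℝ) ^ J * (Hn:ℝ) ^ (M * l + J) with hEr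
  have hsub : (blk P l M) ⊆ words P (M * l) := filter_subset _ _
  have one : ∀ W ∈ (blk P l M).filter (fun W => FewAll l M π t W),
      |∑ n ∈ range N, parI π (a + n) * fam P (1 - 1 / Λ) (xW W (M * l)) (uW π W (M * l)) (vW π W (M * l)) (a + n)| ≤
      N * 3 ^ (M * l) * (iw W.toFinset * (1 / Λ) ^ W.toFinset.card) * Z + Er := by
    intro W hW
    rw [mem_filter] at hW
    obtain ⟨hW, hF⟩ := hW
    obtain ⟨hWl, hWP, hG⟩ := blk_mem hW
    obtain ⟨S, hS1, hS2⟩ := few_S hE hW hF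
    have h := fam_avg hE.prime (two_notin hE) (H := Hn) (by exact_mod_cast hHn) (fun q hq => by exact_mod_cast hE.le q hq)
      (by exact_mod_cast card_P_le hE) (θ := 1 - 1 / Λ) (by linarith) (by linarith) hE.sum (by rw [sub_sub_cancel, one_div, inv_mul_cancel₀ hΛ0.ne'])
      (xW W (M * l)) (uW π W (M * l)) (vW π W (M * l)) (xW_mem hW) (fun q hq => by rw [Fintype.card_fin]; exact hV.trans (hE.ge q hq)) S hS1 J hX π a N
    rw [Fintype.card_fin, image_xW hWl, ← he', sub_sub_cancel] at h
    refine h.trans (add_le_add_left ?_ _)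
    have hSD : S ⊆ W.toFinset := fun q hq => by
      obtain ⟨k, hk, _⟩ := hS1 q hq
      rw [← image_xW hWl, ← hk]; exact mem_image_of_mem _ (mem_univ k)
    have hdV : W.toFinset.card ≤ M * l := (List.toFinset_card_le W).trans hWl.le
    have hMR : M * l = 2 * (R * l) := by rw [hM]; ring
    have hw := few_weight hΛ1 hdV (card_le_card hSD) (A := R * l + M * M * (2 + 4 * t)) (by omega) he0
    change N * 3 ^ (M * l) * iw W.toFinset * _ ≤ _
    calc N * 3 ^ (M * l) * iw W.toFinset * ((1 + e') * (2 * (1 / Λ)) ^ S.card + e')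
        ≤ N * 3 ^ (M * l) * iw W.toFinset * ((1 / Λ) ^ W.toFinset.card * Z) :=
          mul_le_mul_of_nonneg_left hw (mul_nonneg (by positivity) (iw_nonneg _))
      _ = _ := by ring
  have hZ0 : 0 ≤ Z := by positivity
  refine (sum_le_sum one).trans ?_
  rw [sum_add_distrib, sum_const, nsmul_eq_mul, ← sum_mul, ← mul_sum]
  have hcw : (((blk P l M).filter (fun W => FewAll l M π t W)).card : ℝ) ≤ (Hn:ℝ) ^ (M * l) := by
    have h1 : ((blk P l M).filter (fun W => FewAll l M π t W)).card ≤ (words P (M * l)).card := card_le_card ((filter_subset _ _).trans hsub)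
    have h2 : (((blk P l M).filter (fun W => FewAll l M π t W)).card : ℝ) ≤ (words P (M * l)).card := by exact_mod_cast h1
    rw [card_words] at h2
    exact h2.trans (pow_le_pow_left₀ (by positivity) (by exact_mod_cast card_P_le hE) _)
  refine add_le_add ?_ (mul_le_mul_of_nonneg_right hcw (by positivity))
  rw [mul_assoc]
  refine mul_le_mul_of_nonneg_left ?_ (by positivity)
  refine mul_le_mul_of_nonneg_right ?_ hZ0
  exact few_count hE.sum hΛ0 (M * l) _ _ ((filter_subset _ _).trans hsub) fun W hW => brk_le hE (mem_filter.1 hW).1 (mem_filter.1 hW).2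

/-- the kernel -/
noncomputable def tt (B : Finset ℤ) (P : Finset ℕ) (z θ : ℝ) (n : ℤ) (p : ℕ) : ℝ :=
  if n ∈ B ∧ nb n p ∈ B then z * ((indd p n - 1 / p) * θ ^ om P n * θ ^ om P (nb n p)) else 0

lemma tw_eq (t : ℤ → ℕ → ℝ) (n : ℤ) (W : List ℕ) : tw t n W = ∏ k ∈ range W.length, t (walk n (W.take k)) (W.getD k 0) := by
  induction W generalizing n with
  | nil => simp [tw]
  | cons p W ih =>
    rw [tw, ih, List.length_cons, prod_range_succ', mul_comm]
    simp [walk]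

lemma sgn_par {m π : ℤ} (h : (2:ℤ) ∣ m - π) : sgn m = sgn π := by
  unfold sgn
  have : Even m ↔ Even π := by
    rw [Int.even_iff, Int.even_iff]; omega
  simp [this]

lemma tw_tt (hodd : ∀ p ∈ P, Odd p) (hH : ∀ p ∈ P, p ≤ Hn) {B : Finset ℤ} {z θ : ℝ} {m π : ℤ} (hpar : (2:ℤ) ∣ m - π) {V : ℕ} {W : List ℕ} (hW : W ∈ words P V)
    (hB : ∀ n : ℤ, |n - m| ≤ V * Hn → n ∈ B) :
    tw (tt B P z θ) m W = z ^ V * fam P θ (xW W V) (uW π W V) (vW π W V) m := by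
  rw [mem_words] at hW
  obtain ⟨hl, hP⟩ := hW
  rw [tw_eq, hl]
  unfold fam
  have hin : ∀ k, walk m (W.take k) ∈ B := fun k => hB _ (by
    have h1 := walk_dist (w := W.take k) (fun p hp => hH p (hP p (List.mem_of_mem_take hp))) m
    refine h1.trans ?_
    have : (W.take k).length ≤ V := by rw [List.length_take]; omega
    exact mul_le_mul_of_nonneg_right (by exact_mod_cast this) (by positivity))
  have hz : z ^ V = ∏ k : Fin V, z := by simp
  rw [hz, ← prod_mul_distrib, Finset.prod_range]
  refine prod_congr rfl fun k _ => ?_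
  have hstep : nb (walk m (W.take k)) (W.getD k 0) = walk m (W.take (k+1)) := (walk_step (by omega) m).symm
  have ho : ∀ p ∈ W, Odd p := fun p hp => hodd p (hP p hp)
  have e1 : walk m (W.take k) = m + uW π W V k := by rw [walk_eq (odd_take ho _), sgn_par hpar]; rfl
  have e2 : walk m (W.take (k+1)) = m + vW π W V k := by rw [walk_eq (odd_take ho _), sgn_par hpar]; rfl
  unfold tt
  rw [if_pos ⟨hin k, by rw [hstep]; exact hin _⟩, hstep, e1, e2]
  rfl

lemma Ioc_sum (a : ℤ) (N : ℕ) (F : ℤ → ℝ) : ∑ m ∈ Ioc a (a + N), F m = ∑ n ∈ range N, F (a + 1 + n) := by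
  induction N with
  | zero => simp
  | succ N ih =>
    rw [sum_range_succ, ← ih]
    have : Ioc a (a + ((N + 1 : ℕ):ℤ)) = insert (a + 1 + N) (Ioc a (a + N)) := by
      ext x; simp only [mem_Ioc, mem_insert]; push_cast; omega
    rw [this, sum_insert (by simp only [mem_Ioc]; omega), add_comm]

lemma trace_split (hodd : ∀ p ∈ P, Odd p) (hH : ∀ p ∈ P, p ≤ Hn) {B : Finset ℤ} {z θ : ℝ} (hz : 0 ≤ z) {M : ℕ} (a : ℤ) (N : ℕ)
    (hB : Icc (a - M * l * Hn) (a + N + M * l * Hn) ⊆ B) :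
    ∑ m ∈ Ioc a (a + N), ∑ W ∈ blk P l M, (if walk m W = m then tw (tt B P z θ) m W else 0) ≤
     z ^ (M * l) * ∑ π ∈ ({0, 1} : Finset ℤ), ∑ W ∈ blk P l M, |∑ n ∈ range N, parI π (a + 1 + n) * fam P θ (xW W (M * l)) (uW π W (M * l)) (vW π W (M * l)) (a + 1 + n)| := by
  rw [sum_comm, sum_comm (s := ({0,1} : Finset ℤ)), mul_sum]
  refine sum_le_sum fun W hW => ?_
  obtain ⟨hWl, hWP, hG⟩ := blk_mem hW
  have hw : W ∈ words P (M * l) := mem_words.2 ⟨hWl, hWP⟩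
  have ho : ∀ p ∈ W, Odd p := fun p hp => hodd p (hWP p hp)
  have hz0 : 0 ≤ z ^ (M * l) := pow_nonneg hz _
  have hclosed : ∀ m, walk m W = m ↔ alt W = 0 := fun m => by
    rw [walk_eq ho]
    rcases sgn_cases m with h | h <;> rw [h] <;> constructor <;> intro <;> linarith
  by_cases h : alt W = 0
  · rw [sum_congr rfl fun m _ => if_pos ((hclosed m).2 h)]
    rw [mul_sum, sum_pair (by norm_num)]
    have key : ∀ m ∈ Ioc a (a + N), tw (tt B P z θ) m W = z ^ (M * l) * (parI 0 m * fam P θ (xW W (M * l)) (uW 0 W (M * l)) (vW 0 W (M * l)) m)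
       + z ^ (M * l) * (parI 1 m * fam P θ (xW W (M * l)) (uW 1 W (M * l)) (vW 1 W (M * l)) m) := by
      intro m hm
      rw [mem_Ioc] at hm
      have hBm : ∀ n : ℤ, |n - m| ≤ (M * l : ℕ) * Hn → n ∈ B := fun n hn => hB (by
        rw [abs_le] at hn; push_cast at hn
        rw [mem_Icc]; constructor <;> linarith)
      unfold parI
      rcases Int.emod_two_eq_zero_or_one m with h2 | h2
      · rw [if_pos (by omega), if_neg (by omega), tw_tt hodd hH (π := 0) (by omega) hw hBm]; ring
      · rw [if_neg (by omega), if_pos (by omega), tw_tt hodd hH (π := 1) (by omega) hw hBm]; ring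
    rw [sum_congr rfl key, sum_add_distrib, ← mul_sum, ← mul_sum, Ioc_sum, Ioc_sum]
    exact add_le_add (mul_le_mul_of_nonneg_left (le_abs_self _) hz0) (mul_le_mul_of_nonneg_left (le_abs_self _) hz0)
  · rw [sum_congr rfl fun m _ => if_neg (fun hh => h ((hclosed m).1 hh))]
    rw [sum_const_zero]
    exact mul_nonneg hz0 (sum_nonneg fun _ _ => abs_nonneg _)

theorem trace_bound (hE : Env P Λ δ H0 ρ Hn l Bm) (hΛ1 : 1 ≤ Λ) (hHn : 1 ≤ Hn) {R M : ℕ} (hM : M = 2 * R)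
    (hV : (M * l : ℕ) ≤ H0) {u : ℕ} (hu : 0 < u) (J : ℕ) {X : ℝ} (hX : 0 < X) (a : ℤ) (N : ℕ) {e' : ℝ} (he' : e' = Real.exp (X * (2 * (M * l : ℕ))) / X ^ J)
    (hBm : (2 * (M * l * Hn) + 3 * l * Hn : ℕ) ≤ Bm) {c : ℝ} (hc1 : 1 ≤ c) (hc : (M * l : ℕ) + Λ ≤ c)
    {B : Finset ℤ} {z : ℝ} (hz : 0 ≤ z) (hB : Icc (a - M * l * Hn) (a + N + M * l * Hn) ⊆ B) :
    ∑ m ∈ Ioc a (a + N), ∑ W ∈ blk P l M, (if walk m W = m then tw (tt B P z (1 - 1 / Λ)) m W else 0) ≤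
     z ^ (M * l) * (2 * ((N * 3 ^ (M * l) * (4 ^ (M * l) * (1 + (M * l : ℕ)) ^ (M + M * M * (1 + 7 * (u * u))) * ((1 + e') * (2 ^ (M * l) * Λ ^ (R * l + M * M * (2 + 4 * (u * u)))) + Λ ^ (M * l) * e'))
      + (Hn:ℝ) ^ (M * l) * (4 * (J + 1) * (Hn:ℝ) ^ J * (Hn:ℝ) ^ (M * l + J))) + 
     (N * 3 ^ (M * l) * (M ^ 2 * (c ^ (M * l) * ((2 * (M * l * Hn : ℕ) + 1) ^ 2 * ((2 * l * Hn + 4) * (3 * (Λ + 2 * l + 1)) ^ (2 * l) / ρ ^ u))))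
      + (Hn:ℝ) ^ (M * l) * (4 * (Hn:ℝ) ^ (M * l))))) := by
  refine (trace_split hE.odd hE.le hz a N hB).trans (mul_le_mul_of_nonneg_left ?_ (pow_nonneg hz _))
  have hΛ0 : 0 < Λ := by linarith
  have hi1 : 1 / Λ ≤ 1 := by rw [div_le_one hΛ0]; exact hΛ1
  have hi0 : 0 < 1 / Λ := by positivity
  rw [sum_pair (by norm_num), two_mul]
  refine add_le_add ?_ ?_
  · rw [← sum_filter_add_sum_filter_not (blk P l M) (fun W => FewAll l M 0 (u * u) W)]
    have h1 := few_sum hE hΛ1 hHn 0 hM hV (u * u) J hX (a + 1) N he'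
    have h2 := many_sum hE hΛ0.le hHn (θ := 1 - 1 / Λ) (by linarith) (by linarith) 0 hBm hu hc1 hc (a + 1) N
    push_cast at h1 h2 ⊢
    exact add_le_add h1 h2
  · rw [← sum_filter_add_sum_filter_not (blk P l M) (fun W => FewAll l M 1 (u * u) W)]
    have h1 := few_sum hE hΛ1 hHn 1 hM hV (u * u) J hX (a + 1) N he'
    have h2 := many_sum hE hΛ0.le hHn (θ := 1 - 1 / Λ) (by linarith) (by linarith) 1 hBm hu hc1 hc (a + 1) N
    push_cast at h1 h2 ⊢
    exact add_le_add h1 h2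
end
end KK

set_option linter.all false
set_option linter.unusedVariables false
set_option linter.unusedSectionVars false
namespace KK
open Finset
open scoped Classical

section
variable {P : Finset ℕ} {Λ δ H0 ρ : ℝ} {Hn l : ℕ} {Bm : ℤ}

noncomputable def gNx (ρ : ℝ) (h : List ℕ) (p : ℕ) : ℝ :=
  if p ∈ h.toFinset then 0 else
    ρ * (∑ a ∈ range h.length, (if ((h.getD a 0 : ℕ) : ℤ) ∣ nb (walk 0 h) p - walk 0 (h.take a) then (1:ℝ) else 0) +
      ∑ c ∈ range (h.length), (if walk 0 (h.take c) ≠ walk 0 h ∧ (p:ℤ) ∣ walk 0 h - walk 0 (h.take c) then (1:ℝ) else 0))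

noncomputable def gNG (ρ : ℝ) (h : List ℕ) (p : ℕ) : ℝ := bs h.toFinset p * (1 + gNx ρ h p)

lemma sum_ite_nonneg' {m : ℕ} (Q : ℕ → Prop) [DecidablePred Q] : (0:ℝ) ≤ ∑ b ∈ range m, (if Q b then (1:ℝ) else 0) :=
  sum_nonneg fun b _ => by split_ifs <;> norm_num

lemma one_le_sum_ite' {m : ℕ} {Q : ℕ → Prop} [DecidablePred Q] {b : ℕ} (hb : b < m) (h : Q b) : (1:ℝ) ≤ ∑ b ∈ range m, (if Q b then (1:ℝ) else 0) := by
  have := single_le_sum (f := fun b => if Q b then (1:ℝ) else 0) (s := range m) (fun i _ => by split_ifs <;> norm_num) (mem_range.2 hb)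
  simpa [h] using this

lemma gNx_nonneg (hρ : 0 ≤ ρ) (h : List ℕ) (p : ℕ) : 0 ≤ gNx ρ h p := by
  unfold gNx
  split_ifs
  · exact le_rfl
  · exact mul_nonneg hρ (add_nonneg (sum_ite_nonneg' _) (sum_ite_nonneg' _))

lemma gNG_nonneg (hρ : 0 ≤ ρ) (h : List ℕ) (p : ℕ) : 0 ≤ gNG ρ h p :=
  mul_nonneg (bs_nonneg _ _) (by have := gNx_nonneg hρ h p; linarith)

lemma gNG_sum (hE : Env P Λ δ H0 ρ Hn l Bm) (hB : 2 * l * Hn ≤ Bm)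
    (h : List ℕ) (hh : ∀ q ∈ h, q ∈ P) (hl : h.length < l) :
    ∑ p ∈ P, gNG ρ h p ≤ Λ + l + 1 := by
  have hρ0 : 0 ≤ ρ := zero_le_one.trans hE.hρ1
  set y := walk 0 h with hy
  have e : ∀ p ∈ P, gNG ρ h p ≤ bs h.toFinset p + ρ * (∑ b ∈ range h.length, (if ((h.getD b 0 : ℕ) : ℤ) ∣ (y - walk 0 (h.take b)) + sgn y * p then 1 / (p:ℝ) else 0) +
      ∑ c ∈ range (h.length), (if walk 0 (h.take c) ≠ y ∧ (p:ℤ) ∣ y - walk 0 (h.take c) then 1 / (p:ℝ) else 0)) := by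
    intro p _
    unfold gNG gNx
    by_cases hp : p ∈ h.toFinset
    · rw [if_pos hp, add_zero, mul_one]
      have h1 : (0:ℝ) ≤ ∑ b ∈ range h.length, (if ((h.getD b 0 : ℕ) : ℤ) ∣ (y - walk 0 (h.take b)) + sgn y * p then 1 / (p:ℝ) else 0) :=
        sum_nonneg fun _ _ => by split_ifs <;> positivity
      have h2 : (0:ℝ) ≤ ∑ c ∈ range (h.length), (if walk 0 (h.take c) ≠ y ∧ (p:ℤ) ∣ y - walk 0 (h.take c) then 1 / (p:ℝ) else 0) :=
        sum_nonneg fun _ _ => by split_ifs <;> positivity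
      have := mul_nonneg hρ0 (add_nonneg h1 h2)
      linarith
    · rw [if_neg hp]
      have hb : bs h.toFinset p = 1 / (p:ℝ) := by unfold bs; rw [if_neg hp]
      rw [hb, mul_add, mul_one]
      refine add_le_add le_rfl (le_of_eq ?_)
      have e1 : ∀ b, nb y p - walk 0 (h.take b) = (y - walk 0 (h.take b)) + sgn y * p := fun b => by unfold nb; ring
      simp only [← hy, e1]
      rw [mul_left_comm]
      congr 1
      rw [mul_add, mul_sum, mul_sum]
      congr 1 <;> exact sum_congr rfl fun b _ => by rw [mul_ite, mul_one, mul_zero]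
  calc _ ≤ _ := sum_le_sum e
    _ = ∑ p ∈ P, bs h.toFinset p + ρ * (∑ b ∈ range h.length, ∑ p ∈ P, (if ((h.getD b 0 : ℕ) : ℤ) ∣ (y - walk 0 (h.take b)) + sgn y * p then 1 / (p:ℝ) else 0) +
      ∑ c ∈ range (h.length), ∑ p ∈ P, (if walk 0 (h.take c) ≠ y ∧ (p:ℤ) ∣ y - walk 0 (h.take c) then 1 / (p:ℝ) else 0)) := by
        rw [sum_add_distrib, ← mul_sum, sum_add_distrib]
        congr 3 <;> rw [sum_comm]
    _ ≤ (l + Λ) + ρ * (∑ b ∈ range h.length, δ + ∑ c ∈ range (h.length), δ) := by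
        refine add_le_add ((sum_bs hE.sum _).trans ?_) (mul_le_mul_of_nonneg_left (add_le_add (sum_le_sum fun b hb => ?_) (sum_le_sum fun c hc => ?_)) hρ0)
        · have : h.toFinset.card ≤ l := (List.toFinset_card_le h).trans hl.le
          have : (h.toFinset.card : ℝ) ≤ l := by exact_mod_cast this
          linarith
        · refine hE.hres _ (hh _ ?_) _ _ (sgn_cases y)
          rw [List.getD_eq_getElem _ _ (by simpa using hb)]; exact List.getElem_mem _
        · by_cases hne : walk 0 (h.take c) ≠ y
          · simp only [hne, ne_eq, not_false_eq_true, true_and]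
            refine hE.hdiv _ (sub_ne_zero.2 hne.symm) ?_
            have := vert_dist (l := l) (w := h) (w' := h.take c) (fun p hp => hE.le p (hh p hp)) (fun p hp => hE.le p (hh p (List.mem_of_mem_take hp))) hl.le
              (by rw [List.length_take]; omega) 0 0
            simp only [sub_zero, abs_zero, zero_add] at this
            exact this.trans hB
          · simp [hne]; exact hE.hδ
    _ ≤ _ := by
        rw [sum_const, card_range, nsmul_eq_mul]
        have := hE.hρδ
        have h0 : (h.length:ℝ) ≤ l := by exact_mod_cast hl.le
        have h3 := mul_nonneg hρ0 hE.hδ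
        nlinarith [mul_le_mul_of_nonneg_left h0 h3]

lemma iw_hp (h w : List ℕ) : iw (w.toFinset \ h.toFinset) = hp (fun h p => bs h.toFinset p) h w := by
  induction w generalizing h with
  | nil => simp [iw, hp]
  | cons p w ih =>
    rw [hp, List.toFinset_cons, iw_step, ← ih]
    congr 2
    ext x; simp [or_comm]

lemma hp_mono {g g' : List ℕ → ℕ → ℝ} (hg : ∀ h p, 0 ≤ g h p) (hgg : ∀ h p, g h p ≤ g' h p) (h w : List ℕ) : hp g h w ≤ hp g' h w := by
  induction w generalizing h with
  | nil => simp [hp]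
  | cons p w ih => exact mul_le_mul (hgg _ _) (ih _) (hp_nonneg hg _ _) ((hg _ _).trans (hgg _ _))

lemma bs_le_gNG (hρ : 0 ≤ ρ) (h : List ℕ) (p : ℕ) : bs h.toFinset p ≤ gNG ρ h p := by
  unfold gNG
  exact le_mul_of_one_le_right (bs_nonneg _ _) (by have := gNx_nonneg hρ h p; linarith)

lemma hp_one_step {g g' : List ℕ → ℕ → ℝ} (hg : ∀ h p, 0 ≤ g h p) (hgg : ∀ h p, g h p ≤ g' h p) (h : List ℕ) (w w' : List ℕ) (p : ℕ)
    (hx : g (h ++ w) p * ρ ≤ g' (h ++ w) p) (hρ : 0 ≤ ρ) : hp g h (w ++ p :: w') * ρ ≤ hp g' h (w ++ p :: w') := by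
  rw [hp_append, hp_append, hp, hp]
  have h1 := hp_mono hg hgg h w
  have h2 := hp_mono hg hgg ((h ++ w) ++ [p]) w'
  have n1 := hp_nonneg hg h w
  have n2 := hp_nonneg hg ((h ++ w) ++ [p]) w'
  have n3 := hg (h ++ w) p
  have n4 : 0 ≤ g (h ++ w) p * ρ := mul_nonneg n3 hρ
  calc _ = hp g h w * ((g (h ++ w) p * ρ) * hp g (h ++ w ++ [p]) w') := by ring
    _ ≤ _ := mul_le_mul h1 (mul_le_mul hx h2 n2 (n4.trans hx)) (mul_nonneg n4 n2) (n1.trans h1)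

lemma NB_not_good {w : List ℕ} (hodd : ∀ p ∈ w, Odd p) (hpos : ∀ p ∈ w, 0 < p) (hNB : NB w) (hng : ¬ Good w) :
    ∃ k < w.length, (∃ a < k, w.getD a 0 = w.getD k 0 ∧ ¬ ((w.getD k 0 : ℕ):ℤ) ∣ alt (w.take k) - alt (w.take a)) ∨
     (w.getD k 0 ∉ w.take k ∧ ((∃ a < k, ((w.getD a 0 : ℕ):ℤ) ∣ walk 0 (w.take (k+1)) - walk 0 (w.take a)) ∨
       (∃ c < k, walk 0 (w.take c) ≠ walk 0 (w.take k) ∧ ((w.getD k 0 : ℕ):ℤ) ∣ walk 0 (w.take k) - walk 0 (w.take c)))) := by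
  have hex : ∃ k, ¬ Good (w.take k) := ⟨w.length, by rwa [List.take_length]⟩
  set m := Nat.find hex with hm
  have hm1 : ¬ Good (w.take m) := Nat.find_spec hex
  have hm0 : m ≠ 0 := by
    intro h0; rw [h0] at hm1; apply hm1; simp [Good]
  obtain ⟨k, hk⟩ := Nat.exists_eq_succ_of_ne_zero hm0
  have hgk : Good (w.take k) := by
    by_contra h; have := Nat.find_min' hex h; omega
  have hkl : k < w.length := by
    by_contra h
    have h1 : m ≤ w.length := Nat.find_min' hex (by rwa [List.take_length])
    omega
  rw [hk, Nat.succ_eq_add_one] at hm1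
  set p := w.getD k 0 with hp
  have htk : ∀ {j c : ℕ}, c ≤ j → (w.take j).take c = w.take c := fun h => by rw [List.take_take, min_eq_left h]
  have hlk : (w.take k).length = k := by rw [List.length_take]; omega
  have hlk1 : (w.take (k+1)).length = k+1 := by rw [List.length_take]; omega
  have hgd : ∀ {j a : ℕ}, a < j → (w.take j).getD a 0 = w.getD a 0 := fun {j a} h => by
    simp [List.getD_eq_getElem?_getD, List.getElem?_take, h]
  refine ⟨k, hkl, ?_⟩
  have hok := (good_iff (odd_take hodd k) 0).1 hgk
  by_cases hpin : p ∈ w.take k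
  · left
    obtain ⟨a, ha, hae⟩ := List.mem_iff_getElem.1 hpin
    rw [hlk] at ha
    have hae' : w.getD a 0 = p := by
      rw [← hgd ha, List.getD_eq_getElem _ _ (by omega)]; exact hae
    refine ⟨a, ha, hae', fun hd => ?_⟩
    have := hgk.2 a (by omega) k (by omega) (by rw [hgd ha, htk le_rfl, htk ha.le, hae']; exact hd)
    rcases this with h | h
    · omega
    · refine NB_index hNB a (by omega) ?_
      rw [hae', ← h]
  · right
    refine ⟨hpin, ?_⟩
    rw [good_iff (odd_take hodd _) 0] at hm1
    have hnd : (w.take (k+1)).Nodup := by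
      rw [take_succ_getD hkl, List.nodup_append]
      refine ⟨hok.1, by simp, fun a ha b hb => ?_⟩
      simp only [List.mem_singleton] at hb
      rintro rfl; exact hpin (by rw [hp, ← hb]; exact ha)
    have hm2 : ∃ a < k+1, ∃ c ≤ k+1, ((w.getD a 0 : ℕ):ℤ) ∣ walk 0 (w.take c) - walk 0 (w.take a) ∧ c ≠ a ∧ c ≠ a+1 := by
      by_contra hcon
      apply hm1
      refine ⟨hnd, fun a ha c hc hd => ?_⟩
      rw [hlk1] at ha hc
      rw [hgd ha, htk hc, htk ha.le] at hd
      by_contra h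
      push Not at h
      exact hcon ⟨a, ha, c, hc, hd, h.1, h.2⟩
    obtain ⟨a, ha, c, hc, hd, n1, n2⟩ := hm2
    by_cases hak : a < k
    · left
      by_cases hck : c ≤ k
      · exfalso
        have := hok.2 a (by omega) c (by omega) (by rw [hgd hak, htk hck, htk hak.le]; exact hd)
        omega
      · have : c = k + 1 := by omega
        exact ⟨a, hak, this ▸ hd⟩
    · right
      have : a = k := by omega
      subst this
      have hck : c < a := by omega
      refine ⟨c, hck, fun heq => ?_, by rw [← dvd_neg, neg_sub]; exact hd⟩
      have h3 := hok.2 c (by omega) a (by omega) (by rw [htk hck.le, htk le_rfl, heq, sub_self]; exact dvd_zero _)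
      rcases h3 with h3 | h3
      · omega
      · have h4 := walk_step (w := w) (a := c) (by omega) 0
        rw [← h3, ← heq] at h4
        have h5 := abs_nb_sub (walk 0 (w.take c)) (w.getD c 0)
        rw [← h4, sub_self, abs_zero] at h5
        have h6 := hpos (w.getD c 0) (by rw [List.getD_eq_getElem _ _ (by omega)]; exact List.getElem_mem _)
        omega

lemma nongood_weight (hE : Env P Λ δ H0 ρ Hn l Bm) {w : List ℕ} (hw : w ∈ words P l) (hNB : NB w) (hng : ¬ Good w) :
    ∃ NC : Finset ℕ, (∀ q ∈ NC, ∃ k k' : Fin l, xW w l k = q ∧ xW w l k' = q ∧ ¬ (q:ℤ) ∣ alt (w.take k) - alt (w.take k')) ∧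
     iw w.toFinset * iw NC * ρ ≤ hp (gNG ρ) [] w := by
  obtain ⟨hl, hwP⟩ := mem_words.1 hw
  have hρ0 : 0 ≤ ρ := zero_le_one.trans hE.hρ1
  have hbase : iw w.toFinset = hp (fun h p => bs h.toFinset p) [] w := by rw [← iw_hp]; simp
  have hbn : ∀ (h : List ℕ) (p : ℕ), 0 ≤ (fun (h : List ℕ) (p : ℕ) => bs h.toFinset p) h p := fun h p => bs_nonneg _ _
  obtain ⟨k, hk, h | h⟩ := NB_not_good (fun p hp => hE.odd p (hwP p hp)) (fun p hp => (hE.prime p (hwP p hp)).pos) hNB hng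
  · obtain ⟨a, ha, he, hd⟩ := h
    refine ⟨{w.getD k 0}, ?_, ?_⟩
    · intro q hq
      rw [mem_singleton] at hq; subst hq
      exact ⟨⟨k, by omega⟩, ⟨a, by omega⟩, rfl, he, hd⟩
    · have hq : w.getD k 0 ∈ P := hwP _ (by rw [List.getD_eq_getElem _ _ hk]; exact List.getElem_mem _)
      have h1 : iw {w.getD k 0} * ρ ≤ 1 := by
        unfold iw; rw [prod_singleton, one_div, inv_mul_le_iff₀ (by exact_mod_cast (hE.prime _ hq).pos), mul_one]
        exact hE.hρH.trans (hE.ge _ hq)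
      rw [mul_assoc]
      refine (mul_le_of_le_one_right (iw_nonneg _) h1).trans ?_
      rw [hbase]
      exact hp_mono hbn (bs_le_gNG hρ0) _ _
  · refine ⟨∅, by simp, ?_⟩
    have h0 : iw ∅ = 1 := by simp [iw]
    rw [h0, mul_one, hbase]
    have hsplit : w = w.take k ++ w.getD k 0 :: w.drop (k+1) := by
      have := List.take_append_drop (k+1) w
      rw [take_succ_getD hk, List.append_assoc] at this
      exact this.symm
    have hlk : (w.take k).length = k := by rw [List.length_take]; omega
    have htk : ∀ {c : ℕ}, c ≤ k → (w.take k).take c = w.take c := fun h => by rw [List.take_take, min_eq_left h]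
    have hgd : ∀ {a : ℕ}, a < k → (w.take k).getD a 0 = w.getD a 0 := fun {a} h => by
      simp [List.getD_eq_getElem?_getD, List.getElem?_take, h]
    have hx : bs (w.take k).toFinset (w.getD k 0) * ρ ≤ gNG ρ (w.take k) (w.getD k 0) := by
      unfold gNG
      refine mul_le_mul_of_nonneg_left ?_ (bs_nonneg _ _)
      unfold gNx
      rw [if_neg (by rw [List.mem_toFinset]; exact h.1)]
      rcases h.2 with ⟨a, ha, hd⟩ | ⟨c, hc, hne, hd⟩
      · refine auxAE hρ0 (one_le_sum_ite' (b := a) (by omega) ?_) (sum_ite_nonneg' _)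
        rw [hgd ha, htk ha.le, ← walk_step hk]; exact hd
      · rw [add_comm (∑ a ∈ _, _)]
        refine auxAE hρ0 (one_le_sum_ite' (b := c) (by omega) ?_) (sum_ite_nonneg' _)
        rw [htk hc.le]; exact ⟨hne, hd⟩
    have := hp_one_step (g := fun (h : List ℕ) (p : ℕ) => bs h.toFinset p) (g' := gNG ρ) (ρ := ρ) hbn (bs_le_gNG hρ0) [] (w.take k) (w.drop (k+1)) (w.getD k 0) (by simpa using hx) hρ0
    rw [← hsplit] at this
    exact this

end
end KK

set_option linter.all false
set_option linter.unusedVariables false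
set_option linter.unusedSectionVars false
namespace KK
open Finset
open scoped Classical

section
variable {P : Finset ℕ} {Λ δ H0 ρ : ℝ} {Hn l : ℕ} {Bm : ℤ}

noncomputable def ngw (P : Finset ℕ) (l : ℕ) : Finset (List ℕ) := (words P l).filter fun w => NB w ∧ ¬ Good w

lemma xW_mem' {w : List ℕ} (hw : w ∈ words P l) (k : Fin l) : xW w l k ∈ P := by
  obtain ⟨h1, h2⟩ := mem_words.1 hw
  unfold xW
  rw [List.getD_eq_getElem _ _ (by omega)]
  exact h2 _ (List.getElem_mem _)

lemma ng_avg (hE : Env P Λ δ H0 ρ Hn l Bm) (hΛ0 : 0 ≤ Λ) (hHn : 1 ≤ Hn) (hB : 2 * l * Hn ≤ Bm) (π a : ℤ) (N : ℕ) :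
    ∑ w ∈ ngw P l, ∑ n ∈ range N, parI π (a + n) * |∏ k, (indd (xW w l k) (a + n + uW π w l k) - 1 / xW w l k)| ≤
      N * 3 ^ l * ((Λ + l + 1) ^ l / ρ) + (Hn:ℝ) ^ l * (4 * (Hn:ℝ) ^ l) := by
  have hρ : 0 < ρ := lt_of_lt_of_le one_pos hE.hρ1
  have e : ∀ w ∈ ngw P l, ∑ n ∈ range N, parI π (a + n) * |∏ k, (indd (xW w l k) (a + n + uW π w l k) - 1 / xW w l k)| ≤
      N * 3 ^ l * (hp (gNG ρ) [] w / ρ) + 4 * (Hn:ℝ) ^ l := by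
    intro w hw
    obtain ⟨hw1, hNB, hng⟩ := mem_filter.1 hw
    obtain ⟨NC, hNC, hwt⟩ := nongood_weight hE hw1 hNB hng
    have h := fam_abs hE.prime (two_notin hE) (H := Hn) (by exact_mod_cast hHn) (fun q hq => by exact_mod_cast hE.le q hq)
      (xW w l) (uW π w l) (xW_mem' hw1) NC (by
        intro q hq
        obtain ⟨k, k', h1, h2, h3⟩ := hNC q hq
        refine ⟨k, k', h1, h2, ?_⟩
        unfold uW
        rw [← mul_sub, dvd_sgn]; exact h3) π a N
    refine h.trans ?_
    rw [Fintype.card_fin, image_xW (mem_words.1 hw1).1]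
    refine add_le_add ?_ le_rfl
    rw [mul_assoc, mul_assoc]
    refine mul_le_mul_of_nonneg_left (mul_le_mul_of_nonneg_left ?_ (by positivity)) (by positivity)
    rw [le_div_iff₀ hρ]
    exact hwt
  refine (sum_le_sum e).trans ?_
  rw [sum_add_distrib, ← mul_sum, ← sum_div, sum_const, nsmul_eq_mul]
  have hs : ∑ w ∈ ngw P l, hp (gNG ρ) [] w ≤ (Λ + l + 1) ^ l := by
    refine (sum_le_sum_of_subset_of_nonneg (filter_subset _ _) fun w _ _ => hp_nonneg (gNG_nonneg hρ.le) _ _).trans ?_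
    exact seqsum P l (gNG_nonneg hρ.le) (by positivity) l [] (by simp) (by simp) (fun h hh hl => gNG_sum hE hB h hh hl)
  have hcw : ((ngw P l).card : ℝ) ≤ (Hn:ℝ) ^ l := by
    have h2 : ((ngw P l).card : ℝ) ≤ (words P l).card := by exact_mod_cast card_le_card (filter_subset _ _)
    rw [card_words] at h2
    exact h2.trans (pow_le_pow_left₀ (by positivity) (by exact_mod_cast card_P_le hE) _)
  refine add_le_add (mul_le_mul_of_nonneg_left (div_le_div_of_nonneg_right hs hρ.le) (by positivity)) (mul_le_mul_of_nonneg_right hcw (by positivity))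

lemma indd_sub_abs {p : ℕ} (hp : 0 < p) (n : ℤ) : |indd p n - 1 / p| ≤ 1 := by
  have h1 : (1:ℝ) ≤ p := by exact_mod_cast hp
  have h2 : 1 / (p:ℝ) ≤ 1 := by rw [div_le_one (by linarith)]; exact h1
  have h3 : 0 ≤ 1 / (p:ℝ) := by positivity
  unfold indd
  split_ifs <;> rw [abs_le] <;> constructor <;> linarith

lemma tt_abs {B : Finset ℤ} {z θ : ℝ} (hz : 0 ≤ z) (h0 : 0 ≤ θ) (h1 : θ ≤ 1) (n : ℤ) (p : ℕ) :
    |tt B P z θ n p| ≤ z * (|indd p n - 1 / p| * θ ^ om P n) := by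
  unfold tt
  have hn : 0 ≤ |indd p n - 1 / p| * θ ^ om P n := mul_nonneg (abs_nonneg _) (pow_nonneg h0 _)
  split_ifs
  · rw [abs_mul, abs_mul, abs_mul, abs_of_nonneg hz, abs_of_nonneg (pow_nonneg h0 (om P n)), abs_of_nonneg (pow_nonneg h0 (om P (nb n p)))]
    exact mul_le_mul_of_nonneg_left (mul_le_of_le_one_right hn (pow_le_one₀ h0 h1)) hz
  · rw [abs_zero]; positivity

lemma tt_abs' {B : Finset ℤ} {z θ : ℝ} (hz : 0 ≤ z) (h0 : 0 ≤ θ) (h1 : θ ≤ 1) (n : ℤ) (p : ℕ) :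
    |tt B P z θ n p| ≤ z * |indd p n - 1 / p| :=
  (tt_abs hz h0 h1 n p).trans (mul_le_mul_of_nonneg_left (mul_le_of_le_one_right (abs_nonneg _) (pow_le_one₀ h0 h1)) hz)

lemma tw_tt_abs (hodd : ∀ p ∈ P, Odd p) {B : Finset ℤ} {z θ : ℝ} (hz : 0 ≤ z) (h0 : 0 ≤ θ) (h1 : θ ≤ 1) {m π : ℤ} (hpar : (2:ℤ) ∣ m - π)
    {w : List ℕ} (hw : w ∈ words P l) :
    |tw (tt B P z θ) m w| ≤ z ^ l * |∏ k, (indd (xW w l k) (m + uW π w l k) - 1 / xW w l k)| := by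
  obtain ⟨hl, hP⟩ := mem_words.1 hw
  have hzz : z ^ l = ∏ k : Fin l, z := by simp
  rw [tw_eq, hl, abs_prod, abs_prod, hzz, ← prod_mul_distrib, Finset.prod_range]
  refine prod_le_prod (fun _ _ => abs_nonneg _) fun k _ => ?_
  have ho : ∀ p ∈ w, Odd p := fun p hp => hodd p (hP p hp)
  have e1 : walk m (w.take k) = m + uW π w l k := by rw [walk_eq (odd_take ho _), sgn_par hpar]; rfl
  rw [e1]
  exact tt_abs' hz h0 h1 _ _

lemma om_pow (hΛ1 : 1 ≤ Λ) (k : ℕ) : k * (1 - 1 / Λ) ^ k ≤ Λ := by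
  have hΛ0 : 0 < Λ := by linarith
  have hi1 : 1 / Λ ≤ 1 := by rw [div_le_one hΛ0]; exact hΛ1
  have hi0 : 0 < 1 / Λ := by positivity
  have hb := one_add_mul_le_pow (a := 1 / Λ) (by linarith) k
  have h2 : (1 - 1 / Λ) ^ k * (1 + 1 / Λ) ^ k ≤ 1 := by
    rw [← mul_pow]
    exact pow_le_one₀ (by nlinarith) (by nlinarith)
  have h3 : 0 ≤ (1 - 1 / Λ) ^ k := pow_nonneg (by linarith) _
  have h4 : (1 - 1 / Λ) ^ k * (k * (1 / Λ)) ≤ 1 := (mul_le_mul_of_nonneg_left (by linarith) h3).trans h2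
  have h5 : k * (1 - 1 / Λ) ^ k = ((1 - 1 / Λ) ^ k * (k * (1 / Λ))) * Λ := by field_simp
  rw [h5]; nlinarith

lemma tt_sum (hodd : ∀ p ∈ P, Odd p) (hΛ1 : 1 ≤ Λ) (hs : ∑ p ∈ P, 1 / (p:ℝ) ≤ Λ) {B : Finset ℤ} {z : ℝ} (hz : 0 ≤ z) (n : ℤ) :
    ∑ p ∈ P, |tt B P z (1 - 1 / Λ) n p| ≤ 2 * z * Λ := by
  have hΛ0 : 0 < Λ := by linarith
  have hi1 : 1 / Λ ≤ 1 := by rw [div_le_one hΛ0]; exact hΛ1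
  have hi0 : 0 < 1 / Λ := by positivity
  set θ := 1 - 1 / Λ with hθ
  have h0 : 0 ≤ θ := by linarith
  have h1 : θ ≤ 1 := by linarith
  have hind : ∑ p ∈ P, indd p n = om P n := by
    unfold indd om; rw [sum_ite, sum_const_zero, add_zero, sum_const, nsmul_eq_mul, mul_one]
  calc ∑ p ∈ P, |tt B P z θ n p| ≤ ∑ p ∈ P, z * ((indd p n + 1 / p) * θ ^ om P n) := by
        refine sum_le_sum fun p hp => (tt_abs hz h0 h1 n p).trans ?_
        refine mul_le_mul_of_nonneg_left (mul_le_mul_of_nonneg_right ?_ (pow_nonneg h0 _)) hz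
        refine (abs_sub _ _).trans (le_of_eq ?_)
        rw [abs_of_nonneg (indd_nonneg _ _), abs_of_nonneg (by positivity)]
    _ = z * ((om P n + ∑ p ∈ P, 1 / (p:ℝ)) * θ ^ om P n) := by
        rw [← mul_sum, ← sum_mul, sum_add_distrib, hind]
    _ ≤ z * (Λ + Λ) := by
        refine mul_le_mul_of_nonneg_left ?_ hz
        rw [add_mul]
        refine add_le_add (om_pow hΛ1 _) ?_
        exact (mul_le_mul_of_nonneg_right hs (pow_nonneg h0 _)).trans (mul_le_of_le_one_right hΛ0.le (pow_le_one₀ h0 h1))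
    _ = _ := by ring

lemma tt_le {B : Finset ℤ} {z θ : ℝ} (hz : 0 ≤ z) (h0 : 0 ≤ θ) (h1 : θ ≤ 1) (hpos : ∀ p ∈ P, 0 < p) (n : ℤ) (p : ℕ) (hp : p ∈ P) :
    |tt B P z θ n p| ≤ z :=
  (tt_abs' hz h0 h1 n p).trans (mul_le_of_le_one_right hz (indd_sub_abs (hpos p hp) n))

lemma tt_ker (hodd : ∀ p ∈ P, Odd p) (B : Finset ℤ) (z θ : ℝ) : Ker B P nb (tt B P z θ) where
  supp := by
    intro n p hp h
    unfold tt at h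
    by_contra hc
    rw [if_neg hc] at h
    exact h rfl
  inv := fun n p hp => nb_nb (hodd p hp) n
  sym := by
    intro n p hp
    unfold tt
    rw [nb_nb (hodd p hp)]
    have h1 : indd p (nb n p) = indd p n := by
      unfold indd
      have : (p:ℤ) ∣ nb n p ↔ (p:ℤ) ∣ n := by
        have := nb_sub_dvd n p
        rw [← dvd_iff_dvd_of_dvd_sub this]
      simp only [this]
    rw [h1]
    simp only [and_comm]
    congr 1
    ring

noncomputable def NGf (t : ℤ → ℕ → ℝ) (P : Finset ℕ) (l : ℕ) (f : ℤ → ℝ) (n : ℤ) : ℝ := ∑ w ∈ ngw P l, tw t n w * f (walk n w)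

lemma ng_bound (hE : Env P Λ δ H0 ρ Hn l Bm) (hΛ1 : 1 ≤ Λ) (hHn : 1 ≤ Hn) (hB : 2 * l * Hn ≤ Bm) (a : ℤ) (N : ℕ)
    {z : ℝ} (hz : 0 ≤ z) {f : ℤ → ℝ} {F : ℝ} (hF : ∀ n, |f n| ≤ F) :
    nsq (Ioc a (a + N)) (NGf (tt (Ioc a (a + N)) P z (1 - 1 / Λ)) P l f) ≤
      F ^ 2 * (2 * z * Λ) ^ l * (z ^ l * (2 * (N * 3 ^ l * ((Λ + l + 1) ^ l / ρ) + (Hn:ℝ) ^ l * (4 * (Hn:ℝ) ^ l)))) := by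
  have hΛ0 : 0 < Λ := by linarith
  have hi1 : 1 / Λ ≤ 1 := by rw [div_le_one hΛ0]; exact hΛ1
  have hi0 : 0 < 1 / Λ := by positivity
  set θ := 1 - 1 / Λ with hθ
  set B := Ioc a (a + N) with hBd
  set t := tt B P z θ with ht
  have hF0 : 0 ≤ F := (abs_nonneg _).trans (hF 0)
  have e : ∀ n, NGf t P l f n ^ 2 ≤ F ^ 2 * (2 * z * Λ) ^ l * ∑ w ∈ ngw P l, |tw t n w| := by
    intro n
    have h1 : |NGf t P l f n| ≤ F * ∑ w ∈ ngw P l, |tw t n w| := by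
      unfold NGf
      refine (abs_sum_le_sum_abs _ _).trans ?_
      rw [mul_sum]
      refine sum_le_sum fun w _ => ?_
      rw [abs_mul, mul_comm]
      exact mul_le_mul_of_nonneg_right (hF _) (abs_nonneg _)
    have h2 : ∑ w ∈ ngw P l, |tw t n w| ≤ (2 * z * Λ) ^ l :=
      (sum_le_sum_of_subset_of_nonneg (filter_subset _ _) fun w _ _ => abs_nonneg _).trans
       (tw_abs_sum (fun n => tt_sum hE.odd hΛ1 hE.sum hz n) (by positivity) l n)
    have h3 : 0 ≤ ∑ w ∈ ngw P l, |tw t n w| := sum_nonneg fun _ _ => abs_nonneg _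
    rw [← sq_abs]
    calc |NGf t P l f n| ^ 2 ≤ (F * ∑ w ∈ ngw P l, |tw t n w|) ^ 2 := pow_le_pow_left₀ (abs_nonneg _) h1 2
      _ = F ^ 2 * (∑ w ∈ ngw P l, |tw t n w|) * ∑ w ∈ ngw P l, |tw t n w| := by ring
      _ ≤ _ := mul_le_mul_of_nonneg_right (mul_le_mul_of_nonneg_left h2 (by positivity)) h3
  unfold nsq
  refine (sum_le_sum fun n _ => e n).trans ?_
  rw [← mul_sum]
  refine mul_le_mul_of_nonneg_left ?_ (by positivity)
  have e2 : ∀ n, ∑ w ∈ ngw P l, |tw t n w| ≤ z ^ l * ∑ w ∈ ngw P l, parI 0 n * |∏ k, (indd (xW w l k) (n + uW 0 w l k) - 1 / xW w l k)| +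
     z ^ l * ∑ w ∈ ngw P l, parI 1 n * |∏ k, (indd (xW w l k) (n + uW 1 w l k) - 1 / xW w l k)| := by
    intro n
    rw [mul_sum, mul_sum, ← sum_add_distrib]
    refine sum_le_sum fun w hw => ?_
    have hw1 := (mem_filter.1 hw).1
    unfold parI
    rcases Int.emod_two_eq_zero_or_one n with h2 | h2
    · rw [if_pos (by omega), if_neg (by omega), zero_mul, mul_zero, add_zero, one_mul]
      exact tw_tt_abs hE.odd hz (by linarith) (by linarith) (by omega) hw1
    · rw [if_neg (by omega), if_pos (by omega), zero_mul, mul_zero, zero_add, one_mul]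
      exact tw_tt_abs hE.odd hz (by linarith) (by linarith) (by omega) hw1
  refine (sum_le_sum fun n _ => e2 n).trans ?_
  rw [sum_add_distrib, ← mul_sum, ← mul_sum, ← mul_add]
  refine mul_le_mul_of_nonneg_left ?_ (pow_nonneg hz _)
  rw [hBd, Ioc_sum, Ioc_sum, sum_comm, sum_comm (s := range N), two_mul]
  exact add_le_add (ng_avg hE hΛ0.le hHn hB 0 (a + 1) N) (ng_avg hE hΛ0.le hHn hB 1 (a + 1) N)

lemma Yn_le (B : Finset ℤ) (t : ℤ → ℕ → ℝ) (f : ℤ → ℝ) (l : ℕ) :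
    Yn B P nb t f l ≤ 2 * nsq B (Top t (GW P l) f) + 2 * nsq B (NGf t P l f) := by
  unfold Yn nsq
  rw [mul_sum, mul_sum, ← sum_add_distrib]
  refine sum_le_sum fun n _ => ?_
  have : (yj P nb t f l).1 n = Top t (GW P l) f n + NGf t P l f n := by
    rw [(yj_words P t f l).1]
    unfold Top NGf GW ngw
    rw [sum_filter, sum_filter, ← sum_add_distrib]
    refine sum_congr rfl fun w _ => ?_
    by_cases h1 : Good w
    · have := NB_of_nodup h1.1
      simp [h1, this]
    · by_cases h2 : NB w <;> simp [h1, h2]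
  rw [this]
  nlinarith [sq_nonneg (Top t (GW P l) f n - NGf t P l f n)]

end
end KK

set_option linter.all false
set_option linter.unusedVariables false
set_option linter.unusedSectionVars false
namespace KK
open Finset
open scoped Classical

section
variable {P : Finset ℕ} {Λ δ H0 ρ : ℝ} {Hn l : ℕ} {Bm : ℤ}

lemma harm_le {n : ℕ} {y : ℝ} (hn : (n:ℝ) ≤ Real.exp y) (hy : 0 ≤ y) : ∑ j ∈ Icc 1 n, 1 / (j:ℝ) ≤ 1 + y := by
  have h := harmonic_le_one_add_log n
  have h1 : ((harmonic n : ℚ) : ℝ) = ∑ j ∈ Icc 1 n, 1 / (j:ℝ) := by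
    rw [harmonic_eq_sum_Icc]; push_cast; simp
  rw [h1] at h
  refine h.trans (add_le_add le_rfl ?_)
  rcases Nat.eq_zero_or_pos n with h0 | h0
  · simp [h0, hy]
  · rw [Real.log_le_iff_le_exp (by exact_mod_cast h0)]; exact hn

lemma res_bound (hge : ∀ p ∈ P, H0 ≤ p) (hle : ∀ p ∈ P, p ≤ Hn) (hpr : ∀ p ∈ P, p.Prime) (hH0 : 0 < H0) {y : ℝ} (hy : 0 ≤ y) (hHn : (Hn:ℝ) ≤ Real.exp y)
    (q : ℕ) (hq : q ∈ P) (c s : ℤ) (hs : s = 1 ∨ s = -1) :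
    ∑ p ∈ P, (if (q:ℤ) ∣ c + s * p then 1 / (p:ℝ) else 0) ≤ (2 + y) / H0 := by
  have hq0 : 0 < q := (hpr q hq).pos
  have hqr : (0:ℝ) < q := by exact_mod_cast hq0
  rw [← sum_filter]
  set S := P.filter (fun p : ℕ => (q:ℤ) ∣ c + s * p) with hS
  have hinj : Set.InjOn (fun p : ℕ => p / q) S := by
    intro p hp p' hp' h
    have h1 : (q:ℤ) ∣ c + s * p := (mem_filter.1 (mem_coe.1 hp)).2
    have h2 : (q:ℤ) ∣ c + s * p' := (mem_filter.1 (mem_coe.1 hp')).2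
    have h3 : (q:ℤ) ∣ (p:ℤ) - p' := by
      have := dvd_sub h1 h2
      rcases hs with rfl | rfl
      · have e : (p:ℤ) - p' = c + 1 * p - (c + 1 * p') := by ring
        rw [e]; exact this
      · have e : (p:ℤ) - p' = - (c + -1 * p - (c + -1 * p')) := by ring
        rw [e, dvd_neg]; exact this
    have h4 : p' ≡ p [MOD q] := (Nat.modEq_iff_dvd).2 h3
    have h5 : p' % q = p % q := h4
    simp only at h
    rw [← Nat.div_add_mod p q, ← Nat.div_add_mod p' q, h, h5]
  calc ∑ p ∈ S, 1 / (p:ℝ) ≤ ∑ p ∈ S, (fun j : ℕ => if j = 0 then 1 / H0 else 1 / (q * j)) (p / q) := by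
        refine sum_le_sum fun p hp => ?_
        have hpP := (mem_filter.1 hp).1
        have hp0 : (0:ℝ) < p := by exact_mod_cast (hpr p hpP).pos
        simp only
        split_ifs with h
        · exact one_div_le_one_div_of_le hH0 (hge p hpP)
        · have : q * (p / q) ≤ p := Nat.mul_div_le p q
          have h2 : (q:ℝ) * ((p / q : ℕ):ℝ) ≤ p := by exact_mod_cast this
          exact one_div_le_one_div_of_le (mul_pos hqr (by exact_mod_cast Nat.pos_of_ne_zero h)) h2
    _ = ∑ j ∈ S.image (fun p : ℕ => p / q), (fun j : ℕ => if j = 0 then 1 / H0 else 1 / (q * j)) j := by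
        rw [sum_image hinj]
    _ ≤ ∑ j ∈ insert 0 (Icc 1 Hn), (fun j : ℕ => if j = 0 then 1 / H0 else 1 / (q * j)) j := by
        refine sum_le_sum_of_subset_of_nonneg ?_ fun j _ _ => by
          split_ifs <;> positivity
        intro j hj
        obtain ⟨p, hp, rfl⟩ := mem_image.1 hj
        have h1 := hle p (mem_filter.1 hp).1
        have h2 := Nat.div_le_self p q
        rw [mem_insert, mem_Icc]
        rcases Nat.eq_zero_or_pos (p / q) with h0 | h0
        · left; exact h0
        · right; exact ⟨h0, h2.trans h1⟩
    _ = 1 / H0 + (1 / q) * ∑ j ∈ Icc 1 Hn, 1 / (j:ℝ) := by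
        rw [sum_insert (by simp), mul_sum]
        simp only [if_true]
        congr 1
        refine sum_congr rfl fun j hj => ?_
        rw [mem_Icc] at hj
        rw [if_neg (by omega)]
        field_simp
    _ ≤ 1 / H0 + (1 / H0) * (1 + y) := by
        refine add_le_add le_rfl (mul_le_mul (one_div_le_one_div_of_le hH0 (hge q hq)) (harm_le hHn hy) (sum_nonneg fun _ _ => by positivity) (by positivity))
    _ = _ := by field_simp; ring

lemma div_bound (hge : ∀ p ∈ P, H0 ≤ p) (hpr : ∀ p ∈ P, p.Prime) (hodd : ∀ p ∈ P, Odd p) (hH0 : 0 < H0) {y' : ℝ} (hBm : (Bm:ℝ) ≤ Real.exp y')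
    (m : ℤ) (hm : m ≠ 0) (hmB : |m| ≤ Bm) : ∑ p ∈ P, (if (p:ℤ) ∣ m then 1 / (p:ℝ) else 0) ≤ y' / H0 := by
  rw [← sum_filter]
  set S := P.filter (fun p : ℕ => (p:ℤ) ∣ m) with hS
  have h1 : ∏ p ∈ S, p ∣ m.natAbs := by
    refine Finset.prod_primes_dvd _ (fun p hp => (hpr p (mem_filter.1 hp).1).prime) fun p hp => ?_
    exact Int.natCast_dvd.1 (mem_filter.1 hp).2
  have h2 : ∏ p ∈ S, p ≤ m.natAbs := Nat.le_of_dvd (Int.natAbs_pos.2 hm) h1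
  have h3 : 3 ^ S.card ≤ ∏ p ∈ S, p := by
    rw [← prod_const]
    refine prod_le_prod (fun _ _ => by norm_num) fun p hp => ?_
    have hp' := (mem_filter.1 hp).1
    have := (hpr p hp').two_le
    have h5 := hodd p hp'
    by_contra hlt
    have : p = 2 := by omega
    rw [this] at h5; revert h5; decide
  have h4 : Real.exp S.card ≤ Real.exp y' := by
    calc Real.exp S.card = Real.exp 1 ^ S.card := by rw [← Real.exp_nat_mul, mul_one]
      _ ≤ 3 ^ S.card := pow_le_pow_left₀ (Real.exp_pos _).le (by have := Real.exp_one_lt_d9; linarith) _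
      _ ≤ m.natAbs := by exact_mod_cast h3.trans h2
      _ ≤ Bm := by
        have : ((m.natAbs : ℕ):ℤ) ≤ Bm := by rw [Int.natCast_natAbs]; exact hmB
        have h6 : (((m.natAbs : ℕ):ℤ):ℝ) ≤ (Bm:ℝ) := Int.cast_le.2 this
        rwa [Int.cast_natCast] at h6
      _ ≤ _ := hBm
  rw [Real.exp_le_exp] at h4
  calc ∑ p ∈ S, 1 / (p:ℝ) ≤ ∑ p ∈ S, 1 / H0 := sum_le_sum fun p hp => one_div_le_one_div_of_le hH0 (hge p (mem_filter.1 hp).1)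
    _ = S.card / H0 := by rw [sum_const, nsmul_eq_mul]; ring
    _ ≤ _ := div_le_div_of_nonneg_right h4 hH0.le

lemma env_mk (hge : ∀ p ∈ P, H0 ≤ p) (hle : ∀ p ∈ P, p ≤ Hn) (hpr : ∀ p ∈ P, p.Prime) (hodd : ∀ p ∈ P, Odd p) (hsum : ∑ p ∈ P, 1 / (p:ℝ) ≤ Λ) {y : ℝ} (hy : 0 ≤ y)
    (hHn : (Hn:ℝ) ≤ Real.exp y) (hBm : (Bm:ℝ) ≤ Real.exp (2 * y)) (hH : (2 * l + 1) * (2 + 2 * y) ≤ H0) :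
    Env P Λ ((2 + 2 * y) / H0) H0 (H0 / ((2 * l + 1) * (2 + 2 * y))) Hn l Bm := by
  have hD : 1 ≤ (2 * (l:ℝ) + 1) * (2 + 2 * y) := by
    have : (0:ℝ) ≤ l := by positivity
    nlinarith [mul_nonneg this hy]
  have hH0 : 0 < H0 := by linarith
  refine ⟨hpr, hodd, hge, hle, hsum, by positivity, ?_, ?_, ?_, ?_, ?_⟩
  · intro q hq c s hs
    refine (res_bound hge hle hpr hH0 hy hHn q hq c s hs).trans ?_
    gcongr; linarith
  · intro m hm hmB
    refine (div_bound hge hpr hodd hH0 hBm m hm hmB).trans ?_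
    gcongr; linarith
  · rw [le_div_iff₀ (by linarith)]; linarith
  · exact div_le_self hH0.le hD
  · have : 0 < 2 + 2 * y := by linarith
    have : (0:ℝ) < 2 * l + 1 := by positivity
    apply le_of_eq
    field_simp
end
end KK

set_option linter.all false
set_option linter.unusedVariables false
set_option linter.unusedSectionVars false
namespace KK
open Finset
open scoped Classical

structure Nm (x Λ : ℝ) (l R u : ℕ) : Prop where
  hx : 10 ^ 9 ≤ x
  hΛ : 10 ^ 6 ≤ Λ
  hΛx : Λ ≤ x ^ 70
  l1 : x ^ 75 ≤ l
  l2 : l ≤ 9 * x ^ 75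
  R1 : x ^ 25 ≤ R
  R2 : R ≤ 2 * x ^ 25
  u1 : x ^ 22 ≤ u
  u2 : u ≤ 2 * x ^ 22

section
variable {x Λ : ℝ} {l R u : ℕ}

lemma pe (hx : 1 ≤ x) {A : ℝ} (hA : 0 ≤ A) (k : ℕ) : A * x ^ k ≤ Real.exp ((A + k) * x) := by
  have h1 : A ≤ Real.exp (A * x) := by
    have := Real.add_one_le_exp (A * x)
    nlinarith
  have h2 : x ^ k ≤ Real.exp (k * x) := by
    rw [Real.exp_nat_mul]
    exact pow_le_pow_left₀ (by linarith) (by have := Real.add_one_le_exp x; linarith) _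
  rw [add_mul, Real.exp_add]
  exact mul_le_mul h1 h2 (by positivity) (Real.exp_pos _).le

lemma pk (hx : 1 ≤ x) {K : ℝ} (hK : K ≤ x) {a b : ℕ} (h : a < b) : K * x ^ a ≤ x ^ b := by
  calc K * x ^ a ≤ x * x ^ a := mul_le_mul_of_nonneg_right hK (by positivity)
    _ = x ^ (a + 1) := by ring
    _ ≤ x ^ b := pow_le_pow_right₀ hx h

lemma powexp {a b : ℝ} (ha : 0 ≤ a) (h : a ≤ Real.exp b) (n : ℕ) : a ^ n ≤ Real.exp (n * b) := by
  rw [Real.exp_nat_mul]; exact pow_le_pow_left₀ ha h n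

lemma Nm.x1 (h : Nm x Λ l R u) : 1 ≤ x := by have := h.hx; norm_num at this; linarith
lemma Nm.pw (h : Nm x Λ l R u) (k : ℕ) : 1 ≤ x ^ k := one_le_pow₀ h.x1
lemma Nm.mono (h : Nm x Λ l R u) {a b : ℕ} (hab : a ≤ b) : x ^ a ≤ x ^ b := pow_le_pow_right₀ h.x1 hab
lemma Nm.pk' (h : Nm x Λ l R u) {K : ℝ} (hK : K ≤ 10 ^ 9) {a b : ℕ} (hab : a < b) : K * x ^ a ≤ x ^ b := pk h.x1 (hK.trans h.hx) hab

lemma Nm.V1 (h : Nm x Λ l R u) : 2 * x ^ 100 ≤ ((2 * R * l : ℕ):ℝ) := by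
  push_cast
  have h1 := mul_le_mul h.R1 h.l1 (by have := h.pw 75; linarith) (by positivity)
  have : x ^ 25 * x ^ 75 = x ^ 100 := by ring
  nlinarith
lemma Nm.V2 (h : Nm x Λ l R u) : ((2 * R * l : ℕ):ℝ) ≤ 36 * x ^ 100 := by
  push_cast
  have h1 := mul_le_mul h.R2 h.l2 (by positivity) (by have := h.pw 25; linarith)
  have : 2 * x ^ 25 * (9 * x ^ 75) = 18 * x ^ 100 := by ring
  nlinarith

lemma Nm.u3 (h : Nm x Λ l R u) : (u:ℝ) * u ≤ 4 * x ^ 44 := by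
  have h1 := mul_le_mul h.u2 h.u2 (by positivity) (by have := h.pw 22; linarith)
  have : 2 * x ^ 22 * (2 * x ^ 22) = 4 * x ^ 44 := by ring
  linarith
lemma Nm.M2 (h : Nm x Λ l R u) : (2 * R:ℝ) * (2 * R) ≤ 16 * x ^ 50 := by
  have h1 := mul_le_mul h.R2 h.R2 (by positivity) (by have := h.pw 25; linarith)
  have : 2 * x ^ 25 * (2 * x ^ 25) = 4 * x ^ 50 := by ring
  linarith

lemma num1 (h : Nm x Λ l R u) : (1 + ((2 * R * l : ℕ):ℝ)) ^ (2 * R + 2 * R * (2 * R) * (1 + 7 * (u * u))) ≤ Real.exp (2 * R * l : ℕ) := by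
  have hx1 := h.x1
  have hb : 1 + ((2 * R * l : ℕ):ℝ) ≤ Real.exp (137 * x) := by
    have := pe hx1 (A := 37) (by norm_num) 100
    have h2 := h.V2
    have h3 := h.pw 100
    norm_num at this
    linarith
  have h1 := powexp (by positivity) hb (2 * R + 2 * R * (2 * R) * (1 + 7 * (u * u)))
  refine h1.trans (Real.exp_le_exp.2 ?_)
  have hE : ((2 * R + 2 * R * (2 * R) * (1 + 7 * (u * u)) : ℕ):ℝ) ≤ 468 * x ^ 94 := by
    push_cast
    have h44 := h.pw 44
    have e1 : 1 + 7 * ((u:ℝ) * u) ≤ 29 * x ^ 44 := by have := h.u3; linarith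
    have e2 := mul_le_mul h.M2 e1 (by positivity) (by positivity)
    have e3 : 16 * x ^ 50 * (29 * x ^ 44) = 464 * x ^ 94 := by ring
    have e4 := h.R2
    have e5 := h.mono (show 25 ≤ 94 by norm_num)
    linarith
  calc ((2 * R + 2 * R * (2 * R) * (1 + 7 * (u * u)) : ℕ):ℝ) * (137 * x) ≤ 468 * x ^ 94 * (137 * x) := by gcongr
    _ = 64116 * x ^ 95 := by ring
    _ ≤ x ^ 100 := h.pk' (by norm_num) (by norm_num)
    _ ≤ _ := by have := h.V1; have := h.pw 100; linarith

lemma num2 (h : Nm x Λ l R u) : Λ ^ (2 * R * (2 * R) * (2 + 4 * (u * u))) ≤ Real.exp (2 * R * l : ℕ) := by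
  have hx1 := h.x1
  have hΛ := h.hΛ
  have hb : Λ ≤ Real.exp (71 * x) := by
    have := pe hx1 (A := 1) (by norm_num) 70
    norm_num at this
    have h2 := h.hΛx
    linarith
  have h1 := powexp (by linarith) hb (2 * R * (2 * R) * (2 + 4 * (u * u)))
  refine h1.trans (Real.exp_le_exp.2 ?_)
  have hE : ((2 * R * (2 * R) * (2 + 4 * (u * u)) : ℕ):ℝ) ≤ 288 * x ^ 94 := by
    push_cast
    have h44 := h.pw 44
    have e1 : 2 + 4 * ((u:ℝ) * u) ≤ 18 * x ^ 44 := by have := h.u3; linarith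
    have e2 := mul_le_mul h.M2 e1 (by positivity) (by positivity)
    have e3 : 16 * x ^ 50 * (18 * x ^ 44) = 288 * x ^ 94 := by ring
    linarith
  calc ((2 * R * (2 * R) * (2 + 4 * (u * u)) : ℕ):ℝ) * (71 * x) ≤ 288 * x ^ 94 * (71 * x) := by gcongr
    _ = 20448 * x ^ 95 := by ring
    _ ≤ x ^ 100 := h.pk' (by norm_num) (by norm_num)
    _ ≤ _ := by have := h.V1; have := h.pw 100; linarith

lemma sqrt_ge (h : Nm x Λ l R u) : 1000 ≤ Real.sqrt Λ := by
  refine Real.le_sqrt_of_sq_le ?_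
  have := h.hΛ; norm_num at this ⊢; linarith

lemma num3 (h : Nm x Λ l R u) (V : ℕ) : Λ ^ V * (Real.exp (Real.exp 1 * (2 * V)) / Real.exp 1 ^ (V * ⌈Real.sqrt Λ⌉₊)) ≤ 1 := by
  have hΛ := h.hΛ
  norm_num at hΛ
  set s := Real.sqrt Λ with hs
  have hs1 := sqrt_ge h
  rw [← hs] at hs1
  have hss : Λ = s ^ 2 := (Real.sq_sqrt (by linarith)).symm
  have h1 : Λ ≤ Real.exp (s - 6) := by
    have h2 := Real.quadratic_le_exp_of_nonneg (x := (s - 6) / 2) (by linarith)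
    have h3 : Real.exp (s - 6) = Real.exp ((s-6)/2) ^ 2 := by rw [← Real.exp_nat_mul]; congr 1; push_cast; ring
    rw [h3, hss]
    refine pow_le_pow_left₀ (by linarith) ?_ 2
    nlinarith
  have h2 := powexp (by linarith) h1 V
  have h3 : Real.exp (Real.exp 1 * (2 * V)) ≤ Real.exp (6 * V) := by
    refine Real.exp_le_exp.2 ?_
    have := Real.exp_one_lt_d9
    have hv : (0:ℝ) ≤ V := by positivity
    nlinarith
  have h4 : Real.exp (V * s) ≤ Real.exp 1 ^ (V * ⌈s⌉₊) := by
    rw [← Real.exp_nat_mul, mul_one]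
    refine Real.exp_le_exp.2 ?_
    push_cast
    exact mul_le_mul_of_nonneg_left (Nat.le_ceil s) (by positivity)
  rw [mul_div_assoc', div_le_one (by positivity)]
  refine le_trans (mul_le_mul h2 h3 (Real.exp_pos _).le (Real.exp_pos _).le) (le_trans (le_of_eq ?_) h4)
  rw [← Real.exp_add]; congr 1; ring

lemma num4 (h : Nm x Λ l R u) {Hn N : ℕ} (hHn : (Hn:ℝ) ≤ Real.exp (x ^ 100)) (hHn1 : 1 ≤ Hn) (hN : Real.exp (Λ * x ^ 200) ≤ N) :
    (Hn:ℝ) ^ (2 * R * l) * (4 * ((2 * R * l * ⌈Real.sqrt Λ⌉₊ : ℕ) + 1) * (Hn:ℝ) ^ (2 * R * l * ⌈Real.sqrt Λ⌉₊) * (Hn:ℝ) ^ (2 * R * l + 2 * R * l * ⌈Real.sqrt Λ⌉₊)) ≤ N := by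
  have hΛ := h.hΛ
  norm_num at hΛ
  have hV1 := h.V1
  have hV2 := h.V2
  set V := 2 * R * l with hV
  set s := Real.sqrt Λ with hs
  have hs1 := sqrt_ge h
  rw [← hs] at hs1
  have hss : Λ = s ^ 2 := (Real.sq_sqrt (by linarith)).symm
  set J := V * ⌈s⌉₊ with hJ
  have hJ2 : (J:ℝ) ≤ V * (s + 1) := by
    rw [hJ]; push_cast
    exact mul_le_mul_of_nonneg_left (Nat.ceil_lt_add_one (by linarith)).le (by positivity)
  have hJ1 : (1:ℝ) ≤ J := by
    rw [hJ]; push_cast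
    have : s ≤ ⌈s⌉₊ := Nat.le_ceil s
    have := h.pw 100
    nlinarith
  have hy : 8 ≤ x ^ 100 := by
    have := h.pk' (K := 8) (by norm_num) (show 0 < 100 by norm_num)
    simpa using this
  have hH0 : (0:ℝ) ≤ Hn := by positivity
  have e1 : 4 * ((J:ℝ) + 1) ≤ Real.exp (J * x ^ 100) := by
    have := Real.add_one_le_exp (J * x ^ 100)
    nlinarith
  refine le_trans ?_ hN
  calc _ ≤ Real.exp (V * x ^ 100) * (Real.exp (J * x ^ 100) * Real.exp (J * x ^ 100) * Real.exp ((V + J : ℕ) * x ^ 100)) := by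
        refine mul_le_mul (powexp hH0 hHn _) (mul_le_mul (mul_le_mul e1 (powexp hH0 hHn _) (by positivity) (by positivity)) (powexp hH0 hHn _) (by positivity) (by positivity)) (by positivity) (by positivity)
    _ = Real.exp ((2 * V + 3 * J) * x ^ 100) := by
        rw [← Real.exp_add, ← Real.exp_add, ← Real.exp_add]; congr 1; push_cast; ring
    _ ≤ _ := by
        refine Real.exp_le_exp.2 ?_
        have e2 : (2 * V + 3 * J : ℝ) ≤ V * (3 * s + 5) := by nlinarith
        have e3 : (V:ℝ) * (3 * s + 5) ≤ 36 * x ^ 100 * (3 * s + 5) := mul_le_mul_of_nonneg_right hV2 (by linarith)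
        have e4 : 36 * (3 * s + 5) ≤ Λ := by nlinarith
        have e5 := h.pw 100
        calc (2 * V + 3 * J : ℝ) * x ^ 100 ≤ (36 * x ^ 100 * (3 * s + 5)) * x ^ 100 := mul_le_mul_of_nonneg_right (e2.trans e3) (by linarith)
          _ = (36 * (3 * s + 5)) * x ^ 200 := by ring
          _ ≤ _ := mul_le_mul_of_nonneg_right e4 (by have := h.pw 200; linarith)

lemma num4b (h : Nm x Λ l R u) {Hn N : ℕ} (hHn : (Hn:ℝ) ≤ Real.exp (x ^ 100)) (hN : Real.exp (Λ * x ^ 200) ≤ N) :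
    (Hn:ℝ) ^ (2 * R * l) * (4 * (Hn:ℝ) ^ (2 * R * l)) ≤ N := by
  have hΛ := h.hΛ
  norm_num at hΛ
  have hV1 := h.V1
  have hV2 := h.V2
  set V := 2 * R * l with hV
  refine le_trans ?_ hN
  have e1 : (4:ℝ) ≤ Real.exp 4 := by have := Real.add_one_le_exp (4:ℝ); linarith
  have hH0 : (0:ℝ) ≤ Hn := by positivity
  calc _ ≤ Real.exp (V * x ^ 100) * (Real.exp 4 * Real.exp (V * x ^ 100)) := 
        mul_le_mul (powexp hH0 hHn _) (mul_le_mul e1 (powexp hH0 hHn _) (by positivity) (by positivity)) (by positivity) (by positivity)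
    _ = Real.exp (2 * (V * x ^ 100) + 4) := by
        rw [← Real.exp_add, ← Real.exp_add]; congr 1; ring
    _ ≤ _ := by
        refine Real.exp_le_exp.2 ?_
        have e3 : (V:ℝ) * x ^ 100 ≤ 36 * x ^ 200 := by
          calc (V:ℝ) * x ^ 100 ≤ 36 * x ^ 100 * x ^ 100 := mul_le_mul_of_nonneg_right hV2 (by have := h.pw 100; linarith)
            _ = _ := by ring
        have e5 := h.pw 200
        nlinarith

lemma rho_ge (h : Nm x Λ l R u) {H0 : ℝ} (hH0 : Real.exp (x ^ 80) ≤ H0) :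
    Real.exp (x ^ 80 / 2) ≤ H0 / ((2 * l + 1) * (2 + 2 * x ^ 100)) := by
  have hl := h.l2
  have h75 := h.pw 75
  have h100 := h.pw 100
  have hD : (2 * (l:ℝ) + 1) * (2 + 2 * x ^ 100) ≤ Real.exp (x ^ 80 / 2) := by
    calc (2 * (l:ℝ) + 1) * (2 + 2 * x ^ 100) ≤ (19 * x ^ 75) * (4 * x ^ 100) := mul_le_mul (by linarith) (by linarith) (by linarith) (by linarith)
      _ = 76 * x ^ 175 := by ring
      _ ≤ Real.exp ((76 + (175:ℕ)) * x) := pe h.x1 (by norm_num) _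
      _ ≤ _ := by
        refine Real.exp_le_exp.2 ?_
        have := h.pk' (K := 502) (by norm_num) (show 1 < 80 by norm_num)
        push_cast; linarith
  have hx0 : 0 < (2 * (l:ℝ) + 1) * (2 + 2 * x ^ 100) := mul_pos (by positivity) (by linarith)
  rw [le_div_iff₀ hx0]
  calc _ ≤ Real.exp (x ^ 80 / 2) * Real.exp (x ^ 80 / 2) := mul_le_mul_of_nonneg_left hD (Real.exp_pos _).le
    _ = Real.exp (x ^ 80) := by rw [← Real.exp_add]; congr 1; ring
    _ ≤ _ := hH0

lemma num5 (h : Nm x Λ l R u) {Hn : ℕ} (hHn : (Hn:ℝ) ≤ Real.exp (x ^ 100)) (hHn1 : 1 ≤ Hn) {ρ : ℝ} (hρ : Real.exp (x ^ 80 / 2) ≤ ρ) :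
    3 ^ (2 * R * l) * (((2 * R : ℕ):ℝ) ^ 2 * (((2 * R * l : ℕ) + Λ) ^ (2 * R * l) * ((2 * (2 * R * l * Hn : ℕ) + 1) ^ 2 * ((2 * l * Hn + 4) * (3 * (Λ + 2 * l + 1)) ^ (2 * l) / ρ ^ u)))) ≤ 1 := by
  have hΛ := h.hΛ
  norm_num at hΛ
  have hΛx := h.hΛx
  have hV2 := h.V2
  have hx1 := h.x1
  have h75 := h.pw 75
  have h100 := h.pw 100
  have hl2 := h.l2
  set V := 2 * R * l with hV
  have hHr : (1:ℝ) ≤ Hn := by exact_mod_cast hHn1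
  have hρ0 : 0 < ρ := lt_of_lt_of_le (Real.exp_pos _) hρ
  have a1 : (3:ℝ) ^ V ≤ Real.exp (V * 2) := powexp (by norm_num) (by have := Real.add_one_le_exp (2:ℝ); linarith) V
  have a2 : ((2 * R : ℕ):ℝ) ^ 2 ≤ Real.exp (66 * x) := by
    have := pe hx1 (A := 16) (by norm_num) 50
    have h3 := h.M2
    push_cast; norm_num at this; rw [sq]; linarith
  have a3 : ((V:ℝ) + Λ) ^ V ≤ Real.exp (V * (137 * x)) := by
    refine powexp (by positivity) ?_ V
    have := pe hx1 (A := 37) (by norm_num) 100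
    norm_num at this
    have := h.mono (show 70 ≤ 100 by norm_num)
    linarith
  have a4 : ((2 * (V * Hn : ℕ) + 1 : ℝ)) ^ 2 ≤ Real.exp ((2:ℕ) * (173 * x + x ^ 100)) := by
    refine powexp (by positivity) ?_ 2
    have := pe hx1 (A := 73) (by norm_num) 100
    norm_num at this
    rw [Real.exp_add]
    refine le_trans ?_ (mul_le_mul this hHn (by positivity) (by positivity))
    push_cast
    nlinarith [mul_le_mul_of_nonneg_right hV2 (by linarith : (0:ℝ) ≤ Hn)]
  have a5 : (2 * l * Hn + 4 : ℝ) ≤ Real.exp (97 * x + x ^ 100) := by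
    have := pe hx1 (A := 22) (by norm_num) 75
    norm_num at this
    rw [Real.exp_add]
    refine le_trans ?_ (mul_le_mul this hHn (by positivity) (by positivity))
    nlinarith [mul_le_mul_of_nonneg_right hl2 (by linarith : (0:ℝ) ≤ Hn)]
  have a6 : (3 * (Λ + 2 * l + 1)) ^ (2 * l) ≤ Real.exp ((2 * l : ℕ) * (135 * x)) := by
    refine powexp (by positivity) ?_ _
    have := pe hx1 (A := 60) (by norm_num) 75
    norm_num at this
    have := h.mono (show 70 ≤ 75 by norm_num)
    linarith
  have a7 : Real.exp (x ^ 102 / 2) ≤ ρ ^ u := by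
    refine le_trans ?_ (pow_le_pow_left₀ (Real.exp_pos _).le hρ u)
    rw [← Real.exp_nat_mul]
    refine Real.exp_le_exp.2 ?_
    have := mul_le_mul_of_nonneg_right h.u1 (by positivity : 0 ≤ x ^ 80 / 2)
    calc x ^ 102 / 2 = x ^ 22 * (x ^ 80 / 2) := by ring
      _ ≤ _ := this
  have hu0 : 0 < ρ ^ u := by positivity
  have main : 3 ^ V * (((2 * R : ℕ):ℝ) ^ 2 * (((V:ℝ) + Λ) ^ V * ((2 * (V * Hn : ℕ) + 1) ^ 2 * ((2 * l * Hn + 4) * (3 * (Λ + 2 * l + 1)) ^ (2 * l))))) ≤ ρ ^ u := by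
    refine le_trans ?_ a7
    refine le_trans (mul_le_mul a1 (mul_le_mul a2 (mul_le_mul a3 (mul_le_mul a4 (mul_le_mul a5 a6 (by positivity) (by positivity)) (by positivity) (by positivity)) (by positivity) (by positivity)) (by positivity) (by positivity)) (by positivity) (by positivity)) ?_
    rw [← Real.exp_add, ← Real.exp_add, ← Real.exp_add, ← Real.exp_add, ← Real.exp_add]
    refine Real.exp_le_exp.2 ?_
    have b1 : (V:ℝ) * (137 * x) ≤ 36 * x ^ 100 * (137 * x) := by gcongr
    have b2 : 36 * x ^ 100 * (137 * x) = 4932 * x ^ 101 := by ring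
    have b3 : ((2 * l : ℕ):ℝ) * (135 * x) ≤ 18 * x ^ 75 * (135 * x) := by
      refine mul_le_mul_of_nonneg_right ?_ (by linarith)
      push_cast; linarith
    have b4 : 18 * x ^ 75 * (135 * x) = 2430 * x ^ 76 := by ring
    have b5 := h.mono (show 76 ≤ 101 by norm_num)
    have b6 := h.mono (show 100 ≤ 101 by norm_num)
    have b7 := h.mono (show 1 ≤ 101 by norm_num)
    have b8 := h.pk' (K := 20000) (by norm_num) (show 101 < 102 by norm_num)
    push_cast at *
    linarith
  calc _ = (3 ^ V * (((2 * R : ℕ):ℝ) ^ 2 * (((V:ℝ) + Λ) ^ V * ((2 * (V * Hn : ℕ) + 1) ^ 2 * ((2 * l * Hn + 4) * (3 * (Λ + 2 * l + 1)) ^ (2 * l)))))) / ρ ^ u := by ring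
    _ ≤ 1 := by rw [div_le_one hu0]; exact main

end
end KK

set_option linter.all false
set_option linter.unusedVariables false
set_option linter.unusedSectionVars false
namespace KK
open Finset
open scoped Classical

section
variable {x Λ : ℝ} {l R u : ℕ}

lemma exp178 : (24:ℝ) * (Real.exp 1 * Real.exp 1) ≤ 178 := by
  have h1 := Real.exp_one_lt_d9
  have h2 := Real.exp_pos 1
  nlinarith

lemma zpow_aux (hΛ : 0 < Λ) {z : ℝ} (hz : z = 1 / (10 ^ 6 * Real.sqrt Λ)) (R l : ℕ) :
    z ^ (2 * R * l) * Λ ^ (R * l) = (1 / 10 ^ 6) ^ (2 * R * l) := by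
  have h1 : z ^ 2 * Λ = (1 / 10 ^ 6) ^ 2 := by
    rw [hz]
    have : Real.sqrt Λ ^ 2 = Λ := Real.sq_sqrt hΛ.le
    have h0 : Real.sqrt Λ ≠ 0 := (Real.sqrt_pos.2 hΛ).ne'
    rw [div_pow, mul_pow, this]
    field_simp
  rw [show 2 * R * l = 2 * (R * l) by ring, pow_mul z, pow_mul (1 / 10 ^ 6 : ℝ), ← mul_pow, h1]

lemma few_num (h : Nm x Λ l R u) {N : ℝ} (hN : 0 ≤ N) {V : ℕ} (hV : V = 2 * R * l) {e' : ℝ} (he0 : 0 ≤ e') (he : Λ ^ V * e' ≤ 1) :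
    N * 3 ^ V * (4 ^ V * (1 + (V:ℝ)) ^ (2 * R + 2 * R * (2 * R) * (1 + 7 * (u * u))) * ((1 + e') * (2 ^ V * Λ ^ (R * l + 2 * R * (2 * R) * (2 + 4 * (u * u)))) + Λ ^ V * e'))
      ≤ 3 * N * Λ ^ (R * l) * 178 ^ V := by
  have hΛ := h.hΛ
  norm_num at hΛ
  have hΛ1 : 1 ≤ Λ := by linarith
  have n1 := num1 h
  have n2 := num2 h
  rw [← hV] at n1 n2
  have hG : 1 ≤ Λ ^ (R * l) := one_le_pow₀ hΛ1
  have he1 : e' ≤ 1 := by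
    have : 1 ≤ Λ ^ V := one_le_pow₀ hΛ1
    nlinarith
  set E := Real.exp (V:ℝ) with hE
  have hE1 : 1 ≤ E := Real.one_le_exp (by positivity)
  have h2V : (1:ℝ) ≤ 2 ^ V := one_le_pow₀ (by norm_num)
  rw [pow_add Λ]
  set G := Λ ^ (R * l)
  set A := Λ ^ (2 * R * (2 * R) * (2 + 4 * (u * u)))
  set D := (1 + (V:ℝ)) ^ (2 * R + 2 * R * (2 * R) * (1 + 7 * (u * u)))
  have hA0 : 0 ≤ A := by positivity
  have hD0 : 0 ≤ D := by positivity
  have s1 : (1 + e') * (2 ^ V * (G * A)) + Λ ^ V * e' ≤ 3 * (2 ^ V * (G * E)) := by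
    have t1 : 2 ^ V * (G * A) ≤ 2 ^ V * (G * E) := by gcongr
    have t2 : 1 ≤ 2 ^ V * (G * E) := one_le_mul_of_one_le_of_one_le h2V (one_le_mul_of_one_le_of_one_le hG hE1)
    have t0 : 0 ≤ 2 ^ V * (G * A) := by positivity
    nlinarith
  calc _ ≤ N * 3 ^ V * (4 ^ V * E * (3 * (2 ^ V * (G * E)))) := by gcongr
    _ = 3 * N * G * ((3 * 4 * 2) ^ V * (E * E)) := by rw [mul_pow, mul_pow]; ring
    _ = 3 * N * G * (24 * (Real.exp 1 * Real.exp 1)) ^ V := by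
        rw [mul_pow 24, mul_pow (Real.exp 1), ← Real.exp_nat_mul, mul_one, ← hE]; norm_num
    _ ≤ _ := by gcongr; exact exp178

lemma pre_num (h : Nm x Λ l R u) {Hn : ℕ} (hHn : (Hn:ℝ) ≤ Real.exp (x ^ 100)) (hHn1 : 1 ≤ Hn) {F : ℝ} (hF0 : 0 ≤ F) (hF : F ≤ Real.exp (x ^ 71)) :
    (2 * (R * l * Hn) + 1 : ℝ) * F ^ 2 * 12 ≤ Real.exp 1 ^ (2 * R * l) := by
  have hV1 := h.V1
  have hV2 := h.V2
  have hx1 := h.x1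
  have h100 := h.pw 100
  have hHr : (1:ℝ) ≤ Hn := by exact_mod_cast hHn1
  have a1 : (2 * (R * l * Hn) + 1 : ℝ) ≤ Real.exp (137 * x + x ^ 100) := by
    have := pe hx1 (A := 37) (by norm_num) 100
    norm_num at this
    rw [Real.exp_add]
    refine le_trans ?_ (mul_le_mul this hHn (by positivity) (by positivity))
    push_cast at hV2
    nlinarith [mul_le_mul_of_nonneg_right hV2 (by linarith : (0:ℝ) ≤ Hn)]
  have a2 := powexp hF0 hF 2
  have a3 : (12:ℝ) ≤ Real.exp 12 := by have := Real.add_one_le_exp (12:ℝ); linarith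
  refine le_trans (mul_le_mul (mul_le_mul a1 a2 (by positivity) (by positivity)) a3 (by positivity) (by positivity)) ?_
  rw [← Real.exp_add, ← Real.exp_add, ← Real.exp_nat_mul, mul_one]
  refine Real.exp_le_exp.2 ?_
  have b1 := h.mono (show 1 ≤ 71 by norm_num)
  have b2 := h.pk' (K := 1000) (by norm_num) (show 71 < 100 by norm_num)
  have b3 := h.pw 71
  push_cast at *
  linarith

lemma good_bound (h : Nm x Λ l R u) {P : Finset ℕ} {δ H0 ρ : ℝ} {Hn : ℕ} {Bm : ℤ} (hE : Env P Λ δ H0 ρ Hn l Bm)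
    (hHn : (Hn:ℝ) ≤ Real.exp (x ^ 100)) (hHn1 : 1 ≤ Hn) (hρ : Real.exp (x ^ 80 / 2) ≤ ρ)
    (hBm : ((2 * (2 * R * l * Hn) + 3 * l * Hn : ℕ):ℤ) ≤ Bm) {N : ℕ} (hN : Real.exp (Λ * x ^ 200) ≤ N) (a : ℤ)
    {B : Finset ℤ} (hB : Icc (a - (2 * R * l * Hn : ℕ)) (a + N + (2 * R * l * Hn : ℕ)) ⊆ B) {z : ℝ} (hz : z = 1 / (10 ^ 6 * Real.sqrt Λ))
    {f : ℤ → ℝ} (hf : ∀ n ∉ Ioc a (a + N), f n = 0) {F : ℝ} (hF : F ≤ Real.exp (x ^ 71)) (hfF : ∀ n, |f n| ≤ F)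
    (hfN : nsq B f ≤ N) : nsq B (Top (tt B P z (1 - 1 / Λ)) (GW P l) f) ≤ N / 100 := by
  have hΛ := h.hΛ
  norm_num at hΛ
  have hΛ1 : 1 ≤ Λ := by linarith
  have hx1 := h.x1
  have hV1 := h.V1
  have hV2 := h.V2
  have hF0 : 0 ≤ F := (abs_nonneg _).trans (hfF 0)
  have hz0 : 0 ≤ z := by rw [hz]; positivity
  have hVH : ((2 * R * l : ℕ):ℝ) ≤ H0 := by
    refine le_trans ?_ (hρ.trans hE.hρH)
    refine hV2.trans ((pe hx1 (by norm_num) 100).trans (Real.exp_le_exp.2 ?_))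
    have := h.pk' (K := 272) (by norm_num) (show 1 < 80 by norm_num)
    push_cast; linarith
  have hu : 0 < u := by
    have := h.u1
    have h1 := h.pw 22
    have : (0:ℝ) < u := by linarith
    exact_mod_cast this
  have hsub : Icc (a - ((2 * R : ℕ):ℤ) * l * Hn) (a + N + ((2 * R : ℕ):ℤ) * l * Hn) ⊆ B := by
    convert hB using 3 <;> push_cast <;> ring
  have hV0 : (0:ℝ) ≤ ((2 * R * l : ℕ):ℝ) := by positivity
  have tb := trace_bound hE hΛ1 hHn1 (R := R) (M := 2 * R) rfl hVH hu (2 * R * l * ⌈Real.sqrt Λ⌉₊) (Real.exp_pos 1) a N rfl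
    hBm (c := ((2 * R * l : ℕ):ℝ) + Λ) (by linarith) le_rfl hz0 hsub
  have n3 := num3 h (2 * R * l)
  have n4 := num4 h hHn hHn1 hN
  have n4b := num4b h hHn hN
  have n5 := num5 h hHn hHn1 hρ
  have nf := few_num h (N := N) (by positivity) rfl (by positivity) n3
  have zp := zpow_aux (by linarith : 0 < Λ) hz R l
  have pn := pre_num h hHn hHn1 hF0 hF
  have hti := trace_ineq (tt_ker hE.odd B z (1 - 1 / Λ)) hE.odd hE.le (Sf := Ioc a (a + N))
    (fun n hn => hsub (by
      rw [mem_Ioc] at hn; rw [mem_Icc]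
      have : (0:ℤ) ≤ ((2 * R : ℕ):ℤ) * l * Hn := by positivity
      constructor <;> linarith)) hf hfF l R
  set V := 2 * R * l with hV
  set Tr := ∑ m ∈ Ioc a (a + N), ∑ W ∈ blk P l (2 * R), if walk m W = m then tw (tt B P z (1 - 1 / Λ)) m W else 0
  set G := Λ ^ (R * l) with hG
  have hG1 : 1 ≤ G := one_le_pow₀ hΛ1
  have h178 : (1:ℝ) ≤ 178 ^ V := one_le_pow₀ (by norm_num)
  have hNG : (N:ℝ) ≤ N * G * 178 ^ V := by
    have : 1 ≤ G * 178 ^ V := one_le_mul_of_one_le_of_one_le hG1 h178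
    have hN0 : (0:ℝ) ≤ N := by positivity
    rw [mul_assoc]; exact le_mul_of_one_le_right hN0 this
  have tb2 : Tr ≤ 12 * N * (178 / 10 ^ 6) ^ V := by
    refine tb.trans ?_
    have n5' := mul_le_mul_of_nonneg_left n5 (by positivity : (0:ℝ) ≤ N)
    rw [← mul_assoc, mul_one] at n5'
    have hzV : 0 ≤ z ^ V := by positivity
    refine (mul_le_mul_of_nonneg_left (mul_le_mul_of_nonneg_left (add_le_add (add_le_add nf n4) (add_le_add n5' n4b)) (by norm_num : (0:ℝ) ≤ 2)) hzV).trans ?_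
    have q : 2 * (3 * N * G * 178 ^ V + N + (N + N)) ≤ 12 * (N * G * 178 ^ V) := by linarith
    refine (mul_le_mul_of_nonneg_left q hzV).trans (le_of_eq ?_)
    calc z ^ V * (12 * (N * G * 178 ^ V)) = (z ^ V * G) * (12 * (N * 178 ^ V)) := by ring
      _ = 12 * N * ((1 / 10 ^ 6) ^ V * 178 ^ V) := by rw [zp]; ring
      _ = _ := by rw [← mul_pow]; congr 2; norm_num
  have hit : nsq B ((Top (tt B P z (1 - 1 / Λ)) (GW P l))^[R] f) ≤ N * (1 / 100) ^ R := by
    refine hti.trans ?_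
    have hN0 : (0:ℝ) ≤ N := by positivity
    refine (mul_le_mul_of_nonneg_left tb2 (by positivity)).trans ?_
    calc (2 * (R * l * Hn) + 1 : ℝ) * F ^ 2 * (12 * N * (178 / 10 ^ 6) ^ V) = ((2 * (R * l * Hn) + 1 : ℝ) * F ^ 2 * 12) * (N * (178 / 10 ^ 6) ^ V) := by ring
      _ ≤ Real.exp 1 ^ V * (N * (178 / 10 ^ 6) ^ V) := mul_le_mul_of_nonneg_right pn (by positivity)
      _ = N * (Real.exp 1 * (178 / 10 ^ 6)) ^ V := by rw [mul_pow]; ring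
      _ ≤ N * (1 / 100) ^ V := by
          have := Real.exp_one_lt_d9
          gcongr
          linarith
      _ ≤ N * (1 / 100) ^ R := by
          refine mul_le_mul_of_nonneg_left (pow_le_pow_of_le_one (by norm_num) (by norm_num) ?_) hN0
          have : 1 ≤ l := by
            have := h.l1
            have h1 := h.pw 75
            exact_mod_cast (by linarith : (1:ℝ) ≤ l)
          rw [hV]; nlinarith
  obtain ⟨k, rfl⟩ : ∃ k, R = k + 1 := by
    refine ⟨R - 1, ?_⟩
    have : 1 ≤ R := by
      have := h.R1
      have h1 := h.pw 25
      exact_mod_cast (by linarith : (1:ℝ) ≤ R)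
    omega
  have tp := Top_pow (tt_ker hE.odd B z (1 - 1 / Λ)) (GW_sub (P := P) (l := l)) (GW_rev hE.odd) f k
  have hns : 0 ≤ nsq B f := sum_nonneg fun i _ => sq_nonneg _
  have : nsq B (Top (tt B P z (1 - 1 / Λ)) (GW P l) f) ^ (k + 1) ≤ ((N:ℝ) / 100) ^ (k + 1) := by
    refine tp.trans ?_
    calc _ ≤ (N:ℝ) ^ k * (N * (1 / 100) ^ (k + 1)) := mul_le_mul (pow_le_pow_left₀ hns hfN k) hit (sum_nonneg fun i _ => sq_nonneg _) (by positivity)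
      _ = _ := by rw [div_pow, div_pow, pow_succ (N:ℝ)]; ring
  exact le_of_pow_le_pow_left₀ (by omega) (by positivity) this

end
end KK

set_option linter.all false
set_option linter.unusedVariables false
set_option linter.unusedSectionVars false
namespace KK
open Finset
open scoped Classical

section
variable {x Λ : ℝ} {l R u : ℕ}

lemma z2 (hΛ : 0 < Λ) {z : ℝ} (hz : z = 1 / (10 ^ 6 * Real.sqrt Λ)) : z ^ 2 * Λ = 1 / 10 ^ 12 := by
  rw [hz]
  have : Real.sqrt Λ ^ 2 = Λ := Real.sq_sqrt hΛ.le
  rw [div_pow, mul_pow, this]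
  field_simp

lemma ng_num (h : Nm x Λ l R u) {Hn N NB : ℕ} (hHn : (Hn:ℝ) ≤ Real.exp (x ^ 100)) (hN : Real.exp (Λ * x ^ 200) ≤ N) (hNB : NB ≤ 2 * N)
    {ρ : ℝ} (hρ : Real.exp (x ^ 80 / 2) ≤ ρ) {z : ℝ} (hz : z = 1 / (10 ^ 6 * Real.sqrt Λ)) {F : ℝ} (hF0 : 0 ≤ F) (hF : F ≤ Real.exp (x ^ 71)) :
    F ^ 2 * (2 * z * Λ) ^ l * (z ^ l * (2 * (NB * 3 ^ l * ((Λ + l + 1) ^ l / ρ) + (Hn:ℝ) ^ l * (4 * (Hn:ℝ) ^ l)))) ≤ N / 100 := by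
  have hΛ := h.hΛ
  norm_num at hΛ
  have hΛx := h.hΛx
  have hx1 := h.x1
  have h75 := h.pw 75
  have h71 := h.pw 71
  have h200 := h.pw 200
  have hl2 := h.l2
  have hz0 : 0 ≤ z := by rw [hz]; positivity
  have hzz := z2 (by linarith : 0 < Λ) hz
  have hρ0 : 0 < ρ := lt_of_lt_of_le (Real.exp_pos _) hρ
  have hN0 : (0:ℝ) ≤ N := by positivity
  have a1 : (3 * (Λ + l + 1)) ^ l ≤ Real.exp (972 * x ^ 76) := by
    have h1 : 3 * (Λ + l + 1) ≤ Real.exp (108 * x) := by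
      have := pe hx1 (A := 33) (by norm_num) 75
      norm_num at this
      have := h.mono (show 70 ≤ 75 by norm_num)
      linarith
    refine (powexp (by positivity) h1 l).trans (Real.exp_le_exp.2 ?_)
    calc (l:ℝ) * (108 * x) ≤ 9 * x ^ 75 * (108 * x) := mul_le_mul_of_nonneg_right hl2 (by linarith)
      _ = _ := by ring
  have a2 := powexp hF0 hF 2
  have a3 : (Hn:ℝ) ^ l * (Hn:ℝ) ^ l ≤ Real.exp (18 * x ^ 175) := by
    have h1 := powexp (by positivity) hHn l
    refine (mul_le_mul h1 h1 (by positivity) (by positivity)).trans ?_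
    rw [← Real.exp_add]
    refine Real.exp_le_exp.2 ?_
    have h2 : (l:ℝ) * x ^ 100 ≤ 9 * x ^ 75 * x ^ 100 := mul_le_mul_of_nonneg_right hl2 (by have := h.pw 100; linarith)
    have h3 : 9 * x ^ 75 * x ^ 100 = 9 * x ^ 175 := by rw [mul_assoc, ← pow_add]
    linarith
  have c1 : F ^ 2 * ((3 * (Λ + l + 1)) ^ l / ρ) ≤ 1 / 1600 := by
    have h1 : F ^ 2 * (3 * (Λ + l + 1)) ^ l * 1600 ≤ ρ := by
      refine le_trans ?_ hρ
      have h2 : (1600:ℝ) ≤ Real.exp 1600 := by have := Real.add_one_le_exp (1600:ℝ); linarith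
      refine (mul_le_mul (mul_le_mul a2 a1 (by positivity) (by positivity)) h2 (by positivity) (by positivity)).trans ?_
      rw [← Real.exp_add, ← Real.exp_add]
      refine Real.exp_le_exp.2 ?_
      have b1 := h.mono (show 71 ≤ 76 by norm_num)
      have b2 := h.pk' (K := 10000) (by norm_num) (show 76 < 80 by norm_num)
      have b3 := h.pw 76
      push_cast; linarith
    rw [mul_div_assoc', div_le_iff₀ hρ0]; linarith
  have c2 : F ^ 2 * ((Hn:ℝ) ^ l * (Hn:ℝ) ^ l) ≤ N / 1600 := by
    have h2 : (1600:ℝ) ≤ Real.exp 1600 := by have := Real.add_one_le_exp (1600:ℝ); linarith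
    have h1 : F ^ 2 * ((Hn:ℝ) ^ l * (Hn:ℝ) ^ l) * 1600 ≤ N := by
      refine le_trans ?_ hN
      refine (mul_le_mul (mul_le_mul a2 a3 (by positivity) (by positivity)) h2 (by positivity) (by positivity)).trans ?_
      rw [← Real.exp_add, ← Real.exp_add]
      refine Real.exp_le_exp.2 ?_
      have b1 := h.mono (show 71 ≤ 200 by norm_num)
      have b2 := h.mono (show 175 ≤ 200 by norm_num)
      have b3 : 1000000 * x ^ 200 ≤ Λ * x ^ 200 := mul_le_mul_of_nonneg_right hΛ (by linarith)
      push_cast; linarith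
    linarith
  have hq : (2 * z * Λ) ^ l * z ^ l ≤ 1 := by
    rw [← mul_pow]
    refine pow_le_one₀ (by positivity) ?_
    nlinarith
  have hNBr : (NB:ℝ) ≤ 2 * N := by exact_mod_cast hNB
  have hfin : F ^ 2 * (2 * (NB * 3 ^ l * ((Λ + l + 1) ^ l / ρ) + (Hn:ℝ) ^ l * (4 * (Hn:ℝ) ^ l))) ≤ N / 100 := by
    have e : F ^ 2 * (2 * (NB * 3 ^ l * ((Λ + l + 1) ^ l / ρ) + (Hn:ℝ) ^ l * (4 * (Hn:ℝ) ^ l))) = 2 * NB * (F ^ 2 * ((3 * (Λ + l + 1)) ^ l / ρ)) + 8 * (F ^ 2 * ((Hn:ℝ) ^ l * (Hn:ℝ) ^ l)) := by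
      rw [mul_pow 3]; ring
    rw [e]
    have : 2 * (NB:ℝ) * (F ^ 2 * ((3 * (Λ + l + 1)) ^ l / ρ)) ≤ 2 * (2 * N) * (1 / 1600) := by
      refine mul_le_mul (by linarith) c1 (by positivity) (by positivity)
    linarith
  calc _ = ((2 * z * Λ) ^ l * z ^ l) * (F ^ 2 * (2 * (NB * 3 ^ l * ((Λ + l + 1) ^ l / ρ) + (Hn:ℝ) ^ l * (4 * (Hn:ℝ) ^ l)))) := by ring
    _ ≤ 1 * (F ^ 2 * (2 * (NB * 3 ^ l * ((Λ + l + 1) ^ l / ρ) + (Hn:ℝ) ^ l * (4 * (Hn:ℝ) ^ l)))) := mul_le_mul_of_nonneg_right hq (by positivity)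
    _ ≤ _ := by rw [one_mul]; exact hfin

lemma q_num (hΛ : 10 ^ 6 ≤ Λ) {z : ℝ} (hz : z = 1 / (10 ^ 6 * Real.sqrt Λ)) (hl : 1 ≤ l) :
    (2 * z ^ 2) ^ (3 * l) * (4 * (2 * z * Λ) ^ 2 + 1) ^ l ≤ 1 / 2 := by
  norm_num at hΛ
  have hzz := z2 (by linarith : 0 < Λ) hz
  have h1 : z ^ 2 ≤ 1 / 10 ^ 12 := by nlinarith [sq_nonneg z]
  have h0 : 0 ≤ z ^ 2 := sq_nonneg z
  rw [pow_mul, ← mul_pow]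
  have hb : (2 * z ^ 2) ^ 3 * (4 * (2 * z * Λ) ^ 2 + 1) ≤ 1 / 2 := by
    have e : (2 * z ^ 2) ^ 3 * (4 * (2 * z * Λ) ^ 2 + 1) = 8 * (z ^ 2) ^ 2 * (16 * (z ^ 2 * Λ) ^ 2 + z ^ 2) := by ring
    rw [e, hzz]
    have : (z ^ 2) ^ 2 ≤ 1 := by nlinarith
    nlinarith
  calc _ ≤ (1 / 2 : ℝ) ^ l := pow_le_pow_left₀ (by positivity) hb l
    _ ≤ (1 / 2 : ℝ) ^ 1 := pow_le_pow_of_le_one (by norm_num) (by norm_num) hl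
    _ = _ := pow_one _

end

theorem GT {x Λ : ℝ} (hx : 10 ^ 9 ≤ x) (hΛ : 10 ^ 6 ≤ Λ) (hΛx : Λ ≤ x ^ 70) {P : Finset ℕ} {H0 : ℝ} {Hn : ℕ}
    (hge : ∀ p ∈ P, H0 ≤ p) (hle : ∀ p ∈ P, p ≤ Hn) (hpr : ∀ p ∈ P, p.Prime) (hodd : ∀ p ∈ P, Odd p)
    (hsum : ∑ p ∈ P, 1 / (p:ℝ) ≤ Λ) (hHn : (Hn:ℝ) ≤ Real.exp (x ^ 100)) (hHn1 : 1 ≤ Hn) (hH0 : Real.exp (x ^ 80) ≤ H0)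
    {N : ℕ} (hN : Real.exp (Λ * x ^ 200) ≤ N) (a : ℤ) {f : ℤ → ℝ} (hf : ∀ n ∉ Ioc a (a + N), f n = 0)
    {F : ℝ} (hF : F ≤ Real.exp (x ^ 71)) (hfF : ∀ n, |f n| ≤ F) (hfN : ∑ n ∈ Ioc a (a + N), f n ^ 2 ≤ N) :
    ∑ n ∈ Ioc a (a + N), (∑ p ∈ P, (indd p n - 1 / p) * (1 - 1 / Λ) ^ om P n * (1 - 1 / Λ) ^ om P (nb n p) * f (nb n p)) ^ 2 ≤ 3 * 10 ^ 12 * Λ * N := by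
  have hΛ' := hΛ
  norm_num at hΛ'
  have hΛ1 : 1 ≤ Λ := by linarith
  have hx1 : 1 ≤ x := by norm_num at hx; linarith
  have hF0 : 0 ≤ F := (abs_nonneg _).trans (hfF 0)
  obtain ⟨z, hz⟩ : ∃ z : ℝ, z = 1 / (10 ^ 6 * Real.sqrt Λ) := ⟨_, rfl⟩
  have hzp : 0 < z := by rw [hz]; positivity
  have hzz := z2 (by linarith : 0 < Λ) hz
  have pceil : ∀ k : ℕ, x ^ k ≤ ⌈x ^ k⌉₊ ∧ (⌈x ^ k⌉₊ : ℝ) ≤ 2 * x ^ k := fun k => by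
    have h1 : 1 ≤ x ^ k := one_le_pow₀ hx1
    have := Nat.ceil_lt_add_one (a := x ^ k) (by linarith)
    exact ⟨Nat.le_ceil _, by linarith⟩
  set l0 := ⌈x ^ 75⌉₊ with hl0
  set R := ⌈x ^ 25⌉₊ with hR
  set u := ⌈x ^ 22⌉₊ with hu
  have hNm : ∀ l, l0 ≤ l → l ≤ 4 * l0 + 1 → Nm x Λ l R u := fun l h1 h2 => by
    have h1' : (l0:ℝ) ≤ l := by exact_mod_cast h1
    have h2' : (l:ℝ) ≤ 4 * l0 + 1 := by exact_mod_cast h2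
    have h3 := pceil 75
    have h4 : 1 ≤ x ^ 75 := one_le_pow₀ hx1
    exact ⟨hx, hΛ, hΛx, by linarith [h3.1], by linarith [h3.2], (pceil 25).1, (pceil 25).2, (pceil 22).1, (pceil 22).2⟩
  have h0 := hNm l0 le_rfl (by omega)
  set D := (N - 1) / 2 with hD
  have h100 := h0.pw 100
  have hVD : ∀ l, l0 ≤ l → l ≤ 4 * l0 + 1 → 2 * R * l * Hn ≤ D := fun l h1 h2 => by
    have h := hNm l h1 h2
    have hHr : (1:ℝ) ≤ Hn := by exact_mod_cast hHn1
    have : (4 * (2 * R * l * Hn : ℕ) : ℝ) ≤ N := by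
      refine le_trans ?_ hN
      have e1 := pe hx1 (A := 144) (by norm_num) 100
      have : (4 * (2 * R * l * Hn : ℕ) : ℝ) ≤ (144 * x ^ 100) * Hn := by
        have := mul_le_mul_of_nonneg_right h.V2 (by linarith : (0:ℝ) ≤ Hn)
        push_cast at this ⊢; linarith
      refine this.trans ((mul_le_mul e1 hHn (by positivity) (by positivity)).trans ?_)
      rw [← Real.exp_add]
      refine Real.exp_le_exp.2 ?_
      have b1 := h.mono (show 1 ≤ 200 by norm_num)
      have b2 := h.mono (show 100 ≤ 200 by norm_num)
      have b3 : 1000000 * x ^ 200 ≤ Λ * x ^ 200 := mul_le_mul_of_nonneg_right hΛ' (by have := h.pw 200; linarith)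
      have := h.pw 200
      push_cast; linarith
    have h3 : 4 * (2 * R * l * Hn) ≤ N := by exact_mod_cast this
    have h4 : 1 ≤ 2 * R * l * Hn := by
      have := h.V1
      have : (1:ℝ) ≤ ((2 * R * l : ℕ):ℝ) := by linarith
      have : 1 ≤ 2 * R * l := by exact_mod_cast this
      exact Nat.mul_pos this hHn1
    omega
  have hHnD : Hn ≤ D := by
    refine le_trans ?_ (hVD l0 le_rfl (by omega))
    have := h0.V1
    have : (1:ℝ) ≤ ((2 * R * l0 : ℕ):ℝ) := by linarith
    have : 1 ≤ 2 * R * l0 := by exact_mod_cast this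
    exact Nat.le_mul_of_pos_left _ this
  set NB := N + 2 * D + 1 with hNB
  have hNB2 : NB ≤ 2 * N := by omega
  set b := a - D - 1 with hb
  set B := Ioc b (b + (NB:ℕ)) with hBdef
  have hBm : ∀ n, n ∈ B ↔ a - D ≤ n ∧ n ≤ a + N + D := fun n => by
    rw [hBdef, mem_Ioc, hb, hNB]; push_cast; omega
  have hsubf : Ioc a (a + N) ⊆ B := fun n hn => by
    rw [hBm]; rw [mem_Ioc] at hn; omega
  have hnf : nsq B f ≤ N := by
    refine le_trans (le_of_eq ?_) hfN
    unfold nsq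
    refine (sum_subset hsubf fun n _ hn => ?_).symm
    rw [hf n hn]; ring
  set t := tt B P z (1 - 1 / Λ) with ht
  have hθ0 : 0 ≤ 1 - 1 / Λ := by rw [sub_nonneg, div_le_one (by linarith)]; exact hΛ1
  have hθ1 : 1 - 1 / Λ ≤ 1 := by have : 0 ≤ 1 / Λ := by positivity
                                 linarith
  have hK : Ker B P nb t := tt_ker hodd B z _
  have htz : ∀ n, ∀ p ∈ P, |t n p| ≤ z := tt_le hzp.le hθ0 hθ1 (fun p hp => (hpr p hp).pos)
  have hts : ∀ n, ∑ p ∈ P, |t n p| ≤ 2 * z * Λ := tt_sum hodd hΛ1 hsum hzp.le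
  have ht2 : ∀ n, ∑ p ∈ P, t n p ^ 2 ≤ 1 / 8 := fun n => by
    calc ∑ p ∈ P, t n p ^ 2 ≤ ∑ p ∈ P, z * |t n p| := sum_le_sum fun p hp => by
          rw [← sq_abs, sq]; exact mul_le_mul_of_nonneg_right (htz n p hp) (abs_nonneg _)
      _ = z * ∑ p ∈ P, |t n p| := by rw [mul_sum]
      _ ≤ z * (2 * z * Λ) := mul_le_mul_of_nonneg_left (hts n) hzp.le
      _ = 2 * (z ^ 2 * Λ) := by ring
      _ ≤ _ := by rw [hzz]; norm_num
  have hY : ∀ l, l0 ≤ l → l ≤ 4 * l0 + 1 → Yn B P nb t f l ≤ N / 25 := fun l h1 h2 => by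
    have h := hNm l h1 h2
    have hρ := rho_ge h hH0
    have hBmE : ((2 * (2 * R * l * Hn) + 3 * l * Hn : ℕ) : ℝ) ≤ Real.exp (2 * x ^ 100) := by
      have e1 := pe hx1 (A := 99) (by norm_num) 100
      have : ((2 * (2 * R * l * Hn) + 3 * l * Hn : ℕ) : ℝ) ≤ (99 * x ^ 100) * Hn := by
        have e2 : (0:ℝ) ≤ Hn := by positivity
        have := mul_le_mul_of_nonneg_right h.V2 e2
        have := mul_le_mul_of_nonneg_right h.l2 e2
        have := mul_le_mul_of_nonneg_right (h.mono (show 75 ≤ 100 by norm_num)) e2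
        push_cast at *; linarith
      refine this.trans ((mul_le_mul e1 hHn (by positivity) (by positivity)).trans ?_)
      rw [← Real.exp_add]
      refine Real.exp_le_exp.2 ?_
      have := h.pk' (K := 199) (by norm_num) (show 1 < 100 by norm_num)
      push_cast; linarith
    have hD0 : 0 < (2 * (l:ℝ) + 1) * (2 + 2 * x ^ 100) := mul_pos (by positivity) (by linarith)
    have hH : (2 * (l:ℝ) + 1) * (2 + 2 * x ^ 100) ≤ H0 := by
      have h3 : 1 ≤ Real.exp (x ^ 80 / 2) := Real.one_le_exp (by have := h.pw 80; linarith)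
      exact (one_le_div hD0).1 (h3.trans hρ)
    have hE := env_mk (Λ := Λ) (l := l) (Bm := ((2 * (2 * R * l * Hn) + 3 * l * Hn : ℕ):ℤ)) hge hle hpr hodd hsum (by linarith : 0 ≤ x ^ 100) hHn
      (by rw [Int.cast_natCast]; exact hBmE) hH
    have g1 := good_bound h hE hHn hHn1 hρ le_rfl hN a (B := B) (fun n hn => by
      rw [mem_Icc] at hn; rw [hBm]
      have := hVD l h1 h2
      omega) hz hf hF hfF hnf
    have g2 := ng_bound hE hΛ1 hHn1 (by
      push_cast
      have : (0:ℤ) ≤ l * Hn := by positivity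
      have : (0:ℤ) ≤ 2 * R * l * Hn := by positivity
      linarith) b NB hzp.le hfF
    have g3 := ng_num h hHn hN hNB2 hρ hz hF0 hF
    have g4 := Yn_le (P := P) B t f l
    have g5 := g2.trans g3
    linarith
  have hl01 : 1 ≤ l0 := by
    have := h0.l1
    have h1 := h0.pw 75
    exact_mod_cast (by linarith : (1:ℝ) ≤ l0)
  have en := energy_final (f := f) hK ht2 htz (by nlinarith) hts (by nlinarith) hzp.le l0 hY
  have hq := q_num (l := l0) hΛ hz hl01
  have hY0 : Yn B P nb t f 0 ≤ N := hnf
  have hY00 : 0 ≤ Yn B P nb t f 0 := sum_nonneg fun i _ => sq_nonneg _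
  have hY1 : Yn B P nb t f 1 ≤ 3 * N := by
    have := mul_le_mul hq hY0 hY00 (by norm_num)
    linarith
  have hfin : z ^ 2 * ∑ n ∈ Ioc a (a + N), (∑ p ∈ P, (indd p n - 1 / p) * (1 - 1 / Λ) ^ om P n * (1 - 1 / Λ) ^ om P (nb n p) * f (nb n p)) ^ 2 ≤ 3 * N := by
    refine le_trans ?_ hY1
    rw [mul_sum]
    refine le_trans (le_of_eq ?_) (sum_le_sum_of_subset_of_nonneg hsubf fun i _ _ => sq_nonneg _)
    refine sum_congr rfl fun n hn => ?_
    rw [← mul_pow, mul_sum]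
    congr 1
    change _ = ∑ p ∈ P, t n p * (f (nb n p) - 0)
    refine sum_congr rfl fun p hp => ?_
    have hn2 : nb n p ∈ B := by
      rw [hBm]; rw [mem_Ioc] at hn
      have hp1 : (p:ℤ) ≤ D := by exact_mod_cast (hle p hp).trans hHnD
      unfold nb sgn
      split_ifs <;> constructor <;> linarith
    rw [ht]; unfold tt
    rw [if_pos ⟨hsubf hn, hn2⟩]; ring
  calc _ = 10 ^ 12 * Λ * (z ^ 2 * ∑ n ∈ Ioc a (a + N), (∑ p ∈ P, (indd p n - 1 / p) * (1 - 1 / Λ) ^ om P n * (1 - 1 / Λ) ^ om P (nb n p) * f (nb n p)) ^ 2) := by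
        rw [← mul_assoc, mul_assoc (10 ^ 12) Λ, mul_comm Λ, hzz]; norm_num
    _ ≤ 10 ^ 12 * Λ * (3 * N) := mul_le_mul_of_nonneg_left hfin (by positivity)
    _ = _ := by ring

end KK

set_option linter.all false
set_option linter.unusedVariables false
set_option linter.unusedSectionVars false
namespace KK
open Finset
open scoped Classical

noncomputable def pr (w : List ℕ) (n : ℤ) : ℝ := (w.map fun q => indd q n).prod

lemma pr_cons (p : ℕ) (w : List ℕ) (n : ℤ) : pr (p :: w) n = indd p n * pr w n := by simp [pr]

lemma om_eq (P : Finset ℕ) (n : ℤ) : (om P n : ℝ) = ∑ p ∈ P, indd p n := by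
  unfold om indd
  rw [card_filter]; push_cast; rfl

lemma om_pow_words (P : Finset ℕ) (n : ℤ) (k : ℕ) : (om P n : ℝ) ^ k = ∑ w ∈ words P k, pr w n := by
  induction k with
  | zero => simp [sum_words_zero, pr]
  | succ k ih =>
    rw [sum_words_succ, pow_succ', ih, om_eq, sum_mul]
    refine sum_congr rfl fun p _ => ?_
    rw [mul_sum]
    exact sum_congr rfl fun w _ => (pr_cons p w n).symm

lemma pr_eq (w : List ℕ) (n : ℤ) : pr w n = ∏ q ∈ w.toFinset, indd q n := by
  induction w with
  | nil => simp [pr]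
  | cons p w ih =>
    rw [pr_cons, ih, List.toFinset_cons]
    by_cases h : p ∈ w.toFinset
    · rw [insert_eq_of_mem h, ← mul_prod_erase _ _ h, ← mul_assoc]
      congr 1
      unfold indd; split_ifs <;> norm_num
    · rw [prod_insert h]

lemma pr_nonneg (w : List ℕ) (n : ℤ) : 0 ≤ pr w n := by
  rw [pr_eq]; exact prod_nonneg fun _ _ => indd_nonneg _ _
lemma pr_le_one (w : List ℕ) (n : ℤ) : pr w n ≤ 1 := by
  rw [pr_eq]; exact prod_le_one (fun _ _ => indd_nonneg _ _) fun _ _ => indd_le_one _ _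

lemma words_card (P : Finset ℕ) (k : ℕ) : ∑ w ∈ words P k, (1:ℝ) = (P.card:ℝ) ^ k := by
  induction k with
  | zero => rw [sum_words_zero]; simp
  | succ k ih => rw [sum_words_succ, ih, sum_const, nsmul_eq_mul, pow_succ']

section
variable {P : Finset ℕ} {H L : ℝ}

lemma cnt (hP : ∀ q ∈ P, q.Prime) {D : Finset ℕ} (hD : D ⊆ P) (c : ℕ → ℤ) (a : ℤ) (N : ℕ) :
    ∑ m ∈ Ioc a (a + N), ∏ q ∈ D, indd q (m + c q) ≤ N * iw D + 2 * ∏ q ∈ D, (q:ℝ) := by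
  rw [Ioc_sum]
  have h := crt_avg (T := D) (fun q hq => hP q (hD hq)) (g := fun q n => indd q (n + c q)) (fun q hq => indd_per q (c q))
    (fun q hq n => by rw [abs_of_nonneg (indd_nonneg _ _)]; exact indd_le_one _ _) (a + 1) N
  have e : ∏ q ∈ D, Ev q (fun n => indd q (n + c q)) = iw D := prod_congr rfl fun q hq => Ev_indd (hP q (hD hq)).pos _
  rw [e] at h
  have := (abs_le.1 h).2
  linarith

lemma prod_le_H (hH1 : 1 ≤ H) (hH : ∀ q ∈ P, (q:ℝ) ≤ H) {D : Finset ℕ} (hD : D ⊆ P) {k : ℕ} (hk : D.card ≤ k) : ∏ q ∈ D, (q:ℝ) ≤ H ^ k := by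
  calc ∏ q ∈ D, (q:ℝ) ≤ ∏ q ∈ D, H := prod_le_prod (fun _ _ => by positivity) fun q hq => hH q (hD hq)
    _ = H ^ D.card := by rw [prod_const]
    _ ≤ H ^ k := pow_le_pow_right₀ hH1 hk

lemma mom (hP : ∀ q ∈ P, q.Prime) (hH1 : 1 ≤ H) (hH : ∀ q ∈ P, (q:ℝ) ≤ H) (hc : (P.card:ℝ) ≤ H) (hL0 : 0 ≤ L)
    (hL : ∑ p ∈ P, 1 / (p:ℝ) ≤ L) (a : ℤ) (N k : ℕ) :
    ∑ m ∈ Ioc a (a + N), (om P m : ℝ) ^ k ≤ N * (L + k) ^ k + 2 * H ^ (2 * k) := by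
  simp only [om_pow_words]
  rw [sum_comm]
  have h1 : ∀ w ∈ words P k, ∑ m ∈ Ioc a (a + N), pr w m ≤ N * iw (w.toFinset \ ∅) + 2 * H ^ k := fun w hw => by
    have hw' := mem_words.1 hw
    have hs : w.toFinset ⊆ P := fun q hq => hw'.2 q (List.mem_toFinset.1 hq)
    have := cnt hP hs (fun _ => 0) a N
    simp only [add_zero] at this
    simp only [pr_eq, sdiff_empty]
    refine this.trans ?_
    have := prod_le_H hH1 hH hs (k := k) (hw'.1 ▸ List.toFinset_card_le w)
    linarith
  refine (sum_le_sum h1).trans ?_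
  rw [sum_add_distrib, ← mul_sum]
  have h2 := crude (c := L + k) hL hL0 k ∅ (by simp; linarith)
  have h3 : ∑ w ∈ words P k, 2 * H ^ k ≤ 2 * H ^ (2 * k) := by
    have : ∑ w ∈ words P k, 2 * H ^ k = (∑ w ∈ words P k, (1:ℝ)) * (2 * H ^ k) := by rw [sum_mul]; simp
    rw [this, words_card]
    have : (P.card:ℝ) ^ k ≤ H ^ k := pow_le_pow_left₀ (by positivity) hc k
    calc _ ≤ H ^ k * (2 * H ^ k) := mul_le_mul_of_nonneg_right this (by positivity)
      _ = _ := by rw [two_mul k, pow_add]; ring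
  have := mul_le_mul_of_nonneg_left h2 (by positivity : (0:ℝ) ≤ N)
  linarith

lemma mom8 (hP : ∀ q ∈ P, q.Prime) (hH1 : 1 ≤ H) (hH : ∀ q ∈ P, (q:ℝ) ≤ H) (hc : (P.card:ℝ) ≤ H) (hL0 : 0 ≤ L)
    (hL : ∑ p ∈ P, 1 / (p:ℝ) ≤ L) (σ : ℤ) (a : ℤ) (N : ℕ) :
    ∑ m ∈ Ioc a (a + N), (om P m : ℝ) ^ 3 * ∑ p ∈ P, indd p m * (om P (m - σ * p) : ℝ) ^ 4 ≤ N * (L + 8) ^ 8 + 2 * H ^ 16 := by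
  have e : ∀ m : ℤ, (om P m : ℝ) ^ 3 * ∑ p ∈ P, indd p m * (om P (m - σ * p) : ℝ) ^ 4 =
      ∑ p ∈ P, ∑ w ∈ words P 3, ∑ w' ∈ words P 4, indd p m * pr w m * pr w' (m - σ * p) := fun m => by
    rw [mul_sum]
    refine sum_congr rfl fun p _ => ?_
    rw [om_pow_words, om_pow_words, sum_mul]
    refine sum_congr rfl fun w _ => ?_
    rw [mul_sum, mul_sum]
    exact sum_congr rfl fun w' _ => by ring
  simp only [e]
  rw [sum_comm]
  have h1 : ∀ p ∈ P, ∀ w ∈ words P 3, ∀ w' ∈ words P 4, ∑ m ∈ Ioc a (a + N), indd p m * pr w m * pr w' (m - σ * p) ≤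
      N * (1 / p * iw (w.toFinset \ {p}) * iw (w'.toFinset \ insert p w.toFinset)) + 2 * H ^ 8 := fun p hp w hw w' hw' => by
    have hw1 := mem_words.1 hw
    have hw2 := mem_words.1 hw'
    set D := w'.toFinset ∪ insert p w.toFinset with hD
    have hs : D ⊆ P := fun q hq => by
      rw [hD, mem_union, mem_insert, List.mem_toFinset, List.mem_toFinset] at hq
      rcases hq with h | rfl | h
      · exact hw2.2 q h
      · exact hp
      · exact hw1.2 q h
    have hcard : D.card ≤ 8 := by
      have c1 : D.card ≤ _ := card_union_le w'.toFinset (insert p w.toFinset)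
      have c2 := card_insert_le p w.toFinset
      have c3 := List.toFinset_card_le w
      have c4 := List.toFinset_card_le w'
      omega
    have hc := cnt hP hs (fun q => if q ∈ insert p w.toFinset then 0 else - (σ * p)) a N
    have e2 : iw D = 1 / p * iw (w.toFinset \ {p}) * iw (w'.toFinset \ insert p w.toFinset) := by
      rw [hD, iw_union, show insert p w.toFinset = w.toFinset ∪ {p} by rw [union_comm]; rfl, iw_union]
      have : iw {p} = 1 / p := by simp [iw]
      rw [this]; ring
    rw [e2] at hc
    have hpl := prod_le_H hH1 hH hs hcard
    refine le_trans (sum_le_sum fun m _ => ?_) (hc.trans (by linarith))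
    by_cases hd : ∀ q ∈ D, (q:ℤ) ∣ m + (if q ∈ insert p w.toFinset then 0 else - (σ * p))
    · have : ∏ q ∈ D, indd q (m + (if q ∈ insert p w.toFinset then 0 else - (σ * p))) = 1 := prod_eq_one fun q hq => by
        unfold indd; rw [if_pos (hd q hq)]
      rw [this]
      exact mul_le_one₀ (mul_le_one₀ (indd_le_one _ _) (pr_nonneg _ _) (pr_le_one _ _)) (pr_nonneg _ _) (pr_le_one _ _)
    · push Not at hd
      obtain ⟨q, hq, hqd⟩ := hd
      have : indd p m * pr w m * pr w' (m - σ * p) = 0 := by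
        by_cases hq1 : q ∈ insert p w.toFinset
        · rw [if_pos hq1, add_zero] at hqd
          have h0 : indd q m = 0 := by unfold indd; rw [if_neg hqd]
          rw [mem_insert] at hq1
          rcases hq1 with rfl | hq1
          · rw [h0]; ring
          · rw [pr_eq w, prod_eq_zero hq1 h0]; ring
        · rw [if_neg hq1] at hqd
          have h0 : indd q (m - σ * p) = 0 := by unfold indd; rw [if_neg (by rw [sub_eq_add_neg]; exact hqd)]
          rw [hD, mem_union] at hq
          rw [pr_eq w', prod_eq_zero (hq.resolve_right hq1) h0]; ring
      rw [this]
      exact prod_nonneg fun _ _ => indd_nonneg _ _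
  have h2 : ∀ p ∈ P, ∑ m ∈ Ioc a (a + N), ∑ w ∈ words P 3, ∑ w' ∈ words P 4, indd p m * pr w m * pr w' (m - σ * p) ≤
      ∑ w ∈ words P 3, ∑ w' ∈ words P 4, (N * (1 / p * iw (w.toFinset \ {p}) * iw (w'.toFinset \ insert p w.toFinset)) + 2 * H ^ 8) := fun p hp => by
    rw [sum_comm]
    refine sum_le_sum fun w hw => ?_
    rw [sum_comm]
    exact sum_le_sum fun w' hw' => h1 p hp w hw w' hw'
  refine (sum_le_sum h2).trans ?_
  simp only [sum_add_distrib]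
  refine add_le_add ?_ ?_
  · have h3 : ∀ p ∈ P, ∑ w ∈ words P 3, ∑ w' ∈ words P 4, (N * (1 / p * iw (w.toFinset \ {p}) * iw (w'.toFinset \ insert p w.toFinset)) : ℝ)
        ≤ N * (L + 8) ^ 7 * (1 / p) := fun p hp => by
      have h4 : ∀ w ∈ words P 3, ∑ w' ∈ words P 4, (N * (1 / p * iw (w.toFinset \ {p}) * iw (w'.toFinset \ insert p w.toFinset)) : ℝ)
          ≤ N * (1 / p) * (L + 8) ^ 4 * iw (w.toFinset \ {p}) := fun w hw => by
        have hw1 := mem_words.1 hw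
        have c2 := card_insert_le p w.toFinset
        have c3 := List.toFinset_card_le w
        have hcr := crude (c := L + 8) hL hL0 4 (insert p w.toFinset) (by
          have : (insert p w.toFinset).card ≤ 4 := by omega
          have : ((insert p w.toFinset).card:ℝ) ≤ 4 := by exact_mod_cast this
          push_cast; linarith)
        simp only [← mul_sum]
        have : 0 ≤ iw (w.toFinset \ {p}) := iw_nonneg _
        calc _ ≤ (N * (1 / p * iw (w.toFinset \ {p}) * (L + 8) ^ 4) : ℝ) := by gcongr
          _ = _ := by ring
      refine (sum_le_sum h4).trans ?_
      rw [← mul_sum]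
      have hcr := crude (c := L + 8) hL hL0 3 {p} (by rw [card_singleton]; push_cast; linarith)
      calc _ ≤ (N * (1 / p) * (L + 8) ^ 4 * (L + 8) ^ 3 : ℝ) := by gcongr
        _ = _ := by ring
    refine (sum_le_sum h3).trans ?_
    rw [← mul_sum]
    calc _ ≤ N * (L + 8) ^ 7 * (L + 8) := mul_le_mul_of_nonneg_left (by linarith) (by positivity)
      _ = _ := by ring
  · have : ∑ p ∈ P, ∑ w ∈ words P 3, ∑ w' ∈ words P 4, 2 * H ^ 8 = (P.card:ℝ) ^ 8 * (2 * H ^ 8) := by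
      have e4 : ∑ w' ∈ words P 4, 2 * H ^ 8 = (∑ w ∈ words P 4, (1:ℝ)) * (2 * H ^ 8) := by rw [sum_mul]; simp
      have e3 : ∀ C : ℝ, ∑ w' ∈ words P 3, C = (∑ w ∈ words P 3, (1:ℝ)) * C := fun C => by rw [sum_mul]; simp
      rw [e4, e3, words_card, words_card, sum_const, nsmul_eq_mul]; ring
    rw [this]
    have : (P.card:ℝ) ^ 8 ≤ H ^ 8 := pow_le_pow_left₀ (by positivity) hc 8
    calc _ ≤ H ^ 8 * (2 * H ^ 8) := mul_le_mul_of_nonneg_right this (by positivity)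
      _ = _ := by ring

end
end KK

set_option linter.all false
set_option linter.unusedVariables false
set_option linter.unusedSectionVars false
namespace KK
open Finset
open scoped Classical

/-- The standing hypotheses, with `H = exp y`. -/
structure St (P : Finset ℕ) (L y : ℝ) (N : ℕ) : Prop where
  hP : ∀ q ∈ P, q.Prime
  hH : ∀ q ∈ P, (q:ℝ) ≤ Real.exp y
  hL : L = ∑ p ∈ P, 1 / (p:ℝ)
  hL2 : 2 ≤ L
  hy : 100 ≤ y
  hN : Real.exp (L * y ^ 2) ≤ N

lemma card_le_exp {P : Finset ℕ} {y : ℝ} (hP : ∀ q ∈ P, q.Prime) (hH : ∀ q ∈ P, (q:ℝ) ≤ Real.exp y) : (P.card:ℝ) ≤ Real.exp y := by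
  have h1 : P ⊆ Icc 1 ⌊Real.exp y⌋₊ := fun q hq => by
    rw [mem_Icc]; exact ⟨(hP q hq).one_le, Nat.le_floor (hH q hq)⟩
  have h2 := card_le_card h1
  rw [Nat.card_Icc, Nat.add_sub_cancel] at h2
  exact (Nat.cast_le.2 h2).trans (Nat.floor_le (Real.exp_pos y).le)

lemma cs {ι : Type*} (S : Finset ι) (w z : ι → ℝ) (hw : ∀ i ∈ S, 0 ≤ w i) :
    (∑ i ∈ S, w i * z i) ^ 2 ≤ (∑ i ∈ S, w i) * ∑ i ∈ S, w i * z i ^ 2 :=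
  sum_sq_le_sum_mul_sum_of_sq_eq_mul S hw (fun i hi => mul_nonneg (hw i hi) (sq_nonneg _)) fun i _ => by ring

lemma cs4 {ι : Type*} (S : Finset ι) (w z : ι → ℝ) (hw : ∀ i ∈ S, 0 ≤ w i) :
    (∑ i ∈ S, w i * z i) ^ 4 ≤ (∑ i ∈ S, w i) ^ 3 * ∑ i ∈ S, w i * z i ^ 4 := by
  have h1 := cs S w z hw
  have h2 := cs S w (fun i => z i ^ 2) hw
  have h0 : 0 ≤ ∑ i ∈ S, w i := sum_nonneg hw
  simp only [← pow_mul] at h2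
  calc _ = ((∑ i ∈ S, w i * z i) ^ 2) ^ 2 := by ring
    _ ≤ ((∑ i ∈ S, w i) * ∑ i ∈ S, w i * z i ^ 2) ^ 2 := pow_le_pow_left₀ (sq_nonneg _) h1 2
    _ = (∑ i ∈ S, w i) ^ 2 * (∑ i ∈ S, w i * z i ^ 2) ^ 2 := by ring
    _ ≤ (∑ i ∈ S, w i) ^ 2 * ((∑ i ∈ S, w i) * ∑ i ∈ S, w i * z i ^ (2*2)) := mul_le_mul_of_nonneg_left h2 (sq_nonneg _)
    _ = _ := by ring

lemma shift_le {a b c : ℤ} {G : ℤ → ℝ} (h0 : ∀ n, 0 ≤ G n) (hG : ∀ n ∉ Ioc a b, G n = 0) :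
    ∑ n ∈ Ioc a b, G (n + c) ≤ ∑ n ∈ Ioc a b, G n := by
  have e : ∑ n ∈ Ioc a b, G (n + c) = ∑ m ∈ (Ioc a b).image (· + c), G m :=
    (sum_image (fun x _ y _ h => by simpa using h)).symm
  rw [e, ← sum_filter_add_sum_filter_not _ (fun m => m ∈ Ioc a b) G]
  have : ∑ m ∈ (Ioc a b).image (· + c) with ¬ m ∈ Ioc a b, G m = 0 := sum_eq_zero fun m hm => hG m (mem_filter.1 hm).2
  rw [this, add_zero]
  exact sum_le_sum_of_subset_of_nonneg (fun m hm => (mem_filter.1 hm).2) fun m _ _ => h0 m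

abbrev sg : Finset ℤ := {-1, 1}

lemma crude_gen (P : Finset ℕ) (w : ℕ → ℤ → ℝ) (hw : ∀ p n, 0 ≤ w p n) (hper : ∀ p n, ∀ σ ∈ sg, w p (n + σ * p) = w p n)
    {a b : ℤ} (u : ℤ → ℝ) (hu : ∀ n ∉ Ioc a b, u n = 0) (S : ℤ → ℝ) (hS : ∀ n, ∑ p ∈ P, w p n ≤ S n) :
    ∑ n ∈ Ioc a b, (∑ σ ∈ sg, ∑ p ∈ P, w p n * u (n + σ * p)) ^ 2 ≤
      ∑ m ∈ Ioc a b, u m ^ 2 * ∑ σ ∈ sg, ∑ p ∈ P, w p m * (2 * S (m - σ * p)) := by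
  have hS0 : ∀ n, 0 ≤ S n := fun n => (sum_nonneg fun p _ => hw p n).trans (hS n)
  have h1 : ∀ n, (∑ σ ∈ sg, ∑ p ∈ P, w p n * u (n + σ * p)) ^ 2 ≤
      ∑ σ ∈ sg, ∑ p ∈ P, 2 * S n * (w p n * u (n + σ * p) ^ 2) := fun n => by
    have := cs (sg ×ˢ P) (fun x => w x.2 n) (fun x => u (n + x.1 * x.2)) fun x _ => hw _ _
    rw [sum_product, sum_product, sum_product] at this
    refine this.trans ?_
    simp only [← mul_sum]
    refine mul_le_mul_of_nonneg_right ?_ (sum_nonneg fun _ _ => sum_nonneg fun _ _ => mul_nonneg (hw _ _) (sq_nonneg _))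
    simp only [sg]
    rw [sum_pair (by norm_num)]
    have := hS n
    linarith
  refine (sum_le_sum fun n _ => h1 n).trans ?_
  simp only [mul_sum]
  rw [sum_comm, sum_comm (s := Ioc a b)]
  refine sum_le_sum fun σ hσ => ?_
  rw [sum_comm, sum_comm (s := Ioc a b)]
  refine sum_le_sum fun p _ => ?_
  have := shift_le (a := a) (b := b) (c := σ * p) (G := fun m => u m ^ 2 * (w p m * (2 * S (m - σ * p))))
    (fun n => mul_nonneg (sq_nonneg _) (mul_nonneg (hw _ _) (by have := hS0 (n - σ * p); linarith)))
    (fun n hn => by rw [hu n hn]; ring)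
  refine le_trans (le_of_eq (sum_congr rfl fun n _ => ?_)) this
  rw [hper p n σ hσ, add_sub_cancel_right]; ring

noncomputable def Aop (P : Finset ℕ) (g : ℤ → ℂ) (n : ℤ) : ℂ :=
  ∑ σ ∈ sg, ∑ p ∈ P, ((indd p n - 1 / p : ℝ) : ℂ) * g (n + σ * p)

lemma Aop_norm (P : Finset ℕ) (g : ℤ → ℂ) (n : ℤ) :
    ‖Aop P g n‖ ≤ (∑ σ ∈ sg, ∑ p ∈ P, indd p n * ‖g (n + σ * p)‖) + ∑ σ ∈ sg, ∑ p ∈ P, 1 / p * ‖g (n + σ * p)‖ := by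
  unfold Aop
  simp only [← sum_add_distrib]
  refine (norm_sum_le _ _).trans (sum_le_sum fun σ _ => (norm_sum_le _ _).trans (sum_le_sum fun p _ => ?_))
  rw [norm_mul, Complex.norm_real, ← add_mul]
  refine mul_le_mul_of_nonneg_right ?_ (norm_nonneg _)
  have h1 := indd_nonneg p n
  have h2 : (0:ℝ) ≤ 1 / p := by positivity
  exact abs_le.2 ⟨by linarith, by linarith⟩

noncomputable def Xc (P : Finset ℕ) (m : ℤ) : ℝ := ∑ σ ∈ sg, ∑ p ∈ P, indd p m * (2 * (om P (m - σ * p) : ℝ))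

lemma Xc_nonneg (P : Finset ℕ) (m : ℤ) : 0 ≤ Xc P m := sum_nonneg fun _ _ => sum_nonneg fun _ _ => mul_nonneg (indd_nonneg _ _) (by positivity)

lemma indd_shift (p : ℕ) (n σ : ℤ) : indd p (n + σ * p) = indd p n := by
  unfold indd
  exact if_congr (Int.dvd_add_left (Dvd.intro_left σ rfl)) rfl rfl

noncomputable def Wc (P : Finset ℕ) (L : ℝ) (m : ℤ) : ℝ := 2 * Xc P m + 8 * L ^ 2

lemma Wc_nonneg (P : Finset ℕ) (L : ℝ) (m : ℤ) : 0 ≤ Wc P L m := by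
  have := Xc_nonneg P m
  unfold Wc; positivity

section
variable {P : Finset ℕ} {L y : ℝ} {N : ℕ}

lemma crudeA (hL : L = ∑ p ∈ P, 1 / (p:ℝ)) {a b : ℤ} (g : ℤ → ℂ) (hg : ∀ n ∉ Ioc a b, g n = 0) :
    ∑ n ∈ Ioc a b, ‖Aop P g n‖ ^ 2 ≤ ∑ m ∈ Ioc a b, ‖g m‖ ^ 2 * Wc P L m := by
  have h1 := crude_gen P (fun p n => indd p n) (fun p n => indd_nonneg p n) (fun p n σ _ => indd_shift p n σ) (a := a) (b := b)
    (fun n => ‖g n‖) (fun n hn => by rw [hg n hn, norm_zero]) (fun n => om P n) (fun n => (om_eq P n).ge)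
  have h2 := crude_gen P (fun p n => 1 / (p:ℝ)) (fun p n => by positivity) (fun p n σ _ => rfl) (a := a) (b := b)
    (fun n => ‖g n‖) (fun n hn => by rw [hg n hn, norm_zero]) (fun n => L) (fun n => hL.ge)
  have e2 : ∑ σ ∈ sg, ∑ p ∈ P, 1 / (p:ℝ) * (2 * L) = 4 * L ^ 2 := by
    simp only [← sum_mul, ← hL, sg]
    rw [sum_pair (by norm_num)]; ring
  rw [e2] at h2
  have h3 : ∀ n, ‖Aop P g n‖ ^ 2 ≤ 2 * (∑ σ ∈ sg, ∑ p ∈ P, indd p n * ‖g (n + σ * p)‖) ^ 2 + 2 * (∑ σ ∈ sg, ∑ p ∈ P, 1 / p * ‖g (n + σ * p)‖) ^ 2 := fun n => by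
    have := pow_le_pow_left₀ (norm_nonneg _) (Aop_norm P g n) 2
    nlinarith [sq_nonneg ((∑ σ ∈ sg, ∑ p ∈ P, indd p n * ‖g (n + σ * p)‖) - ∑ σ ∈ sg, ∑ p ∈ P, 1 / p * ‖g (n + σ * p)‖)]
  refine (sum_le_sum fun n _ => h3 n).trans ?_
  rw [sum_add_distrib, ← mul_sum, ← mul_sum]
  have e3 : ∑ m ∈ Ioc a b, ‖g m‖ ^ 2 * Wc P L m = 2 * (∑ m ∈ Ioc a b, ‖g m‖ ^ 2 * Xc P m) + 2 * ∑ m ∈ Ioc a b, ‖g m‖ ^ 2 * (4 * L ^ 2) := by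
    rw [mul_sum, mul_sum, ← sum_add_distrib]
    exact sum_congr rfl fun m _ => by unfold Wc; ring
  rw [e3]
  unfold Xc
  linarith

lemma St.two_pow (h : St P L y N) {k : ℕ} (hk : (k:ℝ) ≤ 10 * L) : 2 * Real.exp y ^ k ≤ N := by
  refine le_trans ?_ h.hN
  have h2 : (2:ℝ) ≤ Real.exp 1 := by have := Real.add_one_le_exp 1; linarith
  rw [← Real.exp_nat_mul]
  calc _ ≤ Real.exp 1 * Real.exp (k * y) := mul_le_mul_of_nonneg_right h2 (Real.exp_pos _).le
    _ = Real.exp (1 + k * y) := (Real.exp_add _ _).symm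
    _ ≤ _ := Real.exp_le_exp.2 ?_
  have hy := h.hy
  have hL := h.hL2
  have h1 : k * y ≤ 10 * L * y := mul_le_mul_of_nonneg_right hk (by linarith)
  have h3 : 100 * (L * y) ≤ y * (L * y) := mul_le_mul_of_nonneg_right hy (by nlinarith)
  nlinarith

lemma Wc4 (h : St P L y N) (a : ℤ) : ∑ m ∈ Ioc a (a + N), Wc P L m ^ 4 ≤ 10 ^ 5 * (L + 8) ^ 8 * N := by
  have hL := h.hL2
  have hc := card_le_exp h.hP h.hH
  have hy := h.hy
  have hX : ∀ m, Xc P m ^ 4 ≤ ∑ σ ∈ sg, 128 * ((om P m : ℝ) ^ 3 * ∑ p ∈ P, indd p m * (om P (m - σ * p) : ℝ) ^ 4) := fun m => by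
    have := cs4 (sg ×ˢ P) (fun x => indd x.2 m) (fun x => 2 * (om P (m - x.1 * x.2) : ℝ)) fun x _ => indd_nonneg _ _
    rw [sum_product, sum_product, sum_product] at this
    simp only [← om_eq] at this
    refine this.trans (le_of_eq ?_)
    simp only [sg]
    rw [sum_pair (by norm_num), sum_pair (by norm_num), sum_pair (by norm_num)]
    have : ∀ σ : ℤ, ∑ p ∈ P, indd p m * (2 * (om P (m - σ * p) : ℝ)) ^ 4 = 16 * ∑ p ∈ P, indd p m * (om P (m - σ * p) : ℝ) ^ 4 := fun σ => by
      rw [mul_sum]; exact sum_congr rfl fun p _ => by ring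
    rw [this, this]; ring
  have hs : ∑ m ∈ Ioc a (a + N), Xc P m ^ 4 ≤ 512 * N * (L + 8) ^ 8 := by
    refine (sum_le_sum fun m _ => hX m).trans ?_
    rw [sum_comm]
    have h1 : ∀ σ ∈ sg, ∑ m ∈ Ioc a (a + N), 128 * ((om P m : ℝ) ^ 3 * ∑ p ∈ P, indd p m * (om P (m - σ * p) : ℝ) ^ 4) ≤ 256 * N * (L + 8) ^ 8 := fun σ _ => by
      rw [← mul_sum]
      have m8 := mom8 h.hP (Real.one_le_exp (by linarith)) h.hH hc (by linarith : 0 ≤ L) h.hL.ge σ a N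
      have h2 := h.two_pow (k := 16) (by push_cast; linarith)
      have h3 : (1:ℝ) ≤ (L + 8) ^ 8 := one_le_pow₀ (by linarith)
      have h4 : (N:ℝ) ≤ N * (L + 8) ^ 8 := le_mul_of_one_le_right (by positivity) h3
      linarith
    refine (sum_le_sum h1).trans ?_
    simp only [sg]
    rw [sum_pair (by norm_num)]
    linarith
  have hW : ∀ m, Wc P L m ^ 4 ≤ 128 * Xc P m ^ 4 + 32768 * L ^ 8 := fun m => by
    have key : ∀ a b : ℝ, (a + b) ^ 4 ≤ 8 * a ^ 4 + 8 * b ^ 4 := fun a b => by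
      have h1 : (a + b) ^ 2 ≤ 2 * a ^ 2 + 2 * b ^ 2 := by nlinarith [sq_nonneg (a - b)]
      have h2 := pow_le_pow_left₀ (sq_nonneg _) h1 2
      nlinarith [sq_nonneg (a ^ 2 - b ^ 2)]
    have := key (2 * Xc P m) (8 * L ^ 2)
    unfold Wc
    nlinarith
  refine (sum_le_sum fun m _ => hW m).trans ?_
  rw [sum_add_distrib, ← mul_sum, sum_const, nsmul_eq_mul]
  have hcard : ((Ioc a (a + N)).card : ℝ) = N := by simp
  rw [hcard]
  have : L ^ 8 ≤ (L + 8) ^ 8 := pow_le_pow_left₀ (by linarith) (by linarith) 8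
  have h4 : (N:ℝ) * L ^ 8 ≤ N * (L + 8) ^ 8 := mul_le_mul_of_nonneg_left this (by positivity)
  have h5 : 0 ≤ (N:ℝ) * (L + 8) ^ 8 := by positivity
  nlinarith

lemma tail (h : St P L y N) {τ K : ℝ} (hτ : 0 ≤ τ) (hK : K = 4 * Real.exp (τ + 1)) (a : ℤ) :
    ∑ n ∈ Ioc a (a + N) with K * L < om P n, (om P n : ℝ) ^ 2 ≤ 64 * Real.exp (-(τ * L)) * N := by
  have hL := h.hL2
  have hy := h.hy
  have hc := card_le_exp h.hP h.hH
  set m := ⌈L⌉₊ with hm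
  have m1 : L ≤ m := Nat.le_ceil L
  have m2 : (m:ℝ) ≤ L + 1 := (Nat.ceil_lt_add_one (by linarith)).le
  have hK0 : 0 < K := by rw [hK]; positivity
  have hKL : 0 < K * L := by positivity
  have hmo := mom h.hP (Real.one_le_exp (by linarith)) h.hH hc (by linarith : 0 ≤ L) h.hL.ge a N (m + 2)
  have h2 := h.two_pow (k := 2 * (m + 2)) (by push_cast; linarith)
  have h3 : ∑ n ∈ Ioc a (a + N) with K * L < om P n, (om P n : ℝ) ^ 2 * (K * L) ^ m ≤ ∑ n ∈ Ioc a (a + N), (om P n : ℝ) ^ (m + 2) := by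
    refine le_trans (sum_le_sum fun n hn => ?_) (sum_le_sum_of_subset_of_nonneg (filter_subset _ _) fun n _ _ => by positivity)
    rw [pow_add, mul_comm ((om P n : ℝ) ^ m)]
    exact mul_le_mul_of_nonneg_left (pow_le_pow_left₀ hKL.le (mem_filter.1 hn).2.le m) (by positivity)
  rw [← sum_mul] at h3
  have h4 : (L + (m + 2 : ℕ)) ^ (m + 2) ≤ (4 * L) ^ (m + 2) := pow_le_pow_left₀ (by positivity) (by push_cast; linarith) _
  have h5 : (1:ℝ) ≤ (4 * L) ^ (m + 2) := one_le_pow₀ (by linarith)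
  have hN0 : (0:ℝ) ≤ N := by positivity
  have h6 : (∑ n ∈ Ioc a (a + N) with K * L < om P n, (om P n : ℝ) ^ 2) * (K * L) ^ m ≤ 2 * N * (4 * L) ^ (m + 2) := by
    have := mul_le_mul_of_nonneg_left h4 hN0
    have := le_mul_of_one_le_right hN0 h5
    linarith
  have h7 : (4 * L) ^ (m + 2) = 16 * L ^ 2 * Real.exp (-(m * (τ + 1))) * (K * L) ^ m := by
    have : K * L = 4 * L * Real.exp (τ + 1) := by rw [hK]; ring
    rw [this, mul_pow _ _ m, ← Real.exp_nat_mul, Real.exp_neg, pow_add]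
    have := Real.exp_pos (m * (τ + 1))
    field_simp; ring
  rw [h7] at h6
  have h8 : ∑ n ∈ Ioc a (a + N) with K * L < om P n, (om P n : ℝ) ^ 2 ≤ 2 * N * (16 * L ^ 2 * Real.exp (-(m * (τ + 1)))) :=
    le_of_mul_le_mul_right (by linarith) (pow_pos hKL m)
  refine h8.trans ?_
  have h9 : Real.exp (-(m * (τ + 1))) ≤ Real.exp (-(τ * L)) * Real.exp (-L) := by
    rw [← Real.exp_add]; exact Real.exp_le_exp.2 (by nlinarith)
  have h10 : L ^ 2 * Real.exp (-L) ≤ 2 := by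
    have := Real.quadratic_le_exp_of_nonneg (by linarith : 0 ≤ L)
    rw [Real.exp_neg, ← div_eq_mul_inv, div_le_iff₀ (Real.exp_pos _)]
    linarith
  calc 2 * N * (16 * L ^ 2 * Real.exp (-(m * (τ + 1)))) ≤ 2 * N * (16 * L ^ 2 * (Real.exp (-(τ * L)) * Real.exp (-L))) := by gcongr
    _ = 32 * N * Real.exp (-(τ * L)) * (L ^ 2 * Real.exp (-L)) := by ring
    _ ≤ 32 * N * Real.exp (-(τ * L)) * 2 := by gcongr
    _ = _ := by ring

end
end KK

set_option linter.all false
set_option linter.unusedVariables false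
set_option linter.unusedSectionVars false
namespace KK
open Finset
open scoped Classical

def GoodG (P G : Finset ℕ) (L K F B : ℝ) (N : ℕ) : Prop :=
  ∀ (a : ℤ) (f : ℤ → ℝ), (∀ n ∉ Ioc a (a + N), f n = 0) → (∀ n, |f n| ≤ F) → (∀ n, f n ≠ 0 → (om P n : ℝ) ≤ K * L) →
    ∑ n ∈ Ioc a (a + N), f n ^ 2 ≤ N →
    ∑ n ∈ Ioc a (a + N) with (om P n : ℝ) ≤ K * L, (∑ p ∈ G, (indd p n - 1 / p) * f (nb n p)) ^ 2 ≤ B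

lemma om_mono {G P : Finset ℕ} (h : G ⊆ P) (n : ℤ) : om G n ≤ om P n := by
  unfold om
  exact card_le_card (filter_subset_filter _ h)

lemma theta_lb {L K : ℝ} (hL : 2 ≤ L) {k : ℕ} (hk : (k:ℝ) ≤ K * L) : Real.exp (-(2 * K)) ≤ (1 - 1 / L) ^ k := by
  have hL0 : 0 < L := by linarith
  have ht : 1 / L ≤ 1 / 2 := one_div_le_one_div_of_le (by norm_num) hL
  have ht0 : 0 < 1 / L := by positivity
  have h1 : Real.exp (-(2 * (1 / L))) ≤ 1 - 1 / L := by
    rw [Real.exp_neg]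
    have h2 := Real.add_one_le_exp (2 * (1 / L))
    rw [inv_le_iff_one_le_mul₀ (Real.exp_pos _)]
    nlinarith
  calc Real.exp (-(2 * K)) ≤ Real.exp (k * -(2 * (1 / L))) := Real.exp_le_exp.2 (by
        have : (k:ℝ) / L ≤ K := (div_le_iff₀ hL0).2 hk
        have e : (k:ℝ) * -(2 * (1 / L)) = -(2 * (k / L)) := by ring
        rw [e]; linarith)
    _ = Real.exp (-(2 * (1 / L))) ^ k := Real.exp_nat_mul _ _
    _ ≤ _ := pow_le_pow_left₀ (Real.exp_pos _).le h1 k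

lemma good_of_GT {x L : ℝ} (hx : 10 ^ 9 ≤ x) (hL : 10 ^ 6 ≤ L) (hLx : L ≤ x ^ 70) {P G : Finset ℕ} (hGP : G ⊆ P) {H0 : ℝ} {Hn : ℕ}
    (hge : ∀ p ∈ G, H0 ≤ p) (hle : ∀ p ∈ G, p ≤ Hn) (hpr : ∀ p ∈ G, p.Prime) (hodd : ∀ p ∈ G, Odd p)
    (hsum : ∑ p ∈ G, 1 / (p:ℝ) ≤ L) (hHn : (Hn:ℝ) ≤ Real.exp (x ^ 100)) (hHn1 : 1 ≤ Hn) (hH0 : Real.exp (x ^ 80) ≤ H0)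
    {N : ℕ} (hN : Real.exp (L * x ^ 200) ≤ N) {F : ℝ} (hF : F ≤ Real.exp (x ^ 71)) {K : ℝ} :
    GoodG P G L K F (Real.exp (8 * K) * (3 * 10 ^ 12 * L * N)) N := by
  intro a f hf hfF hfK hfN
  have hL2 : 2 ≤ L := by norm_num at hL; linarith
  set θ := 1 - 1 / L with hθ
  have ht : 1 / L ≤ 1 / 2 := one_div_le_one_div_of_le (by norm_num) hL2
  have hθ0 : 0 < θ := by rw [hθ]; linarith
  have hlb : ∀ n, (om P n : ℝ) ≤ K * L → Real.exp (-(2 * K)) ≤ θ ^ om G n := fun n hn =>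
    theta_lb hL2 ((Nat.cast_le.2 (om_mono hGP n)).trans hn)
  set h : ℤ → ℝ := fun n => Real.exp (-(2 * K)) * (θ ^ om G n)⁻¹ * f n with hh
  have hab : ∀ n, |h n| ≤ |f n| := fun n => by
    by_cases h0 : f n = 0
    · simp [hh, h0]
    · have h1 := hlb n (hfK n h0)
      have h2 : 0 < θ ^ om G n := pow_pos hθ0 _
      have h3 : Real.exp (-(2 * K)) * (θ ^ om G n)⁻¹ ≤ 1 := by
        rw [← div_eq_mul_inv, div_le_one h2]; exact h1
      have h4 : 0 ≤ Real.exp (-(2 * K)) * (θ ^ om G n)⁻¹ := by positivity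
      simp only [hh]
      rw [abs_mul, abs_of_nonneg h4]
      exact mul_le_of_le_one_left (abs_nonneg _) h3
  have hGT := GT hx hL hLx hge hle hpr hodd hsum hHn hHn1 hH0 hN a (f := h) (fun n hn => by simp [hh, hf n hn]) hF
    (fun n => (hab n).trans (hfF n)) ((sum_le_sum fun n _ => sq_le_sq.2 (hab n)).trans hfN)
  rw [← hθ] at hGT
  have e : ∀ n, ∑ p ∈ G, (indd p n - 1 / p) * θ ^ om G n * θ ^ om G (nb n p) * h (nb n p) =
      Real.exp (-(2 * K)) * θ ^ om G n * ∑ p ∈ G, (indd p n - 1 / p) * f (nb n p) := fun n => by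
    rw [mul_sum]
    refine sum_congr rfl fun p _ => ?_
    simp only [hh]
    have h2 : θ ^ om G (nb n p) ≠ 0 := (pow_pos hθ0 _).ne'
    field_simp
  simp only [e] at hGT
  have h5 : ∑ n ∈ Ioc a (a + N) with (om P n : ℝ) ≤ K * L, Real.exp (-(8 * K)) * (∑ p ∈ G, (indd p n - 1 / p) * f (nb n p)) ^ 2 ≤ 3 * 10 ^ 12 * L * N := by
    refine le_trans (sum_le_sum fun n hn => ?_) ((sum_le_sum_of_subset_of_nonneg (filter_subset _ _) fun n _ _ => sq_nonneg _).trans hGT)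
    have h1 := hlb n (mem_filter.1 hn).2
    rw [mul_pow]
    refine mul_le_mul_of_nonneg_right ?_ (sq_nonneg _)
    calc Real.exp (-(8 * K)) = (Real.exp (-(2 * K)) * Real.exp (-(2 * K))) ^ 2 := by
          rw [← Real.exp_add, ← Real.exp_nat_mul]; congr 1; push_cast; ring
      _ ≤ _ := by gcongr
  rw [← mul_sum] at h5
  have h6 := mul_le_mul_of_nonneg_left h5 (Real.exp_pos (8 * K)).le
  rw [← mul_assoc, ← Real.exp_add, add_neg_cancel, Real.exp_zero, one_mul] at h6
  exact h6

noncomputable def Ar (G : Finset ℕ) (r : ℤ → ℝ) (n : ℤ) : ℝ :=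
  ∑ σ ∈ sg, ∑ p ∈ G, (indd p n - 1 / p) * r (n + σ * p)

lemma om_neg (P : Finset ℕ) (n : ℤ) : om P (-n) = om P n := by
  unfold om
  simp only [dvd_neg]

lemma indd_neg (p : ℕ) (n : ℤ) : indd p (-n) = indd p n := by
  unfold indd
  simp only [dvd_neg]

lemma sgn_neg (n : ℤ) : sgn (-n) = sgn n := by
  unfold sgn
  simp only [even_neg]

lemma Ar_split (G : Finset ℕ) (r : ℤ → ℝ) (n : ℤ) :
    Ar G r n = (∑ p ∈ G, (indd p n - 1 / p) * r (nb n p)) + ∑ p ∈ G, (indd p (-n) - 1 / p) * r (- nb (-n) p) := by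
  have e : ∀ p : ℕ, - nb (-n) p = n + (- sgn n) * p := fun p => by unfold nb; rw [sgn_neg]; ring
  simp only [e, indd_neg]
  unfold Ar nb
  simp only [sg]
  rw [sum_pair (by norm_num)]
  unfold sgn
  split_ifs
  · exact add_comm _ _
  · simp only [neg_neg]

lemma sum_reflect (a : ℤ) (N : ℕ) (F : ℤ → ℝ) : ∑ n ∈ Ioc a (a + N), F n = ∑ n ∈ Ioc (-a - N - 1) (-a - N - 1 + N), F (-n) := by
  refine sum_nbij' (fun n => -n) (fun n => -n) ?_ ?_ ?_ ?_ ?_ <;> intro n hn <;> simp only [mem_Ioc, neg_neg] at * <;> first | omega | skip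

lemma good_two {P G : Finset ℕ} {L K F B : ℝ} {N : ℕ} (hG : GoodG P G L K F B N) {a : ℤ} {r : ℤ → ℝ} (hr : ∀ n ∉ Ioc a (a + N), r n = 0)
    (hF : ∀ n, |r n| ≤ F) (hK : ∀ n, r n ≠ 0 → (om P n : ℝ) ≤ K * L) (hN : ∑ n ∈ Ioc a (a + N), r n ^ 2 ≤ N) :
    ∑ n ∈ Ioc a (a + N) with (om P n : ℝ) ≤ K * L, Ar G r n ^ 2 ≤ 4 * B := by
  have h1 := hG a r hr hF hK hN
  have h2 := hG (-a - N - 1) (fun n => r (-n)) (fun n hn => hr _ (fun h => hn (by simp only [mem_Ioc] at *; omega))) (fun n => hF _)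
    (fun n hn => by rw [← om_neg]; exact hK _ hn) (by rw [sum_reflect] at hN; exact hN)
  rw [sum_filter] at h1 h2 ⊢
  have h3 : ∑ n ∈ Ioc (-a - N - 1) (-a - N - 1 + N), (if (om P n : ℝ) ≤ K * L then (∑ p ∈ G, (indd p n - 1 / p) * r (- nb n p)) ^ 2 else 0) =
      ∑ n ∈ Ioc a (a + N), (if (om P n : ℝ) ≤ K * L then (∑ p ∈ G, (indd p (-n) - 1 / p) * r (- nb (-n) p)) ^ 2 else 0) := by
    rw [sum_reflect a]
    refine sum_congr rfl fun n _ => ?_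
    simp only [om_neg, neg_neg]
  rw [h3] at h2
  calc _ ≤ ∑ n ∈ Ioc a (a + N), (2 * (if (om P n : ℝ) ≤ K * L then (∑ p ∈ G, (indd p n - 1 / p) * r (nb n p)) ^ 2 else 0) +
        2 * (if (om P n : ℝ) ≤ K * L then (∑ p ∈ G, (indd p (-n) - 1 / p) * r (- nb (-n) p)) ^ 2 else 0)) := sum_le_sum fun n _ => by
          split_ifs
          · rw [Ar_split]
            nlinarith [sq_nonneg ((∑ p ∈ G, (indd p n - 1 / p) * r (nb n p)) - ∑ p ∈ G, (indd p (-n) - 1 / p) * r (- nb (-n) p))]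
          · norm_num
    _ ≤ 4 * B := by
      rw [sum_add_distrib, ← mul_sum, ← mul_sum]; linarith

lemma Ar_union {P : Finset ℕ} (Q : ℕ → Prop) (r : ℤ → ℝ) (n : ℤ) :
    Ar P r n = Ar (P.filter Q) r n + Ar (P.filter fun p => ¬ Q p) r n := by
  unfold Ar
  rw [← sum_add_distrib]
  exact sum_congr rfl fun σ _ => (sum_filter_add_sum_filter_not _ _ _).symm

lemma Aop_re (P : Finset ℕ) (g : ℤ → ℂ) (n : ℤ) : (Aop P g n).re = Ar P (fun m => (g m).re) n := by
  unfold Aop Ar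
  simp only [Complex.re_sum, Complex.re_ofReal_mul]

lemma Aop_im (P : Finset ℕ) (g : ℤ → ℂ) (n : ℤ) : (Aop P g n).im = Ar P (fun m => (g m).im) n := by
  unfold Aop Ar
  simp only [Complex.im_sum, Complex.im_ofReal_mul]

lemma good_complex {P : Finset ℕ} (Q : ℕ → Prop) {L K F B : ℝ} {N : ℕ} (hG1 : GoodG P (P.filter Q) L K F B N)
    (hG2 : GoodG P (P.filter fun p => ¬ Q p) L K F B N) {a : ℤ} {g : ℤ → ℂ} (hr : ∀ n ∉ Ioc a (a + N), g n = 0)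
    (hF : ∀ n, ‖g n‖ ≤ F) (hK : ∀ n, g n ≠ 0 → (om P n : ℝ) ≤ K * L) (hN : ∑ n ∈ Ioc a (a + N), ‖g n‖ ^ 2 ≤ N) :
    ∑ n ∈ Ioc a (a + N) with (om P n : ℝ) ≤ K * L, ‖Aop P g n‖ ^ 2 ≤ 32 * B := by
  have key : ∀ r : ℤ → ℝ, (∀ n, |r n| ≤ ‖g n‖) → ∑ n ∈ Ioc a (a + N) with (om P n : ℝ) ≤ K * L, Ar P r n ^ 2 ≤ 16 * B := fun r hrg => by
    have c1 : ∀ n ∉ Ioc a (a + N), r n = 0 := fun n hn => by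
      have := hrg n
      rw [hr n hn, norm_zero] at this
      exact abs_nonpos_iff.1 this
    have c2 : ∀ n, r n ≠ 0 → (om P n : ℝ) ≤ K * L := fun n hn => hK n fun h => hn (by
      have := hrg n
      rw [h, norm_zero] at this
      exact abs_nonpos_iff.1 this)
    have c3 : ∑ n ∈ Ioc a (a + N), r n ^ 2 ≤ N := (sum_le_sum fun n _ => by
      rw [← sq_abs]; exact pow_le_pow_left₀ (abs_nonneg _) (hrg n) 2).trans hN
    have h1 := good_two hG1 c1 (fun n => (hrg n).trans (hF n)) c2 c3
    have h2 := good_two hG2 c1 (fun n => (hrg n).trans (hF n)) c2 c3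
    have h3 : ∑ n ∈ Ioc a (a + N) with (om P n : ℝ) ≤ K * L, Ar P r n ^ 2 ≤ ∑ n ∈ Ioc a (a + N) with (om P n : ℝ) ≤ K * L,
        (2 * Ar (P.filter Q) r n ^ 2 + 2 * Ar (P.filter fun p => ¬ Q p) r n ^ 2) := sum_le_sum fun n _ => by
      rw [Ar_union Q]
      nlinarith [sq_nonneg (Ar (P.filter Q) r n - Ar (P.filter fun p => ¬ Q p) r n)]
    rw [sum_add_distrib, ← mul_sum, ← mul_sum] at h3
    linarith
  have h1 := key (fun m => (g m).re) fun n => Complex.abs_re_le_norm _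
  have h2 := key (fun m => (g m).im) fun n => Complex.abs_im_le_norm _
  have e : ∀ n, ‖Aop P g n‖ ^ 2 = Ar P (fun m => (g m).re) n ^ 2 + Ar P (fun m => (g m).im) n ^ 2 := fun n => by
    rw [← Aop_re, ← Aop_im, Complex.sq_norm, Complex.normSq_apply]; ring
  simp only [e]
  rw [sum_add_distrib]
  linarith

end KK

set_option linter.all false
set_option linter.unusedVariables false
set_option linter.unusedSectionVars false
namespace KK
open Finset
open scoped Classical

lemma L_sq {P : Finset ℕ} {L y : ℝ} (hy : 0 ≤ y) (hP : ∀ q ∈ P, q.Prime) (hH : ∀ q ∈ P, (q:ℝ) ≤ Real.exp y) (hL : L = ∑ p ∈ P, 1 / (p:ℝ)) :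
    L ^ 2 ≤ 2 * (1 + 2 * y) := by
  set S := (P ×ˢ P).filter fun x => x.1 ≤ x.2 with hS
  have hmem : ∀ x ∈ S, x.1.Prime ∧ x.2.Prime ∧ x.1 ≤ x.2 ∧ (x.1:ℝ) ≤ Real.exp y ∧ (x.2:ℝ) ≤ Real.exp y := fun x hx => by
    rw [hS, mem_filter, mem_product] at hx
    exact ⟨hP _ hx.1.1, hP _ hx.1.2, hx.2, hH _ hx.1.1, hH _ hx.1.2⟩
  have hmin : ∀ x ∈ S, (x.1 * x.2).minFac = x.1 := fun x hx => by
    obtain ⟨h1, h2, h3, _⟩ := hmem x hx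
    have hne : x.1 * x.2 ≠ 1 := fun h => h1.one_lt.ne' (Nat.eq_one_of_mul_eq_one_right h)
    have hp := Nat.minFac_prime hne
    have hd := Nat.minFac_dvd (x.1 * x.2)
    have hle := Nat.minFac_le_of_dvd h1.two_le (Dvd.intro x.2 rfl)
    rcases (hp.dvd_mul).1 hd with h | h
    · exact (Nat.prime_dvd_prime_iff_eq hp h1).1 h
    · have := (Nat.prime_dvd_prime_iff_eq hp h2).1 h
      omega
  have hS1 : ∑ x ∈ S, 1 / ((x.1:ℝ) * x.2) ≤ 1 + 2 * y := by
    have e : ∑ x ∈ S, 1 / ((x.1:ℝ) * x.2) = ∑ m ∈ S.image (fun x : ℕ × ℕ => (x.1 * x.2 : ℕ)), 1 / (m:ℝ) := by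
      rw [sum_image]
      · exact sum_congr rfl fun x _ => by push_cast; rfl
      · intro x hx x' hx' hxx
        simp only at hxx
        have h1 : x.1 = x'.1 := by rw [← hmin x hx, ← hmin x' hx', hxx]
        have h2 : x.2 = x'.2 := by
          rw [h1] at hxx
          exact Nat.eq_of_mul_eq_mul_left (hmem x' hx').1.pos hxx
        exact Prod.ext h1 h2
    rw [e]
    refine le_trans (sum_le_sum_of_subset_of_nonneg (t := Icc 1 ⌊Real.exp (2 * y)⌋₊) (fun m hm => ?_) fun m _ _ => by positivity)
      (harm_le (Nat.floor_le (Real.exp_pos _).le) (by linarith))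
    obtain ⟨x, hx, rfl⟩ := mem_image.1 hm
    obtain ⟨h1, h2, h3, h4, h5⟩ := hmem x hx
    rw [mem_Icc]
    refine ⟨Nat.mul_pos h1.pos h2.pos, Nat.le_floor ?_⟩
    push_cast
    rw [two_mul, Real.exp_add]
    exact mul_le_mul h4 h5 (by positivity) (Real.exp_pos _).le
  have e1 : L ^ 2 = ∑ x ∈ P ×ˢ P, 1 / ((x.1:ℝ) * x.2) := by
    rw [sq, hL, sum_mul_sum, sum_product]
    exact sum_congr rfl fun p _ => sum_congr rfl fun q _ => by rw [one_div_mul_one_div]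
  have e2 := sum_filter_add_sum_filter_not (P ×ˢ P) (fun x => x.1 ≤ x.2) (fun x => 1 / ((x.1:ℝ) * x.2))
  have e3 : ∑ x ∈ P ×ˢ P with ¬ x.1 ≤ x.2, 1 / ((x.1:ℝ) * x.2) ≤ ∑ x ∈ S, 1 / ((x.1:ℝ) * x.2) := by
    have : ∑ x ∈ P ×ˢ P with ¬ x.1 ≤ x.2, 1 / ((x.1:ℝ) * x.2) = ∑ x ∈ ((P ×ˢ P).filter fun x => ¬ x.1 ≤ x.2).image Prod.swap, 1 / ((x.1:ℝ) * x.2) := by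
      rw [sum_image (fun x _ x' _ h => Prod.swap_injective h)]
      exact sum_congr rfl fun x _ => by simp only [Prod.fst_swap, Prod.snd_swap]; rw [mul_comm]
    rw [this]
    refine sum_le_sum_of_subset_of_nonneg (fun z hz => ?_) fun _ _ _ => by positivity
    obtain ⟨x, hx, rfl⟩ := mem_image.1 hz
    rw [mem_filter, mem_product] at hx
    rw [hS, mem_filter, mem_product]
    exact ⟨⟨hx.1.2, hx.1.1⟩, (not_le.1 hx.2).le⟩
  rw [e1]
  linarith

lemma Aop_add (P : Finset ℕ) (g h : ℤ → ℂ) (n : ℤ) : Aop P (fun m => g m + h m) n = Aop P g n + Aop P h n := by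
  unfold Aop
  simp only [← sum_add_distrib, mul_add]

section
variable {P : Finset ℕ} {L y : ℝ} {N : ℕ}

lemma L8 (hL : 0 ≤ L) : (L + 8) ^ 8 * Real.exp (-L) ≤ 40320 * Real.exp 8 := by
  have := Real.pow_div_factorial_le_exp (L + 8) (by linarith) 8
  rw [div_le_iff₀ (by positivity)] at this
  have e : ((8).factorial : ℝ) = 40320 := by norm_num [Nat.factorial]
  rw [e, Real.exp_add] at this
  calc (L + 8) ^ 8 * Real.exp (-L) ≤ (Real.exp L * Real.exp 8 * 40320) * Real.exp (-L) := mul_le_mul_of_nonneg_right this (Real.exp_pos _).le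
    _ = (Real.exp L * Real.exp (-L)) * (40320 * Real.exp 8) := by ring
    _ = _ := by rw [← Real.exp_add, add_neg_cancel, Real.exp_zero, one_mul]

lemma f2_part (h : St P L y N) {C τ K : ℝ} (hC : 0 < C) (hτ : τ = 8 * C + 1) (hK : K = 4 * Real.exp (τ + 1)) {T : ℝ} (hT : T = Real.exp ((C + τ / 4) * L))
    {a : ℤ} {f : ℤ → ℂ} (hf : ∀ n ∉ Ioc a (a + N), f n = 0)
    (hf4 : ∑ n ∈ Ioc a (a + N), ‖f n‖ ^ 4 ≤ Real.exp (4 * C * L) * N) :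
    ∑ n ∈ Ioc a (a + N), ‖Aop P (fun m => if ‖f m‖ ≤ T ∧ (om P m : ℝ) ≤ K * L then 0 else f m) n‖ ^ 2 ≤ (10 ^ 5 * (40320 * Real.exp 8) + 20) * N := by
  have hL := h.hL2
  have hK4 : 4 ≤ K := by rw [hK]; have := Real.one_le_exp (by linarith : 0 ≤ τ + 1); linarith
  have hKL : 0 < K * L := by positivity
  set I := Ioc a (a + (N:ℤ)) with hI
  set E := I.filter fun m => ¬ (‖f m‖ ≤ T ∧ (om P m : ℝ) ≤ K * L) with hE
  have hN0 : (0:ℝ) ≤ N := by positivity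
  have hEc : (E.card : ℝ) ≤ 65 * Real.exp (-(τ * L)) * N := by
    have ht := tail h (by linarith : 0 ≤ τ) hK a
    have hsub : E ⊆ (I.filter fun m => T < ‖f m‖) ∪ (I.filter fun m => K * L < om P m) := fun m hm => by
      rw [hE, mem_filter, not_and_or, not_le, not_le] at hm
      rw [mem_union, mem_filter, mem_filter]
      exact hm.2.imp (fun h => ⟨hm.1, h⟩) fun h => ⟨hm.1, h⟩
    have h1 : (E.card : ℝ) ≤ ((I.filter fun m => T < ‖f m‖).card : ℝ) + ((I.filter fun m => K * L < om P m).card : ℝ) := by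
      exact_mod_cast (card_le_card hsub).trans (card_union_le _ _)
    have h2 : ((I.filter fun m => K * L < om P m).card : ℝ) ≤ 64 * Real.exp (-(τ * L)) * N := by
      refine le_trans ?_ ht
      rw [← nsmul_one, ← sum_const]
      refine sum_le_sum fun m hm => ?_
      have h3 := (mem_filter.1 hm).2
      have h4 : 0 < om P m := by
        have : (0:ℝ) < om P m := by linarith
        exact_mod_cast this
      have h5 : (1:ℝ) ≤ om P m := by exact_mod_cast h4
      exact one_le_pow₀ h5
    have h3 : ((I.filter fun m => T < ‖f m‖).card : ℝ) * T ^ 4 ≤ Real.exp (4 * C * L) * N := by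
      refine le_trans ?_ hf4
      rw [← nsmul_eq_mul, ← sum_const]
      refine le_trans (sum_le_sum fun m hm => ?_) (sum_le_sum_of_subset_of_nonneg (filter_subset _ _) fun _ _ _ => by positivity)
      exact pow_le_pow_left₀ (by rw [hT]; positivity) (mem_filter.1 hm).2.le 4
    have e : T ^ 4 = Real.exp (4 * C * L) * Real.exp (τ * L) := by
      rw [hT, ← Real.exp_nat_mul, ← Real.exp_add]; congr 1; push_cast; ring
    rw [e] at h3
    have h4 : ((I.filter fun m => T < ‖f m‖).card : ℝ) ≤ Real.exp (-(τ * L)) * N := by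
      rw [Real.exp_neg, ← div_eq_inv_mul, le_div_iff₀ (Real.exp_pos _)]
      refine le_of_mul_le_mul_left ?_ (Real.exp_pos (4 * C * L))
      linarith
    linarith
  set β := Real.exp ((4 * C + 1) * L) with hβ
  have hβ0 : 0 < β := Real.exp_pos _
  have hcr := crudeA h.hL (a := a) (b := a + N) (fun m => if ‖f m‖ ≤ T ∧ (om P m : ℝ) ≤ K * L then 0 else f m)
    (fun n hn => by split_ifs; rfl; exact hf n hn)
  refine hcr.trans ?_
  have h1 : ∑ m ∈ I, ‖(if ‖f m‖ ≤ T ∧ (om P m : ℝ) ≤ K * L then 0 else f m)‖ ^ 2 * Wc P L m = ∑ m ∈ E, ‖f m‖ ^ 2 * Wc P L m := by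
    rw [hE, sum_filter]
    refine sum_congr rfl fun m _ => ?_
    by_cases hm : ‖f m‖ ≤ T ∧ (om P m : ℝ) ≤ K * L
    · simp [hm]
    · rw [if_neg hm, if_pos hm]
  rw [h1]
  set e4 := Real.exp (4 * C * L) with he4
  have he0 : 0 < e4 := Real.exp_pos _
  have hpt : ∀ m, ‖f m‖ ^ 2 * Wc P L m ≤ 1 / 2 * e4⁻¹ * ‖f m‖ ^ 4 + (1 / 4 * e4 * β + 1 / 4 * (e4 * β⁻¹) * Wc P L m ^ 4) := fun m => by
    set W := Wc P L m
    have i1 : e4⁻¹ * e4 = 1 := inv_mul_cancel₀ he0.ne'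
    have i2 : β⁻¹ * β = 1 := inv_mul_cancel₀ hβ0.ne'
    have q1 : 0 ≤ 1 / 2 * e4⁻¹ * (‖f m‖ ^ 2 - e4 * W) ^ 2 := by positivity
    have q2 : 0 ≤ 1 / 4 * e4 * β⁻¹ * (β - W ^ 2) ^ 2 := by positivity
    have r1 : 1 / 2 * e4⁻¹ * (‖f m‖ ^ 2 - e4 * W) ^ 2 = 1 / 2 * e4⁻¹ * ‖f m‖ ^ 4 - (e4⁻¹ * e4) * (‖f m‖ ^ 2 * W) + 1 / 2 * (e4⁻¹ * e4) * e4 * W ^ 2 := by ring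
    have r2 : 1 / 4 * e4 * β⁻¹ * (β - W ^ 2) ^ 2 = 1 / 4 * e4 * (β⁻¹ * β) * β - 1 / 2 * e4 * (β⁻¹ * β) * W ^ 2 + 1 / 4 * (e4 * β⁻¹) * W ^ 4 := by ring
    rw [r1, i1] at q1
    rw [r2, i2] at q2
    linarith
  refine (sum_le_sum fun m _ => hpt m).trans ?_
  rw [sum_add_distrib, sum_add_distrib, ← mul_sum, sum_const, nsmul_eq_mul, ← mul_sum]
  have s1 : ∑ m ∈ E, ‖f m‖ ^ 4 ≤ e4 * N := (sum_le_sum_of_subset_of_nonneg (filter_subset _ _) fun _ _ _ => by positivity).trans hf4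
  have s2 : ∑ m ∈ E, Wc P L m ^ 4 ≤ 10 ^ 5 * (L + 8) ^ 8 * N :=
    (sum_le_sum_of_subset_of_nonneg (filter_subset _ _) fun m _ _ => pow_nonneg (Wc_nonneg _ _ _) 4).trans (Wc4 h a)
  have t1 : 1 / 2 * e4⁻¹ * ∑ m ∈ E, ‖f m‖ ^ 4 ≤ 1 / 2 * N := by
    calc _ ≤ 1 / 2 * e4⁻¹ * (e4 * N) := mul_le_mul_of_nonneg_left s1 (by positivity)
      _ = _ := by field_simp
  have t2 : E.card * (1 / 4 * e4 * β) ≤ 65 / 4 * N := by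
    calc _ ≤ 65 * Real.exp (-(τ * L)) * N * (1 / 4 * e4 * β) := mul_le_mul_of_nonneg_right hEc (by positivity)
      _ = 65 / 4 * N * (Real.exp (-(τ * L)) * e4 * β) := by ring
      _ = 65 / 4 * N := by
        rw [he4, hβ, ← Real.exp_add, ← Real.exp_add, hτ, show -((8 * C + 1) * L) + 4 * C * L + (4 * C + 1) * L = 0 by ring, Real.exp_zero, mul_one]
  have t3 : 1 / 4 * (e4 * β⁻¹) * ∑ m ∈ E, Wc P L m ^ 4 ≤ 10 ^ 5 * (40320 * Real.exp 8) * N := by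
    have e5 : e4 * β⁻¹ = Real.exp (-L) := by
      rw [hβ, he4, ← Real.exp_neg, ← Real.exp_add]; congr 1; ring
    rw [e5]
    have l8 := L8 (by linarith : 0 ≤ L)
    calc _ ≤ 1 / 4 * Real.exp (-L) * (10 ^ 5 * (L + 8) ^ 8 * N) := mul_le_mul_of_nonneg_left s2 (by positivity)
      _ = 1 / 4 * 10 ^ 5 * N * ((L + 8) ^ 8 * Real.exp (-L)) := by ring
      _ ≤ 1 / 4 * 10 ^ 5 * N * (40320 * Real.exp 8) := mul_le_mul_of_nonneg_left l8 (by positivity)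
      _ ≤ _ := by
        have : 0 ≤ (N:ℝ) * Real.exp 8 := by positivity
        linarith
  linarith

lemma f1_tail (h : St P L y N) {C τ K : ℝ} (hC : 0 < C) (hτ : τ = 8 * C + 1) (hK : K = 4 * Real.exp (τ + 1)) {T : ℝ} (hT : T = Real.exp ((C + τ / 4) * L))
    {a : ℤ} {g : ℤ → ℂ} (hg : ∀ n, ‖g n‖ ≤ T) :
    ∑ n ∈ Ioc a (a + N) with K * L < om P n, ‖Aop P g n‖ ^ 2 ≤ 1024 * N := by
  have hL := h.hL2
  have hK4 : 4 ≤ K := by rw [hK]; have := Real.one_le_exp (by linarith : 0 ≤ τ + 1); linarith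
  have ht := tail h (by linarith : 0 ≤ τ) hK a
  have hT0 : 0 < T := by rw [hT]; positivity
  have hpt : ∀ n ∈ (Ioc a (a + (N:ℤ))).filter (fun n => K * L < om P n), ‖Aop P g n‖ ^ 2 ≤ 16 * T ^ 2 * (om P n : ℝ) ^ 2 := fun n hn => by
    have hn := (mem_filter.1 hn).2
    have h1 : ‖Aop P g n‖ ≤ 4 * T * om P n := by
      refine (Aop_norm P g n).trans ?_
      have b1 : ∑ σ ∈ sg, ∑ p ∈ P, indd p n * ‖g (n + σ * p)‖ ≤ ∑ σ ∈ sg, ∑ p ∈ P, indd p n * T :=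
        sum_le_sum fun σ _ => sum_le_sum fun p _ => mul_le_mul_of_nonneg_left (hg _) (indd_nonneg _ _)
      have b2 : ∑ σ ∈ sg, ∑ p ∈ P, 1 / (p:ℝ) * ‖g (n + σ * p)‖ ≤ ∑ σ ∈ sg, ∑ p ∈ P, 1 / (p:ℝ) * T :=
        sum_le_sum fun σ _ => sum_le_sum fun p _ => mul_le_mul_of_nonneg_left (hg _) (by positivity)
      simp only [← sum_mul, ← om_eq, ← h.hL, sg] at b1 b2
      rw [sum_pair (by norm_num : (-1:ℤ) ≠ 1), sum_pair (by norm_num : (-1:ℤ) ≠ 1)] at b1 b2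
      simp only [sg]
      rw [sum_pair (by norm_num : (-1:ℤ) ≠ 1), sum_pair (by norm_num : (-1:ℤ) ≠ 1)]
      have : L ≤ om P n := by nlinarith
      have := mul_le_mul_of_nonneg_right this hT0.le
      linarith
    calc _ ≤ (4 * T * om P n) ^ 2 := pow_le_pow_left₀ (norm_nonneg _) h1 2
      _ = _ := by ring
  refine (sum_le_sum hpt).trans ?_
  rw [← mul_sum]
  calc _ ≤ 16 * T ^ 2 * (64 * Real.exp (-(τ * L)) * N) := mul_le_mul_of_nonneg_left ht (by positivity)
    _ = 1024 * N * (T ^ 2 * Real.exp (-(τ * L))) := by ring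
    _ ≤ 1024 * N * 1 := mul_le_mul_of_nonneg_left (by
        rw [hT, ← Real.exp_nat_mul, ← Real.exp_add]
        refine Real.exp_le_one_iff.2 ?_
        push_cast
        rw [hτ]
        nlinarith) (by positivity)
    _ = _ := mul_one _

lemma main_split (h : St P L y N) {C τ K : ℝ} (hC : 0 < C) (hτ : τ = 8 * C + 1) (hK : K = 4 * Real.exp (τ + 1)) {T : ℝ} (hT : T = Real.exp ((C + τ / 4) * L))
    (Q : ℕ → Prop) {B : ℝ} (hG1 : GoodG P (P.filter Q) L K T B N) (hG2 : GoodG P (P.filter fun p => ¬ Q p) L K T B N)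
    {a : ℤ} {f : ℤ → ℂ} (hf : ∀ n ∉ Ioc a (a + N), f n = 0) (hf2 : ∑ n ∈ Ioc a (a + N), ‖f n‖ ^ 2 ≤ N)
    (hf4 : ∑ n ∈ Ioc a (a + N), ‖f n‖ ^ 4 ≤ Real.exp (4 * C * L) * N) :
    ∑ n ∈ Ioc a (a + N), ‖Aop P f n‖ ^ 2 ≤ 64 * B + (2 * (10 ^ 5 * (40320 * Real.exp 8) + 20) + 2048) * N := by
  have h2 := f2_part h hC hτ hK hT hf hf4
  set f1 : ℤ → ℂ := fun m => if ‖f m‖ ≤ T ∧ (om P m : ℝ) ≤ K * L then f m else 0 with hf1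
  set f2 : ℤ → ℂ := fun m => if ‖f m‖ ≤ T ∧ (om P m : ℝ) ≤ K * L then 0 else f m with hf2'
  have hT0 : 0 < T := by rw [hT]; positivity
  have hle : ∀ n, ‖f1 n‖ ≤ T := fun n => by
    simp only [hf1]; split_ifs with hh
    · exact hh.1
    · rw [norm_zero]; exact hT0.le
  have h1a := good_complex Q hG1 hG2 (a := a) (g := f1) (fun n hn => by simp only [hf1]; split_ifs; exact hf n hn; rfl) hle
    (fun n hn => by
      by_contra hc
      exact hn (by simp only [hf1]; rw [if_neg fun hh => hc hh.2]))
    ((sum_le_sum fun n _ => by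
      simp only [hf1]; split_ifs
      · exact le_rfl
      · rw [norm_zero, zero_pow two_ne_zero]; positivity).trans hf2)
  have h1b := f1_tail h hC hτ hK hT (a := a) hle
  have hs := sum_filter_add_sum_filter_not (Ioc a (a + (N:ℤ))) (fun n => (om P n : ℝ) ≤ K * L) (fun n => ‖Aop P f1 n‖ ^ 2)
  simp only [not_le] at hs
  have e : ∀ n, Aop P f n = Aop P f1 n + Aop P f2 n := fun n => by
    rw [← Aop_add]
    congr 1
    funext m
    simp only [hf1, hf2']
    split_ifs <;> simp
  have hfin : ∀ n, ‖Aop P f n‖ ^ 2 ≤ 2 * ‖Aop P f1 n‖ ^ 2 + 2 * ‖Aop P f2 n‖ ^ 2 := fun n => by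
    rw [e]
    have := pow_le_pow_left₀ (norm_nonneg _) (norm_add_le (Aop P f1 n) (Aop P f2 n)) 2
    nlinarith [sq_nonneg (‖Aop P f1 n‖ - ‖Aop P f2 n‖)]
  refine (sum_le_sum fun n _ => hfin n).trans ?_
  rw [sum_add_distrib, ← mul_sum, ← mul_sum]
  linarith

end
end KK

set_option linter.all false
set_option linter.unusedVariables false
set_option linter.unusedSectionVars false
namespace KK
open Finset
open scoped Classical

section
variable {P : Finset ℕ} {L y : ℝ} {N : ℕ}

lemma vpow {v : ℝ} (a b c : ℕ) (h : a * b = c) : (v ^ a) ^ b = v ^ c := by rw [← pow_mul, h]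

lemma main_case (h : St P L y N) {C τ K v H0 : ℝ} (hC : 0 < C) (hτ : τ = 8 * C + 1) (hK : K = 4 * Real.exp (τ + 1))
    (hv : 1000 ≤ v) (hvC : C + τ / 4 ≤ v) (hyv : y = v ^ 500) (hL6 : 10 ^ 6 ≤ L) (hH0 : Real.exp (v ^ 320) ≤ H0) (hge : ∀ p ∈ P, H0 ≤ p)
    {a : ℤ} {f : ℤ → ℂ} (hf : ∀ n ∉ Ioc a (a + N), f n = 0) (hf2 : ∑ n ∈ Ioc a (a + N), ‖f n‖ ^ 2 ≤ N)
    (hf4 : ∑ n ∈ Ioc a (a + N), ‖f n‖ ^ 4 ≤ Real.exp (4 * C * L) * N) :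
    ∑ n ∈ Ioc a (a + N), ‖Aop P f n‖ ^ 2 ≤ 64 * (Real.exp (8 * K) * (3 * 10 ^ 12 * L * N)) + (2 * (10 ^ 5 * (40320 * Real.exp 8) + 20) + 2048) * N := by
  have hL2 := h.hL2
  have v1 : 1 ≤ v := by linarith
  have v0 : 0 ≤ v := by linarith
  have mono : ∀ {i j : ℕ}, i ≤ j → v ^ i ≤ v ^ j := fun hij => pow_le_pow_right₀ v1 hij
  have hone : ∀ i : ℕ, 1 ≤ v ^ i := fun i => one_le_pow₀ v1
  have hLv : L ≤ v ^ 280 := by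
    have h1 := L_sq (by linarith [h.hy]) h.hP h.hH h.hL
    have h2 : 2 * (1 + 2 * y) ≤ v ^ 560 := by
      have e : v ^ 560 = v ^ 60 * y := by rw [hyv, ← pow_add]
      have h3 : v ≤ v ^ 60 := by simpa using mono (show 1 ≤ 60 by norm_num)
      have hy := h.hy
      rw [e]; nlinarith
    refine le_of_pow_le_pow_left₀ (n := 2) (by norm_num) (pow_nonneg v0 _) ?_
    rw [vpow 280 2 560 (by norm_num)]
    exact h1.trans h2
  have hv4 : (10:ℝ) ^ 9 ≤ v ^ 4 := by
    calc (10:ℝ) ^ 9 ≤ 1000 ^ 4 := by norm_num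
      _ ≤ v ^ 4 := pow_le_pow_left₀ (by norm_num) hv 4
  have hv45 : v ^ 4 ≤ v ^ 5 := mono (by norm_num)
  have hT4 : Real.exp ((C + τ / 4) * L) ≤ Real.exp ((v ^ 4) ^ 71) := by
    refine Real.exp_le_exp.2 ?_
    rw [vpow 4 71 284 (by norm_num)]
    have e : v ^ 284 = v ^ 4 * v ^ 280 := by rw [← pow_add]
    rw [e]
    have : v ≤ v ^ 4 := by simpa using mono (show 1 ≤ 4 by norm_num)
    exact mul_le_mul (hvC.trans this) hLv (by linarith) (by linarith)
  have hT5 : Real.exp ((C + τ / 4) * L) ≤ Real.exp ((v ^ 5) ^ 71) :=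
    hT4.trans (Real.exp_le_exp.2 (pow_le_pow_left₀ (by linarith) hv45 71))
  have hodd : ∀ p ∈ P, Odd p := fun p hp => by
    refine (h.hP p hp).odd_of_ne_two fun h2 => ?_
    have h3 := hge p hp
    rw [h2] at h3
    have h4 := Real.add_one_le_exp (v ^ 320)
    have h5 : v ≤ v ^ 320 := by simpa using mono (show 1 ≤ 320 by norm_num)
    push_cast at h3
    linarith
  have hsub : ∀ G : Finset ℕ, G ⊆ P → ∑ p ∈ G, 1 / (p:ℝ) ≤ L := fun G hG => by
    rw [h.hL]
    exact sum_le_sum_of_subset_of_nonneg hG fun _ _ _ => by positivity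
  obtain ⟨Q, hQ⟩ : ∃ Q : ℕ → Prop, ∀ p, Q p ↔ Real.exp (v ^ 400) ≤ (p:ℝ) := ⟨fun p => Real.exp (v ^ 400) ≤ (p:ℝ), fun p => Iff.rfl⟩
  obtain ⟨Z, hZ⟩ : ∃ Z : ℝ, Z = Real.exp (v ^ 400) := ⟨_, rfl⟩
  rw [← hZ] at hQ
  have hZ1 : 1 ≤ Z := by rw [hZ]; exact Real.one_le_exp (pow_nonneg v0 _)
  have hG1 : GoodG P (P.filter Q) L K (Real.exp ((C + τ / 4) * L)) (Real.exp (8 * K) * (3 * 10 ^ 12 * L * N)) N := by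
    have c1 : L ≤ (v ^ 5) ^ 70 := by rw [vpow 5 70 350 (by norm_num)]; exact hLv.trans (mono (by norm_num))
    have c2 : ((⌊Real.exp y⌋₊ : ℕ) : ℝ) ≤ Real.exp ((v ^ 5) ^ 100) := by
      rw [vpow 5 100 500 (by norm_num), ← hyv]; exact Nat.floor_le (Real.exp_pos _).le
    have c3 : 1 ≤ ⌊Real.exp y⌋₊ := Nat.le_floor (by push_cast; exact Real.one_le_exp (by linarith [h.hy]))
    have c4 : Real.exp ((v ^ 5) ^ 80) ≤ Z := by rw [vpow 5 80 400 (by norm_num), hZ]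
    have c5 : Real.exp (L * (v ^ 5) ^ 200) ≤ N := by
      have e : y ^ 2 = (v ^ 5) ^ 200 := by rw [hyv, vpow 500 2 1000 (by norm_num), vpow 5 200 1000 (by norm_num)]
      rw [← e]; exact h.hN
    have c0 : (10:ℝ) ^ 9 ≤ v ^ 5 := hv4.trans hv45
    generalize v ^ 5 = x at c0 c1 c2 c4 c5 hT5
    have hm : ∀ p ∈ P.filter Q, p ∈ P ∧ Q p := fun p hp => mem_filter.1 hp
    generalize P.filter Q = G at hm ⊢
    have hGP : G ⊆ P := fun p hp => (hm p hp).1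
    exact good_of_GT (x := x) (H0 := Z) (Hn := ⌊Real.exp y⌋₊) c0 hL6 c1 hGP
      (fun p hp => (hQ p).1 (hm p hp).2) (fun p hp => Nat.le_floor (h.hH p (hm p hp).1)) (fun p hp => h.hP p (hm p hp).1)
      (fun p hp => hodd p (hm p hp).1) (hsub G hGP) c2 c3 c4 c5 hT5
  have hG2 : GoodG P (P.filter fun p => ¬ Q p) L K (Real.exp ((C + τ / 4) * L)) (Real.exp (8 * K) * (3 * 10 ^ 12 * L * N)) N := by
    have c1 : L ≤ (v ^ 4) ^ 70 := by rw [vpow 4 70 280 (by norm_num)]; exact hLv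
    have c2 : ((⌊Z⌋₊ : ℕ) : ℝ) ≤ Real.exp ((v ^ 4) ^ 100) := by
      rw [vpow 4 100 400 (by norm_num), ← hZ]; exact Nat.floor_le (by linarith)
    have c3 : 1 ≤ ⌊Z⌋₊ := Nat.le_floor (by push_cast; exact hZ1)
    have c4 : Real.exp ((v ^ 4) ^ 80) ≤ H0 := by rw [vpow 4 80 320 (by norm_num)]; exact hH0
    have c5 : Real.exp (L * (v ^ 4) ^ 200) ≤ N := by
      refine le_trans (Real.exp_le_exp.2 ?_) h.hN
      refine mul_le_mul_of_nonneg_left ?_ (by linarith)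
      rw [hyv, vpow 500 2 1000 (by norm_num), vpow 4 200 800 (by norm_num)]
      exact mono (by norm_num)
    generalize v ^ 4 = x at hv4 c1 c2 c4 c5 hT4
    have hm : ∀ p ∈ P.filter (fun p => ¬ Q p), p ∈ P ∧ ¬ Q p := fun p hp => mem_filter.1 hp
    generalize P.filter (fun p => ¬ Q p) = G at hm ⊢
    have hGP : G ⊆ P := fun p hp => (hm p hp).1
    exact good_of_GT (x := x) (H0 := H0) (Hn := ⌊Z⌋₊) hv4 hL6 c1 hGP
      (fun p hp => hge p (hm p hp).1) (fun p hp => Nat.le_floor ((not_le.1 fun hh => (hm p hp).2 ((hQ p).2 hh)).le)) (fun p hp => h.hP p (hm p hp).1)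
      (fun p hp => hodd p (hm p hp).1) (hsub G hGP) c2 c3 c4 c5 hT4
  exact main_split h hC hτ hK rfl Q hG1 hG2 hf hf2 hf4

lemma small_L (h : St P L y N) {C : ℝ} (hC : 0 < C) (hL6 : L ≤ 10 ^ 6)
    {a : ℤ} {f : ℤ → ℂ} (hf : ∀ n ∉ Ioc a (a + N), f n = 0)
    (hf4 : ∑ n ∈ Ioc a (a + N), ‖f n‖ ^ 4 ≤ Real.exp (4 * C * L) * N) :
    ∑ n ∈ Ioc a (a + N), ‖Aop P f n‖ ^ 2 ≤ (Real.exp (4 * C * 10 ^ 6) + 1 + 10 ^ 5 * (10 ^ 6 + 8) ^ 8) * N := by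
  have hL := h.hL2
  refine (crudeA h.hL f hf).trans ?_
  have hW := Wc4 h a
  have hpt : ∀ m, ‖f m‖ ^ 2 * Wc P L m ≤ ‖f m‖ ^ 4 + (1 + Wc P L m ^ 4) := fun m => by
    nlinarith [sq_nonneg (‖f m‖ ^ 2 - Wc P L m), sq_nonneg (Wc P L m ^ 2 - 1), sq_nonneg (‖f m‖ ^ 2), sq_nonneg (Wc P L m ^ 2)]
  refine (sum_le_sum fun m _ => hpt m).trans ?_
  rw [sum_add_distrib, sum_add_distrib, sum_const, nsmul_eq_mul]
  have hcard : ((Ioc a (a + N)).card : ℝ) = N := by simp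
  rw [hcard]
  have h1 : Real.exp (4 * C * L) * N ≤ Real.exp (4 * C * 10 ^ 6) * N :=
    mul_le_mul_of_nonneg_right (Real.exp_le_exp.2 (mul_le_mul_of_nonneg_left hL6 (by positivity))) (by positivity)
  have h2 : (L + 8) ^ 8 * (N:ℝ) ≤ (10 ^ 6 + 8) ^ 8 * N :=
    mul_le_mul_of_nonneg_right (pow_le_pow_left₀ (by linarith) (by linarith) 8) (by positivity)
  linarith

lemma small_H (hP : ∀ q ∈ P, q.Prime) {Y : ℝ} (hH : ∀ q ∈ P, (q:ℝ) ≤ Real.exp Y)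
    {a : ℤ} {f : ℤ → ℂ} (hf : ∀ n ∉ Ioc a (a + N), f n = 0) (hf2 : ∑ n ∈ Ioc a (a + N), ‖f n‖ ^ 2 ≤ N) :
    ∑ n ∈ Ioc a (a + N), ‖Aop P f n‖ ^ 2 ≤ 4 * Real.exp Y ^ 2 * N := by
  have hc := card_le_exp hP hH
  have h1 := crude_gen P (fun p n => 1) (fun p n => zero_le_one) (fun p n σ _ => rfl) (a := a) (b := a + N)
    (fun n => ‖f n‖) (fun n hn => by rw [hf n hn, norm_zero]) (fun n => P.card) (fun n => by simp)
  have e2 : ∑ σ ∈ sg, ∑ p ∈ P, (1:ℝ) * (2 * P.card) = 4 * (P.card:ℝ) ^ 2 := by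
    simp only [sg]
    rw [sum_pair (by norm_num), sum_const, nsmul_eq_mul]; ring
  rw [e2, ← sum_mul] at h1
  have h3 : ∀ n, ‖Aop P f n‖ ^ 2 ≤ (∑ σ ∈ sg, ∑ p ∈ P, 1 * ‖f (n + σ * p)‖) ^ 2 := fun n => by
    refine pow_le_pow_left₀ (norm_nonneg _) ?_ 2
    unfold Aop
    refine (norm_sum_le _ _).trans (sum_le_sum fun σ _ => (norm_sum_le _ _).trans (sum_le_sum fun p hp => ?_))
    rw [norm_mul, Complex.norm_real]
    refine mul_le_mul_of_nonneg_right ?_ (norm_nonneg _)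
    have h1 := indd_nonneg p n
    have h1' := indd_le_one p n
    have h2 : (0:ℝ) ≤ 1 / p := by positivity
    have h4 : 1 / (p:ℝ) ≤ 1 := by
      have : (1:ℝ) ≤ p := by exact_mod_cast (hP p hp).one_le
      exact (div_le_one (by linarith)).2 this
    exact abs_le.2 ⟨by linarith, by linarith⟩
  refine (sum_le_sum fun n _ => h3 n).trans (h1.trans ?_)
  calc _ ≤ (N:ℝ) * (4 * Real.exp Y ^ 2) := by gcongr
    _ = _ := by ring

end

lemma rpow_conv {x B κ : ℝ} {k : ℕ} (hk : k ≠ 0) (hκ : κ = k) (h : x ^ ((1:ℝ) / κ) ≤ B) (hx : 0 ≤ x) : x ≤ B ^ k := by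
  rw [hκ] at h
  have h1 := pow_le_pow_left₀ (Real.rpow_nonneg hx _) h k
  rwa [← Real.rpow_natCast, ← Real.rpow_mul hx, one_div_mul_cancel (Nat.cast_ne_zero.2 hk), Real.rpow_one] at h1

lemma goal_eq (P : Finset ℕ) (f : ℤ → ℂ) (n : ℤ) :
    ((∑ σ ∈ ({-1, 1} : Finset ℤ), ∑ p ∈ P, if (p : ℤ) ∣ n then f (n + σ * (p : ℤ)) else 0) -
              ∑ σ ∈ ({-1, 1} : Finset ℤ), ∑ p ∈ P, f (n + σ * (p : ℤ)) / (p : ℂ)) = Aop P f n := by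
  unfold Aop
  simp only [← sum_sub_distrib]
  refine sum_congr rfl fun σ _ => sum_congr rfl fun p _ => ?_
  unfold indd
  split_ifs <;> push_cast <;> ring

theorem final (C : ℝ) (hC : 0 < C) : ∃ C' : ℝ, 0 < C' ∧
    ∀ (N : ℕ) (H₀ H : ℝ) (P : Finset ℕ) (L : ℝ) (f : ℤ → ℂ), 0 < N → 1 ≤ H₀ → H₀ ≤ H →
      Real.log H ^ ((2 : ℝ) / 3) * Real.log (Real.log H) ^ 2 ≤ Real.log H₀ →
      (∀ p ∈ P, Nat.Prime p ∧ H₀ ≤ (p : ℝ) ∧ (p : ℝ) ≤ H) →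
      L = ∑ p ∈ P, (1 : ℝ) / (p : ℝ) → 2 ≤ L →
      Real.log H ≤ Real.sqrt (Real.log (N : ℝ) / L) →
      (∀ n : ℤ, n ∉ Ioc (N : ℤ) ((N : ℤ) + N) → f n = 0) →
      ∑ n ∈ Ioc (N : ℤ) ((N : ℤ) + N), ‖f n‖ ^ 2 ≤ N →
      ∑ n ∈ Ioc (N : ℤ) ((N : ℤ) + N), ‖f n‖ ^ 4 ≤ Real.exp (4 * C * L) * N →
      ∑ n ∈ Ioc (N : ℤ) ((N : ℤ) + N), ‖Aop P f n‖ ^ 2 ≤ C' * L * N := by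
  obtain ⟨τ, hτ⟩ : ∃ τ, τ = 8 * C + 1 := ⟨_, rfl⟩
  obtain ⟨K, hK⟩ : ∃ K, K = 4 * Real.exp (τ + 1) := ⟨_, rfl⟩
  obtain ⟨v0, hv0⟩ : ∃ v0, v0 = 1000 + (C + τ / 4) := ⟨_, rfl⟩
  have hv1 : 1000 ≤ v0 := by linarith
  obtain ⟨Y, hY⟩ : ∃ Y, Y = v0 ^ 500 := ⟨_, rfl⟩
  have hY1 : v0 ≤ Y := by
    rw [hY]; exact le_self_pow₀ (by linarith) (by norm_num)
  obtain ⟨A1, hA1⟩ : ∃ A1, A1 = 4 * Real.exp Y ^ 2 := ⟨_, rfl⟩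
  obtain ⟨A2, hA2⟩ : ∃ A2 : ℝ, A2 = Real.exp (4 * C * 10 ^ 6) + 1 + 10 ^ 5 * (10 ^ 6 + 8) ^ 8 := ⟨_, rfl⟩
  obtain ⟨A3, hA3⟩ : ∃ A3 : ℝ, A3 = 64 * (Real.exp (8 * K) * (3 * 10 ^ 12)) := ⟨_, rfl⟩
  obtain ⟨A4, hA4⟩ : ∃ A4 : ℝ, A4 = (2 * (10 ^ 5 * (40320 * Real.exp 8) + 20) + 2048) := ⟨_, rfl⟩
  have p1 : 0 < A1 := by rw [hA1]; positivity
  have p2 : 0 < A2 := by rw [hA2]; positivity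
  have p3 : 0 < A3 := by rw [hA3]; positivity
  have p4 : 0 < A4 := by rw [hA4]; positivity
  refine ⟨A1 + A2 + A3 + A4, by linarith, ?_⟩
  intro N H₀ H P L f hN hH1 hHH hlog hP hL hL2 hy hf hf2 hf4
  have hN0 : (0:ℝ) < N := by exact_mod_cast hN
  have hLN : (N:ℝ) ≤ L * N := le_mul_of_one_le_left hN0.le (by linarith)
  have hpr : ∀ q ∈ P, q.Prime := fun q hq => (hP q hq).1
  have hHpos : 0 < H := by linarith
  have hexp : Real.exp (Real.log H) = H := Real.exp_log hHpos
  obtain ⟨y, hyd⟩ : ∃ y, y = Real.log H := ⟨_, rfl⟩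
  rw [← hyd] at hlog hy hexp
  have hy0 : 0 ≤ y := by rw [hyd]; exact Real.log_nonneg (by linarith)
  have hHy : ∀ q ∈ P, (q:ℝ) ≤ Real.exp y := fun q hq => by rw [hexp]; exact (hP q hq).2.2
  have fin : ∀ A : ℝ, 0 ≤ A → A ≤ A1 + A2 + A3 + A4 → ∀ S : ℝ, S ≤ A * (L * N) → S ≤ (A1 + A2 + A3 + A4) * L * N := fun A hA hA' S hS => by
    have := mul_le_mul_of_nonneg_right hA' (by linarith : 0 ≤ L * (N:ℝ))
    linarith
  rcases lt_or_ge y Y with hyY | hyY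
  · have := small_H hpr (Y := Y) (fun q hq => (hHy q hq).trans (Real.exp_le_exp.2 hyY.le)) hf hf2
    rw [← hA1] at this
    exact fin A1 p1.le (by linarith) _ (this.trans (mul_le_mul_of_nonneg_left hLN p1.le))
  have hNy : Real.exp (L * y ^ 2) ≤ N := by
    have hlN : 0 ≤ Real.log N := Real.log_nonneg (by exact_mod_cast hN)
    have h1 : y ^ 2 ≤ Real.log N / L := (Real.le_sqrt' (by linarith)).1 hy
    rw [le_div_iff₀ (by linarith)] at h1
    calc _ ≤ Real.exp (Real.log N) := Real.exp_le_exp.2 (by linarith)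
      _ = N := Real.exp_log hN0
  have st : St P L y N := ⟨hpr, hHy, hL, hL2, by linarith, hNy⟩
  rcases le_total L (10 ^ 6) with hL6 | hL6
  · have := small_L st hC hL6 hf hf4
    rw [← hA2] at this
    exact fin A2 p2.le (by linarith) _ (this.trans (mul_le_mul_of_nonneg_left hLN p2.le))
  · obtain ⟨v, hvd⟩ : ∃ v, v = y ^ ((1:ℝ) / 500) := ⟨_, rfl⟩
    have hyv : y = v ^ 500 := by
      rw [hvd, ← Real.rpow_natCast, ← Real.rpow_mul hy0]; norm_num
    have hvnn : 0 ≤ v := by rw [hvd]; exact Real.rpow_nonneg hy0 _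
    have hvv : v0 ≤ v := by
      refine le_of_pow_le_pow_left₀ (n := 500) (by norm_num) hvnn ?_
      rw [← hyv, ← hY]; exact hyY
    have hH0 : Real.exp (v ^ 320) ≤ H₀ := by
      rw [← Real.le_log_iff_exp_le (by linarith)]
      refine le_trans ?_ hlog
      have e : v ^ 320 = y ^ ((320:ℝ) / 500) := by
        rw [hvd, ← Real.rpow_natCast, ← Real.rpow_mul hy0]; norm_num
      rw [e]
      have h1 : y ^ ((320:ℝ) / 500) ≤ y ^ ((2:ℝ) / 3) := Real.rpow_le_rpow_of_exponent_le (by linarith) (by norm_num)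
      have h2 : 1 ≤ Real.log y := by
        rw [Real.le_log_iff_exp_le (by linarith)]
        have := Real.exp_one_lt_d9
        linarith
      have h3 : 1 ≤ Real.log y ^ 2 := one_le_pow₀ h2
      exact h1.trans (le_mul_of_one_le_right (Real.rpow_nonneg hy0 _) h3)
    have := main_case st hC hτ hK (by linarith) (by linarith) hyv hL6 hH0 (fun p hp => (hP p hp).2.1) hf hf2 hf4
    rw [← hA4] at this
    refine fin (A3 + A4) (by linarith) (by linarith) _ (this.trans ?_)
    have h1 := mul_le_mul_of_nonneg_left hLN p4.le
    have e : 64 * (Real.exp (8 * K) * (3 * 10 ^ 12 * L * N)) = A3 * (L * N) := by rw [hA3]; ring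
    rw [e]
    linarith

end KK

theorem cor_kukuruc :
    ∀ C : ℝ, 0 < C → ∃ C' : ℝ, 0 < C' ∧
      ∀ (N : ℕ) (H₀ H : ℝ) (P : Finset ℕ) (L : ℝ) (f : ℤ → ℂ),
        0 < N →
        1 ≤ H₀ → H₀ ≤ H →
        Real.log H ^ ((2 : ℝ) / 3) * Real.log (Real.log H) ^ 2 ≤ Real.log H₀ →
        (∀ p ∈ P, Nat.Prime p ∧ H₀ ≤ (p : ℝ) ∧ (p : ℝ) ≤ H) →
        L = ∑ p ∈ P, (1 : ℝ) / (p : ℝ) →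
        Real.exp 1 ≤ L →
        Real.log H ≤ Real.sqrt (Real.log (N : ℝ) / L) →
        (∀ n : ℤ, n ∉ Finset.Ioc (N : ℤ) (2 * (N : ℤ)) → f n = 0) →
        ((1 / (N : ℝ)) * ∑ n ∈ Finset.Ioc (N : ℤ) (2 * (N : ℤ)), ‖f n‖ ^ 2) ^ ((1 : ℝ) / 2) ≤ 1 →
        ((1 / (N : ℝ)) * ∑ n ∈ Finset.Ioc (N : ℤ) (2 * (N : ℤ)), ‖f n‖ ^ 4) ^ ((1 : ℝ) / 4) ≤
          Real.exp (C * L) →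
        (1 / (N : ℝ)) * ∑ n ∈ Finset.Ioc (N : ℤ) (2 * (N : ℤ)),
            ‖(∑ σ ∈ ({-1, 1} : Finset ℤ), ∑ p ∈ P,
                if (p : ℤ) ∣ n then f (n + σ * (p : ℤ)) else 0) -
              ∑ σ ∈ ({-1, 1} : Finset ℤ), ∑ p ∈ P, f (n + σ * (p : ℤ)) / (p : ℂ)‖ ^ 2 ≤
          C' * L := by
  intro C hC
  obtain ⟨C', hC', hmain⟩ := KK.final C hC
  refine ⟨C', hC', ?_⟩
  intro N H₀ H P L f hN hH1 hHH hlog hP hL hL2 hy hf hf2 hf4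
  have hN0 : (0:ℝ) < N := by exact_mod_cast hN
  rw [two_mul] at hf hf2 hf4 ⊢
  have h2 := KK.rpow_conv (k := 2) (by norm_num) (by norm_num) hf2 (mul_nonneg (by positivity) (Finset.sum_nonneg fun _ _ => by positivity))
  have h4 := KK.rpow_conv (k := 4) (by norm_num) (by norm_num) hf4 (mul_nonneg (by positivity) (Finset.sum_nonneg fun _ _ => by positivity))
  rw [one_div, inv_mul_le_iff₀ hN0] at h2 h4 ⊢
  simp only [KK.goal_eq]
  have h5 := hmain N H₀ H P L f hN hH1 hHH hlog hP hL (by have := Real.add_one_le_exp 1; linarith) hy hf (by linarith) (by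
    rw [← Real.exp_nat_mul] at h4
    refine h4.trans (le_of_eq ?_)
    rw [mul_comm]; congr 2; push_cast; ring)
  linarith
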